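/- Let u ∈ P₁(0,M) with limsup_{r→0⁺} δ_r(u) = 0, let e be a unit vector, and let r_j → 0⁺ be a sequence such that the rescalings u_j(x) = u(r_j·x)/r_j² converge, together with their gradients, uniformly on compact subsets of ℝ^N to a function u₀ whose directional derivative D_e u₀ is not identically zero. Then there exists a constant C_e > 0 such that φ(r, D_e u) ≥ C_e for all 0 < r < 1. -/

import Mathlib

open MeasureTheory Metric Set Filter
open scoped RealInnerProductSpace

noncomputable section

/-- The Laplacian of `φ` at `x`, as the sum of the pure second derivatives. -/
def lap (N : ℕ) (φ : EuclideanSpace ℝ (Fin N) → ℝ) (x : EuclideanSpace ℝ (Fin N)) : ℝ :=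
  ∑ i : Fin N,
    fderiv ℝ (fun y => fderiv ℝ φ y (EuclideanSpace.single i 1)) x (EuclideanSpace.single i 1)

/-- Membership in the class `P_r(z, M)`. -/
def MemP (N : ℕ) (r : ℝ) (z : EuclideanSpace ℝ (Fin N)) (M : ℝ)
    (Ω : Set (EuclideanSpace ℝ (Fin N))) (u : EuclideanSpace ℝ (Fin N) → ℝ) : Prop :=
  IsOpen Ω ∧ ContDiff ℝ 1 u ∧
    (∀ φ : EuclideanSpace ℝ (Fin N) → ℝ, ContDiff ℝ (⊤ : ℕ∞) φ → tsupport φ ⊆ ball z r →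
      ∫ x, u x * lap N φ x = ∫ x in Ω, φ x) ∧
    (∀ x ∈ ball z r \ Ω, u x = 0 ∧ gradient u x = 0) ∧
    (∀ x ∈ ball z r, |u x| ≤ M) ∧
    z ∈ frontier Ω

/-- Membership in the class `P_∞(0, M)` of global solutions with quadratic growth. -/
def MemPinf (N : ℕ) (M : ℝ) (Ω : Set (EuclideanSpace ℝ (Fin N)))
    (u : EuclideanSpace ℝ (Fin N) → ℝ) : Prop :=
  IsOpen Ω ∧ ContDiff ℝ 1 u ∧
    (∀ φ : EuclideanSpace ℝ (Fin N) → ℝ, ContDiff ℝ (⊤ : ℕ∞) φ → HasCompactSupport φ →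
      ∫ x, u x * lap N φ x = ∫ x in Ω, φ x) ∧
    (∀ x ∈ Ωᶜ, u x = 0 ∧ gradient u x = 0) ∧
    (0 : EuclideanSpace ℝ (Fin N)) ∈ frontier Ω ∧
    (∀ x, |u x| ≤ M * (‖x‖ ^ 2 + 1))

/-- The minimum diameter of a set: the smallest width of a slab containing it. -/
def MD (N : ℕ) (D : Set (EuclideanSpace ℝ (Fin N))) : ℝ :=
  ⨅ e : {e : EuclideanSpace ℝ (Fin N) // ‖e‖ = 1},
    ((⨆ x : D, ⟪(x : EuclideanSpace ℝ (Fin N)), (e : EuclideanSpace ℝ (Fin N))⟫) -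
      ⨅ x : D, ⟪(x : EuclideanSpace ℝ (Fin N)), (e : EuclideanSpace ℝ (Fin N))⟫)

/-- The density function `δ_r(u)`. -/
def deltaFn (N : ℕ) (u : EuclideanSpace ℝ (Fin N) → ℝ) (r : ℝ) : ℝ :=
  MD N ({x | u x = 0 ∧ gradient u x = 0} ∩ ball 0 r) / r

/-- Half-space solutions `x ↦ (max(⟪x,e⟫,0))²/2`. -/
def IsHalfSpaceSol (N : ℕ) (u : EuclideanSpace ℝ (Fin N) → ℝ) : Prop :=
  ∃ e : EuclideanSpace ℝ (Fin N), ‖e‖ = 1 ∧ ∀ x, u x = (max ⟪x, e⟫ 0) ^ 2 / 2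

/-- `∂Ω ∩ B` is the graph of a `C¹` function. -/
def IsC1Graph (N : ℕ) (Ω B : Set (EuclideanSpace ℝ (Fin N))) : Prop :=
  ∃ (e : EuclideanSpace ℝ (Fin N)) (f : EuclideanSpace ℝ (Fin N) → ℝ),
    ‖e‖ = 1 ∧ ContDiff ℝ 1 f ∧
    Ω ∩ B = {x ∈ B | f (x - ⟪x, e⟫ • e) < ⟪x, e⟫} ∧
    frontier Ω ∩ B = {x ∈ B | ⟪x, e⟫ = f (x - ⟪x, e⟫ • e)}

/-- `∂Ω ∩ B` is the graph of a real-analytic function. -/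
def IsAnalyticGraph (N : ℕ) (Ω B : Set (EuclideanSpace ℝ (Fin N))) : Prop :=
  ∃ (e : EuclideanSpace ℝ (Fin N)) (f : EuclideanSpace ℝ (Fin N) → ℝ),
    ‖e‖ = 1 ∧ (∀ x, AnalyticAt ℝ f x) ∧
    Ω ∩ B = {x ∈ B | f (x - ⟪x, e⟫ • e) < ⟪x, e⟫} ∧
    frontier Ω ∩ B = {x ∈ B | ⟪x, e⟫ = f (x - ⟪x, e⟫ • e)}

/-- The Alt–Caffarelli–Friedman functional `φ(r, v)` centered at the origin. -/
def acf (N : ℕ) (v : EuclideanSpace ℝ (Fin N) → ℝ) (r : ℝ) : ℝ :=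
  r ^ (-4 : ℤ) *
    (∫ x in ball (0 : EuclideanSpace ℝ (Fin N)) r,
      ‖gradient (fun y => max (v y) 0) x‖ ^ 2 * ‖x‖ ^ ((2 : ℤ) - (N : ℤ))) *
    ∫ x in ball (0 : EuclideanSpace ℝ (Fin N)) r,
      ‖gradient (fun y => max (-v y) 0) x‖ ^ 2 * ‖x‖ ^ ((2 : ℤ) - (N : ℤ))

/-- `S_j(z, u) = sup_{B(z, 2^{-j})} |u|`. -/
def Sj (N : ℕ) (z : EuclideanSpace ℝ (Fin N)) (u : EuclideanSpace ℝ (Fin N) → ℝ) (j : ℕ) : ℝ :=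
  sSup ((fun x => |u x|) '' ball z ((2 : ℝ) ^ (-(j : ℤ))))
section

variable {N : ℕ}

/-- Euclidean space of dimension `N`. -/
abbrev EE (N : ℕ) := EuclideanSpace ℝ (Fin N)


/-- The divergence of a vector field. -/
def dv (X : EE N → EE N) (x : EE N) : ℝ :=
  ∑ i : Fin N, fderiv ℝ X x (EuclideanSpace.single i 1) i

lemma gradient_sub' {f g : EE N → ℝ} {x : EE N} (hf : DifferentiableAt ℝ f x)
    (hg : DifferentiableAt ℝ g x) :
    gradient (fun y => f y - g y) x = gradient f x - gradient g x := by
  simp only [gradient]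
  rw [fderiv_fun_sub hf hg, map_sub]

lemma gradient_mul' {f g : EE N → ℝ} {x : EE N} (hf : DifferentiableAt ℝ f x)
    (hg : DifferentiableAt ℝ g x) :
    gradient (fun y => f y * g y) x = f x • gradient g x + g x • gradient f x := by
  simp only [gradient]
  rw [fderiv_fun_mul hf hg, map_add, map_smulₛₗ, map_smulₛₗ]; simp

lemma gradient_comp' {T : ℝ → ℝ} {f : EE N → ℝ} {x : EE N} (hT : DifferentiableAt ℝ T (f x))
    (hf : DifferentiableAt ℝ f x) :
    gradient (fun y => T (f y)) x = deriv T (f x) • gradient f x := by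
  simp only [gradient]
  have := (hT.hasDerivAt.comp_hasFDerivAt x hf.hasFDerivAt).fderiv
  simp only [Function.comp_def] at this
  rw [this, map_smulₛₗ]; simp

lemma gradient_normSq_comp {A : ℝ → ℝ} {x : EE N} (hA : DifferentiableAt ℝ A (‖x‖ ^ 2)) :
    gradient (fun y : EE N => A (‖y‖ ^ 2)) x = (2 * deriv A (‖x‖ ^ 2)) • x := by
  have h1 : HasFDerivAt (fun y : EE N => ‖y‖ ^ 2) (2 • innerSL ℝ x) x :=
    (hasStrictFDerivAt_norm_sq x).hasFDerivAt
  rw [gradient_comp' (f := fun y : EE N => ‖y‖ ^ 2) hA h1.differentiableAt]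
  have : gradient (fun y : EE N => ‖y‖ ^ 2) x = (2 : ℝ) • x := by
    refine ext_inner_right ℝ fun y => ?_
    rw [inner_gradient_left, h1.fderiv]
    simp [inner_smul_left]
  rw [this, smul_smul, mul_comm]

lemma norm_gradient (f : EE N → ℝ) (x : EE N) : ‖gradient f x‖ = ‖fderiv ℝ f x‖ := by
  simp [gradient]

lemma fderiv_apply_eq_inner (f : EE N → ℝ) (x y : EE N) :
    fderiv ℝ f x y = ⟪gradient f x, y⟫ := inner_gradient_left.symm

lemma contDiff_gradient {f : EE N → ℝ} {m n : WithTop ℕ∞} (hf : ContDiff ℝ n f) (h : m + 1 ≤ n) :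
    ContDiff ℝ m (gradient f) := by
  have := hf.fderiv_right h
  exact ((InnerProductSpace.toDual ℝ (EE N)).symm.contDiff).comp this

lemma continuous_gradient {f : EE N → ℝ} (hf : ContDiff ℝ 1 f) : Continuous (gradient f) :=
  (contDiff_gradient (m := 0) hf (by simp)).continuous

lemma measurable_gradient (f : EE N → ℝ) : Measurable (gradient f) :=
  (InnerProductSpace.toDual ℝ (EE N)).symm.continuous.measurable.comp (measurable_fderiv ℝ f)

lemma dv_smul {f : EE N → ℝ} {X : EE N → EE N} {x : EE N} (hf : DifferentiableAt ℝ f x)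
    (hX : DifferentiableAt ℝ X x) :
    dv (fun y => f y • X y) x = f x * dv X x + fderiv ℝ f x (X x) := by
  unfold dv
  rw [fderiv_fun_smul hf hX]
  simp only [add_apply, smul_apply,
    ContinuousLinearMap.smulRight_apply, PiLp.add_apply, PiLp.smul_apply, smul_eq_mul,
    Finset.sum_add_distrib, Finset.mul_sum]
  congr 1
  conv_rhs => rw [← (EuclideanSpace.basisFun (Fin N) ℝ).sum_repr (X x)]
  simp [mul_comm]

lemma dv_id (x : EE N) : dv (fun y => y) x = N := by
  simp [dv]

lemma dv_const (e x : EE N) : dv (fun _ => e) x = 0 := by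
  simp [dv]

lemma gradient_apply (f : EE N → ℝ) (x : EE N) (i : Fin N) :
    gradient f x i = fderiv ℝ f x (EuclideanSpace.single i 1) := by
  rw [fderiv_apply_eq_inner, EuclideanSpace.inner_single_right]; simp

lemma dv_gradient {h : EE N → ℝ} (hh : ContDiff ℝ 2 h) (x : EE N) :
    dv (gradient h) x = lap N h x := by
  unfold dv lap
  refine Finset.sum_congr rfl fun i _ => ?_
  have hd : DifferentiableAt ℝ (gradient h) x :=
    ((contDiff_gradient (m := 1) hh (by norm_num)).differentiable (by norm_num)) x
  have : (fun y => fderiv ℝ h y (EuclideanSpace.single i 1)) =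
      fun y => (EuclideanSpace.proj i : EE N →L[ℝ] ℝ) (gradient h y) := by
    ext y; simp [gradient_apply]
  have h2 := ((EuclideanSpace.proj i : EE N →L[ℝ] ℝ).hasFDerivAt.comp x hd.hasFDerivAt).fderiv
  rw [this]
  simp only [Function.comp_def] at h2
  rw [h2]
  simp

lemma integral_fderiv_apply_eq_zero {f : EE N → ℝ} (hf : ContDiff ℝ 1 f)
    (hc : HasCompactSupport f) (e : EE N) : ∫ x, fderiv ℝ f x e = 0 := by
  have h := integral_mul_fderiv_eq_neg_fderiv_mul_of_integrable (μ := (volume : Measure (EE N)))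
    (f := fun _ => (1 : ℝ)) (g := f) (v := e) (by simp)
    (by
      simp only [one_mul]
      exact ((hf.continuous_fderiv (by norm_num)).clm_apply continuous_const).integrable_of_hasCompactSupport
        (hc.fderiv_apply (𝕜 := ℝ) e))
    (by simpa using hf.continuous.integrable_of_hasCompactSupport hc)
    (by intros; fun_prop) (fun x _ => (hf.differentiable (by norm_num)) x)
  simpa using h

lemma integral_dv_eq_zero {X : EE N → EE N} (hX : ContDiff ℝ 1 X) (hc : HasCompactSupport X) :
    ∫ x, dv X x = 0 := by
  unfold dv
  have key : ∀ i : Fin N, ∀ x, fderiv ℝ X x (EuclideanSpace.single i 1) i =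
      fderiv ℝ (fun y => X y i) x (EuclideanSpace.single i 1) := by
    intro i x
    have hd : DifferentiableAt ℝ X x := hX.differentiable (by norm_num) x
    have := ((EuclideanSpace.proj i : EE N →L[ℝ] ℝ).hasFDerivAt.comp x hd.hasFDerivAt).fderiv
    have h2 : ((EuclideanSpace.proj i : EE N →L[ℝ] ℝ) : EE N → ℝ) ∘ X = fun y => X y i := by
      ext y; simp
    rw [h2] at this
    rw [this]; simp
  have hXi : ∀ i : Fin N, ContDiff ℝ 1 (fun y => X y i) := fun i =>
    (EuclideanSpace.proj i : EE N →L[ℝ] ℝ).contDiff.comp hX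
  have hci : ∀ i : Fin N, HasCompactSupport (fun y => X y i) := fun i =>
    hc.comp_left (g := fun z : EE N => z i) (by simp)
  simp only [key]
  rw [integral_finsetSum]
  · exact Finset.sum_eq_zero fun i _ => integral_fderiv_apply_eq_zero (hXi i) (hci i) _
  · intro i _
    exact (((hXi i).continuous_fderiv (by norm_num)).clm_apply continuous_const).integrable_of_hasCompactSupport
        ((hci i).fderiv_apply (𝕜 := ℝ) _)

lemma continuous_dv {X : EE N → EE N} (hX : ContDiff ℝ 1 X) : Continuous (dv X) := by
  unfold dv
  refine continuous_finsetSum _ fun i _ => ?_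
  have h1 : Continuous fun x => fderiv ℝ X x (EuclideanSpace.single i 1) :=
    (hX.continuous_fderiv (by norm_num)).clm_apply continuous_const
  exact (EuclideanSpace.proj i : EE N →L[ℝ] ℝ).continuous.comp h1

/-- Integration by parts against a vector field. -/
lemma integral_fderiv_field {f : EE N → ℝ} {X : EE N → EE N} (hf : ContDiff ℝ 1 f)
    (hX : ContDiff ℝ 1 X) (hc : HasCompactSupport f) :
    ∫ x, fderiv ℝ f x (X x) = - ∫ x, f x * dv X x := by
  have h := integral_dv_eq_zero (hf.smul hX) hc.smul_right
  have e : ∀ x, dv (f • X) x = f x * dv X x + fderiv ℝ f x (X x) := fun x =>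
    dv_smul (hf.differentiable (by norm_num) x) (hX.differentiable (by norm_num) x)
  have i1 : Integrable fun x => f x * dv X x :=
    (hf.continuous.mul (continuous_dv hX)).integrable_of_hasCompactSupport hc.mul_right
  have i2 : Integrable fun x => fderiv ℝ f x (X x) := by
    refine ((hf.continuous_fderiv (by norm_num)).clm_apply hX.continuous).integrable_of_hasCompactSupport ?_
    exact (hc.fderiv (𝕜 := ℝ)).mono (by intro x hx h; simp only [Function.mem_support] at hx; simp [h] at hx)
  change ∫ x, dv (f • X) x = 0 at h
  simp only [e] at h
  rw [integral_add i1 i2] at h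
  linarith

/-- Green's identity with the first function compactly supported. -/
lemma integral_inner_gradient {f h : EE N → ℝ} (hf : ContDiff ℝ 1 f) (hh : ContDiff ℝ 2 h)
    (hc : HasCompactSupport f) :
    ∫ x, ⟪gradient f x, gradient h x⟫ = - ∫ x, f x * lap N h x := by
  have := integral_fderiv_field hf (contDiff_gradient (m := 1) hh (by norm_num)) hc
  simpa only [fderiv_apply_eq_inner, dv_gradient hh] using this

/-- Integration by parts with a compactly supported vector field. -/
lemma integral_fderiv_field' {f : EE N → ℝ} {X : EE N → EE N} (hf : ContDiff ℝ 1 f)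
    (hX : ContDiff ℝ 1 X) (hc : HasCompactSupport X) :
    ∫ x, fderiv ℝ f x (X x) = - ∫ x, f x * dv X x := by
  have h := integral_dv_eq_zero (hf.smul hX) hc.smul_left
  have e : ∀ x, dv (f • X) x = f x * dv X x + fderiv ℝ f x (X x) := fun x =>
    dv_smul (hf.differentiable (by norm_num) x) (hX.differentiable (by norm_num) x)
  have i2 : Integrable fun x => fderiv ℝ f x (X x) := by
    refine ((hf.continuous_fderiv (by norm_num)).clm_apply hX.continuous).integrable_of_hasCompactSupport ?_
    exact hc.mono (by intro x hx h; simp only [Function.mem_support] at hx; simp [h] at hx)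
  have hcd : HasCompactSupport (dv X) := by
    refine (hc.fderiv (𝕜 := ℝ)).mono ?_
    intro x hx h
    exact hx (by simp [dv, h])
  have i1 : Integrable fun x => f x * dv X x :=
    (hf.continuous.mul (continuous_dv hX)).integrable_of_hasCompactSupport hcd.mul_left
  change ∫ x, dv (f • X) x = 0 at h
  simp only [e] at h
  rw [integral_add i1 i2] at h
  linarith

lemma HasCompactSupport.gradient {f : EE N → ℝ} (hc : HasCompactSupport f) :
    HasCompactSupport (gradient f) :=
  (hc.fderiv (𝕜 := ℝ)).mono (by intro x hx h; exact hx (by simp [_root_.gradient, h]))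

lemma hasCompactSupport_of_tsupport_subset_ball {f : EE N → ℝ} {x : EE N} {r : ℝ}
    (h : tsupport f ⊆ ball x r) : HasCompactSupport f :=
  (isCompact_closedBall x r).of_isClosed_subset (isClosed_tsupport f)
    (h.trans ball_subset_closedBall)

section MemPBasic

variable {M : ℝ} {Ω : Set (EE N)} {u : EE N → ℝ}

lemma MemP.isOpen (hu : MemP N 1 0 M Ω u) : IsOpen Ω := hu.1
lemma MemP.contDiff (hu : MemP N 1 0 M Ω u) : ContDiff ℝ 1 u := hu.2.1

lemma MemP.weak (hu : MemP N 1 0 M Ω u) {φ : EE N → ℝ} (hφ : ContDiff ℝ (⊤ : ℕ∞) φ)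
    (hs : tsupport φ ⊆ ball 0 1) :
    ∫ x, ⟪gradient u x, gradient φ x⟫ = - ∫ x in Ω, φ x := by
  have hc := hasCompactSupport_of_tsupport_subset_ball hs
  have hφ2 : ContDiff ℝ 2 φ := contDiff_infty.1 hφ 2
  have := integral_fderiv_field' hu.contDiff (contDiff_gradient (m := 1) hφ2 (by norm_num))
    hc.gradient
  rw [← hu.2.2.1 φ hφ hs]
  simpa only [fderiv_apply_eq_inner, dv_gradient hφ2] using this

lemma MemP.zero_off (hu : MemP N 1 0 M Ω u) {x : EE N} (hx : ‖x‖ < 1) (hxΩ : x ∉ Ω) :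
    u x = 0 ∧ gradient u x = 0 :=
  hu.2.2.2.1 x ⟨by simpa using hx, hxΩ⟩

lemma MemP.zero_notMem (hu : MemP N 1 0 M Ω u) : (0 : EE N) ∉ Ω := by
  have := hu.2.2.2.2.2
  rw [hu.1.frontier_eq] at this
  exact this.2

end MemPBasic

end

section

variable {N : ℕ}

/-- Differentiation under the integral sign, for integrands supported in a fixed compact set. -/
lemma hasFDerivAt_integral_of_compact {H : Type*} [NormedAddCommGroup H] [NormedSpace ℝ H]
    [ProperSpace H] {F : H → EE N → ℝ} {F' : H → EE N → H →L[ℝ] ℝ} {U : Set H} {K : Set (EE N)}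
    (hU : IsOpen U) (hK : IsCompact K)
    (hd : ∀ h ∈ U, ∀ x, HasFDerivAt (fun h => F h x) (F' h x) h)
    (hF : ∀ h ∈ U, Continuous (F h))
    (hF' : ContinuousOn (Function.uncurry F') (U ×ˢ univ))
    (h0 : ∀ h ∈ U, ∀ x ∉ K, F h x = 0) (h0' : ∀ h ∈ U, ∀ x ∉ K, F' h x = 0) {a : H} (ha : a ∈ U) :
    HasFDerivAt (fun h => ∫ x, F h x) (∫ x, F' a x) a := by
  obtain ⟨r, hr, hrU⟩ := Metric.isOpen_iff.1 hU a ha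
  have hsub : closedBall a (r / 2) ⊆ U :=
    (closedBall_subset_ball (by linarith)).trans hrU
  have hcomp : IsCompact (closedBall a (r / 2) ×ˢ K) := (isCompact_closedBall a (r / 2)).prod hK
  obtain ⟨C, hC⟩ := hcomp.exists_bound_of_continuousOn
    (hF'.mono (prod_mono hsub (subset_univ K)))
  have hF'c : ∀ h ∈ U, Continuous (F' h) := by
    intro h hh
    rw [← continuousOn_univ]
    exact hF'.comp (f := fun x => (h, x)) (by fun_prop) (fun x _ => ⟨hh, mem_univ _⟩)
  refine hasFDerivAt_integral_of_dominated_of_fderiv_le (s := ball a (r / 2))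
    (bound := K.indicator fun _ => C) (ball_mem_nhds a (by linarith)) ?_ ?_ ?_ ?_ ?_ ?_
  · filter_upwards [hU.mem_nhds ha] with h hh
    exact (hF h hh).aestronglyMeasurable
  · exact (hF a ha).integrable_of_hasCompactSupport (HasCompactSupport.intro hK (h0 a ha))
  · exact (hF'c a ha).aestronglyMeasurable
  · refine Eventually.of_forall fun x h hh => ?_
    by_cases hx : x ∈ K
    · rw [indicator_of_mem hx]
      exact hC (h, x) ⟨ball_subset_closedBall hh, hx⟩
    · rw [indicator_of_notMem hx, h0' h (hsub (ball_subset_closedBall hh)) x hx, norm_zero]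
  · exact (integrable_indicator_iff hK.measurableSet).2
      (integrableOn_const (hK.measure_lt_top.ne))
  · exact Eventually.of_forall fun x h hh => hd h (hsub (ball_subset_closedBall hh)) x

/-- One-parameter version of `hasFDerivAt_integral_of_compact`. -/
lemma hasDerivAt_integral_of_compact {F F' : ℝ → EE N → ℝ} {U : Set ℝ} {K : Set (EE N)}
    (hU : IsOpen U) (hK : IsCompact K)
    (hd : ∀ t ∈ U, ∀ x, HasDerivAt (fun t => F t x) (F' t x) t)
    (hF : ∀ t ∈ U, Continuous (F t))
    (hF' : ContinuousOn (Function.uncurry F') (U ×ˢ univ))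
    (h0 : ∀ t ∈ U, ∀ x ∉ K, F t x = 0) (h0' : ∀ t ∈ U, ∀ x ∉ K, F' t x = 0) {a : ℝ} (ha : a ∈ U) :
    HasDerivAt (fun t => ∫ x, F t x) (∫ x, F' a x) a := by
  have hF'c : Continuous (F' a) := by
    rw [← continuousOn_univ]
    exact hF'.comp (f := fun x => (a, x)) (by fun_prop) (fun x _ => ⟨ha, mem_univ _⟩)
  have hi : Integrable (F' a) :=
    hF'c.integrable_of_hasCompactSupport (HasCompactSupport.intro hK (h0' a ha))
  have := hasFDerivAt_integral_of_compact (F := F)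
    (F' := fun t x => (ContinuousLinearMap.toSpanSingleton ℝ (F' t x))) hU hK
    (fun t ht x => (hd t ht x).hasFDerivAt) hF
    (by
      have : Continuous fun c : ℝ => ContinuousLinearMap.toSpanSingleton ℝ c :=
        (ContinuousLinearMap.toSpanSingletonCLE (𝕜 := ℝ) (E := ℝ)).continuous
      exact this.comp_continuousOn hF')
    h0 (fun t ht x hx => by simp [h0' t ht x hx]) ha
  have h2 := this.hasDerivAt
  convert h2 using 1
  rw [ContinuousLinearMap.integral_apply]
  · simp
  · exact (ContinuousLinearMap.toSpanSingletonCLE (𝕜 := ℝ) (E := ℝ)).toContinuousLinearMap.integrable_comp hi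

end

section

variable {N : ℕ}

lemma hasDerivAt_primitive {f : ℝ → ℝ} (hf : Continuous f) (a x : ℝ) :
    HasDerivAt (fun x => ∫ t in a..x, f t) (f x) x :=
  intervalIntegral.integral_hasDerivAt_right (hf.intervalIntegrable _ _)
    (hf.stronglyMeasurableAtFilter _ _) hf.continuousAt

lemma contDiff_primitive {f : ℝ → ℝ} (hf : ContDiff ℝ (⊤ : ℕ∞) f) (a : ℝ) :
    ContDiff ℝ (⊤ : ℕ∞) (fun x => ∫ t in a..x, f t) := by
  have hd := hasDerivAt_primitive hf.continuous a
  rw [contDiff_infty_iff_deriv]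
  refine ⟨fun x => (hd x).differentiableAt, ?_⟩
  have : deriv (fun x => ∫ t in a..x, f t) = f := funext fun x => (hd x).deriv
  rw [this]; exact hf

/-- A nonnegative smooth profile supported in `σ < 1`. -/
def prof : ContDiffBump (0 : ℝ) := ⟨1 / 2, 1, by norm_num, by norm_num⟩

/-- Unnormalized radial bump. -/
def kap0 (z : EE N) : ℝ := prof (‖z‖ ^ 2)

/-- Normalized radial mollification kernel. -/
def kap (z : EE N) : ℝ := (∫ z : EE N, kap0 z)⁻¹ * kap0 z

/-- A potential of `kap z • z`. -/
def psi (z : EE N) : ℝ := (∫ z : EE N, kap0 z)⁻¹ * (2⁻¹ * ∫ t in (1:ℝ)..(‖z‖ ^ 2), prof t)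

lemma contDiff_kap0 : ContDiff ℝ (⊤ : ℕ∞) (kap0 : EE N → ℝ) :=
  prof.contDiff.comp (contDiff_norm_sq ℝ)

lemma kap0_nonneg (z : EE N) : 0 ≤ kap0 z := prof.nonneg

lemma prof_eq_zero {t : ℝ} (h : 1 ≤ t) : prof t = 0 := by
  refine prof.zero_of_le_dist ?_
  simp [prof]; exact h.trans (le_abs_self t)

lemma kap0_eq_zero {z : EE N} (h : 1 ≤ ‖z‖) : kap0 z = 0 :=
  prof_eq_zero (one_le_pow₀ h)

lemma hasCompactSupport_kap0 : HasCompactSupport (kap0 : EE N → ℝ) :=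
  HasCompactSupport.intro (isCompact_closedBall 0 1) fun x hx =>
    kap0_eq_zero (by simp at hx; exact hx.le)

lemma integral_kap0_pos : 0 < ∫ z : EE N, kap0 z := by
  refine contDiff_kap0.continuous.integral_pos_of_hasCompactSupport_nonneg_nonzero
    hasCompactSupport_kap0 kap0_nonneg (x := 0) ?_
  have : (kap0 : EE N → ℝ) 0 = 1 := by
    apply prof.one_of_mem_closedBall; simp [prof]
  rw [this]; norm_num

lemma contDiff_kap : ContDiff ℝ (⊤ : ℕ∞) (kap : EE N → ℝ) := contDiff_const.mul contDiff_kap0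

lemma kap_nonneg (z : EE N) : 0 ≤ kap z :=
  mul_nonneg (inv_nonneg.2 integral_kap0_pos.le) (kap0_nonneg z)

lemma kap_eq_zero {z : EE N} (h : 1 ≤ ‖z‖) : kap z = 0 := by simp [kap, kap0_eq_zero h]

lemma kap_neg (z : EE N) : kap (-z) = kap z := by simp [kap, kap0]

lemma integral_kap : ∫ z : EE N, kap z = 1 := by
  simp only [kap, integral_const_mul]
  exact inv_mul_cancel₀ integral_kap0_pos.ne'

lemma hasCompactSupport_kap : HasCompactSupport (kap : EE N → ℝ) :=
  hasCompactSupport_kap0.mul_left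

lemma contDiff_psi : ContDiff ℝ (⊤ : ℕ∞) (psi : EE N → ℝ) :=
  contDiff_const.mul (contDiff_const.mul
    ((contDiff_primitive prof.contDiff 1).comp (contDiff_norm_sq ℝ)))

lemma gradient_psi (z : EE N) : gradient psi z = kap z • z := by
  have hd : ∀ t : ℝ, HasDerivAt (fun t => (∫ z : EE N, kap0 z)⁻¹ * (2⁻¹ * ∫ t in (1:ℝ)..t, prof t))
      ((∫ z : EE N, kap0 z)⁻¹ * (2⁻¹ * prof t)) t := fun t =>
    ((hasDerivAt_primitive prof.continuous 1 t).const_mul _).const_mul _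
  have := gradient_normSq_comp (x := z) (hd (‖z‖ ^ 2)).differentiableAt
  rw [(hd _).deriv] at this
  change gradient (fun y => psi y) z = _
  unfold psi
  rw [this, kap, kap0]
  congr 1; ring

lemma psi_eq_zero {z : EE N} (h : 1 ≤ ‖z‖) : psi z = 0 := by
  have : ∫ t in (1:ℝ)..(‖z‖ ^ 2), prof t = 0 := by
    rw [intervalIntegral.integral_congr (g := fun _ => 0)]
    · simp
    · intro t ht
      rw [uIcc_of_le (one_le_pow₀ h)] at ht
      exact prof_eq_zero ht.1
  simp [psi, this]

lemma psi_nonpos (z : EE N) : psi z ≤ 0 := by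
  rcases le_total 1 ‖z‖ with h | h
  · rw [psi_eq_zero h]
  · refine mul_nonpos_of_nonneg_of_nonpos (inv_nonneg.2 integral_kap0_pos.le) ?_
    rw [intervalIntegral.integral_symm]
    have : 0 ≤ ∫ t in (‖z‖ ^ 2)..(1:ℝ), prof t :=
      intervalIntegral.integral_nonneg (pow_le_one₀ (norm_nonneg _) h) fun t _ => prof.nonneg
    linarith

/-- Radial mollification at scale `δ`. -/
def moll (δ : ℝ) (f : EE N → ℝ) (x : EE N) : ℝ := ∫ z, kap z * f (x + δ • z)

lemma moll_integrable (δ : ℝ) {f : EE N → ℝ} (hf : Continuous f) (x : EE N) :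
    Integrable fun z => kap z * f (x + δ • z) :=
  (contDiff_kap.continuous.mul (by fun_prop)).integrable_of_hasCompactSupport
    hasCompactSupport_kap.mul_right

lemma moll_zero (f : EE N → ℝ) (x : EE N) : moll 0 f x = f x := by
  simp [moll, integral_mul_const, integral_kap]

lemma abs_moll_sub_le {δ : ℝ} {f : EE N → ℝ} (hf : Continuous f) {x : EE N} {c ε : ℝ}
    (h : ∀ z : EE N, ‖z‖ ≤ 1 → |f (x + δ • z) - c| ≤ ε) : |moll δ f x - c| ≤ ε := by
  have h1 : moll δ f x - c = ∫ z, kap z * (f (x + δ • z) - c) := by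
    simp only [mul_sub]
    rw [integral_sub (moll_integrable δ hf x)
      ((contDiff_kap.continuous.integrable_of_hasCompactSupport hasCompactSupport_kap).mul_const c),
      integral_mul_const, integral_kap, one_mul, moll]
  have h2 : |∫ z : EE N, kap z * (f (x + δ • z) - c)| ≤ ∫ z : EE N, kap z * ε := by
    rw [← Real.norm_eq_abs]
    refine norm_integral_le_of_norm_le
      ((contDiff_kap.continuous.integrable_of_hasCompactSupport hasCompactSupport_kap).mul_const ε)
      (Eventually.of_forall fun z => ?_)
    rw [norm_mul, Real.norm_eq_abs, Real.norm_eq_abs, abs_of_nonneg (kap_nonneg z)]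
    rcases le_total ‖z‖ 1 with hz | hz
    · exact mul_le_mul_of_nonneg_left (h z hz) (kap_nonneg z)
    · simp [kap_eq_zero hz]
  rw [h1]
  refine h2.trans ?_
  rw [integral_mul_const, integral_kap, one_mul]

lemma moll_eq_integral {δ : ℝ} (hδ : 0 < δ) (f : EE N → ℝ) (x : EE N) :
    moll δ f x = ∫ y, ((δ ^ N)⁻¹ * kap (δ⁻¹ • (y - x))) * f y := by
  have h := Measure.integral_comp_smul (μ := (volume : Measure (EE N)))
    (fun y => kap (δ⁻¹ • y) * f (x + y)) δ
  have h2 := integral_add_left_eq_self (μ := (volume : Measure (EE N)))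
    (fun y => ((δ ^ N)⁻¹ * kap (δ⁻¹ • (y - x))) * f y) x
  rw [← h2]
  simp only [smul_smul, inv_mul_cancel₀ hδ.ne', one_smul] at h
  simp only [add_sub_cancel_left, mul_assoc]
  rw [integral_const_mul, moll, h]
  simp [abs_of_pos hδ]

/-- The rescaled kernel. -/
def rho (δ : ℝ) (y : EE N) : ℝ := (δ ^ N)⁻¹ * kap (δ⁻¹ • y)

lemma contDiff_rho (δ : ℝ) : ContDiff ℝ (⊤ : ℕ∞) (rho δ : EE N → ℝ) :=
  contDiff_const.mul (contDiff_kap.comp (by fun_prop))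

lemma rho_eq_zero {δ : ℝ} (hδ : 0 < δ) {y : EE N} (h : δ ≤ ‖y‖) : rho δ y = 0 := by
  have : 1 ≤ ‖δ⁻¹ • y‖ := by
    rw [norm_smul, norm_inv, Real.norm_eq_abs, abs_of_pos hδ, inv_mul_eq_div]
    exact (one_le_div hδ).2 h
  simp [rho, kap_eq_zero this]

lemma hasCompactSupport_rho {δ : ℝ} (hδ : 0 < δ) : HasCompactSupport (rho δ : EE N → ℝ) :=
  HasCompactSupport.intro (isCompact_closedBall 0 δ) fun x hx =>
    rho_eq_zero hδ (by simp at hx; exact hx.le)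

lemma rho_nonneg {δ : ℝ} (hδ : 0 < δ) (y : EE N) : 0 ≤ rho δ y :=
  mul_nonneg (by positivity) (kap_nonneg _)

lemma integral_rho {δ : ℝ} (hδ : 0 < δ) : ∫ y : EE N, rho δ y = 1 := by
  have := moll_eq_integral hδ (fun _ : EE N => (1 : ℝ)) 0
  simp only [moll, mul_one, integral_kap, sub_zero] at this
  exact this.symm

lemma contDiff_moll {δ : ℝ} (hδ : 0 < δ) {f : EE N → ℝ} (hf : Continuous f) :
    ContDiff ℝ (⊤ : ℕ∞) (moll δ f) := by
  have h := (hasCompactSupport_rho (N := N) hδ).contDiff_convolution_left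
    (ContinuousLinearMap.mul ℝ ℝ) (μ := volume) (contDiff_rho δ) hf.locallyIntegrable (n := (⊤ : ℕ∞))
  convert h using 1
  ext x
  rw [moll_eq_integral hδ, convolution_def]
  have h2 := integral_sub_left_eq_self (fun t => rho δ t * f (x - t)) (volume : Measure (EE N)) x
  simp only [ContinuousLinearMap.mul_apply']
  rw [← h2]
  refine integral_congr_ae (Eventually.of_forall fun y => ?_)
  simp only [rho, sub_sub_cancel]
  congr 2
  rw [← kap_neg, ← smul_neg, neg_sub]

lemma fderiv_moll (δ : ℝ) {f : EE N → ℝ} (hf : ContDiff ℝ 1 f) (x e : EE N) :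
    fderiv ℝ (moll δ f) x e = moll δ (fun y => fderiv ℝ f y e) x := by
  have hfc : Continuous (fderiv ℝ f) := hf.continuous_fderiv (by norm_num)
  have := hasFDerivAt_integral_of_compact (H := EE N) (F := fun x z => kap z * f (x + δ • z))
    (F' := fun x z => kap z • fderiv ℝ f (x + δ • z)) (U := univ) (K := closedBall 0 1)
    isOpen_univ (isCompact_closedBall 0 1)
    (fun x _ z => by
      have h1 : HasFDerivAt f (fderiv ℝ f (x + δ • z)) (x + δ • z) :=
        (hf.differentiable (by norm_num) _).hasFDerivAt
      have h2 := h1.comp x ((hasFDerivAt_id x).add_const (δ • z))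
      exact h2.const_mul (kap z))
    (fun x _ => contDiff_kap.continuous.mul (hf.continuous.comp (by fun_prop)))
    (by
      have := (contDiff_kap (N := N)).continuous
      apply Continuous.continuousOn
      simp only [Function.uncurry_def]
      fun_prop)
    (fun x _ z hz => by rw [kap_eq_zero (by simp at hz; exact hz.le), zero_mul])
    (fun x _ z hz => by rw [kap_eq_zero (by simp at hz; exact hz.le), zero_smul]) (mem_univ x)
  change fderiv ℝ (fun x => ∫ z, kap z * f (x + δ • z)) x e = _
  rw [this.fderiv, ContinuousLinearMap.integral_apply]
  · rfl
  · have := (contDiff_kap (N := N)).continuous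
    refine Continuous.integrable_of_hasCompactSupport (by fun_prop) ?_
    exact hasCompactSupport_kap.smul_right

lemma continuous_moll_swap {f : EE N → ℝ} (hf : ContDiff ℝ 1 f) (x : EE N) (ε : ℝ) :
    HasDerivAt (fun ε => moll ε f x) (∫ z, ⟪gradient psi z, gradient f (x + ε • z)⟫) ε := by
  have hfc : Continuous (fderiv ℝ f) := hf.continuous_fderiv (by norm_num)
  have := hasDerivAt_integral_of_compact (F := fun ε z => kap z * f (x + ε • z))
    (F' := fun ε z => kap z * fderiv ℝ f (x + ε • z) z) (U := univ) (K := closedBall 0 1) (a := ε)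
    isOpen_univ (isCompact_closedBall 0 1)
    (fun t _ z => by
      have h1 : HasFDerivAt f (fderiv ℝ f (x + t • z)) (x + t • z) :=
        (hf.differentiable (by norm_num) _).hasFDerivAt
      have h2 : HasDerivAt (fun t : ℝ => x + t • z) z t := by
        simpa using ((hasDerivAt_id t).smul_const z).const_add x
      exact (h1.comp_hasDerivAt t h2).const_mul (kap z))
    (fun x _ => contDiff_kap.continuous.mul (hf.continuous.comp (by fun_prop)))
    (by
      have := (contDiff_kap (N := N)).continuous
      apply Continuous.continuousOn
      simp only [Function.uncurry_def]
      fun_prop)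
    (fun x _ z hz => by rw [kap_eq_zero (by simp at hz; exact hz.le), zero_mul])
    (fun x _ z hz => by rw [kap_eq_zero (by simp at hz; exact hz.le), zero_mul]) (mem_univ ε)
  have e : ∀ z, ⟪gradient psi z, gradient f (x + ε • z)⟫ = kap z * fderiv ℝ f (x + ε • z) z := by
    intro z
    rw [gradient_psi, real_inner_smul_left, real_inner_comm, inner_gradient_left]
  simp only [e]
  exact this

/-- The rescaled potential centred at `x`. -/
def psiAt (δ : ℝ) (x y : EE N) : ℝ := psi (δ⁻¹ • (y - x))

lemma contDiff_psiAt (δ : ℝ) (x : EE N) : ContDiff ℝ (⊤ : ℕ∞) (psiAt δ x) :=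
  contDiff_psi.comp (by fun_prop)

lemma psiAt_nonpos (δ : ℝ) (x y : EE N) : psiAt δ x y ≤ 0 := psi_nonpos _

lemma tsupport_psiAt {δ : ℝ} (hδ : 0 < δ) (x : EE N) : tsupport (psiAt δ x) ⊆ closedBall x δ := by
  refine closure_minimal ?_ isClosed_closedBall
  intro y hy
  by_contra h
  simp only [mem_closedBall, dist_eq_norm, not_le] at h
  refine hy (psi_eq_zero ?_)
  rw [norm_smul, norm_inv, Real.norm_eq_abs, abs_of_pos hδ, inv_mul_eq_div]
  exact (one_le_div hδ).2 h.le

lemma gradient_psiAt (δ : ℝ) (x y : EE N) :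
    gradient (psiAt δ x) y = δ⁻¹ • gradient psi (δ⁻¹ • (y - x)) := by
  refine ext_inner_right ℝ fun w => ?_
  have h1 : HasFDerivAt psi (fderiv ℝ psi (δ⁻¹ • (y - x))) (δ⁻¹ • (y - x)) :=
    ((contDiff_psi (N := N)).differentiable (by simp) _).hasFDerivAt
  have h2 : HasFDerivAt (fun y : EE N => δ⁻¹ • (y - x)) (δ⁻¹ • ContinuousLinearMap.id ℝ (EE N)) y :=
    ((hasFDerivAt_id y).sub_const x).const_smul δ⁻¹
  have h3 := (h1.comp y h2).fderiv
  rw [inner_gradient_left]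
  change fderiv ℝ (psi ∘ fun y : EE N => δ⁻¹ • (y - x)) y w = _
  rw [h3]
  rw [real_inner_smul_left, inner_gradient_left]
  simp

lemma integral_comp_add_smul {δ : ℝ} (hδ : 0 < δ) (x : EE N) (f : EE N → ℝ) :
    ∫ z, f (x + δ • z) = (δ ^ N)⁻¹ * ∫ y, f y := by
  have h := Measure.integral_comp_smul (μ := (volume : Measure (EE N)))
    (fun y => f (x + y)) δ
  rw [h, integral_add_left_eq_self]
  simp [abs_of_pos hδ]

lemma hasDerivAt_moll {f : EE N → ℝ} (hf : ContDiff ℝ 1 f) (x : EE N) {ε : ℝ} (hε : 0 < ε) :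
    HasDerivAt (fun ε => moll ε f x)
      ((ε ^ N)⁻¹ * (ε * ∫ y, ⟪gradient f y, gradient (psiAt ε x) y⟫)) ε := by
  convert continuous_moll_swap hf x ε using 1
  have := integral_comp_add_smul hε x
    (fun y => ε * ⟪gradient f y, gradient (psiAt ε x) y⟫)
  simp only [integral_const_mul (μ := volume) ε (fun y => ⟪gradient f y, gradient (psiAt ε x) y⟫)] at this
  rw [← this]
  refine integral_congr_ae (Eventually.of_forall fun z => ?_)
  simp only [gradient_psiAt, add_sub_cancel_left, smul_smul, inv_mul_cancel₀ hε.ne', one_smul,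
    inner_smul_right, mul_inv_cancel_left₀ hε.ne']
  rw [real_inner_comm]

end

section

variable {N : ℕ}

lemma contDiff_two_of_infty {f : EE N → ℝ} (hf : ContDiff ℝ (⊤ : ℕ∞) f) : ContDiff ℝ 2 f :=
  contDiff_infty.1 hf 2

lemma contDiff_one_of_infty {f : EE N → ℝ} (hf : ContDiff ℝ (⊤ : ℕ∞) f) : ContDiff ℝ 1 f :=
  contDiff_infty.1 hf 1

lemma contDiff_fderiv_apply {f : EE N → ℝ} (hf : ContDiff ℝ (⊤ : ℕ∞) f) (e : EE N) :
    ContDiff ℝ (⊤ : ℕ∞) (fun x => fderiv ℝ f x e) :=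
  (hf.fderiv_right (m := (⊤ : ℕ∞)) (by exact_mod_cast le_refl _)).clm_apply contDiff_const

lemma contDiff_gradient_infty {f : EE N → ℝ} (hf : ContDiff ℝ (⊤ : ℕ∞) f) :
    ContDiff ℝ (⊤ : ℕ∞) (gradient f) :=
  contDiff_gradient hf (by exact_mod_cast le_refl _)

lemma continuous_lap {f : EE N → ℝ} (hf : ContDiff ℝ (⊤ : ℕ∞) f) : Continuous (lap N f) :=
  continuous_finsetSum _ fun _ _ =>
    (contDiff_fderiv_apply (contDiff_fderiv_apply hf _) _).continuous

/-- Symmetry of second derivatives, in iterated directional form. -/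
lemma fderiv_fderiv_comm {f : EE N → ℝ} (hf : ContDiff ℝ 2 f) (a b x : EE N) :
    fderiv ℝ (fun y => fderiv ℝ f y a) x b = fderiv ℝ (fun y => fderiv ℝ f y b) x a := by
  have hd : DifferentiableAt ℝ (fderiv ℝ f) x :=
    (hf.fderiv_right (m := 1) (by norm_num)).differentiable (by norm_num) x
  have h : ∀ a b, fderiv ℝ (fun y => fderiv ℝ f y a) x b = fderiv ℝ (fderiv ℝ f) x b a := by
    intro a b
    rw [fderiv_clm_apply hd (differentiableAt_const _)]
    simp
  rw [h, h]
  exact (hf.contDiffAt.isSymmSndFDerivAt (by simp)) b a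

lemma lap_fderiv {f : EE N → ℝ} (hf : ContDiff ℝ (⊤ : ℕ∞) f) (e x : EE N) :
    lap N (fun y => fderiv ℝ f y e) x = fderiv ℝ (lap N f) x e := by
  unfold lap
  rw [fderiv_fun_sum (fun i _ => (contDiff_fderiv_apply (contDiff_fderiv_apply hf _) _).differentiable
    (by simp) x)]
  rw [sum_apply]
  refine Finset.sum_congr rfl fun i _ => ?_
  have h1 : (fun y => fderiv ℝ (fun y => fderiv ℝ f y e) y (EuclideanSpace.single i 1)) =
      fun y => fderiv ℝ (fun y => fderiv ℝ f y (EuclideanSpace.single i 1)) y e :=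
    funext fun y => fderiv_fderiv_comm (contDiff_two_of_infty hf) _ _ _
  rw [h1, fderiv_fderiv_comm (contDiff_two_of_infty (contDiff_fderiv_apply hf _))]

lemma fderiv_shift (ρ : EE N → ℝ) (x y e : EE N) :
    fderiv ℝ (fun y => ρ (y - x)) y e = fderiv ℝ ρ (y - x) e := by
  rw [fderiv_comp_sub]

lemma lap_shift (ρ : EE N → ℝ) (x y : EE N) :
    lap N (fun y => ρ (y - x)) y = lap N ρ (y - x) := by
  unfold lap
  refine Finset.sum_congr rfl fun i _ => ?_
  simp only [fderiv_comp_sub]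
  exact fderiv_shift (fun z => fderiv ℝ ρ z (EuclideanSpace.single i 1)) x y _

lemma fderiv_kernel {ρ f : EE N → ℝ} (hρ : ContDiff ℝ 1 ρ) {δ : ℝ}
    (hs : ∀ y, δ ≤ ‖y‖ → ρ y = 0) (hf : Continuous f) (x e : EE N) :
    fderiv ℝ (fun x => ∫ y, ρ (y - x) * f y) x e = - ∫ y, fderiv ℝ ρ (y - x) e * f y := by
  have hρ' : Continuous (fderiv ℝ ρ) := hρ.continuous_fderiv (by norm_num)
  have hs' : ∀ y, δ < ‖y‖ → fderiv ℝ ρ y = 0 := by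
    intro y hy
    have : ρ =ᶠ[nhds y] fun _ => 0 := by
      filter_upwards [(isOpen_lt continuous_const continuous_norm).mem_nhds hy] with z hz
      exact hs z hz.le
    rw [this.fderiv_eq]; simp
  have hK : ∀ x' ∈ ball x 1, ∀ y ∉ closedBall x (1 + δ), δ < ‖y - x'‖ := by
    intro x' hx' y hy
    simp only [mem_ball, mem_closedBall, not_le] at hx' hy
    have := dist_triangle y x' x
    rw [← dist_eq_norm]; linarith
  have := hasFDerivAt_integral_of_compact (H := EE N) (F := fun x y => ρ (y - x) * f y)
    (F' := fun x y => -(f y • fderiv ℝ ρ (y - x))) (U := ball x 1) (K := closedBall x (1 + δ))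
    isOpen_ball (isCompact_closedBall _ _)
    (fun x' _ y => by
      have h1 : HasFDerivAt ρ (fderiv ℝ ρ (y - x')) (y - x') :=
        (hρ.differentiable (by norm_num) _).hasFDerivAt
      have h2 := h1.comp x' ((hasFDerivAt_id x').const_sub y)
      have h3 := h2.mul_const (f y)
      refine h3.congr_fderiv ?_
      ext z; simp)
    (fun x' _ => (hρ.continuous.comp (by fun_prop)).mul hf)
    (by
      apply Continuous.continuousOn
      simp only [Function.uncurry_def]
      fun_prop)
    (fun x' hx' y hy => by rw [hs _ (hK x' hx' y hy).le, zero_mul])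
    (fun x' hx' y hy => by rw [hs' _ (hK x' hx' y hy), smul_zero, neg_zero])
    (mem_ball_self one_pos)
  rw [this.fderiv, ContinuousLinearMap.integral_apply]
  · rw [← integral_neg]
    simp [mul_comm]
  · refine Continuous.integrable_of_hasCompactSupport (by fun_prop)
      (HasCompactSupport.intro (isCompact_closedBall x (1 + δ)) fun y hy => ?_)
    rw [hs' _ (hK x (mem_ball_self one_pos) y hy), smul_zero, neg_zero]

lemma lap_kernel {ρ f : EE N → ℝ} (hρ : ContDiff ℝ (⊤ : ℕ∞) ρ) {δ : ℝ}
    (hs : ∀ y, δ ≤ ‖y‖ → ρ y = 0) (hf : Continuous f) (x : EE N) :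
    lap N (fun x => ∫ y, ρ (y - x) * f y) x = ∫ y, lap N ρ (y - x) * f y := by
  have hs1 : ∀ e y, δ + 1 ≤ ‖y‖ → fderiv ℝ ρ y e = 0 := by
    intro e y hy
    have : ρ =ᶠ[nhds y] fun _ => 0 := by
      filter_upwards [(isOpen_lt continuous_const continuous_norm).mem_nhds
        (show δ < ‖y‖ by linarith)] with z hz
      exact hs z hz.le
    rw [this.fderiv_eq]; simp
  have h2 : ∀ i : Fin N, Integrable fun y => fderiv ℝ (fun z => fderiv ℝ ρ z
      (EuclideanSpace.single i 1)) (y - x) (EuclideanSpace.single i 1) * f y := by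
    intro i
    have hc := (contDiff_fderiv_apply (contDiff_fderiv_apply hρ (EuclideanSpace.single i 1))
      (EuclideanSpace.single i 1)).continuous
    refine Continuous.integrable_of_hasCompactSupport ((hc.comp (by fun_prop)).mul hf)
      (HasCompactSupport.intro (isCompact_closedBall x (δ + 1)) fun y hy => ?_)
    simp only [mem_closedBall, not_le, dist_eq_norm] at hy
    have : (fun z => fderiv ℝ ρ z (EuclideanSpace.single i 1)) =ᶠ[nhds (y - x)] fun _ => 0 := by
      filter_upwards [(isOpen_lt continuous_const continuous_norm).mem_nhds hy] with z hz
      exact hs1 _ z hz.le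
    rw [this.fderiv_eq]; simp
  unfold lap
  simp only [Finset.sum_mul]
  rw [integral_finsetSum _ fun i _ => h2 i]
  refine Finset.sum_congr rfl fun i _ => ?_
  have e1 : (fun x => fderiv ℝ (fun x => ∫ y, ρ (y - x) * f y) x (EuclideanSpace.single i 1)) =
      fun x => ∫ y, (-(fderiv ℝ ρ (y - x) (EuclideanSpace.single i 1))) * f y := by
    ext x
    rw [fderiv_kernel (contDiff_one_of_infty hρ) hs hf, ← integral_neg]
    simp
  rw [e1]
  have hc : ContDiff ℝ (⊤ : ℕ∞) (fun z => -(fderiv ℝ ρ z (EuclideanSpace.single i 1))) :=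
    (contDiff_fderiv_apply hρ _).neg
  rw [fderiv_kernel (ρ := fun z => -(fderiv ℝ ρ z (EuclideanSpace.single i 1)))
    (contDiff_one_of_infty hc) (δ := δ + 1) (fun y hy => by rw [hs1 _ y hy, neg_zero]) hf,
    ← integral_neg]
  refine integral_congr_ae (Eventually.of_forall fun y => ?_)
  simp only [fderiv_fun_neg]
  simp

lemma lap_moll {δ : ℝ} (hδ : 0 < δ) {f : EE N → ℝ} (hf : Continuous f) (x : EE N) :
    lap N (moll δ f) x = ∫ y, f y * lap N (fun y => rho δ (y - x)) y := by
  have : moll δ f = fun x => ∫ y, rho δ (y - x) * f y := by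
    ext x; rw [moll_eq_integral hδ]; rfl
  rw [this, lap_kernel (contDiff_rho δ) (fun y hy => rho_eq_zero hδ hy) hf]
  simp only [lap_shift, mul_comm]

lemma contDiff_rho_shift (δ : ℝ) (x : EE N) : ContDiff ℝ (⊤ : ℕ∞) (fun y => rho δ (y - x)) :=
  (contDiff_rho δ).comp (by fun_prop)

lemma tsupport_rho_shift {δ : ℝ} (hδ : 0 < δ) (x : EE N) :
    tsupport (fun y => rho δ (y - x)) ⊆ closedBall x δ := by
  refine closure_minimal ?_ isClosed_closedBall
  intro y hy
  by_contra h
  simp only [mem_closedBall, dist_eq_norm, not_le] at h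
  exact hy (rho_eq_zero hδ h.le)

/-- Submean value property for functions that are weakly subharmonic near a ball. -/
lemma le_moll_of_subharmonic {w : EE N → ℝ} (hw : ContDiff ℝ 1 w) {x : EE N} {δ : ℝ} (hδ : 0 < δ)
    (h : ∀ ε ∈ Ioo 0 δ, 0 ≤ ∫ y, ⟪gradient w y, gradient (psiAt ε x) y⟫) :
    w x ≤ moll δ w x := by
  have hm : MonotoneOn (fun ε => moll ε w x) (Icc 0 δ) := by
    refine monotoneOn_of_deriv_nonneg (convex_Icc 0 δ) ?_ ?_ ?_
    · exact fun ε _ => (continuous_moll_swap hw x ε).continuousAt.continuousWithinAt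
    · exact fun ε _ => (continuous_moll_swap hw x ε).differentiableAt.differentiableWithinAt
    · intro ε hε
      rw [interior_Icc] at hε
      rw [(hasDerivAt_moll hw x hε.1).deriv]
      exact mul_nonneg (inv_nonneg.2 (pow_nonneg hε.1.le _)) (mul_nonneg hε.1.le (h ε hε))
  have := hm (left_mem_Icc.2 hδ.le) (right_mem_Icc.2 hδ.le) hδ.le
  simpa only [moll_zero] using this

section

variable {M : ℝ} {Ω : Set (EE N)} {u : EE N → ℝ}

lemma MemP.lap_moll (hu : MemP N 1 0 M Ω u) {δ : ℝ} (hδ : 0 < δ) {x : EE N}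
    (hx : closedBall x δ ⊆ ball 0 1) :
    lap N (moll δ u) x = ∫ y in Ω, rho δ (y - x) := by
  rw [_root_.lap_moll hδ hu.contDiff.continuous]
  exact hu.2.2.1 _ (contDiff_rho_shift δ x) ((tsupport_rho_shift hδ x).trans hx)

lemma MemP.lap_moll_mem (hu : MemP N 1 0 M Ω u) {δ : ℝ} (hδ : 0 < δ) {x : EE N}
    (hx : closedBall x δ ⊆ ball 0 1) : |lap N (moll δ u) x| ≤ 1 := by
  rw [hu.lap_moll hδ hx, abs_of_nonneg (setIntegral_nonneg hu.isOpen.measurableSet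
    fun y _ => rho_nonneg hδ _)]
  have hi : Integrable fun y : EE N => rho δ (y - x) :=
    ((contDiff_rho δ).continuous.integrable_of_hasCompactSupport
      (hasCompactSupport_rho hδ)).comp_sub_right x
  refine (setIntegral_le_integral hi (Eventually.of_forall fun y => rho_nonneg hδ _)).trans ?_
  rw [integral_sub_right_eq_self (fun y => rho δ y) x, integral_rho hδ]

lemma MemP.lap_moll_eq_one (hu : MemP N 1 0 M Ω u) {δ : ℝ} (hδ : 0 < δ) {x : EE N}
    (hx : closedBall x δ ⊆ ball 0 1) (hxΩ : closedBall x δ ⊆ Ω) : lap N (moll δ u) x = 1 := by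
  rw [hu.lap_moll hδ hx, setIntegral_eq_integral_of_forall_compl_eq_zero,
    integral_sub_right_eq_self (fun y => rho δ y) x, integral_rho hδ]
  intro y hy
  by_contra h
  exact hy (hxΩ (tsupport_rho_shift hδ x (subset_tsupport _ h)))

lemma MemP.moll_eq (hu : MemP N 1 0 M Ω u) {δ : ℝ} (hδ : 0 < δ) {x : EE N}
    (hx : closedBall x δ ⊆ ball 0 1) (hxΩ : closedBall x δ ⊆ Ω) :
    moll δ u x = u x - δ ^ 2 / 2 * ∫ z : EE N, psi z := by
  have hd : ∀ ε ∈ Ioo 0 δ, HasDerivAt (fun ε => moll ε u x + ε ^ 2 / 2 * ∫ z : EE N, psi z) 0 ε := by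
    intro ε hε
    have h1 := hasDerivAt_moll hu.contDiff x hε.1
    have hs := (tsupport_psiAt hε.1 x).trans (closedBall_subset_closedBall hε.2.le)
    rw [hu.weak (contDiff_psiAt ε x) (hs.trans hx),
      setIntegral_eq_integral_of_forall_compl_eq_zero (fun y hy => by
        by_contra h
        exact hy (hxΩ (hs (subset_tsupport _ h))))] at h1
    have h2 := integral_comp_add_smul hε.1 x (psiAt ε x)
    simp only [psiAt, add_sub_cancel_left, smul_smul, inv_mul_cancel₀ hε.1.ne', one_smul] at h2
    have h3 : HasDerivAt (fun ε : ℝ => ε ^ 2 / 2 * ∫ z : EE N, psi z)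
        (ε * ∫ z : EE N, psi z) ε := by
      have := ((hasDerivAt_pow 2 ε).div_const 2).mul_const (∫ z : EE N, psi z)
      refine this.congr_deriv ?_; norm_num
    refine (h1.add h3).congr_deriv ?_
    simp only [psiAt]; rw [h2]; ring
  have hc : ContinuousOn (fun ε => moll ε u x + ε ^ 2 / 2 * ∫ z : EE N, psi z) (Icc 0 δ) := by
    intro ε _
    refine ((continuous_moll_swap hu.contDiff x ε).continuousAt.add ?_).continuousWithinAt
    fun_prop
  obtain ⟨c, _, hc2⟩ := exists_hasDerivAt_eq_slope _ _ hδ hc hd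
  rw [eq_comm, div_eq_zero_iff] at hc2
  rcases hc2 with hc2 | hc2
  · simp only [moll_zero] at hc2
    linarith
  · linarith

lemma eventually_closedBall_subset_of_isOpen {O : Set (EE N)} (hO : IsOpen O) {δ : ℝ} {x : EE N}
    (hx : closedBall x δ ⊆ O) : ∀ᶠ y in nhds x, closedBall y δ ⊆ O := by
  obtain ⟨η, hη, h⟩ := (isCompact_closedBall x δ).exists_thickening_subset_open hO hx
  filter_upwards [ball_mem_nhds x hη] with y hy z hz
  refine h (mem_thickening_iff.2 ⟨z + (x - y), ?_, ?_⟩)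
  · simp only [mem_closedBall, dist_eq_norm] at hz ⊢
    convert hz using 2; abel
  · simp only [mem_ball, dist_eq_norm] at hy
    rw [dist_eq_norm, show z - (z + (x - y)) = y - x by abel]; exact hy

lemma MemP.eventually_moll_eq (hu : MemP N 1 0 M Ω u) {δ : ℝ} (hδ : 0 < δ) {x : EE N}
    (hx : closedBall x δ ⊆ ball 0 1) (hxΩ : closedBall x δ ⊆ Ω) :
    u =ᶠ[nhds x] fun y => moll δ u y + δ ^ 2 / 2 * ∫ z : EE N, psi z := by
  filter_upwards [eventually_closedBall_subset_of_isOpen isOpen_ball hx,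
    eventually_closedBall_subset_of_isOpen hu.isOpen hxΩ] with y h1 h2
  rw [hu.moll_eq hδ h1 h2]; ring

lemma MemP.moll_fderiv_eq (hu : MemP N 1 0 M Ω u) {δ : ℝ} (hδ : 0 < δ) {x : EE N}
    (hx : closedBall x δ ⊆ ball 0 1) (hxΩ : closedBall x δ ⊆ Ω) (e : EE N) :
    moll δ (fun y => fderiv ℝ u y e) x = fderiv ℝ u x e := by
  rw [← fderiv_moll δ hu.contDiff, (hu.eventually_moll_eq hδ hx hxΩ).fderiv_eq, fderiv_add_const]

lemma MemP.continuous_fderiv_apply (hu : MemP N 1 0 M Ω u) (e : EE N) :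
    Continuous fun y => fderiv ℝ u y e :=
  (hu.contDiff.continuous_fderiv (by norm_num)).clm_apply continuous_const

lemma MemP.lap_moll_fderiv (hu : MemP N 1 0 M Ω u) {δ : ℝ} (hδ : 0 < δ) {x : EE N}
    (hx : closedBall x δ ⊆ ball 0 1) (hxΩ : closedBall x δ ⊆ Ω) (e : EE N) :
    lap N (moll δ (fun y => fderiv ℝ u y e)) x = 0 := by
  have h1 : moll δ (fun y => fderiv ℝ u y e) = fun y => fderiv ℝ (moll δ u) y e := by
    ext y; rw [fderiv_moll δ hu.contDiff]
  rw [h1, lap_fderiv (contDiff_moll hδ hu.contDiff.continuous)]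
  have : lap N (moll δ u) =ᶠ[nhds x] fun _ => 1 := by
    filter_upwards [eventually_closedBall_subset_of_isOpen isOpen_ball hx,
      eventually_closedBall_subset_of_isOpen hu.isOpen hxΩ] with y h2 h3
    exact hu.lap_moll_eq_one hδ h2 h3
  rw [this.fderiv_eq]; simp

lemma MemP.differentiableAt_fderiv (hu : MemP N 1 0 M Ω u) {x : EE N} (hx : ‖x‖ < 1)
    (hxΩ : x ∈ Ω) (e : EE N) : DifferentiableAt ℝ (fun y => fderiv ℝ u y e) x := by
  obtain ⟨δ, hδ, h⟩ := Metric.isOpen_iff.1 (hu.isOpen.inter isOpen_ball) x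
    ⟨hxΩ, (by simpa using hx : x ∈ ball (0 : EE N) 1)⟩
  have h' : closedBall x (δ / 2) ⊆ Ω ∩ ball 0 1 :=
    (closedBall_subset_ball (by linarith)).trans h
  have hδ2 : 0 < δ / 2 := by linarith
  have hev : (fun y => fderiv ℝ u y e) =ᶠ[nhds x] moll (δ / 2) (fun y => fderiv ℝ u y e) := by
    filter_upwards [eventually_closedBall_subset_of_isOpen isOpen_ball (h'.trans inter_subset_right),
      eventually_closedBall_subset_of_isOpen hu.isOpen (h'.trans inter_subset_left)] with y h2 h3
    exact (hu.moll_fderiv_eq hδ2 h2 h3 e).symm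
  refine DifferentiableAt.congr_of_eventuallyEq ?_ hev
  exact (contDiff_moll hδ2 (hu.continuous_fderiv_apply e)).differentiable (by simp) x

end

end

section

variable {N : ℕ}

/-- A smooth convex approximation of the positive part. -/
def Tr (ε s : ℝ) : ℝ := ∫ t in (0:ℝ)..s, Real.smoothTransition (t / ε - 1)

lemma contDiff_Tr_integrand (ε : ℝ) :
    ContDiff ℝ (⊤ : ℕ∞) (fun t : ℝ => Real.smoothTransition (t / ε - 1)) :=
  Real.smoothTransition.contDiff.comp (by fun_prop)

lemma contDiff_Tr (ε : ℝ) : ContDiff ℝ (⊤ : ℕ∞) (Tr ε) :=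
  contDiff_primitive (contDiff_Tr_integrand ε) 0

lemma hasDerivAt_Tr (ε s : ℝ) : HasDerivAt (Tr ε) (Real.smoothTransition (s / ε - 1)) s :=
  hasDerivAt_primitive (contDiff_Tr_integrand ε).continuous 0 s

lemma deriv_Tr (ε : ℝ) : deriv (Tr ε) = fun s => Real.smoothTransition (s / ε - 1) :=
  funext fun s => (hasDerivAt_Tr ε s).deriv

lemma Tr_monotone (ε : ℝ) : Monotone (Tr ε) :=
  monotone_of_hasDerivAt_nonneg (hasDerivAt_Tr ε) fun _ => Real.smoothTransition.nonneg _

lemma Tr_zero (ε : ℝ) : Tr ε 0 = 0 := by simp [Tr]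

lemma Tr_eq_zero {ε s : ℝ} (hε : 0 < ε) (hs : s ≤ ε) : Tr ε s = 0 := by
  unfold Tr
  rw [intervalIntegral.integral_congr (g := fun _ => (0 : ℝ)), intervalIntegral.integral_zero]
  intro t ht
  refine Real.smoothTransition.zero_of_nonpos ?_
  have : t ≤ ε := by
    rcases le_total 0 s with h | h
    · rw [uIcc_of_le h] at ht; exact ht.2.trans hs
    · rw [uIcc_of_ge h] at ht; exact ht.2.trans hε.le
  have := (div_le_one hε).2 this
  linarith

lemma Tr_nonneg {ε : ℝ} (hε : 0 < ε) (s : ℝ) : 0 ≤ Tr ε s := by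
  rcases le_total s ε with h | h
  · rw [Tr_eq_zero hε h]
  · rw [← Tr_zero ε]; exact Tr_monotone ε (hε.le.trans h)

lemma Tr_le {ε : ℝ} (hε : 0 < ε) (s : ℝ) : Tr ε s ≤ max s 0 := by
  have hm : Monotone fun s => s - Tr ε s := by
    refine monotone_of_hasDerivAt_nonneg
      (fun s => (hasDerivAt_id s).sub (hasDerivAt_Tr ε s)) fun s => ?_
    have := Real.smoothTransition.le_one (s / ε - 1)
    simpa using this
  rcases le_total s 0 with h | h
  · rw [Tr_eq_zero hε (h.trans hε.le)]; exact le_max_right _ _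
  · have := hm h
    simp only [Tr_zero] at this
    exact le_max_of_le_left (by linarith)

lemma le_Tr {ε : ℝ} (hε : 0 < ε) (s : ℝ) : max s 0 - 2 * ε ≤ Tr ε s := by
  rcases le_total s (2 * ε) with h | h
  · have : max s 0 ≤ 2 * ε := max_le h (by linarith)
    linarith [Tr_nonneg hε s]
  · have hm : MonotoneOn (fun s => Tr ε s - s) (Ici (2 * ε)) := by
      refine monotoneOn_of_deriv_nonneg (convex_Ici _) ?_ ?_ ?_
      · exact ((contDiff_Tr ε).continuous.sub continuous_id).continuousOn
      · exact fun s _ => ((hasDerivAt_Tr ε s).sub (hasDerivAt_id s)).differentiableAt.differentiableWithinAt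
      · intro s hs
        rw [interior_Ici] at hs
        have h1 : Real.smoothTransition (s / ε - 1) = 1 := by
          refine Real.smoothTransition.one_of_one_le ?_
          have : 2 ≤ s / ε := (le_div_iff₀ hε).2 (le_of_lt hs)
          linarith
        have h2 := ((hasDerivAt_Tr ε s).sub (hasDerivAt_id s)).deriv
        rw [h1, sub_self] at h2
        exact h2.ge
    have h1 := hm (mem_Ici.2 le_rfl) h h
    have h2 := Tr_nonneg hε (2 * ε)
    simp only at h1
    rw [max_eq_left (by linarith : (0:ℝ) ≤ s)]
    linarith

lemma lap_comp {T : ℝ → ℝ} {V : EE N → ℝ} (hT : ContDiff ℝ (⊤ : ℕ∞) T)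
    (hV : ContDiff ℝ (⊤ : ℕ∞) V) (x : EE N) :
    lap N (fun y => T (V y)) x =
      deriv T (V x) * lap N V x + deriv (deriv T) (V x) * ‖gradient V x‖ ^ 2 := by
  have hT1 : ContDiff ℝ (⊤ : ℕ∞) (deriv T) := (contDiff_infty_iff_deriv.1 hT).2
  have hc : ContDiff ℝ (⊤ : ℕ∞) (fun y => T (V y)) := hT.comp hV
  have hc1 : ContDiff ℝ (⊤ : ℕ∞) (fun y => deriv T (V y)) := hT1.comp hV
  have hg : gradient (fun y => T (V y)) = fun y => deriv T (V y) • gradient V y :=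
    funext fun y => gradient_comp' (hT.differentiable (by simp) _) (hV.differentiable (by simp) y)
  rw [← dv_gradient (contDiff_two_of_infty hc), hg,
    dv_smul (hc1.differentiable (by simp) x) ((contDiff_gradient_infty hV).differentiable (by simp) x),
    dv_gradient (contDiff_two_of_infty hV), fderiv_apply_eq_inner,
    gradient_comp' (hT1.differentiable (by simp) _) (hV.differentiable (by simp) x),
    real_inner_smul_left, real_inner_self_eq_norm_sq]

lemma deriv_deriv_Tr_nonneg {ε : ℝ} (hε : 0 < ε) (s : ℝ) : 0 ≤ deriv (deriv (Tr ε)) s := by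
  have : Monotone (deriv (Tr ε)) := by
    rw [deriv_Tr]
    intro a b hab
    refine Real.smoothTransition.monotone ?_
    have := div_le_div_of_nonneg_right hab hε.le
    linarith
  exact this.deriv_nonneg

section

variable {M : ℝ} {Ω : Set (EE N)} {u : EE N → ℝ}

lemma MemP.fderiv_off (hu : MemP N 1 0 M Ω u) {x : EE N} (hx : ‖x‖ < 1) (hxΩ : x ∉ Ω) (e : EE N) :
    fderiv ℝ u x e = 0 := by
  rw [fderiv_apply_eq_inner, (hu.zero_off hx hxΩ).2, inner_zero_left]

/-- Smooth subharmonic truncations of the directional derivative. -/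
lemma MemP.exists_trunc (hu : MemP N 1 0 M Ω u) (e : EE N) {R ε : ℝ} (hR : R < 1) (hε : 0 < ε) :
    ∃ w : EE N → ℝ, ContDiff ℝ (⊤ : ℕ∞) w ∧ (∀ x, 0 ≤ w x) ∧
      (∀ x ∈ ball (0 : EE N) R, w x = Tr ε (fderiv ℝ u x e)) ∧
      ∀ x ∈ ball (0 : EE N) R, 0 ≤ lap N w x := by
  set v : EE N → ℝ := fun y => fderiv ℝ u y e with hv
  have hvc : Continuous v := hu.continuous_fderiv_apply e
  obtain ⟨δ₀, hδ₀, huc⟩ := Metric.uniformContinuousOn_iff_le.1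
    ((isCompact_closedBall (0 : EE N) 1).uniformContinuousOn_of_continuous hvc.continuousOn)
    (ε / 3) (by linarith)
  obtain ⟨δ, hδ, hδ1, hδ2⟩ : ∃ δ > 0, δ ≤ δ₀ / 2 ∧ δ < (1 - R) / 2 :=
    ⟨min (δ₀ / 2) ((1 - R) / 4), lt_min (by linarith) (by linarith), min_le_left _ _,
      (min_le_right _ _).trans_lt (by linarith)⟩
  have hmem : ∀ x ∈ ball (0 : EE N) (R + (1 - R) / 2), closedBall x δ ⊆ ball 0 1 := by
    intro x hx y hy
    simp only [mem_ball, mem_closedBall, dist_zero_right] at *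
    have := norm_le_norm_add_norm_sub x y
    rw [dist_eq_norm] at hy
    rw [norm_sub_rev] at this
    linarith
  have hsub : ball (0 : EE N) R ⊆ ball (0 : EE N) (R + (1 - R) / 2) :=
    ball_subset_ball (by linarith)
  have hsmall : ∀ x ∈ ball (0 : EE N) (R + (1 - R) / 2), ¬ closedBall x δ ⊆ Ω →
      v x ≤ ε / 3 ∧ moll δ v x ≤ 2 * (ε / 3) := by
    intro x hx hn
    obtain ⟨y, hy, hyΩ⟩ := not_subset.1 hn
    have hc : ∀ z, z ∈ closedBall x δ → z ∈ closedBall (0 : EE N) 1 := fun z hz =>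
      ball_subset_closedBall (hmem x hx hz)
    have hy1 : ‖y‖ < 1 := by simpa using hmem x hx hy
    have hvy : v y = 0 := hu.fderiv_off hy1 hyΩ e
    have key : ∀ z ∈ closedBall x δ, |v z - 0| ≤ ε / 3 := by
      intro z hz
      have := huc z (hc z hz) y (hc y hy) (by
        have := dist_triangle_right z y x
        simp only [mem_closedBall] at hz hy
        linarith)
      rwa [hvy, Real.dist_eq] at this
    refine ⟨?_, ?_⟩
    · have := key x (mem_closedBall_self hδ.le)
      rw [sub_zero] at this
      exact (le_abs_self _).trans this
    · have := abs_moll_sub_le (δ := δ) hvc (x := x) (c := 0) (ε := ε / 3) (fun z hz => key _ (by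
        simp only [mem_closedBall, dist_self_add_left, norm_smul, Real.norm_eq_abs, abs_of_pos hδ]
        exact mul_le_of_le_one_right hδ.le hz))
      rw [sub_zero] at this
      linarith [(le_abs_self _).trans this]
  have hVs : ContDiff ℝ (⊤ : ℕ∞) (moll δ v) := contDiff_moll hδ hvc
  refine ⟨fun x => Tr ε (moll δ v x), (contDiff_Tr ε).comp hVs, fun x => Tr_nonneg hε _, ?_, ?_⟩
  · intro x hx
    by_cases h : closedBall x δ ⊆ Ω
    · simp only [hv]
      rw [hu.moll_fderiv_eq hδ (hmem x (hsub hx)) h]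
    · obtain ⟨h1, h2⟩ := hsmall x (hsub hx) h
      simp only
      rw [Tr_eq_zero hε (h2.trans (by linarith)), Tr_eq_zero hε (h1.trans (by linarith))]
  · intro x hx
    rw [lap_comp (contDiff_Tr ε) hVs]
    have h2 : 0 ≤ deriv (deriv (Tr ε)) (moll δ v x) * ‖gradient (moll δ v) x‖ ^ 2 :=
      mul_nonneg (deriv_deriv_Tr_nonneg hε _) (sq_nonneg _)
    by_cases h : closedBall x δ ⊆ Ω
    · rw [hu.lap_moll_fderiv hδ (hmem x (hsub hx)) h, mul_zero, zero_add]
      exact h2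
    · have := (hsmall x (hsub hx) h).2
      have h3 : deriv (Tr ε) (moll δ v x) = 0 := by
        rw [deriv_Tr]
        refine Real.smoothTransition.zero_of_nonpos ?_
        rw [sub_nonpos, div_le_one hε]; linarith
      rw [h3, zero_mul, zero_add]
      exact h2

lemma MemP.gradient_trunc (hu : MemP N 1 0 M Ω u) (e : EE N) {R ε : ℝ} (hR : R < 1) (hε : 0 < ε)
    {w : EE N → ℝ} (hw : ∀ x ∈ ball (0 : EE N) R, w x = Tr ε (fderiv ℝ u x e))
    {x : EE N} (hx : x ∈ ball (0 : EE N) R) :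
    gradient w x = Real.smoothTransition (fderiv ℝ u x e / ε - 1) •
      gradient (fun y => max (fderiv ℝ u y e) 0) x := by
  have hvc : Continuous fun y => fderiv ℝ u y e := hu.continuous_fderiv_apply e
  have hx1 : ‖x‖ < 1 := (by simpa using hx : ‖x‖ < R).trans hR
  rcases lt_or_ge (fderiv ℝ u x e) ε with h | h
  · have h0 : w =ᶠ[nhds x] fun _ => 0 := by
      filter_upwards [isOpen_ball.mem_nhds hx, (isOpen_lt hvc continuous_const).mem_nhds h]
        with y hy hy2
      rw [hw y hy, Tr_eq_zero hε (le_of_lt hy2)]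
    rw [Real.smoothTransition.zero_of_nonpos, zero_smul]
    · simp only [gradient]; rw [h0.fderiv_eq]; simp
    · rw [sub_nonpos, div_le_one hε]; exact h.le
  · have hpos : 0 < fderiv ℝ u x e := hε.trans_le h
    have hxΩ : x ∈ Ω := by
      by_contra hn
      rw [hu.fderiv_off hx1 hn e] at hpos
      exact lt_irrefl _ hpos
    have h1 : w =ᶠ[nhds x] fun y => Tr ε (fderiv ℝ u y e) := by
      filter_upwards [isOpen_ball.mem_nhds hx] with y hy using hw y hy
    have h2 : (fun y => max (fderiv ℝ u y e) 0) =ᶠ[nhds x] fun y => fderiv ℝ u y e := by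
      filter_upwards [(isOpen_lt continuous_const hvc).mem_nhds hpos] with y hy
      exact max_eq_left (le_of_lt hy)
    have h3 := gradient_comp' (T := Tr ε) (hasDerivAt_Tr ε _).differentiableAt
      (hu.differentiableAt_fderiv hx1 hxΩ e)
    rw [deriv_Tr] at h3
    simp only [gradient] at h3 ⊢
    rw [h1.fderiv_eq, h2.fderiv_eq, h3]

lemma gradient_max_eq_zero {v : EE N → ℝ} {x : EE N} (hx : v x ≤ 0) :
    gradient (fun y => max (v y) 0) x = 0 := by
  have : IsLocalMin (fun y => max (v y) 0) x := Eventually.of_forall fun y => by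
    simp only [max_eq_right hx]; exact le_max_right _ _
  simp [gradient, this.fderiv_eq_zero]

end

end

section

variable {N : ℕ}

/-- The Gaussian density with variance `s` in every coordinate. -/
def gs (s : ℝ) (x : EE N) : ℝ :=
  Real.exp (-‖x‖ ^ 2 / (2 * s) - N / 2 * Real.log (2 * Real.pi * s))

lemma gs_pos (s : ℝ) (x : EE N) : 0 < gs s x := Real.exp_pos _

lemma contDiff_gs (s : ℝ) : ContDiff ℝ (⊤ : ℕ∞) (gs s : EE N → ℝ) := by
  unfold gs
  exact Real.contDiff_exp.comp (((contDiff_norm_sq ℝ).neg.div_const _).sub contDiff_const)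

lemma continuous_gs (s : ℝ) : Continuous (gs s : EE N → ℝ) := (contDiff_gs s).continuous

lemma gs_neg (s : ℝ) (x : EE N) : gs s (-x) = gs s x := by simp [gs]

lemma gradient_gs (s : ℝ) (x : EE N) : gradient (gs s) x = (-(gs s x / s)) • x := by
  have hd : ∀ σ : ℝ, HasDerivAt
      (fun σ => Real.exp (-σ / (2 * s) - N / 2 * Real.log (2 * Real.pi * s)))
      (Real.exp (-σ / (2 * s) - N / 2 * Real.log (2 * Real.pi * s)) * (-1 / (2 * s))) σ :=
    fun σ => (((hasDerivAt_neg σ).div_const _).sub_const _).exp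
  have := gradient_normSq_comp (x := x) (hd (‖x‖ ^ 2)).differentiableAt
  rw [(hd _).deriv] at this
  change gradient (fun y : EE N =>
    Real.exp (-‖y‖ ^ 2 / (2 * s) - N / 2 * Real.log (2 * Real.pi * s))) x = _
  rw [this]
  congr 1
  unfold gs
  rcases eq_or_ne s 0 with h | h
  · simp [h]
  · field_simp

lemma hasDerivAt_gs {s : ℝ} (hs : 0 < s) (x : EE N) :
    HasDerivAt (fun s => gs s x) ((‖x‖ ^ 2 / (2 * s ^ 2) - N / (2 * s)) * gs s x) s := by
  have h1 : HasDerivAt (fun s : ℝ => 2 * s) 2 s := by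
    simpa using (hasDerivAt_id s).const_mul (2 : ℝ)
  have h2 : HasDerivAt (fun s : ℝ => -‖x‖ ^ 2 / (2 * s)) (‖x‖ ^ 2 / (2 * s ^ 2)) s := by
    refine ((hasDerivAt_const s (-‖x‖ ^ 2)).div h1 (by positivity)).congr_deriv ?_
    field_simp; ring
  have h3 : HasDerivAt (fun s : ℝ => N / 2 * Real.log (2 * Real.pi * s)) (N / (2 * s)) s := by
    have h4 : HasDerivAt (fun s : ℝ => 2 * Real.pi * s) (2 * Real.pi) s := by
      simpa using (hasDerivAt_id s).const_mul (2 * Real.pi)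
    refine ((h4.log (by positivity)).const_mul (N / 2 : ℝ)).congr_deriv ?_
    field_simp
  refine (h2.sub h3).exp.congr_deriv ?_
  unfold gs; simp only [Pi.sub_apply]; ring

lemma integral_gs {s : ℝ} (hs : 0 < s) : ∫ x : EE N, gs s x = 1 := by
  have h := GaussianFourier.integral_rexp_neg_mul_sq_norm (V := EE N) (b := 1 / (2 * s)) (by positivity)
  have e : ∀ x : EE N, gs s x = Real.exp (-(1 / (2 * s)) * ‖x‖ ^ 2) *
      Real.exp (-(N / 2 * Real.log (2 * Real.pi * s))) := by
    intro x
    rw [← Real.exp_add, gs]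
    congr 1; ring
  simp only [e]
  rw [integral_mul_const, h, finrank_euclideanSpace_fin, Real.rpow_def_of_pos (by positivity),
    ← Real.exp_add, show Real.pi / (1 / (2 * s)) = 2 * Real.pi * s by field_simp]
  rw [Real.exp_eq_one_iff]; ring

lemma integrable_gs {s : ℝ} (hs : 0 < s) : Integrable (gs s : EE N → ℝ) := by
  by_contra h
  have := integral_gs (N := N) hs
  rw [integral_undef h] at this
  exact zero_ne_one this

lemma gs_eq_four {s : ℝ} (hs : 0 < s) (x : EE N) :
    gs s x = 2 ^ N * Real.exp (-(3 * ‖x‖ ^ 2 / (8 * s))) * gs (4 * s) x := by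
  have h2 : (2 : ℝ) ^ N = Real.exp (N * Real.log 2) := by
    rw [mul_comm, Real.exp_mul, Real.exp_log two_pos, Real.rpow_natCast]
  rw [h2, gs, gs, ← Real.exp_add, ← Real.exp_add]
  congr 1
  rw [show 2 * Real.pi * (4 * s) = 2 ^ 2 * (2 * Real.pi * s) by ring,
    Real.log_mul (x := 2 ^ 2) (y := 2 * Real.pi * s) (by norm_num) (by positivity), Real.log_pow]
  push_cast
  field_simp
  ring

lemma gs_le_four {s : ℝ} (hs : 0 < s) (x : EE N) : gs s x ≤ 2 ^ N * gs (4 * s) x := by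
  rw [gs_eq_four hs]
  refine mul_le_mul_of_nonneg_right ?_ (gs_pos _ _).le
  refine mul_le_of_le_one_right (by positivity) (Real.exp_le_one_iff.2 ?_)
  rw [neg_nonpos]; positivity

lemma gs_le_of_le {s t : ℝ} (hs : 0 < s) (hst : s ≤ t) (ht : t ≤ 4 * s) (x : EE N) :
    gs s x ≤ 2 ^ N * gs t x := by
  have ht0 : 0 < t := hs.trans_le hst
  have h2 : (2 : ℝ) ^ N = Real.exp (N * Real.log 2) := by
    rw [mul_comm, Real.exp_mul, Real.exp_log two_pos, Real.rpow_natCast]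
  rw [h2, gs, gs, ← Real.exp_add]
  refine Real.exp_le_exp.2 ?_
  have h3 : Real.log (2 * Real.pi * t) ≤ 2 * Real.log 2 + Real.log (2 * Real.pi * s) := by
    have e : (2 : ℝ) * Real.log 2 = Real.log (2 ^ 2) := by rw [Real.log_pow]; norm_num
    rw [e, ← Real.log_mul (by norm_num) (by positivity)]
    refine Real.log_le_log (by positivity) ?_
    nlinarith [Real.pi_pos]
  have h4 : -‖x‖ ^ 2 / (2 * s) ≤ -‖x‖ ^ 2 / (2 * t) := by
    rw [neg_div, neg_div, neg_le_neg_iff]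
    exact div_le_div_of_nonneg_left (sq_nonneg _) (by positivity) (by linarith)
  have hN : (0 : ℝ) ≤ N / 2 := by positivity
  nlinarith [mul_le_mul_of_nonneg_left h3 hN]

/-- Polynomial weights are absorbed by a wider Gaussian. -/
lemma exists_exp_bound (n : ℕ) {c : ℝ} (hc : 0 < c) :
    ∃ C : ℝ, 0 < C ∧ ∀ y : ℝ, 0 ≤ y → (1 + y) ^ n * Real.exp (-(c * y)) ≤ C := by
  refine ⟨(n.factorial : ℝ) * c⁻¹ ^ n * Real.exp c, by positivity, fun y hy => ?_⟩
  have h := Real.pow_div_factorial_le_exp (c * (1 + y)) (by positivity) n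
  have h1 : (1 + y) ^ n ≤ (n.factorial : ℝ) * c⁻¹ ^ n * Real.exp (c * (1 + y)) := by
    rw [div_le_iff₀ (by positivity), mul_pow] at h
    calc (1 + y) ^ n = c⁻¹ ^ n * (c ^ n * (1 + y) ^ n) := by
          rw [← mul_assoc, ← mul_pow, inv_mul_cancel₀ hc.ne', one_pow, one_mul]
      _ ≤ c⁻¹ ^ n * (Real.exp (c * (1 + y)) * n.factorial) := by gcongr
      _ = _ := by ring
  calc (1 + y) ^ n * Real.exp (-(c * y))
      ≤ ((n.factorial : ℝ) * c⁻¹ ^ n * Real.exp (c * (1 + y))) * Real.exp (-(c * y)) := by gcongr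
    _ = (n.factorial : ℝ) * c⁻¹ ^ n * Real.exp c := by
        rw [mul_assoc, ← Real.exp_add]; ring_nf

lemma exists_poly_gs_le (n : ℕ) : ∃ C : ℝ, 0 < C ∧ ∀ s : ℝ, 0 < s → ∀ x : EE N,
    (s + ‖x‖ ^ 2) ^ n * gs s x ≤ C * s ^ n * gs (4 * s) x := by
  obtain ⟨C, hC, h⟩ := exists_exp_bound n (show (0 : ℝ) < 3 / 8 by norm_num)
  refine ⟨2 ^ N * C, by positivity, fun s hs x => ?_⟩
  have h1 := h (‖x‖ ^ 2 / s) (by positivity)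
  rw [gs_eq_four hs]
  have e1 : (s + ‖x‖ ^ 2) ^ n = s ^ n * (1 + ‖x‖ ^ 2 / s) ^ n := by
    rw [← mul_pow]; congr 1; field_simp
  have e2 : 3 * ‖x‖ ^ 2 / (8 * s) = 3 / 8 * (‖x‖ ^ 2 / s) := by field_simp
  rw [e1, e2]
  calc s ^ n * (1 + ‖x‖ ^ 2 / s) ^ n * (2 ^ N * Real.exp (-(3 / 8 * (‖x‖ ^ 2 / s))) * gs (4 * s) x)
      = (s ^ n * 2 ^ N * gs (4 * s) x) *
          ((1 + ‖x‖ ^ 2 / s) ^ n * Real.exp (-(3 / 8 * (‖x‖ ^ 2 / s)))) := by ring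
    _ ≤ (s ^ n * 2 ^ N * gs (4 * s) x) * C := by
        have := gs_pos (4 * s) x
        gcongr
    _ = _ := by ring

/-- Outside a fixed ball the Gaussian is negligible as `s → 0`. -/
lemma exists_tail_bound : ∃ C : ℝ, 0 < C ∧ ∀ s : ℝ, 0 < s → ∀ (R : EE N → ℝ) (K : ℝ),
    (∀ x, ‖x‖ < 1 / 4 → R x = 0) → (∀ x, |R x| ≤ K) → |∫ x, R x * gs s x| ≤ K * (C * s ^ 6) := by
  obtain ⟨C, hC, h⟩ := exists_poly_gs_le (N := N) 6
  refine ⟨16 ^ 6 * C, by positivity, fun s hs R K h0 hK => ?_⟩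
  have hK0 : 0 ≤ K := (abs_nonneg _).trans (hK 0)
  rw [← Real.norm_eq_abs]
  have hb : Integrable fun x : EE N => K * (16 ^ 6 * C * s ^ 6) * gs (4 * s) x :=
    (integrable_gs (by positivity)).const_mul _
  refine (norm_integral_le_of_norm_le hb (Eventually.of_forall fun x => ?_)).trans ?_
  · rw [norm_mul, Real.norm_eq_abs, Real.norm_eq_abs, abs_of_pos (gs_pos _ _)]
    rcases lt_or_ge ‖x‖ (1 / 4) with hx | hx
    · rw [h0 x hx]; have := gs_pos (4 * s) x; simp; positivity
    · have h1 : (1 : ℝ) ≤ 16 ^ 6 * (s + ‖x‖ ^ 2) ^ 6 := by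
        rw [← mul_pow]; refine one_le_pow₀ ?_; nlinarith
      have h2 := h s hs x
      have h3 := gs_pos s x
      calc |R x| * gs s x ≤ K * gs s x := by gcongr; exact hK x
        _ ≤ K * (16 ^ 6 * ((s + ‖x‖ ^ 2) ^ 6 * gs s x)) := by
            gcongr
            calc gs s x = 1 * gs s x := by ring
              _ ≤ (16 ^ 6 * (s + ‖x‖ ^ 2) ^ 6) * gs s x := by gcongr
              _ = _ := by ring
        _ ≤ K * (16 ^ 6 * (C * s ^ 6 * gs (4 * s) x)) := by gcongr
        _ = _ := by ring
  · rw [integral_const_mul, integral_gs (by positivity), mul_one]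

/-- Gaussian integration by parts. -/
lemma integral_dv_mul_gs (s : ℝ) {X : EE N → EE N} (hX : ContDiff ℝ 1 X) (hc : HasCompactSupport X) :
    ∫ x, dv X x * gs s x = s⁻¹ * ∫ x, ⟪X x, x⟫ * gs s x := by
  have h := integral_fderiv_field' (contDiff_one_of_infty (contDiff_gs s)) hX hc
  simp only [fderiv_apply_eq_inner, gradient_gs, real_inner_smul_left] at h
  rw [← integral_const_mul]
  have e : ∀ x, s⁻¹ * (⟪X x, x⟫ * gs s x) = -(-(gs s x / s) * ⟪x, X x⟫) := by
    intro x; rw [real_inner_comm]; ring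
  simp only [e]
  rw [integral_neg, h, neg_neg]
  exact integral_congr_ae (Eventually.of_forall fun x => mul_comm _ _)

/-- Differentiating Gaussian averages in the variance. -/
lemma hasDerivAt_integral_gs {h : EE N → ℝ} (hh : Continuous h) (hc : HasCompactSupport h) {s : ℝ}
    (hs : 0 < s) : HasDerivAt (fun s => ∫ x, h x * gs s x)
      (∫ x, h x * ((‖x‖ ^ 2 / (2 * s ^ 2) - N / (2 * s)) * gs s x)) s := by
  refine hasDerivAt_integral_of_compact (F := fun s x => h x * gs s x)
    (F' := fun s x => h x * ((‖x‖ ^ 2 / (2 * s ^ 2) - N / (2 * s)) * gs s x)) (U := Ioi 0)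
    (K := tsupport h) isOpen_Ioi hc
    (fun t ht x => (hasDerivAt_gs ht x).const_mul _) (fun t _ => hh.mul (continuous_gs t)) ?_
    (fun t _ x hx => by rw [image_eq_zero_of_notMem_tsupport hx, zero_mul])
    (fun t _ x hx => by rw [image_eq_zero_of_notMem_tsupport hx, zero_mul]) hs
  have h1 : ∀ p ∈ Ioi (0:ℝ) ×ˢ (univ : Set (EE N)), 2 * p.1 ≠ 0 := fun p hp => by
    have : 0 < p.1 := hp.1
    positivity
  have h2 : ∀ p ∈ Ioi (0:ℝ) ×ˢ (univ : Set (EE N)), 2 * p.1 ^ 2 ≠ 0 := fun p hp => by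
    have : 0 < p.1 := hp.1
    positivity
  have h3 : ∀ p ∈ Ioi (0:ℝ) ×ˢ (univ : Set (EE N)), 2 * Real.pi * p.1 ≠ 0 := fun p hp => by
    have : 0 < p.1 := hp.1
    have := Real.pi_pos
    positivity
  simp only [Function.uncurry_def, gs]
  fun_prop (disch := assumption)

/-- The heat equation for Gaussian averages. -/
lemma hasDerivAt_integral_gs_lap {h : EE N → ℝ} (hh : ContDiff ℝ 2 h) (hc : HasCompactSupport h)
    {s : ℝ} (hs : 0 < s) : HasDerivAt (fun s => ∫ x, h x * gs s x)
      (2⁻¹ * ∫ x, lap N h x * gs s x) s := by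
  refine (hasDerivAt_integral_gs hh.continuous hc hs).congr_deriv ?_
  have hd : ContDiff ℝ 1 h := hh.of_le (by norm_num)
  have h1 := integral_dv_mul_gs s (X := fun x => h x • x) (hd.smul contDiff_id) hc.smul_right
  have h2 := integral_dv_mul_gs s (contDiff_gradient (m := 1) hh (by norm_num)) hc.gradient
  simp only [dv_gradient hh] at h2
  have e1 : ∀ x, dv (fun x => h x • x) x = h x * N + ⟪gradient h x, x⟫ := by
    intro x
    rw [dv_smul (X := fun y => y) (hd.differentiable (by norm_num) x) differentiableAt_fun_id, dv_id,
      fderiv_apply_eq_inner]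
  simp only [e1, real_inner_smul_left, real_inner_self_eq_norm_sq, add_mul] at h1
  have i1 : Integrable fun x => h x * N * gs s x :=
    ((hh.continuous.mul continuous_const).mul (continuous_gs s)).integrable_of_hasCompactSupport
      (hc.mul_right.mul_right)
  have i2 : Integrable fun x => ⟪gradient h x, x⟫ * gs s x := by
    refine (((continuous_gradient hd).inner continuous_id).mul
      (continuous_gs s)).integrable_of_hasCompactSupport (HasCompactSupport.mul_right ?_)
    exact hc.gradient.mono (by intro x hx h; exact hx (by simp [h]))
  have i3 : Integrable fun x => h x * ‖x‖ ^ 2 * gs s x :=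
    ((hh.continuous.mul (by fun_prop)).mul (continuous_gs s)).integrable_of_hasCompactSupport
      (hc.mul_right.mul_right)
  rw [integral_add i1 i2] at h1
  have e2 : ∀ x, h x * ((‖x‖ ^ 2 / (2 * s ^ 2) - N / (2 * s)) * gs s x) =
      (1 / (2 * s ^ 2)) * (h x * ‖x‖ ^ 2 * gs s x) - (1 / (2 * s)) * (h x * N * gs s x) := by
    intro x; field_simp
  simp only [e2]
  rw [integral_sub (i3.const_mul _) (i1.const_mul _), integral_const_mul (1 / (2 * s ^ 2)),
    integral_const_mul (1 / (2 * s)), h2]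
  have h3 : ∫ x, h x * ‖x‖ ^ 2 * gs s x =
      s * ((∫ x, h x * N * gs s x) + ∫ x, ⟪gradient h x, x⟫ * gs s x) := by
    rw [h1]; field_simp
  rw [h3]
  generalize ∫ x, h x * N * gs s x = I1
  generalize ∫ x, ⟪gradient h x, x⟫ * gs s x = I2
  field_simp
  ring

end

section

variable {N : ℕ}

/-- The rotation of the product space mixing the two factors. -/
def rot (c s : ℝ) (p : EE N × EE N) : EE N × EE N := (c • p.1 - s • p.2, s • p.1 + c • p.2)

lemma continuous_rot (c s : ℝ) : Continuous (rot c s : EE N × EE N → EE N × EE N) := by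
  unfold rot; fun_prop

lemma rot_neg_rot {c s : ℝ} (h : c ^ 2 + s ^ 2 = 1) (p : EE N × EE N) : rot c (-s) (rot c s p) = p := by
  ext1
  · calc _ = (c ^ 2 + s ^ 2) • p.1 := by simp only [rot]; module
      _ = p.1 := by rw [h, one_smul]
  · calc _ = (c ^ 2 + s ^ 2) • p.2 := by simp only [rot]; module
      _ = p.2 := by rw [h, one_smul]

lemma rot_add (c s : ℝ) (p q : EE N × EE N) : rot c s (p + q) = rot c s p + rot c s q := by
  ext1 <;> simp only [rot, Prod.fst_add, Prod.snd_add] <;> module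

lemma rot_smul (c s a : ℝ) (p : EE N × EE N) : rot c s (a • p) = a • rot c s p := by
  ext1 <;> simp only [rot, Prod.smul_fst, Prod.smul_snd] <;> module

lemma norm_sq_rot {c s : ℝ} (h : c ^ 2 + s ^ 2 = 1) (p : EE N × EE N) :
    ‖(rot c s p).1‖ ^ 2 + ‖(rot c s p).2‖ ^ 2 = ‖p.1‖ ^ 2 + ‖p.2‖ ^ 2 := by
  simp only [rot, norm_sub_sq_real, norm_add_sq_real, norm_smul, mul_pow, Real.norm_eq_abs, sq_abs,
    real_inner_smul_left, real_inner_smul_right]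
  linear_combination (‖p.1‖ ^ 2 + ‖p.2‖ ^ 2) * h

lemma measurePreserving_rot {c s : ℝ} (h : c ^ 2 + s ^ 2 = 1) :
    MeasurePreserving (rot c s : EE N × EE N → EE N × EE N) := by
  have h' : c ^ 2 + (-s) ^ 2 = 1 := by rw [neg_sq, h]
  let L : WithLp 2 (EE N × EE N) ≃ₗᵢ[ℝ] WithLp 2 (EE N × EE N) :=
    { toFun := fun p => WithLp.toLp 2 (rot c s (WithLp.ofLp p))
      invFun := fun p => WithLp.toLp 2 (rot c (-s) (WithLp.ofLp p))
      left_inv := fun p => by simp [rot_neg_rot h]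
      right_inv := fun p => by
        have := rot_neg_rot h' (WithLp.ofLp p)
        rw [neg_neg] at this
        simp [this]
      map_add' := fun p q => by rw [WithLp.ofLp_add, rot_add, WithLp.toLp_add]
      map_smul' := fun a p => by rw [WithLp.ofLp_smul, rot_smul, WithLp.toLp_smul, RingHom.id_apply]
      norm_map' := fun p => by
        rw [← sq_eq_sq₀ (norm_nonneg _) (norm_nonneg _), WithLp.prod_norm_sq_eq_of_L2,
          WithLp.prod_norm_sq_eq_of_L2]
        exact norm_sq_rot h _ }
  exact (WithLp.volume_preserving_ofLp (EE N) (EE N)).comp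
    (L.measurePreserving.comp (WithLp.volume_preserving_toLp (EE N) (EE N)))

lemma integral_comp_rot {c s : ℝ} (h : c ^ 2 + s ^ 2 = 1) {F : EE N × EE N → ℝ} (hF : Continuous F) :
    ∫ p, F (rot c s p) = ∫ p, F p := by
  have hm := measurePreserving_rot (N := N) h
  rw [← integral_map hm.measurable.aemeasurable hF.aestronglyMeasurable, hm.map_eq]

/-- The product Gaussian. -/
def gg (s : ℝ) (p : EE N × EE N) : ℝ := gs s p.1 * gs s p.2

lemma continuous_gg (s : ℝ) : Continuous (gg s : EE N × EE N → ℝ) :=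
  ((continuous_gs s).comp continuous_fst).mul ((continuous_gs s).comp continuous_snd)

lemma gg_pos (s : ℝ) (p : EE N × EE N) : 0 < gg s p := mul_pos (gs_pos _ _) (gs_pos _ _)

lemma integrable_gg {s : ℝ} (hs : 0 < s) : Integrable (gg s : EE N × EE N → ℝ) :=
  (integrable_gs hs).mul_prod (integrable_gs hs)

lemma gg_rot {c s : ℝ} (h : c ^ 2 + s ^ 2 = 1) (t : ℝ) (p : EE N × EE N) : gg t (rot c s p) = gg t p := by
  have := norm_sq_rot h p
  unfold gg gs
  rw [← Real.exp_add, ← Real.exp_add]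
  congr 1
  rw [show ∀ a b d : ℝ, -a / (2 * t) - d + (-b / (2 * t) - d) = -(a + b) / (2 * t) - 2 * d by
    intros; ring, this]
  ring

lemma integrable_mul_gg {s : ℝ} (hs : 0 < s) {F : EE N × EE N → ℝ} (hF : Continuous F) {C : ℝ}
    (hC : ∀ p, |F p| ≤ C) : Integrable fun p => F p * gg s p := by
  refine ((integrable_gg hs).const_mul C).mono' (hF.mul (continuous_gg s)).aestronglyMeasurable
    (Eventually.of_forall fun p => ?_)
  rw [norm_mul, Real.norm_eq_abs, Real.norm_eq_abs, abs_of_pos (gg_pos s p)]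
  exact mul_le_mul_of_nonneg_right (hC p) (gg_pos s p).le

lemma exists_norm_mul_gg_le {s : ℝ} (hs : 0 < s) : ∃ C : ℝ, 0 < C ∧ ∀ p : EE N × EE N,
    (‖p.1‖ + ‖p.2‖) * gg s p ≤ C * gg (4 * s) p := by
  obtain ⟨C, hC, h⟩ := exists_poly_gs_le (N := N) 1
  have key : ∀ x : EE N, ‖x‖ * gs s x ≤ (1 + s⁻¹) * (C * s) * gs (4 * s) x := by
    intro x
    have h1 := h s hs x
    simp only [pow_one] at h1
    have h2 : ‖x‖ ≤ (1 + s⁻¹) * (s + ‖x‖ ^ 2) := by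
      have : (1 + s⁻¹) * (s + ‖x‖ ^ 2) = s + 1 + ‖x‖ ^ 2 + s⁻¹ * ‖x‖ ^ 2 := by field_simp; ring
      have : 0 ≤ s⁻¹ * ‖x‖ ^ 2 := by positivity
      nlinarith [sq_nonneg (‖x‖ - 1)]
    calc ‖x‖ * gs s x ≤ (1 + s⁻¹) * (s + ‖x‖ ^ 2) * gs s x :=
          mul_le_mul_of_nonneg_right h2 (gs_pos _ _).le
      _ = (1 + s⁻¹) * ((s + ‖x‖ ^ 2) * gs s x) := by ring
      _ ≤ (1 + s⁻¹) * (C * s * gs (4 * s) x) := by gcongr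
      _ = _ := by ring
  set A := (1 + s⁻¹) * (C * s) with hA
  have hA0 : 0 < A := by positivity
  refine ⟨2 * (A * 2 ^ N), by positivity, fun p => ?_⟩
  have k1 := key p.1
  have k2 := key p.2
  have l1 := gs_le_four hs p.1
  have l2 := gs_le_four hs p.2
  have p1 := gs_pos s p.1
  have p2 := gs_pos s p.2
  have q1 := gs_pos (4 * s) p.1
  have q2 := gs_pos (4 * s) p.2
  unfold gg
  calc (‖p.1‖ + ‖p.2‖) * (gs s p.1 * gs s p.2)
      = (‖p.1‖ * gs s p.1) * gs s p.2 + gs s p.1 * (‖p.2‖ * gs s p.2) := by ring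
    _ ≤ (A * gs (4 * s) p.1) * (2 ^ N * gs (4 * s) p.2) +
        (2 ^ N * gs (4 * s) p.1) * (A * gs (4 * s) p.2) := by gcongr
    _ = _ := by ring

lemma exists_bound_of_hasCompactSupport {F : Type*} [NormedAddCommGroup F] {f : EE N → F}
    (hf : Continuous f) (hc : HasCompactSupport f) : ∃ C : ℝ, 0 ≤ C ∧ ∀ x, ‖f x‖ ≤ C := by
  obtain ⟨C, hC⟩ := hc.exists_bound_of_continuous hf
  exact ⟨C, (norm_nonneg _).trans (hC 0), hC⟩

/-- The correlation of `f` with its rotated copy under the Gaussian. -/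
def corr (f : EE N → ℝ) (s θ : ℝ) : ℝ :=
  ∫ p : EE N × EE N, f p.1 * f (Real.cos θ • p.1 + Real.sin θ • p.2) * gg s p

lemma hasDerivAt_corr {f : EE N → ℝ} (hf : ContDiff ℝ 1 f) (hc : HasCompactSupport f) {s : ℝ}
    (hs : 0 < s) (θ : ℝ) : HasDerivAt (corr f s) (∫ p : EE N × EE N, f p.1 *
      ⟪gradient f (Real.cos θ • p.1 + Real.sin θ • p.2), (-Real.sin θ) • p.1 + Real.cos θ • p.2⟫ *
        gg s p) θ := by
  obtain ⟨A, hA0, hA⟩ := exists_bound_of_hasCompactSupport hf.continuous hc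
  obtain ⟨B, hB0, hB⟩ := exists_bound_of_hasCompactSupport (continuous_gradient hf) hc.gradient
  obtain ⟨C, hC0, hC⟩ := exists_norm_mul_gg_le (N := N) hs
  have hgc := continuous_gradient hf
  have hfc := hf.continuous
  have hg := continuous_gg (N := N) s
  refine (hasDerivAt_integral_of_dominated_loc_of_deriv_le (μ := volume)
    (F := fun θ (p : EE N × EE N) => f p.1 * f (Real.cos θ • p.1 + Real.sin θ • p.2) * gg s p)
    (F' := fun θ (p : EE N × EE N) => f p.1 *
      ⟪gradient f (Real.cos θ • p.1 + Real.sin θ • p.2), (-Real.sin θ) • p.1 + Real.cos θ • p.2⟫ *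
        gg s p) (bound := fun p => A * B * (C * gg (4 * s) p)) (s := univ) univ_mem
    (Eventually.of_forall fun t => ?_) ?_ ?_ (Eventually.of_forall fun p t _ => ?_) ?_
    (Eventually.of_forall fun p t _ => ?_)).2
  · exact Continuous.aestronglyMeasurable (by fun_prop)
  · refine integrable_mul_gg hs (by fun_prop) (C := A * A) fun p => ?_
    rw [abs_mul]
    exact mul_le_mul (hA _) (hA _) (abs_nonneg _) hA0
  · exact Continuous.aestronglyMeasurable (by fun_prop)
  · rw [norm_mul, norm_mul, Real.norm_eq_abs (gg s p), abs_of_pos (gg_pos s p)]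
    have h1 : ‖(-Real.sin t) • p.1 + Real.cos t • p.2‖ ≤ ‖p.1‖ + ‖p.2‖ := by
      refine (norm_add_le _ _).trans ?_
      rw [norm_smul, norm_smul, norm_neg]
      gcongr
      · exact mul_le_of_le_one_left (norm_nonneg _) (Real.abs_sin_le_one t)
      · exact mul_le_of_le_one_left (norm_nonneg _) (Real.abs_cos_le_one t)
    calc _ ≤ A * (B * (‖p.1‖ + ‖p.2‖)) * gg s p := by
          refine mul_le_mul_of_nonneg_right ?_ (gg_pos s p).le
          refine mul_le_mul (hA _) ?_ (norm_nonneg _) hA0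
          refine (norm_inner_le_norm _ _).trans ?_
          exact mul_le_mul (hB _) h1 (norm_nonneg _) hB0
      _ = A * B * ((‖p.1‖ + ‖p.2‖) * gg s p) := by ring
      _ ≤ _ := mul_le_mul_of_nonneg_left (hC p) (by positivity)
  · exact ((integrable_gg (by positivity)).const_mul _).const_mul _
  · have h1 : HasDerivAt (fun θ => Real.cos θ • p.1 + Real.sin θ • p.2)
        ((-Real.sin t) • p.1 + Real.cos t • p.2) t :=
      ((Real.hasDerivAt_cos t).smul_const _).add ((Real.hasDerivAt_sin t).smul_const _)
    have h2 := ((hf.differentiable (by norm_num)) (Real.cos t • p.1 + Real.sin t • p.2)).hasFDerivAt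
    have h3 := h2.comp_hasDerivAt t h1
    rw [fderiv_apply_eq_inner] at h3
    exact (h3.const_mul _).mul_const _

lemma integral_fst_mul_gg {f : EE N → ℝ} {s : ℝ} (hs : 0 < s) :
    ∫ p : EE N × EE N, f p.1 * gg s p = ∫ x, f x * gs s x := by
  have : ∀ p : EE N × EE N, f p.1 * gg s p = (f p.1 * gs s p.1) * gs s p.2 := by
    intro p; unfold gg; ring
  simp only [this]
  rw [Measure.volume_eq_prod, integral_prod_mul (fun x => f x * gs s x) (gs s), integral_gs hs, mul_one]

lemma corr_zero {f : EE N → ℝ} {s : ℝ} (hs : 0 < s) : corr f s 0 = ∫ x, f x ^ 2 * gs s x := by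
  rw [← integral_fst_mul_gg hs, corr]
  simp [sq]

lemma corr_pi_div_two (f : EE N → ℝ) (s : ℝ) : corr f s (Real.pi / 2) = (∫ x, f x * gs s x) ^ 2 := by
  have : ∀ p : EE N × EE N, f p.1 * f (Real.cos (Real.pi / 2) • p.1 + Real.sin (Real.pi / 2) • p.2) *
      gg s p = (f p.1 * gs s p.1) * (f p.2 * gs s p.2) := by
    intro p; simp [gg]; ring
  simp only [corr, this]
  rw [Measure.volume_eq_prod, integral_prod_mul (fun x => f x * gs s x) (fun x => f x * gs s x), sq]

lemma integral_inner_rot {f : EE N → ℝ} (hf : ContDiff ℝ 1 f) (hc : HasCompactSupport f) {s : ℝ}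
    (hs : 0 < s) {a b : ℝ} (h : a ^ 2 + b ^ 2 = 1) (hb : b ≠ 0) :
    ∫ p : EE N × EE N, f p.1 * ⟪gradient f (a • p.1 + b • p.2), (-b) • p.1 + a • p.2⟫ * gg s p =
      -(s * b * ∫ p : EE N × EE N, ⟪gradient f (a • p.1 - b • p.2), gradient f p.1⟫ * gg s p) := by
  obtain ⟨A, hA0, hA⟩ := exists_bound_of_hasCompactSupport hf.continuous hc
  obtain ⟨B, hB0, hB⟩ := exists_bound_of_hasCompactSupport (continuous_gradient hf) hc.gradient
  obtain ⟨C, hC0, hC⟩ := exists_norm_mul_gg_le (N := N) hs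
  have hgc := continuous_gradient hf
  have hfc := hf.continuous
  have hg := continuous_gg (N := N) s
  have hg1 := continuous_gs (N := N) s
  have h' : a ^ 2 + (-b) ^ 2 = 1 := by rw [neg_sq, h]
  rw [← integral_comp_rot h (F := fun p : EE N × EE N => f p.1 *
    ⟪gradient f (a • p.1 + b • p.2), (-b) • p.1 + a • p.2⟫ * gg s p) (by fun_prop)]
  have e1 : ∀ p : EE N × EE N, a • (rot a b p).1 + b • (rot a b p).2 = p.1 := fun p => by
    refine Eq.trans ?_ (congrArg Prod.fst (rot_neg_rot h p))
    simp only [rot]; module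
  have e2 : ∀ p : EE N × EE N, (-b) • (rot a b p).1 + a • (rot a b p).2 = p.2 := fun p => by
    refine Eq.trans ?_ (congrArg Prod.snd (rot_neg_rot h p))
    simp only [rot]
  simp only [e1, e2, gg_rot h]
  have i1 : Integrable fun p : EE N × EE N => f (rot a b p).1 * ⟪gradient f p.1, p.2⟫ * gg s p := by
    refine (((integrable_gg (s := 4 * s) (by positivity)).const_mul C).const_mul (A * B)).mono'
      (Continuous.aestronglyMeasurable (by have := continuous_rot (N := N) a b; fun_prop))
      (Eventually.of_forall fun p => ?_)
    rw [norm_mul, norm_mul, Real.norm_eq_abs (gg s p), abs_of_pos (gg_pos s p)]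
    have h1 : ‖p.2‖ ≤ ‖p.1‖ + ‖p.2‖ := by linarith [norm_nonneg p.1]
    calc _ ≤ A * (B * (‖p.1‖ + ‖p.2‖)) * gg s p := by
          refine mul_le_mul_of_nonneg_right ?_ (gg_pos s p).le
          refine mul_le_mul (hA _) ?_ (norm_nonneg _) hA0
          refine (norm_inner_le_norm _ _).trans ?_
          exact mul_le_mul (hB _) h1 (norm_nonneg _) hB0
      _ = A * B * ((‖p.1‖ + ‖p.2‖) * gg s p) := by ring
      _ ≤ _ := mul_le_mul_of_nonneg_left (hC p) (by positivity)
  have i2 : Integrable fun p : EE N × EE N =>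
      ⟪gradient f (a • p.1 - b • p.2), gradient f p.1⟫ * gg s p := by
    refine integrable_mul_gg hs (by fun_prop) (C := B * B) fun p => ?_
    exact (abs_real_inner_le_norm _ _).trans (mul_le_mul (hB _) (hB _) (norm_nonneg _) hB0)
  rw [Measure.volume_eq_prod] at i1 i2 ⊢
  rw [integral_prod _ i1, integral_prod _ i2, ← integral_const_mul, ← integral_neg]
  refine integral_congr_ae (Eventually.of_forall fun x => ?_)
  simp only [rot, gg]
  have hin : ContDiff ℝ 1 fun y : EE N => f (a • x - b • y) :=
    hf.comp (contDiff_const.sub (contDiff_id.const_smul b))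
  have hcs : HasCompactSupport fun y : EE N => f (a • x - b • y) :=
    hc.comp_homeomorph ((Homeomorph.smulOfNeZero b hb).trans (Homeomorph.subLeft (a • x)))
  have hp := integral_dv_mul_gs s (X := fun y => f (a • x - b • y) • gradient f x)
    (hin.smul contDiff_const) hcs.smul_right
  have hd : ∀ y, dv (fun y => f (a • x - b • y) • gradient f x) y =
      -(b * ⟪gradient f (a • x - b • y), gradient f x⟫) := by
    intro y
    rw [dv_smul (X := fun _ => gradient f x) (hin.differentiable (by norm_num) y) (by fun_prop), dv_const]
    have h1 : HasFDerivAt (fun y : EE N => a • x - b • y) (-(b • ContinuousLinearMap.id ℝ (EE N))) y :=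
      ((hasFDerivAt_id y).const_smul b).const_sub _
    have h2 := ((hf.differentiable (by norm_num)) (a • x - b • y)).hasFDerivAt.comp y h1
    have h3 : fderiv ℝ (fun y => f (a • x - b • y)) y = _ := h2.fderiv
    rw [h3]
    simp only [ContinuousLinearMap.comp_apply, neg_apply,
      smul_apply, ContinuousLinearMap.id_apply, map_neg, map_smul, smul_eq_mul,
      mul_zero, zero_add]
    rw [fderiv_apply_eq_inner f]
  simp only [hd, real_inner_smul_left] at hp
  have hL : ∀ y, f (a • x - b • y) * ⟪gradient f x, y⟫ * (gs s x * gs s y) =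
      gs s x * (f (a • x - b • y) * ⟪gradient f x, y⟫ * gs s y) := fun y => by ring
  have hR : ∀ y, s * b * (⟪gradient f (a • x - b • y), gradient f x⟫ * (gs s x * gs s y)) =
      (-(s * gs s x)) * (-(b * ⟪gradient f (a • x - b • y), gradient f x⟫) * gs s y) :=
    fun y => by ring
  rw [← integral_const_mul]
  simp only [hL, hR]
  rw [integral_const_mul, integral_const_mul, hp]
  field_simp

/-- The Gaussian Poincaré inequality with its sharp constant. -/
lemma gaussian_poincare {f : EE N → ℝ} (hf : ContDiff ℝ 1 f) (hc : HasCompactSupport f) {s : ℝ}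
    (hs : 0 < s) : ∫ x, f x ^ 2 * gs s x ≤
      (∫ x, f x * gs s x) ^ 2 + s * ∫ x, ‖gradient f x‖ ^ 2 * gs s x := by
  obtain ⟨B, hB0, hB⟩ := exists_bound_of_hasCompactSupport (continuous_gradient hf) hc.gradient
  have hgc := continuous_gradient hf
  set D := ∫ x, ‖gradient f x‖ ^ 2 * gs s x with hD
  have hcont : ContinuousOn (fun θ => corr f s θ - s * D * Real.cos θ) (Icc 0 (Real.pi / 2)) :=
    fun θ _ => (((hasDerivAt_corr hf hc hs θ).sub
      ((Real.hasDerivAt_cos θ).const_mul (s * D))).continuousAt).continuousWithinAt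
  have hmono := monotoneOn_of_deriv_nonneg (convex_Icc 0 (Real.pi / 2)) hcont
    (fun θ _ => ((hasDerivAt_corr hf hc hs θ).sub
      ((Real.hasDerivAt_cos θ).const_mul (s * D))).differentiableAt.differentiableWithinAt)
    (fun θ hθ => ?_)
  · have := hmono (left_mem_Icc.2 (by positivity)) (right_mem_Icc.2 (by positivity))
      (by positivity)
    simp only [corr_zero hs, corr_pi_div_two, Real.cos_zero, Real.cos_pi_div_two] at this
    linarith
  · rw [interior_Icc] at hθ
    have hsin : 0 < Real.sin θ := Real.sin_pos_of_pos_of_lt_pi hθ.1 (by linarith [hθ.2, Real.pi_pos])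
    have h1 : Real.cos θ ^ 2 + Real.sin θ ^ 2 = 1 := by rw [add_comm, Real.sin_sq_add_cos_sq]
    have hder := (hasDerivAt_corr hf hc hs θ).sub ((Real.hasDerivAt_cos θ).const_mul (s * D))
    change 0 ≤ deriv (corr f s - fun θ => s * D * Real.cos θ) θ
    rw [hder.deriv, integral_inner_rot hf hc hs h1 hsin.ne']
    have hb : ∀ p : EE N, |‖gradient f p‖ ^ 2| ≤ B ^ 2 := fun p => by
      rw [abs_of_nonneg (sq_nonneg _)]
      exact pow_le_pow_left₀ (norm_nonneg _) (hB _) 2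
    have i1 : Integrable fun p : EE N × EE N => ‖gradient f p.1‖ ^ 2 * gg s p :=
      integrable_mul_gg hs (by fun_prop) fun p => hb _
    have i2 : Integrable fun p : EE N × EE N =>
        ‖gradient f (Real.cos θ • p.1 - Real.sin θ • p.2)‖ ^ 2 * gg s p :=
      integrable_mul_gg hs (by fun_prop) fun p => hb _
    have i3 : Integrable fun p : EE N × EE N =>
        ⟪gradient f (Real.cos θ • p.1 - Real.sin θ • p.2), gradient f p.1⟫ * gg s p :=
      integrable_mul_gg hs (by fun_prop) (C := B * B) fun p =>
        (abs_real_inner_le_norm _ _).trans (mul_le_mul (hB _) (hB _) (norm_nonneg _) hB0)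
    have e1 : ∫ p : EE N × EE N, ‖gradient f p.1‖ ^ 2 * gg s p = D :=
      integral_fst_mul_gg (f := fun x => ‖gradient f x‖ ^ 2) hs
    have e2 : ∫ p : EE N × EE N, ‖gradient f (Real.cos θ • p.1 - Real.sin θ • p.2)‖ ^ 2 * gg s p = D := by
      rw [← e1, ← integral_comp_rot h1 (F := fun p : EE N × EE N => ‖gradient f p.1‖ ^ 2 * gg s p)
        (by have := continuous_gg (N := N) s; fun_prop)]
      simp only [gg_rot h1]
      rfl
    have h2 : ∫ p : EE N × EE N, ⟪gradient f (Real.cos θ • p.1 - Real.sin θ • p.2), gradient f p.1⟫ *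
        gg s p ≤ D := by
      calc _ ≤ ∫ p : EE N × EE N, (2⁻¹ * (‖gradient f (Real.cos θ • p.1 - Real.sin θ • p.2)‖ ^ 2 * gg s p)
            + 2⁻¹ * (‖gradient f p.1‖ ^ 2 * gg s p)) := by
            refine integral_mono i3 ((i2.const_mul _).add (i1.const_mul _)) fun p => ?_
            have h3 := real_inner_le_norm (gradient f (Real.cos θ • p.1 - Real.sin θ • p.2))
              (gradient f p.1)
            have h4 := gg_pos s p
            have h5 := two_mul_le_add_sq (‖gradient f (Real.cos θ • p.1 - Real.sin θ • p.2)‖)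
              (‖gradient f p.1‖)
            have h6 : ⟪gradient f (Real.cos θ • p.1 - Real.sin θ • p.2), gradient f p.1⟫ ≤
              2⁻¹ * ‖gradient f (Real.cos θ • p.1 - Real.sin θ • p.2)‖ ^ 2 +
                2⁻¹ * ‖gradient f p.1‖ ^ 2 := by linarith
            refine (mul_le_mul_of_nonneg_right h6 h4.le).trans (le_of_eq ?_)
            ring
        _ = D := by
            rw [integral_add (i2.const_mul _) (i1.const_mul _), integral_const_mul,
              integral_const_mul, e1, e2]
            ring
    have h3 := mul_le_mul_of_nonneg_left h2 (mul_pos hs hsin).le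
    linarith

end

section

variable {N : ℕ}

lemma fderiv_normSq_comp {A : ℝ → ℝ} {x : EE N} (hA : DifferentiableAt ℝ A (‖x‖ ^ 2)) (y : EE N) :
    fderiv ℝ (fun y : EE N => A (‖y‖ ^ 2)) x y = 2 * deriv A (‖x‖ ^ 2) * ⟪x, y⟫ := by
  rw [fderiv_apply_eq_inner, gradient_normSq_comp hA, real_inner_smul_left]

/-- The deviation of `u` from two-homogeneity. -/
def Zf (u : EE N → ℝ) (x : EE N) : ℝ := ⟪gradient u x, x⟫ - 2 * u x

lemma continuous_Zf {u : EE N → ℝ} (hu : ContDiff ℝ 1 u) : Continuous (Zf u) := by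
  have := continuous_gradient hu
  have := hu.continuous
  unfold Zf; fun_prop

lemma hasCompactSupport_radial {A : ℝ → ℝ} {R : ℝ} (hR : 0 ≤ R) (hA : ∀ σ, R ^ 2 ≤ σ → A σ = 0) :
    HasCompactSupport fun x : EE N => A (‖x‖ ^ 2) :=
  HasCompactSupport.intro (isCompact_closedBall 0 R) fun x hx =>
    hA _ (pow_le_pow_left₀ hR (by simp at hx; exact hx.le) 2)

lemma deriv_eq_zero_of_eq_zero {A : ℝ → ℝ} {c : ℝ} (hA1 : ContDiff ℝ 1 A) (hA : ∀ σ, c ≤ σ → A σ = 0) :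
    ∀ σ, c ≤ σ → deriv A σ = 0 := by
  have h : ∀ σ ∈ Ioi c, deriv A σ = 0 := fun σ hσ => by
    have : A =ᶠ[nhds σ] fun _ => 0 := by
      filter_upwards [isOpen_Ioi.mem_nhds hσ] with t ht using hA t (le_of_lt ht)
    rw [this.deriv_eq]; simp
  have hcl : Set.EqOn (deriv A) (fun _ => 0) (closure (Ioi c)) :=
    Set.EqOn.closure h (hA1.continuous_deriv (by norm_num)) continuous_const
  intro σ hσ
  exact hcl (by rw [closure_Ioi]; exact hσ)

lemma hasCompactSupport_dv {X : EE N → EE N} (hc : HasCompactSupport X) : HasCompactSupport (dv X) :=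
  (hc.fderiv (𝕜 := ℝ)).mono (by
    intro x hx h
    exact hx (by simp [dv, h]))

/-- The Weiss-type identity for smooth functions with a radial weight. -/
lemma weiss_smooth {U : EE N → ℝ} (hU : ContDiff ℝ (⊤ : ℕ∞) U) {A : ℝ → ℝ}
    (hA : ContDiff ℝ (⊤ : ℕ∞) A) {R : ℝ} (hR : 0 ≤ R) (hA0 : ∀ σ, R ^ 2 ≤ σ → A σ = 0) :
    ∫ x : EE N, (A (‖x‖ ^ 2) * Zf U x * lap N U x + 2 * deriv A (‖x‖ ^ 2) * Zf U x ^ 2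
      - 2⁻¹ * ‖gradient U x‖ ^ 2 * (2 * ‖x‖ ^ 2 * deriv A (‖x‖ ^ 2) + (N + 2) * A (‖x‖ ^ 2))
      - 2 * U x ^ 2 * (2 * ‖x‖ ^ 2 * deriv (deriv A) (‖x‖ ^ 2) + (N + 4) * deriv A (‖x‖ ^ 2))) = 0 := by
  have hA' : ContDiff ℝ (⊤ : ℕ∞) (deriv A) := (contDiff_infty_iff_deriv.1 hA).2
  have hA0' := deriv_eq_zero_of_eq_zero (hA.of_le (by exact_mod_cast le_top)) hA0
  have hG := contDiff_gradient_infty hU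
  have hns : ContDiff ℝ (⊤ : ℕ∞) fun x : EE N => ‖x‖ ^ 2 := contDiff_norm_sq ℝ
  have ha : ContDiff ℝ (⊤ : ℕ∞) fun x : EE N => A (‖x‖ ^ 2) := hA.comp hns
  have ha' : ContDiff ℝ (⊤ : ℕ∞) fun x : EE N => deriv A (‖x‖ ^ 2) := hA'.comp hns
  have hZ : ContDiff ℝ (⊤ : ℕ∞) (Zf U) := (hG.inner ℝ contDiff_id).sub (contDiff_const.mul hU)
  have c1 : HasCompactSupport fun x : EE N => A (‖x‖ ^ 2) := hasCompactSupport_radial hR hA0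
  have c2 : HasCompactSupport fun x : EE N => deriv A (‖x‖ ^ 2) := hasCompactSupport_radial hR hA0'
  have dU := hU.differentiable (by simp)
  have dG := hG.differentiable (by simp)
  have da := ha.differentiable (by simp)
  have da' := ha'.differentiable (by simp)
  have dZ := hZ.differentiable (by simp)
  have symm : ∀ x a b : EE N, ⟪fderiv ℝ (gradient U) x a, b⟫ = ⟪fderiv ℝ (gradient U) x b, a⟫ := by
    have : ∀ x a b : EE N, fderiv ℝ (fun y => fderiv ℝ U y b) x a = ⟪fderiv ℝ (gradient U) x a, b⟫ := by
      intro x a b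
      have e : (fun y => fderiv ℝ U y b) = fun y => ⟪gradient U y, b⟫ := funext fun y =>
        fderiv_apply_eq_inner U y b
      rw [e, fderiv_inner_apply ℝ (dG x) (differentiableAt_const b)]
      simp
    intro x a b
    rw [← this, ← this, fderiv_fderiv_comm (contDiff_two_of_infty hU)]
  have fZ : ∀ x v, fderiv ℝ (Zf U) x v = ⟪fderiv ℝ (gradient U) x v, x⟫ - ⟪gradient U x, v⟫ := by
    intro x v
    have e : Zf U = fun y => ⟪gradient U y, y⟫ - 2 * U y := rfl
    rw [e, fderiv_fun_sub ((dG x).inner ℝ differentiableAt_fun_id) ((dU x).const_mul 2),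
      fderiv_const_mul (dU x), sub_apply, fderiv_inner_apply ℝ (dG x) differentiableAt_fun_id,
      smul_apply, fderiv_apply_eq_inner U]
    simp; ring
  have dc : Differentiable ℝ fun y => A (‖y‖ ^ 2) * Zf U y := da.mul dZ
  have d1 : ∀ x, dv (fun y => (A (‖y‖ ^ 2) * Zf U y) • gradient U y) x =
      A (‖x‖ ^ 2) * Zf U x * lap N U x + (A (‖x‖ ^ 2) *
        (⟪fderiv ℝ (gradient U) x (gradient U x), x⟫ - ‖gradient U x‖ ^ 2) +
        Zf U x * (2 * deriv A (‖x‖ ^ 2) * ⟪gradient U x, x⟫)) := by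
    intro x
    rw [dv_smul (X := gradient U) (dc x) (dG x), dv_gradient (contDiff_two_of_infty hU),
      fderiv_fun_mul (da x) (dZ x), add_apply, smul_apply, smul_apply, fZ,
      fderiv_normSq_comp (hA.differentiable (by simp) _), real_inner_comm (gradient U x) x,
      real_inner_self_eq_norm_sq]
    simp
  have dn : Differentiable ℝ fun y => ‖gradient U y‖ ^ 2 := fun y => (dG y).norm_sq ℝ
  have fn : ∀ x v, fderiv ℝ (fun y => ‖gradient U y‖ ^ 2) x v =
      2 * ⟪fderiv ℝ (gradient U) x v, gradient U x⟫ := by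
    intro x v
    simp only [← real_inner_self_eq_norm_sq]
    rw [fderiv_inner_apply ℝ (dG x) (dG x), real_inner_comm]; ring
  have db1 : Differentiable ℝ fun y => A (‖y‖ ^ 2) * ‖gradient U y‖ ^ 2 := da.mul dn
  have dp : Differentiable ℝ fun y => U y ^ 2 := dU.pow 2
  have db2 : Differentiable ℝ fun y => deriv A (‖y‖ ^ 2) * U y ^ 2 := da'.mul dp
  have d2 : ∀ x, dv (fun y => (A (‖y‖ ^ 2) * ‖gradient U y‖ ^ 2) • y) x =
      A (‖x‖ ^ 2) * ‖gradient U x‖ ^ 2 * N + (A (‖x‖ ^ 2) *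
        (2 * ⟪fderiv ℝ (gradient U) x x, gradient U x⟫) +
        ‖gradient U x‖ ^ 2 * (2 * deriv A (‖x‖ ^ 2) * ‖x‖ ^ 2)) := by
    intro x
    rw [dv_smul (X := fun y => y) (db1 x) differentiableAt_fun_id, dv_id,
      fderiv_fun_mul (da x) (dn x), add_apply, smul_apply, smul_apply, fn,
      fderiv_normSq_comp (hA.differentiable (by simp) _), real_inner_self_eq_norm_sq]
    simp
  have d3 : ∀ x, dv (fun y => (deriv A (‖y‖ ^ 2) * U y ^ 2) • y) x =
      deriv A (‖x‖ ^ 2) * U x ^ 2 * N + (deriv A (‖x‖ ^ 2) * (2 * U x * ⟪gradient U x, x⟫) +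
        U x ^ 2 * (2 * deriv (deriv A) (‖x‖ ^ 2) * ‖x‖ ^ 2)) := by
    intro x
    rw [dv_smul (X := fun y => y) (db2 x) differentiableAt_fun_id, dv_id,
      fderiv_fun_mul (da' x) (dp x), add_apply, smul_apply, smul_apply,
      fderiv_normSq_comp (hA'.differentiable (by simp) _), real_inner_self_eq_norm_sq,
      fderiv_fun_pow 2 (dU x), smul_apply, fderiv_apply_eq_inner U]
    simp
  have one : ∀ {f : EE N → EE N}, ContDiff ℝ (⊤ : ℕ∞) f → ContDiff ℝ 1 f := fun h =>
    h.of_le (by exact_mod_cast le_top)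
  have s1 := (ha.mul hZ).smul hG
  have s2 := (ha.mul (hG.norm_sq ℝ)).smul (contDiff_id (𝕜 := ℝ) (E := EE N))
  have s3 := (ha'.mul (hU.pow 2)).smul (contDiff_id (𝕜 := ℝ) (E := EE N))
  have k1 := integral_dv_eq_zero (one s1) (c1.mul_right.smul_right)
  have k2 := integral_dv_eq_zero (one s2) (c1.mul_right.smul_right)
  have k3 := integral_dv_eq_zero (one s3) (c2.mul_right.smul_right)
  have i1 := (continuous_dv (one s1)).integrable_of_hasCompactSupport (μ := volume)
    (hasCompactSupport_dv (c1.mul_right.smul_right))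
  have i2 := (continuous_dv (one s2)).integrable_of_hasCompactSupport (μ := volume)
    (hasCompactSupport_dv (c1.mul_right.smul_right))
  have i3 := (continuous_dv (one s3)).integrable_of_hasCompactSupport (μ := volume)
    (hasCompactSupport_dv (c2.mul_right.smul_right))
  have key := integral_sub (i1.sub (i2.const_mul 2⁻¹)) (i3.const_mul 2)
  simp only [Pi.sub_apply] at key
  rw [integral_sub i1 (i2.const_mul 2⁻¹), integral_const_mul, integral_const_mul] at key
  rw [k1, k2, k3] at key
  refine Eq.trans (integral_congr_ae (Eventually.of_forall fun x => ?_)) (key.trans (by ring))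
  have d1 := d1 x
  have d2 := d2 x
  have d3 := d3 x
  change _ = dv (fun y => (A (‖y‖ ^ 2) * Zf U y) • gradient U y) x -
    2⁻¹ * dv (fun y => (A (‖y‖ ^ 2) * ‖gradient U y‖ ^ 2) • y) x -
    2 * dv (fun y => (deriv A (‖y‖ ^ 2) * U y ^ 2) • y) x
  rw [d1, d2, d3, symm x x (gradient U x)]
  simp only [Zf]
  ring

end

section

variable {N : ℕ}

lemma tendsto_moll {f : EE N → ℝ} (hf : Continuous f) (x : EE N) {δ : ℕ → ℝ} (hδ : Tendsto δ atTop (nhds 0)) :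
    Tendsto (fun n => moll (δ n) f x) atTop (nhds (f x)) := by
  rw [Metric.tendsto_atTop]
  intro ε hε
  obtain ⟨d, hd, h⟩ := Metric.continuousAt_iff.1 hf.continuousAt (ε / 2) (half_pos hε)
  obtain ⟨n0, hn0⟩ := Metric.tendsto_atTop.1 hδ d hd
  refine ⟨n0, fun n hn => lt_of_le_of_lt ?_ (half_lt_self hε)⟩
  rw [Real.dist_eq]
  refine abs_moll_sub_le hf fun z hz => ?_
  have h1 := hn0 n hn
  rw [Real.dist_eq, sub_zero] at h1
  refine (h (x := x + δ n • z) ?_).le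
  rw [dist_eq_norm, add_sub_cancel_left, norm_smul, Real.norm_eq_abs]
  exact (mul_le_of_le_one_right (abs_nonneg _) hz).trans_lt h1

lemma abs_moll_le {f : EE N → ℝ} (hf : Continuous f) {x : EE N} {δ K : ℝ}
    (h : ∀ y, ‖y - x‖ ≤ |δ| → |f y| ≤ K) : |moll δ f x| ≤ K := by
  have := abs_moll_sub_le (δ := δ) hf (x := x) (c := 0) (ε := K) fun z hz => by
    rw [sub_zero]
    refine h _ ?_
    rw [add_sub_cancel_left, norm_smul, Real.norm_eq_abs]
    exact mul_le_of_le_one_right (abs_nonneg _) hz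
  rwa [sub_zero] at this

lemma norm_le_sum_abs (x : EE N) : ‖x‖ ≤ ∑ i, |x i| := by
  rw [EuclideanSpace.norm_eq]
  refine Real.sqrt_le_iff.2 ⟨Finset.sum_nonneg fun i _ => abs_nonneg _, ?_⟩
  simp only [Real.norm_eq_abs]
  exact Finset.sum_sq_le_sq_sum_of_nonneg fun i _ => abs_nonneg _

/-- Smooth approximations of a solution, bounded together with their gradients and Laplacians. -/
lemma MemP.exists_approx {M : ℝ} {Ω : Set (EE N)} {u : EE N → ℝ} (hu : MemP N 1 0 M Ω u) {R : ℝ}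
    (hR : R < 1) : ∃ (U : ℕ → EE N → ℝ) (K : ℝ), 0 ≤ K ∧ (∀ n, ContDiff ℝ (⊤ : ℕ∞) (U n)) ∧
      ∀ x : EE N, ‖x‖ ≤ R → Tendsto (fun n => U n x) atTop (nhds (u x)) ∧
        Tendsto (fun n => gradient (U n) x) atTop (nhds (gradient u x)) ∧
        (∀ n, |U n x| ≤ K ∧ ‖gradient (U n) x‖ ≤ K ∧ |lap N (U n) x| ≤ 1) ∧
        (x ∈ Ω → Tendsto (fun n => lap N (U n) x) atTop (nhds 1)) := by
  have huc := hu.contDiff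
  have hgc := continuous_gradient huc
  obtain ⟨K1, hK1⟩ := (isCompact_closedBall (0 : EE N) 1).exists_bound_of_continuousOn
    huc.continuous.continuousOn
  obtain ⟨K2, hK2⟩ := (isCompact_closedBall (0 : EE N) 1).exists_bound_of_continuousOn
    hgc.continuousOn
  set δ : ℕ → ℝ := fun n => (1 - R) / (n + 2) with hδ
  have hδ0 : ∀ n, 0 < δ n := fun n => div_pos (by linarith) (by positivity)
  have hδ1 : ∀ n, δ n < 1 - R := fun n => by
    rw [hδ, div_lt_iff₀ (by positivity)]
    have : (0 : ℝ) ≤ n := n.cast_nonneg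
    nlinarith
  have hδt : Tendsto δ atTop (nhds 0) := by
    refine Tendsto.div_atTop tendsto_const_nhds ?_
    exact tendsto_atTop_add_const_right _ _ tendsto_natCast_atTop_atTop
  have hin : ∀ n, ∀ x : EE N, ‖x‖ ≤ R → ∀ y, ‖y - x‖ ≤ |δ n| → y ∈ closedBall (0 : EE N) 1 := by
    intro n x hx y hy
    rw [abs_of_pos (hδ0 n)] at hy
    rw [mem_closedBall_zero_iff]
    have := norm_add_le (y - x) x
    rw [sub_add_cancel] at this
    linarith [hδ1 n]
  have hK10 : 0 ≤ K1 := (norm_nonneg _).trans (hK1 0 (by simp))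
  have hK20 : 0 ≤ K2 := (norm_nonneg _).trans (hK2 0 (by simp))
  have hgi : ∀ n x i, gradient (moll (δ n) u) x i =
      moll (δ n) (fun y => fderiv ℝ u y (EuclideanSpace.single i 1)) x := fun n x i => by
    rw [gradient_apply, fderiv_moll _ huc]
  refine ⟨fun n => moll (δ n) u, K1 + N * K2, by positivity, fun n => contDiff_moll (hδ0 n) huc.continuous,
    fun x hx => ⟨tendsto_moll huc.continuous x hδt, ?_, fun n => ⟨?_, ?_, ?_⟩, fun hxΩ => ?_⟩⟩
  · have h1 : Tendsto (fun n => WithLp.ofLp (gradient (moll (δ n) u) x)) atTop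
        (nhds (WithLp.ofLp (gradient u x))) := by
      rw [tendsto_pi_nhds]
      intro i
      simp only [hgi, gradient_apply]
      exact tendsto_moll (hu.continuous_fderiv_apply _) x hδt
    exact ((PiLp.continuous_toLp 2 _).tendsto _).comp h1
  · exact (abs_moll_le huc.continuous fun y hy => hK1 y (hin n x hx y hy)).trans
      (le_add_of_nonneg_right (by positivity))
  · refine (norm_le_sum_abs _).trans ?_
    refine (Finset.sum_le_sum (g := fun _ => K2) fun i _ => ?_).trans ?_
    · rw [hgi]
      refine abs_moll_le (hu.continuous_fderiv_apply _) fun y hy => ?_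
      have h2 := (fderiv ℝ u y).le_opNorm (EuclideanSpace.single i 1)
      rw [← norm_gradient] at h2
      have h3 := hK2 y (hin n x hx y hy)
      simp only [PiLp.norm_single, norm_one, mul_one] at h2
      exact h2.trans h3
    · simp; exact hK10
  · refine hu.lap_moll_mem (hδ0 n) fun y hy => ?_
    rw [mem_closedBall, dist_eq_norm] at hy
    have := norm_add_le (y - x) x
    rw [sub_add_cancel] at this
    rw [mem_ball_zero_iff]
    linarith [hδ1 n]
  · obtain ⟨d, hd, hdΩ⟩ := Metric.isOpen_iff.1 hu.isOpen x hxΩ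
    refine tendsto_const_nhds.congr' ?_
    filter_upwards [hδt.eventually (Iio_mem_nhds hd)] with n hn
    refine (hu.lap_moll_eq_one (hδ0 n) (fun y hy => ?_) ((closedBall_subset_ball hn).trans hdΩ)).symm
    rw [mem_closedBall, dist_eq_norm] at hy
    have := norm_add_le (y - x) x
    rw [sub_add_cancel] at this
    rw [mem_ball_zero_iff]
    linarith [hδ1 n]

lemma integral_radial_mul_Zf {u : EE N → ℝ} (hu : ContDiff ℝ 1 u) {A : ℝ → ℝ}
    (hA : ContDiff ℝ (⊤ : ℕ∞) A) {R : ℝ} (hR : 0 ≤ R) (hA0 : ∀ σ, R ^ 2 ≤ σ → A σ = 0) :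
    ∫ x : EE N, A (‖x‖ ^ 2) * Zf u x =
      - ∫ x : EE N, u x * (2 * ‖x‖ ^ 2 * deriv A (‖x‖ ^ 2) + (N + 2) * A (‖x‖ ^ 2)) := by
  have hns : ContDiff ℝ (⊤ : ℕ∞) fun x : EE N => ‖x‖ ^ 2 := contDiff_norm_sq ℝ
  have ha : ContDiff ℝ 1 fun x : EE N => A (‖x‖ ^ 2) := contDiff_one_of_infty (hA.comp hns)
  have hA' : Continuous (deriv A) := hA.continuous_deriv (by exact_mod_cast le_top)
  have c1 : HasCompactSupport fun x : EE N => A (‖x‖ ^ 2) := hasCompactSupport_radial hR hA0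
  have hA0' := deriv_eq_zero_of_eq_zero (hA.of_le (by exact_mod_cast le_top)) hA0
  have c2 : HasCompactSupport fun x : EE N => deriv A (‖x‖ ^ 2) := hasCompactSupport_radial hR hA0'
  have h := integral_fderiv_field' hu (ha.smul contDiff_id) c1.smul_right
  have d1 : ∀ x, dv ((fun x : EE N => A (‖x‖ ^ 2)) • (id : EE N → EE N)) x =
      A (‖x‖ ^ 2) * N + 2 * deriv A (‖x‖ ^ 2) * ‖x‖ ^ 2 := by
    intro x
    refine (dv_smul (X := fun y => y) (ha.differentiable (by norm_num) x)
      differentiableAt_fun_id).trans ?_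
    rw [dv_id, fderiv_normSq_comp (hA.differentiable (by simp) _), real_inner_self_eq_norm_sq]
  simp only [d1] at h
  have h2 : ∀ x : EE N, A (‖x‖ ^ 2) * Zf u x =
      fderiv ℝ u x (((fun x : EE N => A (‖x‖ ^ 2)) • (id : EE N → EE N)) x) - 2 * (u x * A (‖x‖ ^ 2)) := by
    intro x
    rw [fderiv_apply_eq_inner u]
    simp only [Zf, Pi.smul_apply', id, real_inner_smul_right]
    ring
  have hac := ha.continuous
  have huc := hu.continuous
  have hgc := continuous_gradient hu
  have i1 : Integrable fun x : EE N => fderiv ℝ u x (((fun x : EE N => A (‖x‖ ^ 2)) • (id : EE N → EE N)) x) := by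
    have : (fun x : EE N => fderiv ℝ u x (((fun x : EE N => A (‖x‖ ^ 2)) • (id : EE N → EE N)) x)) =
        fun x => A (‖x‖ ^ 2) * ⟪gradient u x, x⟫ := by
      funext x; rw [fderiv_apply_eq_inner u]
      simp only [Pi.smul_apply', id, real_inner_smul_right]
    rw [this]
    exact Continuous.integrable_of_hasCompactSupport (by fun_prop) c1.mul_right
  have i2 : Integrable fun x : EE N => u x * A (‖x‖ ^ 2) :=
    Continuous.integrable_of_hasCompactSupport (by fun_prop) c1.mul_left
  have i3 : Integrable fun x : EE N => u x * (A (‖x‖ ^ 2) * N + 2 * deriv A (‖x‖ ^ 2) * ‖x‖ ^ 2) :=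
    Continuous.integrable_of_hasCompactSupport (by fun_prop)
      ((c1.mul_right.add (c2.mul_left.mul_right)).mul_left)
  simp only [h2]
  rw [integral_sub i1 (i2.const_mul 2), h, integral_const_mul, neg_sub_left, neg_inj, ← integral_const_mul,
    ← integral_add (i2.const_mul 2) i3]
  refine integral_congr_ae (Eventually.of_forall fun x => ?_)
  ring

/-- The Weiss-type identity for solutions of the obstacle-type problem. -/
lemma MemP.weiss {M : ℝ} {Ω : Set (EE N)} {u : EE N → ℝ} (hu : MemP N 1 0 M Ω u) {A : ℝ → ℝ}
    (hA : ContDiff ℝ (⊤ : ℕ∞) A) {R : ℝ} (hR : 0 ≤ R) (hR1 : R < 1) (hA0 : ∀ σ, R ^ 2 ≤ σ → A σ = 0) :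
    ∫ x : EE N, ((2⁻¹ * ‖gradient u x‖ ^ 2 + u x) *
        (2 * ‖x‖ ^ 2 * deriv A (‖x‖ ^ 2) + (N + 2) * A (‖x‖ ^ 2))
      + 2 * u x ^ 2 * (2 * ‖x‖ ^ 2 * deriv (deriv A) (‖x‖ ^ 2) + (N + 4) * deriv A (‖x‖ ^ 2))) =
    ∫ x : EE N, 2 * deriv A (‖x‖ ^ 2) * Zf u x ^ 2 := by
  have hA' : ContDiff ℝ (⊤ : ℕ∞) (deriv A) := (contDiff_infty_iff_deriv.1 hA).2
  have hA'' : ContDiff ℝ (⊤ : ℕ∞) (deriv (deriv A)) := (contDiff_infty_iff_deriv.1 hA').2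
  have hA0' := deriv_eq_zero_of_eq_zero (hA.of_le (by exact_mod_cast le_top)) hA0
  have hA0'' := deriv_eq_zero_of_eq_zero (hA'.of_le (by exact_mod_cast le_top)) hA0'
  obtain ⟨U, K, hK, hU, hlim⟩ := hu.exists_approx hR1
  have huc := hu.contDiff.continuous
  have hgc := continuous_gradient hu.contDiff
  have hZc := continuous_Zf hu.contDiff
  have bdd : ∀ {B : ℝ → ℝ}, ContDiff ℝ (⊤ : ℕ∞) B → (∀ σ, R ^ 2 ≤ σ → B σ = 0) →
      ∃ C, 0 ≤ C ∧ ∀ x : EE N, |B (‖x‖ ^ 2)| ≤ C := fun {B} hB hB0 =>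
    exists_bound_of_hasCompactSupport (N := N) (f := fun x => B (‖x‖ ^ 2))
      (by have := hB.continuous; fun_prop) (hasCompactSupport_radial hR hB0)
  obtain ⟨C0, hC00, hC0⟩ := bdd hA hA0
  obtain ⟨C1, hC10, hC1⟩ := bdd hA' hA0'
  obtain ⟨C2, hC20, hC2⟩ := bdd hA'' hA0''
  have hAc := hA.continuous
  have hAc' := hA'.continuous
  have hAc'' := hA''.continuous
  have lim : Tendsto (fun n => ∫ x : EE N, (A (‖x‖ ^ 2) * Zf (U n) x * lap N (U n) x
      + 2 * deriv A (‖x‖ ^ 2) * Zf (U n) x ^ 2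
      - 2⁻¹ * ‖gradient (U n) x‖ ^ 2 * (2 * ‖x‖ ^ 2 * deriv A (‖x‖ ^ 2) + (N + 2) * A (‖x‖ ^ 2))
      - 2 * U n x ^ 2 * (2 * ‖x‖ ^ 2 * deriv (deriv A) (‖x‖ ^ 2) + (N + 4) * deriv A (‖x‖ ^ 2)))) atTop
      (nhds (∫ x : EE N, (A (‖x‖ ^ 2) * Zf u x + 2 * deriv A (‖x‖ ^ 2) * Zf u x ^ 2
      - 2⁻¹ * ‖gradient u x‖ ^ 2 * (2 * ‖x‖ ^ 2 * deriv A (‖x‖ ^ 2) + (N + 2) * A (‖x‖ ^ 2))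
      - 2 * u x ^ 2 * (2 * ‖x‖ ^ 2 * deriv (deriv A) (‖x‖ ^ 2) + (N + 4) * deriv A (‖x‖ ^ 2))))) := by
    have hZ : ∀ n, ∀ x : EE N, ‖x‖ ≤ R → |Zf (U n) x| ≤ 3 * K := by
      intro n x hx
      obtain ⟨_, _, h3, _⟩ := hlim x hx
      obtain ⟨b1, b2, _⟩ := h3 n
      have h4 := abs_real_inner_le_norm (gradient (U n) x) x
      have h5 : ‖gradient (U n) x‖ * ‖x‖ ≤ K * 1 :=
        mul_le_mul b2 (hx.trans hR1.le) (norm_nonneg _) hK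
      unfold Zf
      refine (abs_sub _ _).trans ?_
      rw [abs_mul, abs_two]
      linarith
    refine tendsto_integral_of_dominated_convergence (indicator (closedBall 0 R) fun _ =>
      C0 * (3 * K) * 1 + 2 * C1 * (3 * K) ^ 2 + 2⁻¹ * K ^ 2 * (2 * C1 + (N + 2) * C0)
        + 2 * K ^ 2 * (2 * C2 + (N + 4) * C1)) (fun n => ?_) ?_ (fun n => Eventually.of_forall fun x => ?_)
        (Eventually.of_forall fun x => ?_)
    · have e1 := (hU n).continuous
      have e2 := (contDiff_gradient_infty (hU n)).continuous
      have e3 := continuous_lap (hU n)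
      have e4 := continuous_Zf (contDiff_one_of_infty (hU n))
      exact Continuous.aestronglyMeasurable (by fun_prop)
    · exact (integrable_indicator_iff measurableSet_closedBall).2
        (integrableOn_const (measure_closedBall_lt_top.ne))
    · by_cases hx : ‖x‖ ≤ R
      · rw [indicator_of_mem (by simpa using hx)]
        obtain ⟨_, _, h3, _⟩ := hlim x hx
        obtain ⟨b1, b2, b3⟩ := h3 n
        have hx1 : ‖x‖ ^ 2 ≤ 1 := pow_le_one₀ (norm_nonneg _) (hx.trans hR1.le)
        have t1 : |A (‖x‖ ^ 2) * Zf (U n) x * lap N (U n) x| ≤ C0 * (3 * K) * 1 := by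
          rw [abs_mul, abs_mul]
          have := hC0 x; have := hZ n x hx
          gcongr
        have t2 : |2 * deriv A (‖x‖ ^ 2) * Zf (U n) x ^ 2| ≤ 2 * C1 * (3 * K) ^ 2 := by
          rw [abs_mul, abs_mul, abs_two, abs_pow]
          have := hC1 x; have := hZ n x hx
          gcongr
        have t3 : |2⁻¹ * ‖gradient (U n) x‖ ^ 2 * (2 * ‖x‖ ^ 2 * deriv A (‖x‖ ^ 2) + (N + 2) * A (‖x‖ ^ 2))|
            ≤ 2⁻¹ * K ^ 2 * (2 * C1 + (N + 2) * C0) := by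
          rw [abs_mul, abs_of_nonneg (by positivity)]
          gcongr
          refine (abs_add_le _ _).trans ?_
          rw [abs_mul (2 * ‖x‖ ^ 2), abs_mul ((N : ℝ) + 2), abs_of_nonneg (show (0 : ℝ) ≤ 2 * ‖x‖ ^ 2 by positivity),
            abs_of_nonneg (show (0 : ℝ) ≤ N + 2 by positivity)]
          exact add_le_add (mul_le_mul (by linarith) (hC1 x) (abs_nonneg _) (by norm_num))
            (mul_le_mul_of_nonneg_left (hC0 x) (by positivity))
        have t4 : |2 * U n x ^ 2 * (2 * ‖x‖ ^ 2 * deriv (deriv A) (‖x‖ ^ 2) + (N + 4) * deriv A (‖x‖ ^ 2))|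
            ≤ 2 * K ^ 2 * (2 * C2 + (N + 4) * C1) := by
          rw [abs_mul, abs_mul, abs_two, abs_pow]
          gcongr
          refine (abs_add_le _ _).trans ?_
          rw [abs_mul (2 * ‖x‖ ^ 2), abs_mul ((N : ℝ) + 4), abs_of_nonneg (show (0 : ℝ) ≤ 2 * ‖x‖ ^ 2 by positivity),
            abs_of_nonneg (show (0 : ℝ) ≤ N + 4 by positivity)]
          exact add_le_add (mul_le_mul (by linarith) (hC2 x) (abs_nonneg _) (by norm_num))
            (mul_le_mul_of_nonneg_left (hC1 x) (by positivity))
        rw [Real.norm_eq_abs]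
        exact (abs_sub _ _).trans (add_le_add ((abs_sub _ _).trans
          (add_le_add ((abs_add_le _ _).trans (add_le_add t1 t2)) t3)) t4)
      · push Not at hx
        have hx2 : R ^ 2 ≤ ‖x‖ ^ 2 := pow_le_pow_left₀ hR hx.le 2
        rw [indicator_of_notMem (by simpa using hx), hA0 _ hx2, hA0' _ hx2, hA0'' _ hx2]
        simp
    · by_cases hx : ‖x‖ ≤ R
      · obtain ⟨l1, l2, h3, l4⟩ := hlim x hx
        have lZ : Tendsto (fun n => Zf (U n) x) atTop (nhds (Zf u x)) :=
          (l2.inner tendsto_const_nhds).sub (l1.const_mul 2)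
        have lfirst : Tendsto (fun n => A (‖x‖ ^ 2) * Zf (U n) x * lap N (U n) x) atTop
            (nhds (A (‖x‖ ^ 2) * Zf u x)) := by
          by_cases hxΩ : x ∈ Ω
          · simpa using (lZ.const_mul (A (‖x‖ ^ 2))).mul (l4 hxΩ)
          · obtain ⟨z1, z2⟩ := hu.zero_off (hx.trans_lt hR1) hxΩ
            have hz : Zf u x = 0 := by simp [Zf, z1, z2]
            rw [hz] at lZ ⊢
            have := lZ.const_mul (A (‖x‖ ^ 2))
            rw [mul_zero] at this ⊢
            refine squeeze_zero_norm (fun n => ?_) (tendsto_zero_iff_norm_tendsto_zero.1 this)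
            rw [norm_mul]
            exact mul_le_of_le_one_right (norm_nonneg _) (h3 n).2.2
        exact ((lfirst.add ((lZ.pow 2).const_mul _)).sub
          (((l2.norm.pow 2).const_mul _).mul_const _)).sub (((l1.pow 2).const_mul _).mul_const _)
      · push Not at hx
        have hx2 : R ^ 2 ≤ ‖x‖ ^ 2 := pow_le_pow_left₀ hR hx.le 2
        rw [hA0 _ hx2, hA0' _ hx2, hA0'' _ hx2]
        simp
  simp only [fun n => weiss_smooth (hU n) hA hR hA0] at lim
  have h0 := tendsto_nhds_unique lim tendsto_const_nhds
  have hI := integral_radial_mul_Zf hu.contDiff hA hR hA0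
  have c0 : HasCompactSupport fun x : EE N => A (‖x‖ ^ 2) := hasCompactSupport_radial hR hA0
  have c1 : HasCompactSupport fun x : EE N => deriv A (‖x‖ ^ 2) := hasCompactSupport_radial hR hA0'
  have c2 : HasCompactSupport fun x : EE N => deriv (deriv A) (‖x‖ ^ 2) := hasCompactSupport_radial hR hA0''
  have cP : HasCompactSupport fun x : EE N =>
      2 * ‖x‖ ^ 2 * deriv A (‖x‖ ^ 2) + (N + 2) * A (‖x‖ ^ 2) := c1.mul_left.add c0.mul_left
  have cQ : HasCompactSupport fun x : EE N =>
      2 * ‖x‖ ^ 2 * deriv (deriv A) (‖x‖ ^ 2) + (N + 4) * deriv A (‖x‖ ^ 2) := c2.mul_left.add c1.mul_left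
  have j1 : Integrable fun x : EE N => A (‖x‖ ^ 2) * Zf u x :=
    Continuous.integrable_of_hasCompactSupport (by fun_prop) c0.mul_right
  have j2 : Integrable fun x : EE N => 2 * deriv A (‖x‖ ^ 2) * Zf u x ^ 2 :=
    Continuous.integrable_of_hasCompactSupport (by fun_prop) c1.mul_left.mul_right
  have j3 : Integrable fun x : EE N => 2⁻¹ * ‖gradient u x‖ ^ 2 *
      (2 * ‖x‖ ^ 2 * deriv A (‖x‖ ^ 2) + (N + 2) * A (‖x‖ ^ 2)) :=
    Continuous.integrable_of_hasCompactSupport (by fun_prop) cP.mul_left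
  have j4 : Integrable fun x : EE N => 2 * u x ^ 2 *
      (2 * ‖x‖ ^ 2 * deriv (deriv A) (‖x‖ ^ 2) + (N + 4) * deriv A (‖x‖ ^ 2)) :=
    Continuous.integrable_of_hasCompactSupport (by fun_prop) cQ.mul_left
  have j5 : Integrable fun x : EE N => u x *
      (2 * ‖x‖ ^ 2 * deriv A (‖x‖ ^ 2) + (N + 2) * A (‖x‖ ^ 2)) :=
    Continuous.integrable_of_hasCompactSupport (by fun_prop) cP.mul_left
  have j12 : Integrable fun x : EE N => A (‖x‖ ^ 2) * Zf u x + 2 * deriv A (‖x‖ ^ 2) * Zf u x ^ 2 := j1.add j2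
  have j123 : Integrable fun x : EE N => A (‖x‖ ^ 2) * Zf u x + 2 * deriv A (‖x‖ ^ 2) * Zf u x ^ 2 -
      2⁻¹ * ‖gradient u x‖ ^ 2 * (2 * ‖x‖ ^ 2 * deriv A (‖x‖ ^ 2) + (N + 2) * A (‖x‖ ^ 2)) := j12.sub j3
  have j35 : Integrable fun x : EE N =>
      2⁻¹ * ‖gradient u x‖ ^ 2 * (2 * ‖x‖ ^ 2 * deriv A (‖x‖ ^ 2) + (N + 2) * A (‖x‖ ^ 2)) +
      u x * (2 * ‖x‖ ^ 2 * deriv A (‖x‖ ^ 2) + (N + 2) * A (‖x‖ ^ 2)) := j3.add j5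
  rw [integral_sub j123 j4, integral_sub j12 j3, integral_add j1 j2, hI] at h0
  have : ∀ x : EE N, (2⁻¹ * ‖gradient u x‖ ^ 2 + u x) *
        (2 * ‖x‖ ^ 2 * deriv A (‖x‖ ^ 2) + (N + 2) * A (‖x‖ ^ 2))
      + 2 * u x ^ 2 * (2 * ‖x‖ ^ 2 * deriv (deriv A) (‖x‖ ^ 2) + (N + 4) * deriv A (‖x‖ ^ 2)) =
      2⁻¹ * ‖gradient u x‖ ^ 2 * (2 * ‖x‖ ^ 2 * deriv A (‖x‖ ^ 2) + (N + 2) * A (‖x‖ ^ 2)) +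
      u x * (2 * ‖x‖ ^ 2 * deriv A (‖x‖ ^ 2) + (N + 2) * A (‖x‖ ^ 2)) +
      2 * u x ^ 2 * (2 * ‖x‖ ^ 2 * deriv (deriv A) (‖x‖ ^ 2) + (N + 4) * deriv A (‖x‖ ^ 2)) := by
    intro x; ring
  simp only [this]
  rw [integral_add j35 j4, integral_add j3 j5]
  linarith

end

section

variable {N : ℕ}

/-- A smooth radial profile, as a function of the squared radius. -/
def wk (σ : ℝ) : ℝ := Tr (1 / 64) (1 / 2 - σ)

lemma contDiff_wk : ContDiff ℝ (⊤ : ℕ∞) wk := (contDiff_Tr _).comp (by fun_prop)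

lemma hasDerivAt_wk (σ : ℝ) :
    HasDerivAt wk (-Real.smoothTransition ((1 / 2 - σ) / (1 / 64) - 1)) σ := by
  have := (hasDerivAt_Tr (1 / 64) (1 / 2 - σ)).comp σ ((hasDerivAt_id σ).const_sub (1 / 2))
  exact this.congr_deriv (by ring)

lemma deriv_wk (σ : ℝ) : deriv wk σ = -Real.smoothTransition ((1 / 2 - σ) / (1 / 64) - 1) :=
  (hasDerivAt_wk σ).deriv

lemma wk_eq_zero {σ : ℝ} (hσ : (3 / 4) ^ 2 ≤ σ) : wk σ = 0 :=
  Tr_eq_zero (by norm_num) (by linarith)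

lemma deriv_wk_eq_zero {σ : ℝ} (hσ : (3 / 4) ^ 2 ≤ σ) : deriv wk σ = 0 :=
  deriv_eq_zero_of_eq_zero (contDiff_wk.of_le (by exact_mod_cast le_top)) (fun _ => wk_eq_zero) σ hσ

lemma wk_nonneg (σ : ℝ) : 0 ≤ wk σ := Tr_nonneg (by norm_num) _

lemma wk_le_one {σ : ℝ} (hσ : 0 ≤ σ) : wk σ ≤ 1 :=
  (Tr_le (by norm_num) _).trans (max_le (by linarith) zero_le_one)

lemma deriv_wk_nonpos (σ : ℝ) : deriv wk σ ≤ 0 := by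
  rw [deriv_wk]; linarith [Real.smoothTransition.nonneg ((1 / 2 - σ) / (1 / 64) - 1)]

lemma neg_one_le_deriv_wk (σ : ℝ) : -1 ≤ deriv wk σ := by
  rw [deriv_wk]; linarith [Real.smoothTransition.le_one ((1 / 2 - σ) / (1 / 64) - 1)]

lemma deriv_wk_eq_neg_one {σ : ℝ} (hσ : σ ≤ 1 / 4) : deriv wk σ = -1 := by
  rw [deriv_wk, Real.smoothTransition.one_of_one_le (by linarith)]

/-- The unnormalized smooth Weiss energy. -/
def Wy (u : EE N → ℝ) (t : ℝ) : ℝ :=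
  ∫ x : EE N, ((2⁻¹ * ‖gradient u x‖ ^ 2 + u x) * wk (‖x‖ ^ 2 / t ^ 2)
    + 2 * u x ^ 2 * (deriv wk (‖x‖ ^ 2 / t ^ 2) / t ^ 2))

lemma sq_div_sq_ge {x : EE N} {t T : ℝ} (ht : 0 < t) (htT : t ≤ T) (hx : x ∉ closedBall (0 : EE N) T) :
    (3 / 4 : ℝ) ^ 2 ≤ ‖x‖ ^ 2 / t ^ 2 := by
  simp only [mem_closedBall_zero_iff, not_le] at hx
  rw [← div_pow]
  have : 1 ≤ ‖x‖ / t := (one_le_div ht).2 (htT.trans hx.le)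
  nlinarith

lemma MemP.hasDerivAt_Wy {M : ℝ} {Ω : Set (EE N)} {u : EE N → ℝ} (hu : MemP N 1 0 M Ω u) {t : ℝ}
    (ht : 0 < t) (ht1 : t ≤ 1) : HasDerivAt (Wy u)
      (t⁻¹ * ((N + 2) * Wy u t + 2 * (t ^ 2)⁻¹ * ∫ x : EE N, -deriv wk (‖x‖ ^ 2 / t ^ 2) * Zf u x ^ 2)) t := by
  have huc := hu.contDiff.continuous
  have hgc := continuous_gradient hu.contDiff
  have hk' : ContDiff ℝ (⊤ : ℕ∞) (deriv wk) := (contDiff_infty_iff_deriv.1 contDiff_wk).2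
  have hk'' : ContDiff ℝ (⊤ : ℕ∞) (deriv (deriv wk)) := (contDiff_infty_iff_deriv.1 hk').2
  have kc := contDiff_wk.continuous
  have kc' := hk'.continuous
  have kc'' := hk''.continuous
  have k0'' : ∀ σ, (3 / 4 : ℝ) ^ 2 ≤ σ → deriv (deriv wk) σ = 0 :=
    deriv_eq_zero_of_eq_zero (hk'.of_le (by exact_mod_cast le_top)) (fun _ => deriv_wk_eq_zero)
  have hdiv : ∀ (s : ℝ), 0 < s → ∀ x : EE N,
      HasDerivAt (fun s => ‖x‖ ^ 2 / s ^ 2) (-2 * ‖x‖ ^ 2 / s ^ 3) s := fun s hs x => by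
    refine ((hasDerivAt_const s (‖x‖ ^ 2)).div ((hasDerivAt_id s).pow 2) (pow_ne_zero 2 hs.ne')).congr_deriv ?_
    simp; field_simp
  have hD := hasDerivAt_integral_of_compact
    (F := fun t x => (2⁻¹ * ‖gradient u x‖ ^ 2 + u x) * wk (‖x‖ ^ 2 / t ^ 2)
      + 2 * u x ^ 2 * (deriv wk (‖x‖ ^ 2 / t ^ 2) / t ^ 2))
    (F' := fun t x => (2⁻¹ * ‖gradient u x‖ ^ 2 + u x) * (deriv wk (‖x‖ ^ 2 / t ^ 2) * (-2 * ‖x‖ ^ 2 / t ^ 3))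
      + 2 * u x ^ 2 * (deriv (deriv wk) (‖x‖ ^ 2 / t ^ 2) * (-2 * ‖x‖ ^ 2 / t ^ 3) / t ^ 2 -
        2 * deriv wk (‖x‖ ^ 2 / t ^ 2) / t ^ 3)) (U := Ioo 0 2) (K := closedBall (0 : EE N) 2)
    isOpen_Ioo (isCompact_closedBall _ _) (fun s hs x => ?_) (fun s hs => ?_) ?_
    (fun s hs x hx => ?_) (fun s hs x hx => ?_) (a := t) ⟨ht, by linarith⟩
  · refine hD.congr_deriv ?_
    have hA : ContDiff ℝ (⊤ : ℕ∞) fun σ : ℝ => wk (σ / t ^ 2) := contDiff_wk.comp (by fun_prop)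
    have hA1 : deriv (fun σ : ℝ => wk (σ / t ^ 2)) = fun σ => deriv wk (σ / t ^ 2) / t ^ 2 := by
      funext σ
      have := ((contDiff_wk.differentiable (by simp)) (σ / t ^ 2)).hasDerivAt.comp σ
        ((hasDerivAt_id σ).div_const (t ^ 2))
      refine HasDerivAt.deriv (this.congr_deriv ?_)
      ring
    have hA2 : deriv (deriv (fun σ : ℝ => wk (σ / t ^ 2))) =
        fun σ => deriv (deriv wk) (σ / t ^ 2) / t ^ 4 := by
      rw [hA1]
      funext σ
      have := (((hk'.differentiable (by simp)) (σ / t ^ 2)).hasDerivAt.comp σ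
        ((hasDerivAt_id σ).div_const (t ^ 2))).div_const (t ^ 2)
      refine HasDerivAt.deriv (this.congr_deriv ?_)
      field_simp
    have hz : ∀ σ, (3 / 4 * t) ^ 2 ≤ σ → wk (σ / t ^ 2) = 0 := fun σ hσ => by
      refine wk_eq_zero ?_
      rw [le_div_iff₀ (by positivity)]; linarith
    have hw := hu.weiss hA (R := 3 / 4 * t) (by positivity) (by linarith) hz
    rw [hA2, hA1] at hw
    have e2 : ∫ x : EE N, 2 * (deriv wk (‖x‖ ^ 2 / t ^ 2) / t ^ 2) * Zf u x ^ 2 =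
        -(2 * (t ^ 2)⁻¹ * ∫ x : EE N, -deriv wk (‖x‖ ^ 2 / t ^ 2) * Zf u x ^ 2) := by
      rw [← integral_const_mul, ← integral_neg]
      congr 1; funext x; ring
    rw [e2] at hw
    rw [eq_neg_iff_add_eq_zero, add_comm] at hw
    rw [eq_neg_of_add_eq_zero_left hw, Wy, ← integral_const_mul, ← sub_eq_add_neg,
      ← integral_sub, ← integral_const_mul]
    · refine integral_congr_ae (Eventually.of_forall fun x => ?_)
      field_simp
      ring
    · refine Continuous.integrable_of_hasCompactSupport (by fun_prop)
        (HasCompactSupport.intro (isCompact_closedBall 0 t) fun x hx => ?_)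
      have := sq_div_sq_ge ht le_rfl hx
      simp only [wk_eq_zero this, deriv_wk_eq_zero this]; simp
    · refine Continuous.integrable_of_hasCompactSupport (by fun_prop)
        (HasCompactSupport.intro (isCompact_closedBall 0 t) fun x hx => ?_)
      have := sq_div_sq_ge ht le_rfl hx
      simp only [wk_eq_zero this, deriv_wk_eq_zero this, k0'' _ this]; simp
  · have h1 := ((contDiff_wk.differentiable (by simp)) (‖x‖ ^ 2 / s ^ 2)).hasDerivAt.comp s (hdiv s hs.1 x)
    have h2 := (((hk'.differentiable (by simp)) (‖x‖ ^ 2 / s ^ 2)).hasDerivAt.comp s (hdiv s hs.1 x)).div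
      ((hasDerivAt_id s).pow 2) (by have := hs.1; simp; positivity)
    refine ((h1.const_mul _).add (h2.const_mul _)).congr_deriv ?_
    have := hs.1
    simp
    field_simp
    exact Or.inl trivial
  · fun_prop
  · have hne : ∀ p ∈ Ioo (0 : ℝ) 2 ×ˢ (univ : Set (EE N)), p.1 ≠ 0 := fun p hp => hp.1.1.ne'
    have h3 : ∀ n : ℕ, ∀ p ∈ Ioo (0 : ℝ) 2 ×ˢ (univ : Set (EE N)), p.1 ^ n ≠ 0 :=
      fun n p hp => pow_ne_zero _ (hne p hp)
    have q : ContinuousOn (fun p : ℝ × EE N => ‖p.2‖ ^ 2 / p.1 ^ 2) (Ioo (0 : ℝ) 2 ×ˢ univ) :=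
      ContinuousOn.div (by fun_prop) (by fun_prop) (h3 2)
    have q3 : ContinuousOn (fun p : ℝ × EE N => -2 * ‖p.2‖ ^ 2 / p.1 ^ 3) (Ioo (0 : ℝ) 2 ×ˢ univ) :=
      ContinuousOn.div (by fun_prop) (by fun_prop) (h3 3)
    have a1 := kc'.comp_continuousOn q
    have a2 := kc''.comp_continuousOn q
    have b1 : ContinuousOn (fun p : ℝ × EE N => 2⁻¹ * ‖gradient u p.2‖ ^ 2 + u p.2) (Ioo (0 : ℝ) 2 ×ˢ univ) := by
      fun_prop
    have b2 : ContinuousOn (fun p : ℝ × EE N => 2 * u p.2 ^ 2) (Ioo (0 : ℝ) 2 ×ˢ univ) := by fun_prop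
    exact (b1.mul (a1.mul q3)).add (b2.mul (((a2.mul q3).div (by fun_prop) (h3 2)).sub
      ((continuousOn_const.mul a1).div (by fun_prop) (h3 3))))
  · have := sq_div_sq_ge hs.1 hs.2.le hx
    simp only [wk_eq_zero this, deriv_wk_eq_zero this]; simp
  · have := sq_div_sq_ge hs.1 hs.2.le hx
    simp only [deriv_wk_eq_zero this, k0'' _ this]; simp

end

section

variable {N : ℕ}

/-- The smooth Weiss energy. -/
def Ww (u : EE N → ℝ) (t : ℝ) : ℝ := Wy u t / t ^ (N + 2)

lemma MemP.hasDerivAt_Ww {M : ℝ} {Ω : Set (EE N)} {u : EE N → ℝ} (hu : MemP N 1 0 M Ω u) {t : ℝ}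
    (ht : 0 < t) (ht1 : t ≤ 1) : HasDerivAt (Ww u)
      (2 * (t ^ (N + 5))⁻¹ * ∫ x : EE N, -deriv wk (‖x‖ ^ 2 / t ^ 2) * Zf u x ^ 2) t := by
  refine ((hu.hasDerivAt_Wy ht ht1).div (hasDerivAt_pow (N + 2) t) (by positivity)).congr_deriv ?_
  generalize ∫ x : EE N, -deriv wk (‖x‖ ^ 2 / t ^ 2) * Zf u x ^ 2 = I
  push_cast
  field_simp
  ring

lemma MemP.monotoneOn_Ww {M : ℝ} {Ω : Set (EE N)} {u : EE N → ℝ} (hu : MemP N 1 0 M Ω u) :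
    MonotoneOn (Ww u) (Ioc 0 1) := by
  refine monotoneOn_of_deriv_nonneg (convex_Ioc 0 1)
    (fun t ht => (hu.hasDerivAt_Ww ht.1 ht.2).continuousAt.continuousWithinAt)
    (fun t ht => ?_) (fun t ht => ?_)
  · rw [interior_Ioc] at ht
    exact (hu.hasDerivAt_Ww ht.1 ht.2.le).differentiableAt.differentiableWithinAt
  · rw [interior_Ioc] at ht
    rw [(hu.hasDerivAt_Ww ht.1 ht.2.le).deriv]
    have := ht.1
    refine mul_nonneg (by positivity) (integral_nonneg fun x => ?_)
    exact mul_nonneg (neg_nonneg.2 (deriv_wk_nonpos _)) (sq_nonneg _)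

/-- Quadratic growth along a sequence of radii tending to zero. -/
def QuadGrowth (u : EE N → ℝ) : Prop :=
  ∃ C : ℝ, ∀ τ : ℝ, 0 < τ → ∃ t, 0 < t ∧ t ≤ τ ∧ ∀ x : EE N, ‖x‖ ≤ t → |u x| ≤ C * t ^ 2

lemma volume_real_ball {t : ℝ} (ht : 0 < t) :
    (volume (closedBall (0 : EE N) t)).toReal = t ^ N * (volume (closedBall (0 : EE N) 1)).toReal := by
  rw [← Measure.real, ← Measure.real, Measure.addHaar_real_closedBall' volume (0 : EE N) ht.le]
  simp

lemma MemP.exists_le_Ww {M : ℝ} {Ω : Set (EE N)} {u : EE N → ℝ} (hu : MemP N 1 0 M Ω u)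
    (hq : QuadGrowth u) : ∃ C : ℝ, ∀ t ∈ Ioc (0 : ℝ) 1, -C ≤ Ww u t := by
  obtain ⟨C, hC⟩ := hq
  set V := (volume (closedBall (0 : EE N) 1)).toReal
  refine ⟨(|C| + 2 * C ^ 2) * V, fun τ hτ => ?_⟩
  obtain ⟨t, ht, htτ, h⟩ := hC τ hτ.1
  refine le_trans ?_ (hu.monotoneOn_Ww ⟨ht, htτ.trans hτ.2⟩ hτ htτ)
  have huc := hu.contDiff.continuous
  have hgc := continuous_gradient hu.contDiff
  have kc := contDiff_wk.continuous
  have kc' : Continuous (deriv wk) := contDiff_wk.continuous_deriv (by exact_mod_cast le_top)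
  rw [Ww, le_div_iff₀ (by positivity), Wy]
  have h1 : ∫ x : EE N, (closedBall (0 : EE N) t).indicator (fun _ => -(|C| + 2 * C ^ 2) * t ^ 2) x =
      -((|C| + 2 * C ^ 2) * V) * t ^ (N + 2) := by
    rw [integral_indicator measurableSet_closedBall, setIntegral_const, Measure.real, volume_real_ball ht,
      smul_eq_mul]
    ring
  rw [← h1]
  refine integral_mono ((integrable_indicator_iff measurableSet_closedBall).2
        (integrableOn_const (measure_closedBall_lt_top.ne))) ?_ fun x => ?_
  · refine Continuous.integrable_of_hasCompactSupport (by fun_prop)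
        (HasCompactSupport.intro (isCompact_closedBall 0 t) fun x hx => ?_)
    have := sq_div_sq_ge ht le_rfl hx
    simp only [wk_eq_zero this, deriv_wk_eq_zero this]; simp
  · by_cases hx : x ∈ closedBall (0 : EE N) t
    · rw [indicator_of_mem hx]
      have hux := h x (by simpa using hx)
      have k1 := wk_le_one (show 0 ≤ ‖x‖ ^ 2 / t ^ 2 by positivity)
      have k0 := wk_nonneg (‖x‖ ^ 2 / t ^ 2)
      have k2 := neg_one_le_deriv_wk (‖x‖ ^ 2 / t ^ 2)
      have hCt : C * t ^ 2 ≤ |C| * t ^ 2 := by gcongr; exact le_abs_self C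
      have hux' : u x ^ 2 ≤ C ^ 2 * t ^ 4 := by
        have := pow_le_pow_left₀ (abs_nonneg _) hux 2
        rw [sq_abs] at this; linarith
      have hd : -(t ^ 2)⁻¹ ≤ deriv wk (‖x‖ ^ 2 / t ^ 2) / t ^ 2 := by
        rw [div_eq_mul_inv, neg_eq_neg_one_mul]
        exact mul_le_mul_of_nonneg_right k2 (by positivity)
      have e1 : -(|C| * t ^ 2) ≤ (2⁻¹ * ‖gradient u x‖ ^ 2 + u x) * wk (‖x‖ ^ 2 / t ^ 2) := by
        have a1 : -(|C| * t ^ 2) ≤ u x := by have := (abs_le.1 hux).1; linarith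
        have a2 : 0 ≤ ‖gradient u x‖ ^ 2 := sq_nonneg _
        have a3 : 0 ≤ |C| * t ^ 2 := by positivity
        nlinarith
      have e2 : -(2 * C ^ 2 * t ^ 2) ≤ 2 * u x ^ 2 * (deriv wk (‖x‖ ^ 2 / t ^ 2) / t ^ 2) := by
        calc -(2 * C ^ 2 * t ^ 2) = 2 * (C ^ 2 * t ^ 4) * -(t ^ 2)⁻¹ := by field_simp
          _ ≤ 2 * u x ^ 2 * -(t ^ 2)⁻¹ := by
            refine mul_le_mul_of_nonpos_right (by linarith) ?_
            rw [neg_nonpos]; positivity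
          _ ≤ _ := mul_le_mul_of_nonneg_left hd (by positivity)
      linarith
    · rw [indicator_of_notMem hx]
      simp only [mem_closedBall_zero_iff, not_le] at hx
      have := sq_div_sq_ge ht le_rfl (x := x) (by simpa using hx)
      simp only [wk_eq_zero this, deriv_wk_eq_zero this]; simp

/-- Scale invariant square deviation from homogeneity on dyadic balls is summable. -/
lemma MemP.summable_Zf {M : ℝ} {Ω : Set (EE N)} {u : EE N → ℝ} (hu : MemP N 1 0 M Ω u)
    (hq : QuadGrowth u) :
    Summable fun k : ℕ => (((1 / 2 : ℝ) ^ k) ^ (N + 4))⁻¹ *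
      ∫ x in closedBall (0 : EE N) ((1 / 2) ^ k / 2), Zf u x ^ 2 := by
  obtain ⟨C, hC⟩ := hu.exists_le_Ww hq
  have hZ := continuous_Zf hu.contDiff
  have hZ2 : Continuous fun x => Zf u x ^ 2 := hZ.pow 2
  have kc' : Continuous (deriv wk) := contDiff_wk.continuous_deriv (by exact_mod_cast le_top)
  have tp : ∀ k : ℕ, (0 : ℝ) < (1 / 2) ^ k := fun k => by positivity
  have tl : ∀ k : ℕ, (1 / 2 : ℝ) ^ k ≤ 1 := fun k => pow_le_one₀ (by norm_num) (by norm_num)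
  have key : ∀ k : ℕ, (((1 / 2 : ℝ) ^ k) ^ (N + 4))⁻¹ *
      (∫ x in closedBall (0 : EE N) ((1 / 2) ^ k / 4), Zf u x ^ 2) ≤
      Ww u ((1 / 2) ^ k) - Ww u ((1 / 2) ^ (k + 1)) := by
    intro k
    set t := (1 / 2 : ℝ) ^ k with ht
    have ht0 : 0 < t := tp k
    have ht1 : t ≤ 1 := tl k
    have e : (1 / 2 : ℝ) ^ (k + 1) = t / 2 := by rw [pow_succ]; ring
    rw [e]
    obtain ⟨ξ, hξ, h⟩ := exists_hasDerivAt_eq_slope (Ww u)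
      (fun t => 2 * (t ^ (N + 5))⁻¹ * ∫ x : EE N, -deriv wk (‖x‖ ^ 2 / t ^ 2) * Zf u x ^ 2)
      (show t / 2 < t by linarith)
      (fun s hs => (hu.hasDerivAt_Ww (by linarith [hs.1]) (hs.2.trans ht1)).continuousAt.continuousWithinAt)
      (fun s hs => hu.hasDerivAt_Ww (by linarith [hs.1]) (hs.2.le.trans ht1))
    have hξ0 : 0 < ξ := by linarith [hξ.1]
    rw [eq_div_iff (by linarith)] at h
    rw [← h]
    have hI : ∫ x in closedBall (0 : EE N) (t / 4), Zf u x ^ 2 ≤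
        ∫ x : EE N, -deriv wk (‖x‖ ^ 2 / ξ ^ 2) * Zf u x ^ 2 := by
      rw [← integral_indicator measurableSet_closedBall]
      refine integral_mono ((integrable_indicator_iff measurableSet_closedBall).2
        (hZ2.continuousOn.integrableOn_compact (isCompact_closedBall _ _))) ?_ fun x => ?_
      · refine Continuous.integrable_of_hasCompactSupport (by fun_prop)
          (HasCompactSupport.intro (isCompact_closedBall 0 ξ) fun x hx => ?_)
        rw [deriv_wk_eq_zero (sq_div_sq_ge hξ0 le_rfl hx)]; simp
      · by_cases hx : x ∈ closedBall (0 : EE N) (t / 4)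
        · rw [indicator_of_mem hx, deriv_wk_eq_neg_one]
          · simp
          · rw [mem_closedBall_zero_iff] at hx
            rw [div_le_iff₀ (by positivity)]
            have : ‖x‖ ≤ ξ / 2 := by linarith [hξ.1]
            have := pow_le_pow_left₀ (norm_nonneg _) this 2
            linarith
        · rw [indicator_of_notMem hx]
          exact mul_nonneg (neg_nonneg.2 (deriv_wk_nonpos _)) (sq_nonneg _)
    have hI0 : 0 ≤ ∫ x in closedBall (0 : EE N) (t / 4), Zf u x ^ 2 :=
      integral_nonneg fun x => sq_nonneg _
    calc (t ^ (N + 4))⁻¹ * ∫ x in closedBall (0 : EE N) (t / 4), Zf u x ^ 2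
        = 2 * (t ^ (N + 5))⁻¹ * (∫ x in closedBall (0 : EE N) (t / 4), Zf u x ^ 2) * (t - t / 2) := by
          generalize ∫ x in closedBall (0 : EE N) (t / 4), Zf u x ^ 2 = I
          field_simp; ring
      _ ≤ _ := by
          have : (t ^ (N + 5))⁻¹ ≤ (ξ ^ (N + 5))⁻¹ := by
            gcongr; exact hξ.2.le
          have h2 : 0 ≤ t - t / 2 := by linarith
          gcongr
  have s1 : Summable fun k : ℕ => (((1 / 2 : ℝ) ^ k) ^ (N + 4))⁻¹ *
      ∫ x in closedBall (0 : EE N) ((1 / 2) ^ k / 4), Zf u x ^ 2 := by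
    refine summable_of_sum_range_le (c := Ww u 1 + C) (fun k => mul_nonneg (by positivity)
      (integral_nonneg fun x => sq_nonneg _)) fun n => ?_
    refine (Finset.sum_le_sum fun k _ => key k).trans ?_
    rw [Finset.sum_range_sub' (fun k => Ww u ((1 / 2) ^ k)), pow_zero]
    linarith [hC _ ⟨tp n, tl n⟩]
  rw [← summable_nat_add_iff 1]
  refine (s1.mul_left (2 ^ (N + 4))).congr fun k => ?_
  rw [show (1 / 2 : ℝ) ^ (k + 1) / 2 = (1 / 2) ^ k / 4 by rw [pow_succ]; ring]
  generalize ∫ x in closedBall (0 : EE N) ((1 / 2) ^ k / 4), Zf u x ^ 2 = I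
  rw [pow_succ (1 / 2 : ℝ) k, mul_pow]
  field_simp
  rw [mul_right_comm, ← mul_pow]; norm_num

end

section

variable {N : ℕ}

lemma gs_sq_le {t : ℝ} (ht : 0 < t) (x : EE N) :
    gs (t ^ 2) x ≤ (t ^ N)⁻¹ * Real.exp (-(1 / 2 * (‖x‖ ^ 2 / t ^ 2))) := by
  have h2 : (t ^ N)⁻¹ = Real.exp (-(N * Real.log t)) := by
    rw [Real.exp_neg, mul_comm, Real.exp_mul, Real.exp_log ht, Real.rpow_natCast]
  rw [h2, gs, ← Real.exp_add]
  refine Real.exp_le_exp.2 ?_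
  rw [Real.log_mul (by positivity) (by positivity), Real.log_pow]
  have : 0 ≤ Real.log (2 * Real.pi) := Real.log_nonneg (by linarith [Real.pi_gt_three])
  have h3 : (0 : ℝ) ≤ N * Real.log (2 * Real.pi) := by positivity
  have h4 : -‖x‖ ^ 2 / (2 * t ^ 2) = -(1 / 2 * (‖x‖ ^ 2 / t ^ 2)) := by field_simp
  rw [h4]
  push_cast
  linarith

lemma exists_gs_le_sum : ∃ C : ℝ, 0 ≤ C ∧ ∀ (k : ℕ) (x : EE N), ‖x‖ ≤ 1 / 2 →
    ((((1 / 4 : ℝ) ^ k) ^ 2)⁻¹ * gs ((1 / 4) ^ k) x ≤ C * ∑ m ∈ Finset.range (k + 1),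
      (1 / 2 : ℝ) ^ m * ((((1 / 2 : ℝ) ^ (k - m)) ^ (N + 4))⁻¹ *
        (closedBall (0 : EE N) ((1 / 2) ^ (k - m) / 2)).indicator (fun _ => 1) x)) := by
  obtain ⟨C, hC, h⟩ := exists_exp_bound (N + 5) (show (0 : ℝ) < 1 / 2 by norm_num)
  refine ⟨C * 16 ^ (N + 5), by positivity, fun k x hx => ?_⟩
  set t := (1 / 2 : ℝ) ^ k with ht
  have ht0 : 0 < t := by positivity
  have e4 : (1 / 4 : ℝ) ^ k = t ^ 2 := by rw [ht, ← pow_mul, mul_comm, pow_mul]; norm_num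
  have ex : ∃ m, ‖x‖ ≤ 2 ^ m * t / 2 := ⟨k, by rw [ht, ← mul_pow]; norm_num; linarith⟩
  classical
  set m := Nat.find ex with hm
  have hmx : ‖x‖ ≤ 2 ^ m * t / 2 := Nat.find_spec ex
  have hmk : m ≤ k := Nat.find_min' ex (by rw [ht, ← mul_pow]; norm_num; linarith)
  have hy := h (‖x‖ ^ 2 / t ^ 2) (by positivity)
  have hlow : (2 : ℝ) ^ m / 16 ≤ 1 + ‖x‖ ^ 2 / t ^ 2 := by
    rcases Nat.eq_zero_or_pos m with h0 | h0
    · rw [h0, pow_zero]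
      have : 0 ≤ ‖x‖ ^ 2 / t ^ 2 := by positivity
      linarith
    · obtain ⟨n, hn⟩ : ∃ n, m = n + 1 := ⟨m - 1, by omega⟩
      have hlt := Nat.find_min ex (show n < m by omega)
      rw [not_le] at hlt
      rw [hn]
      have h1 : ((2 : ℝ) ^ n / 2) ^ 2 ≤ ‖x‖ ^ 2 / t ^ 2 := by
        rw [le_div_iff₀ (by positivity), ← mul_pow]
        refine pow_le_pow_left₀ (by positivity) ?_ 2
        linarith
      have h2 : (1 : ℝ) ≤ 2 ^ n := one_le_pow₀ (by norm_num)
      rw [pow_succ]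
      nlinarith
  have hexp : Real.exp (-(1 / 2 * (‖x‖ ^ 2 / t ^ 2))) ≤ C * 16 ^ (N + 5) * ((2 : ℝ) ^ m)⁻¹ ^ (N + 5) := by
    have h1 : ((2 : ℝ) ^ m / 16) ^ (N + 5) * Real.exp (-(1 / 2 * (‖x‖ ^ 2 / t ^ 2))) ≤ C :=
      (mul_le_mul_of_nonneg_right (pow_le_pow_left₀ (by positivity) hlow _) (Real.exp_pos _).le).trans hy
    have h2 : ((2 : ℝ) ^ m / 16) ^ (N + 5) * (16 * ((2 : ℝ) ^ m)⁻¹) ^ (N + 5) = 1 := by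
      rw [← mul_pow]
      have : (2 : ℝ) ^ m / 16 * (16 * (2 ^ m)⁻¹) = 1 := by field_simp
      rw [this, one_pow]
    calc Real.exp (-(1 / 2 * (‖x‖ ^ 2 / t ^ 2)))
        = (((2 : ℝ) ^ m / 16) ^ (N + 5) * Real.exp (-(1 / 2 * (‖x‖ ^ 2 / t ^ 2)))) *
            (16 * ((2 : ℝ) ^ m)⁻¹) ^ (N + 5) := by
          rw [mul_right_comm, h2, one_mul]
      _ ≤ C * (16 * ((2 : ℝ) ^ m)⁻¹) ^ (N + 5) := by gcongr
      _ = _ := by rw [mul_pow]; ring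
  have et : (1 / 2 : ℝ) ^ (k - m) = 2 ^ m * t := by
    rw [ht, pow_sub₀ _ (by norm_num) hmk, one_div, inv_pow, inv_pow, inv_inv]; ring
  have hsingle := Finset.single_le_sum (s := Finset.range (k + 1)) (a := m) (f := fun m =>
    (1 / 2 : ℝ) ^ m * ((((1 / 2 : ℝ) ^ (k - m)) ^ (N + 4))⁻¹ *
        (closedBall (0 : EE N) ((1 / 2) ^ (k - m) / 2)).indicator (fun _ => 1) x))
    (fun i _ => mul_nonneg (by positivity) (mul_nonneg (by positivity)
      (indicator_nonneg (fun _ _ => zero_le_one) _))) (Finset.mem_range.2 (by omega))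
  refine le_trans ?_ (mul_le_mul_of_nonneg_left hsingle (by positivity))
  rw [et, indicator_of_mem (by simpa using hmx), e4, mul_one]
  calc ((t ^ 2) ^ 2)⁻¹ * gs (t ^ 2) x
      ≤ ((t ^ 2) ^ 2)⁻¹ * ((t ^ N)⁻¹ * (C * 16 ^ (N + 5) * ((2 : ℝ) ^ m)⁻¹ ^ (N + 5))) := by
        refine mul_le_mul_of_nonneg_left ((gs_sq_le ht0 x).trans ?_) (by positivity)
        exact mul_le_mul_of_nonneg_left hexp (by positivity)
    _ = C * 16 ^ (N + 5) * ((1 / 2) ^ m * ((2 ^ m * t) ^ (N + 4))⁻¹) := by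
        rw [one_div, inv_pow, mul_pow, inv_pow]
        have hz : (0 : ℝ) < 2 ^ m := by positivity
        generalize (2 : ℝ) ^ m = z at hz
        field_simp
        ring

lemma summable_gs_of_summable_balls {H : EE N → ℝ} (hH : Continuous H) (h0 : ∀ x, 0 ≤ H x)
    (hs : Summable fun k : ℕ => (((1 / 2 : ℝ) ^ k) ^ (N + 4))⁻¹ *
      ∫ x in closedBall (0 : EE N) ((1 / 2) ^ k / 2), H x) :
    Summable fun k : ℕ => (((1 / 4 : ℝ) ^ k) ^ 2)⁻¹ *
      ∫ x in closedBall (0 : EE N) (1 / 2), H x * gs ((1 / 4) ^ k) x := by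
  obtain ⟨C, hC0, hC⟩ := exists_gs_le_sum (N := N)
  have h_int : ∀ r, IntegrableOn H (closedBall (0 : EE N) r) := fun r =>
    hH.continuousOn.integrableOn_compact (isCompact_closedBall _ _)
  set D : ℕ → ℝ := fun k => (((1 / 2 : ℝ) ^ k) ^ (N + 4))⁻¹ *
      ∫ x in closedBall (0 : EE N) ((1 / 2) ^ k / 2), H x with hD
  have hD0 : ∀ k, 0 ≤ D k := fun k => mul_nonneg (by positivity) (integral_nonneg h0)
  have hgeo : Summable fun m : ℕ => ‖(1 / 2 : ℝ) ^ m‖ := by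
    simpa using (summable_geometric_two)
  have hcp := (summable_norm_sum_mul_antidiagonal_of_summable_norm hgeo hs.norm).mul_left C
  refine Summable.of_nonneg_of_le (fun k => mul_nonneg (by positivity)
    (integral_nonneg fun x => mul_nonneg (h0 x) (gs_pos _ _).le)) (fun k => ?_) hcp
  refine le_trans ?_ (mul_le_mul_of_nonneg_left (Real.le_norm_self _) hC0)
  rw [Finset.Nat.sum_antidiagonal_eq_sum_range_succ (fun m n => (1 / 2 : ℝ) ^ m * D n), ← integral_const_mul]
  have hmono : ∀ m ≤ k, closedBall (0 : EE N) ((1 / 2) ^ (k - m) / 2) ⊆ closedBall 0 (1 / 2) := fun m _ => by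
    refine closedBall_subset_closedBall ?_
    have : (1 / 2 : ℝ) ^ (k - m) ≤ 1 := pow_le_one₀ (by norm_num) (by norm_num)
    linarith
  have hi : ∀ m ∈ Finset.range (k + 1), IntegrableOn (fun x => (1 / 2 : ℝ) ^ m * ((((1 / 2 : ℝ) ^ (k - m)) ^ (N + 4))⁻¹ *
        (closedBall (0 : EE N) ((1 / 2) ^ (k - m) / 2)).indicator H x)) (closedBall (0 : EE N) (1 / 2)) := by
    intro m _
    exact (((h_int _).indicator measurableSet_closedBall).const_mul _).const_mul _
  calc ∫ x in closedBall (0 : EE N) (1 / 2), (((1 / 4 : ℝ) ^ k) ^ 2)⁻¹ * (H x * gs ((1 / 4) ^ k) x)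
      ≤ ∫ x in closedBall (0 : EE N) (1 / 2), C * ∑ m ∈ Finset.range (k + 1),
        (1 / 2 : ℝ) ^ m * ((((1 / 2 : ℝ) ^ (k - m)) ^ (N + 4))⁻¹ *
        (closedBall (0 : EE N) ((1 / 2) ^ (k - m) / 2)).indicator H x) := by
        refine setIntegral_mono_on ?_ ((integrable_finsetSum _ hi).const_mul C) measurableSet_closedBall
          fun x hx => ?_
        · have := continuous_gs (N := N) ((1 / 4) ^ k)
          exact Continuous.continuousOn (by fun_prop) |>.integrableOn_compact (isCompact_closedBall _ _)
        · have := mul_le_mul_of_nonneg_left (hC k x (by simpa using hx)) (h0 x)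
          refine le_trans (le_of_eq (by ring)) (this.trans (le_of_eq ?_))
          rw [mul_left_comm, Finset.mul_sum]
          congr 1
          refine Finset.sum_congr rfl fun m _ => ?_
          by_cases hxm : x ∈ closedBall (0 : EE N) ((1 / 2) ^ (k - m) / 2)
          · rw [indicator_of_mem hxm, indicator_of_mem hxm]; ring
          · rw [indicator_of_notMem hxm, indicator_of_notMem hxm]; ring
    _ = _ := by
        rw [integral_const_mul, integral_finsetSum _ hi]
        congr 1
        refine Finset.sum_congr rfl fun m hm => ?_
        rw [integral_const_mul, integral_const_mul, setIntegral_indicator measurableSet_closedBall,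
          inter_eq_right.2 (hmono m (by simp at hm; omega))]

end

section

variable {N : ℕ}

lemma lap_mul {f g : EE N → ℝ} (hf : ContDiff ℝ 2 f) (hg : ContDiff ℝ 2 g) (x : EE N) :
    lap N (fun y => f y * g y) x =
      f x * lap N g x + 2 * ⟪gradient f x, gradient g x⟫ + g x * lap N f x := by
  have hf1 : Differentiable ℝ f := hf.differentiable (by norm_num)
  have hg1 : Differentiable ℝ g := hg.differentiable (by norm_num)
  have hgf : Differentiable ℝ (gradient f) :=
    (contDiff_gradient (m := 1) hf (by norm_num)).differentiable (by norm_num)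
  have hgg : Differentiable ℝ (gradient g) :=
    (contDiff_gradient (m := 1) hg (by norm_num)).differentiable (by norm_num)
  rw [← dv_gradient (hf.mul hg)]
  have e : gradient (fun y => f y * g y) = fun y => f y • gradient g y + g y • gradient f y :=
    funext fun y => gradient_mul' (hf1 y) (hg1 y)
  rw [e]
  have d1 := dv_smul (hf1 x) (hgg x)
  have d2 := dv_smul (hg1 x) (hgf x)
  have h3 : dv (fun y => f y • gradient g y + g y • gradient f y) x =
      dv (fun y => f y • gradient g y) x + dv (fun y => g y • gradient f y) x := by
    unfold dv
    rw [← Finset.sum_add_distrib]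
    refine Finset.sum_congr rfl fun i _ => ?_
    have hA : DifferentiableAt ℝ (fun y => f y • gradient g y) x := (hf1 x).smul (hgg x)
    have hB : DifferentiableAt ℝ (fun y => g y • gradient f y) x := (hg1 x).smul (hgf x)
    rw [fderiv_fun_add hA hB]
    rfl
  rw [h3, d1, d2, dv_gradient hf, dv_gradient hg, fderiv_apply_eq_inner f, fderiv_apply_eq_inner g,
    real_inner_comm (gradient f x)]
  ring

lemma gradient_eq_zero_of_eventuallyEq {f : EE N → ℝ} {c : ℝ} {x : EE N}
    (h : f =ᶠ[nhds x] fun _ => c) : gradient f x = 0 := by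
  simp [gradient, h.fderiv_eq]

lemma lap_eq_zero_of_eventuallyEq {f : EE N → ℝ} {c : ℝ} {x : EE N}
    (h : f =ᶠ[nhds x] fun _ => c) : lap N f x = 0 := by
  refine Finset.sum_eq_zero fun i _ => ?_
  have : (fun y => fderiv ℝ f y (EuclideanSpace.single i 1)) =ᶠ[nhds x] fun _ => 0 := by
    filter_upwards [h.eventuallyEq_nhds] with y hy
    simp [hy.fderiv_eq]
  simp [this.fderiv_eq]

variable (N) in
/-- The bump function used for the cutoff. -/
def etaBump : ContDiffBump (0 : EE N) := ⟨1 / 4, 1 / 2, by norm_num, by norm_num⟩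

/-- A smooth even cutoff, equal to one on the ball of radius `1/4`. -/
def eta (x : EE N) : ℝ := etaBump N x

lemma contDiff_eta : ContDiff ℝ (⊤ : ℕ∞) (eta : EE N → ℝ) := (etaBump N).contDiff

lemma continuous_eta : Continuous (eta : EE N → ℝ) := contDiff_eta.continuous

lemma eta_nonneg (x : EE N) : 0 ≤ eta x := (etaBump N).nonneg

lemma eta_le_one (x : EE N) : eta x ≤ 1 := (etaBump N).le_one

lemma eta_neg (x : EE N) : eta (-x) = eta x := (etaBump N).neg x

lemma eta_eq_one {x : EE N} (hx : ‖x‖ ≤ 1 / 4) : eta x = 1 :=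
  (etaBump N).one_of_mem_closedBall (by rw [mem_closedBall_zero_iff]; exact hx)

lemma eta_eq_zero {x : EE N} (hx : 1 / 2 ≤ ‖x‖) : eta x = 0 :=
  (etaBump N).zero_of_le_dist (by rw [dist_zero_right]; exact hx)

lemma tsupport_eta : tsupport (eta : EE N → ℝ) = closedBall 0 (1 / 2) := (etaBump N).tsupport_eq

lemma hasCompactSupport_eta : HasCompactSupport (eta : EE N → ℝ) := (etaBump N).hasCompactSupport

lemma eta_eventuallyEq_one {x : EE N} (hx : ‖x‖ < 1 / 4) : (eta : EE N → ℝ) =ᶠ[nhds x] fun _ => 1 := by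
  filter_upwards [isOpen_ball.mem_nhds (show x ∈ ball (0 : EE N) (1 / 4) by simpa using hx)] with y hy
  exact eta_eq_one (by simpa using (mem_ball_zero_iff.1 hy).le)

lemma eta_eventuallyEq_zero {x : EE N} (hx : 1 / 2 < ‖x‖) : (eta : EE N → ℝ) =ᶠ[nhds x] fun _ => 0 := by
  filter_upwards [(isOpen_lt continuous_const continuous_norm).mem_nhds hx] with y hy
  exact eta_eq_zero (le_of_lt hy)

lemma exists_eta_bound : ∃ K : ℝ, 0 ≤ K ∧ ∀ x : EE N, ‖gradient eta x‖ ≤ K ∧ |lap N eta x| ≤ K := by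
  obtain ⟨K1, h1, hK1⟩ := exists_bound_of_hasCompactSupport
    (continuous_gradient (contDiff_one_of_infty contDiff_eta)) (hasCompactSupport_eta (N := N)).gradient
  obtain ⟨K2, h2, hK2⟩ := exists_bound_of_hasCompactSupport (f := lap N eta)
    (continuous_lap contDiff_eta) (HasCompactSupport.intro (isCompact_closedBall 0 (1 / 2)) fun x hx =>
      lap_eq_zero_of_eventuallyEq (eta_eventuallyEq_zero (by simpa using hx)))
  exact ⟨K1 + K2, by positivity, fun x => ⟨(hK1 x).trans (by linarith), (hK2 x).trans (by linarith)⟩⟩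

lemma MemP.integral_Zf_mul {M : ℝ} {Ω : Set (EE N)} {u : EE N → ℝ} (hu : MemP N 1 0 M Ω u)
    {q : EE N → ℝ} (hq : ContDiff ℝ (⊤ : ℕ∞) q) (hqs : tsupport q ⊆ ball 0 1) {s : ℝ} (hs : 0 < s) :
    ∫ x, Zf u x * q x * gs s x = s * (∫ x in Ω, q x * gs s x) -
      ∫ x, u x * (s * lap N q x - ⟪x, gradient q x⟫ + 2 * q x) * gs s x := by
  have hc := hasCompactSupport_of_tsupport_subset_ball hqs
  have hg := contDiff_gs (N := N) s
  have hqg : ContDiff ℝ (⊤ : ℕ∞) fun x => q x * gs s x := hq.mul hg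
  have hw := hu.weak hqg ((tsupport_mul_subset_left).trans hqs)
  have q1 : ContDiff ℝ 1 q := contDiff_one_of_infty hq
  have g1 : ContDiff ℝ 1 (gs s : EE N → ℝ) := contDiff_one_of_infty hg
  have hGq : ContDiff ℝ 1 (gradient q) :=
    contDiff_gradient (m := 1) (contDiff_two_of_infty hq) (by norm_num)
  have hf := integral_fderiv_field' hu.contDiff (g1.smul hGq) hc.gradient.smul_left
  have huc := hu.contDiff.continuous
  have hgc := continuous_gradient hu.contDiff
  have hZ := continuous_Zf hu.contDiff
  have c1 := q1.continuous
  have c2 := g1.continuous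
  have c3 := hGq.continuous
  have c4 := continuous_lap hq
  have hl : HasCompactSupport (lap N q) := by
    have := hasCompactSupport_dv hc.gradient
    rwa [show dv (gradient q) = lap N q from funext fun x => dv_gradient (contDiff_two_of_infty hq) x] at this
  have e1 : ∀ x, fderiv ℝ u x (((gs s : EE N → ℝ) • gradient q) x) = gs s x * ⟪gradient u x, gradient q x⟫ := by
    intro x; rw [fderiv_apply_eq_inner u]; exact real_inner_smul_right _ _ _
  have e2 : ∀ x, dv ((gs s : EE N → ℝ) • gradient q) x =
      gs s x * lap N q x - s⁻¹ * (gs s x * ⟪x, gradient q x⟫) := by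
    intro x
    refine (dv_smul (g1.differentiable (by norm_num) x) (hGq.differentiable (by norm_num) x)).trans ?_
    rw [dv_gradient (contDiff_two_of_infty hq), fderiv_apply_eq_inner, gradient_gs, real_inner_smul_left]
    ring
  have e3 : ∀ x, ⟪gradient u x, gradient (fun x => q x * gs s x) x⟫ =
      gs s x * ⟪gradient u x, gradient q x⟫ - s⁻¹ * (⟪gradient u x, x⟫ * q x * gs s x) := by
    intro x
    rw [gradient_mul' (q1.differentiable (by norm_num) x) (g1.differentiable (by norm_num) x), gradient_gs,
      inner_add_right, real_inner_smul_right, real_inner_smul_right, real_inner_smul_right]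
    ring
  simp only [e1, e2] at hf
  simp only [e3] at hw
  have i1 : Integrable fun x => gs s x * ⟪gradient u x, gradient q x⟫ :=
    Continuous.integrable_of_hasCompactSupport (by fun_prop)
      (hc.gradient.mono fun x hx h => hx (by simp [h]))
  have i2 : Integrable fun x => ⟪gradient u x, x⟫ * q x * gs s x :=
    Continuous.integrable_of_hasCompactSupport (by fun_prop) (hc.mono fun x hx h => hx (by simp [h]))
  have i3 : Integrable fun x => u x * q x * gs s x :=
    Continuous.integrable_of_hasCompactSupport (by fun_prop) (hc.mono fun x hx h => hx (by simp [h]))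
  have i4 : Integrable fun x => u x * (gs s x * lap N q x - s⁻¹ * (gs s x * ⟪x, gradient q x⟫)) := by
    refine Continuous.integrable_of_hasCompactSupport (by fun_prop) (HasCompactSupport.mul_left ?_)
    exact hl.mul_left.sub ((hc.gradient.mono fun x hx h => hx (by simp [h])))
  rw [integral_sub i1 (i2.const_mul s⁻¹), hf, integral_const_mul s⁻¹] at hw
  have e4 : ∀ x, Zf u x * q x * gs s x = ⟪gradient u x, x⟫ * q x * gs s x - 2 * (u x * q x * gs s x) := by
    intro x; unfold Zf; ring
  have e5 : ∀ x, u x * (s * lap N q x - ⟪x, gradient q x⟫ + 2 * q x) * gs s x =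
      s * (u x * (gs s x * lap N q x - s⁻¹ * (gs s x * ⟪x, gradient q x⟫))) + 2 * (u x * q x * gs s x) := by
    intro x; field_simp
  simp only [e4, e5]
  rw [integral_sub i2 (i3.const_mul 2), integral_add (i4.const_mul s) (i3.const_mul 2), integral_const_mul s,
    integral_const_mul 2]
  generalize (∫ x, u x * (gs s x * lap N q x - s⁻¹ * (gs s x * ⟪x, gradient q x⟫))) = I4 at *
  generalize (∫ x, ⟪gradient u x, x⟫ * q x * gs s x) = I2 at *
  generalize (∫ x in Ω, q x * gs s x) = I0 at *
  field_simp at hw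
  linarith

/-- The cutoff version of `MemP.integral_Zf_mul`, with a controlled error. -/
lemma MemP.exists_integral_Zf_eta {M : ℝ} {Ω : Set (EE N)} {u : EE N → ℝ} (hu : MemP N 1 0 M Ω u) :
    ∃ C : ℝ, 0 < C ∧ ∀ s : ℝ, 0 < s → s ≤ 1 → ∀ p : EE N → ℝ, ContDiff ℝ (⊤ : ℕ∞) p →
      (∀ x : EE N, ‖x‖ ≤ 1 → |p x| ≤ 2 ∧ ‖gradient p x‖ ≤ 2) →
      |(∫ x, Zf u x * (p x * eta x) * gs s x) - (s * (∫ x in Ω, p x * eta x * gs s x) -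
        ∫ x, u x * (eta x * (s * lap N p x - ⟪x, gradient p x⟫ + 2 * p x)) * gs s x)| ≤ C * s ^ 6 := by
  obtain ⟨C, hC, hT⟩ := exists_tail_bound (N := N)
  obtain ⟨K, hK0, hK⟩ := exists_eta_bound (N := N)
  have hM0 : 0 ≤ M := (abs_nonneg _).trans (hu.2.2.2.2.1 0 (by simp))
  refine ⟨(M * (8 * K) + 1) * C, by positivity, fun s hs hs1 p hp hpb => ?_⟩
  have he := contDiff_eta (N := N)
  have hsub : tsupport (fun x => p x * eta x) ⊆ ball (0 : EE N) 1 :=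
    tsupport_mul_subset_right.trans (tsupport_eta.subset.trans (closedBall_subset_ball (by norm_num)))
  have h := hu.integral_Zf_mul (hp.mul he) hsub hs
  have hlap : ∀ x, lap N (fun x => p x * eta x) x =
      p x * lap N eta x + 2 * ⟪gradient p x, gradient eta x⟫ + eta x * lap N p x :=
    lap_mul (contDiff_two_of_infty hp) (contDiff_two_of_infty he)
  have hgr : ∀ x, gradient (fun x => p x * eta x) x = p x • gradient eta x + eta x • gradient p x := fun x =>
    gradient_mul' (hp.differentiable (by simp) x) (he.differentiable (by simp) x)
  set E : EE N → ℝ := fun x => u x * (s * (p x * lap N eta x + 2 * ⟪gradient p x, gradient eta x⟫) -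
    p x * ⟪x, gradient eta x⟫) with hE
  have e1 : ∀ x, u x * (s * lap N (fun x => p x * eta x) x - ⟪x, gradient (fun x => p x * eta x) x⟫ +
      2 * (p x * eta x)) * gs s x =
      u x * (eta x * (s * lap N p x - ⟪x, gradient p x⟫ + 2 * p x)) * gs s x + E x * gs s x := by
    intro x
    rw [hlap, hgr, inner_add_right, real_inner_smul_right, real_inner_smul_right, hE]
    ring
  simp only [e1] at h
  have huc := hu.contDiff.continuous
  have c1 := hp.continuous
  have c2 := continuous_gs (N := N) s
  have c3 := (contDiff_gradient_infty hp).continuous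
  have c4 := (contDiff_gradient_infty he).continuous
  have c5 := continuous_lap he
  have c6 := continuous_lap hp
  have c7 := continuous_eta (N := N)
  have Eoff : ∀ x : EE N, 1 / 2 < ‖x‖ → E x = 0 := fun x hx => by
    rw [hE]
    simp only [lap_eq_zero_of_eventuallyEq (eta_eventuallyEq_zero hx),
      gradient_eq_zero_of_eventuallyEq (eta_eventuallyEq_zero hx)]
    simp
  have i1 : Integrable fun x => u x * (eta x * (s * lap N p x - ⟪x, gradient p x⟫ + 2 * p x)) * gs s x :=
    Continuous.integrable_of_hasCompactSupport (by fun_prop)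
      (hasCompactSupport_eta.mono fun x hx h => hx (by simp [h]))
  have i2 : Integrable fun x => E x * gs s x := by
    refine Continuous.integrable_of_hasCompactSupport (by fun_prop)
      (HasCompactSupport.intro (isCompact_closedBall 0 (1 / 2)) fun x hx => ?_)
    rw [Eoff x (by simpa using hx), zero_mul]
  rw [integral_add i1 i2] at h
  have hb := hT s hs E (M * (8 * K) + 1) (fun x hx => ?_) (fun x => ?_)
  · rw [h, ← sub_sub, sub_sub_cancel_left, abs_neg]
    linarith
  · rw [hE]
    simp only [lap_eq_zero_of_eventuallyEq (eta_eventuallyEq_one hx),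
      gradient_eq_zero_of_eventuallyEq (eta_eventuallyEq_one hx)]
    simp
  · rcases le_or_gt ‖x‖ (1 / 2) with hx | hx
    · obtain ⟨p1, p2⟩ := hpb x (by linarith)
      obtain ⟨k1, k2⟩ := hK x
      have hux := hu.2.2.2.2.1 x (by rw [mem_ball_zero_iff]; linarith)
      have a1 : |p x * lap N eta x| ≤ 2 * K := by rw [abs_mul]; gcongr
      have a2 : |2 * ⟪gradient p x, gradient eta x⟫| ≤ 4 * K := by
        rw [abs_mul, abs_two]
        have := (abs_real_inner_le_norm (gradient p x) (gradient eta x)).trans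
          (mul_le_mul p2 k1 (norm_nonneg _) (by norm_num))
        linarith
      have a3 : |p x * ⟪x, gradient eta x⟫| ≤ 2 * K := by
        rw [abs_mul]
        have := (abs_real_inner_le_norm x (gradient eta x)).trans
          (mul_le_mul (show ‖x‖ ≤ 1 by linarith) k1 (norm_nonneg _) (by norm_num))
        calc |p x| * |⟪x, gradient eta x⟫| ≤ 2 * (1 * K) :=
              mul_le_mul p1 this (abs_nonneg _) (by norm_num)
          _ = 2 * K := by ring
      have a4 : |s * (p x * lap N eta x + 2 * ⟪gradient p x, gradient eta x⟫)| ≤ 6 * K := by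
        rw [abs_mul, abs_of_pos hs]
        have := (abs_add_le (p x * lap N eta x) (2 * ⟪gradient p x, gradient eta x⟫)).trans (add_le_add a1 a2)
        calc _ ≤ 1 * (2 * K + 4 * K) := mul_le_mul hs1 this (abs_nonneg _) (by norm_num)
          _ = _ := by ring
      rw [hE]
      simp only [abs_mul (u x)]
      have a5 := (abs_sub (s * (p x * lap N eta x + 2 * ⟪gradient p x, gradient eta x⟫))
        (p x * ⟪x, gradient eta x⟫)).trans (add_le_add a4 a3)
      calc _ ≤ M * (6 * K + 2 * K) := mul_le_mul hux a5 (abs_nonneg _) hM0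
        _ ≤ _ := by linarith
    · rw [Eoff x hx, abs_zero]; positivity

end

section

variable {N : ℕ}

lemma sq_integral_mul_le {α : Type*} [MeasurableSpace α] {μ : Measure α} {f g : α → ℝ}
    (hf : Integrable (fun x => f x ^ 2) μ) (hg : Integrable (fun x => g x ^ 2) μ)
    (hfg : Integrable (fun x => f x * g x) μ) :
    (∫ x, f x * g x ∂μ) ^ 2 ≤ (∫ x, f x ^ 2 ∂μ) * ∫ x, g x ^ 2 ∂μ := by
  have h : ∀ t : ℝ, 0 ≤ (∫ x, f x ^ 2 ∂μ) * (t * t) + (2 * ∫ x, f x * g x ∂μ) * t + ∫ x, g x ^ 2 ∂μ := by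
    intro t
    have h0 : 0 ≤ ∫ x, (t * f x + g x) ^ 2 ∂μ := integral_nonneg fun x => sq_nonneg _
    have e : ∀ x, (t * f x + g x) ^ 2 = (t ^ 2 * f x ^ 2 + 2 * t * (f x * g x)) + g x ^ 2 := fun x => by ring
    have i1 : Integrable (fun x => t ^ 2 * f x ^ 2 + 2 * t * (f x * g x)) μ :=
      (hf.const_mul _).add (hfg.const_mul _)
    simp only [e] at h0
    rw [integral_add i1 hg, integral_add (hf.const_mul _) (hfg.const_mul _), integral_const_mul,
      integral_const_mul] at h0
    linarith
  have := discrim_le_zero h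
  unfold discrim at this
  linarith

lemma summable_of_le_mul_add {a b : ℕ → ℝ} {θ : ℝ} (ha : ∀ k, 0 ≤ a k) (hθ : θ < 1)
    (hb : Summable b) (hb0 : ∀ k, 0 ≤ b k) {k₀ : ℕ} (h : ∀ k, k₀ ≤ k → a (k + 1) ≤ θ * a k + b k) :
    Summable a := by
  rw [← summable_nat_add_iff k₀]
  refine summable_of_sum_range_le (c := (1 - θ)⁻¹ * (a k₀ + ∑' k, b (k + k₀))) (fun k => ha _) fun n => ?_
  have hb' := (summable_nat_add_iff k₀).2 hb
  have key : ∀ n, (∑ i ∈ Finset.range n, a (i + k₀)) * (1 - θ) ≤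
      a k₀ + ∑ i ∈ Finset.range n, b (i + k₀) - a (n + k₀) := by
    intro n
    induction n with
    | zero => simp
    | succ n ih =>
      rw [Finset.sum_range_succ, Finset.sum_range_succ]
      have := h (n + k₀) (by omega)
      rw [show n + 1 + k₀ = n + k₀ + 1 by omega]
      linarith
  rw [inv_mul_eq_div, le_div_iff₀ (by linarith)]
  have := hb'.sum_le_tsum (Finset.range n) (fun i _ => hb0 _)
  linarith [key n, ha (n + k₀)]

lemma exists_slab {M : ℝ} {Ω : Set (EE N)} {u : EE N → ℝ} (hu : MemP N 1 0 M Ω u)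
    (hN : ∃ e : EE N, ‖e‖ = 1)
    (hδ : limsup (fun r => deltaFn N u r) (nhdsWithin 0 (Ioi 0)) = 0) {ε : ℝ} (hε : 0 < ε) :
    ∃ r₀ : ℝ, 0 < r₀ ∧ r₀ ≤ 1 ∧ ∀ r, 0 < r → r < r₀ → ∃ f : EE N, ‖f‖ = 1 ∧
      ∀ x : EE N, ‖x‖ < r → x ∉ Ω → |⟪x, f⟫| ≤ ε * r := by
  have bdd : ∀ (r : ℝ) (f : EE N), ‖f‖ = 1 →
      BddAbove (range fun x : ({x | u x = 0 ∧ gradient u x = 0} ∩ ball (0 : EE N) r : Set (EE N)) => ⟪(x : EE N), f⟫) ∧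
      BddBelow (range fun x : ({x | u x = 0 ∧ gradient u x = 0} ∩ ball (0 : EE N) r : Set (EE N)) => ⟪(x : EE N), f⟫) := by
    intro r f hf
    have : ∀ x : ({x | u x = 0 ∧ gradient u x = 0} ∩ ball (0 : EE N) r : Set (EE N)), |⟪(x : EE N), f⟫| ≤ r := by
      rintro ⟨x, hx1, hx2⟩
      have := abs_real_inner_le_norm x f
      rw [hf, mul_one] at this
      exact this.trans (mem_ball_zero_iff.1 hx2).le
    exact ⟨⟨r, by rintro _ ⟨x, rfl⟩; exact (abs_le.1 (this x)).2⟩,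
      ⟨-r, by rintro _ ⟨x, rfl⟩; exact (abs_le.1 (this x)).1⟩⟩
  have zero : ∀ r : ℝ, 0 < r → (0 : EE N) ∈ {x | u x = 0 ∧ gradient u x = 0} ∩ ball (0 : EE N) r :=
    fun r hr => ⟨hu.zero_off (by simp) hu.zero_notMem, by simpa using hr⟩
  have hle : ∀ r : ℝ, 0 < r → deltaFn N u r ≤ 2 := by
    intro r hr
    obtain ⟨e, he⟩ := hN
    have : Nonempty ({x | u x = 0 ∧ gradient u x = 0} ∩ ball (0 : EE N) r : Set (EE N)) := ⟨⟨0, zero r hr⟩⟩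
    unfold deltaFn MD
    rw [div_le_iff₀ hr]
    refine (ciInf_le ⟨0, ?_⟩ ⟨e, he⟩).trans ?_
    · rintro _ ⟨f, rfl⟩
      exact sub_nonneg.2 ((ciInf_le (bdd r f f.2).2 ⟨0, zero r hr⟩).trans
        (le_ciSup (bdd r f f.2).1 ⟨0, zero r hr⟩))
    · have h1 : ∀ x : ({x | u x = 0 ∧ gradient u x = 0} ∩ ball (0 : EE N) r : Set (EE N)),
          |⟪(x : EE N), e⟫| ≤ r := by
        rintro ⟨x, hx1, hx2⟩
        have := abs_real_inner_le_norm x e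
        rw [he, mul_one] at this
        exact this.trans (mem_ball_zero_iff.1 hx2).le
      have h2 := ciSup_le fun x => (abs_le.1 (h1 x)).2
      have h3 := le_ciInf fun x => (abs_le.1 (h1 x)).1
      simp only
      linarith
  have hev : ∀ᶠ r in nhdsWithin (0 : ℝ) (Ioi 0), deltaFn N u r < ε := by
    refine eventually_lt_of_limsup_lt (by rw [hδ]; exact hε) ⟨2, ?_⟩
    rw [eventually_map]
    filter_upwards [self_mem_nhdsWithin] with r hr using hle r hr
  rw [eventually_nhdsWithin_iff, Metric.eventually_nhds_iff] at hev
  obtain ⟨r₀, hr0, h⟩ := hev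
  refine ⟨min r₀ 1, by positivity, min_le_right _ _, fun r hr hrr => ?_⟩
  have h1 := h (y := r) (by rw [Real.dist_0_eq_abs, abs_of_pos hr]; exact hrr.trans_le (min_le_left _ _)) hr
  unfold deltaFn MD at h1
  rw [div_lt_iff₀ hr] at h1
  have : Nonempty {e : EE N // ‖e‖ = 1} := by obtain ⟨e, he⟩ := hN; exact ⟨⟨e, he⟩⟩
  obtain ⟨f, hf⟩ := exists_lt_of_ciInf_lt h1
  refine ⟨f, f.2, fun x hx hxΩ => ?_⟩
  have hxr : ‖x‖ < 1 := hx.trans (hrr.trans_le (min_le_right _ _))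
  have hxD : x ∈ {x | u x = 0 ∧ gradient u x = 0} ∩ ball (0 : EE N) r :=
    ⟨hu.zero_off hxr hxΩ, by simpa using hx⟩
  have a1 := le_ciSup (bdd r f f.2).1 ⟨x, hxD⟩
  have a2 := ciInf_le (bdd r f f.2).2 ⟨x, hxD⟩
  have a3 := le_ciSup (bdd r f f.2).1 ⟨0, zero r hr⟩
  have a4 := ciInf_le (bdd r f f.2).2 ⟨0, zero r hr⟩
  simp only [inner_zero_left] at a1 a2 a3 a4
  rw [abs_le]
  constructor <;> linarith

end

section

variable {N : ℕ}

/-- The Gaussian average of the squared homogeneity defect. -/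
def dq (u : EE N → ℝ) (s : ℝ) : ℝ := ∫ x in closedBall (0 : EE N) (1 / 2), Zf u x ^ 2 * gs s x

/-- The Gaussian density of the complement of a set. -/
def Th (Ω : Set (EE N)) (s : ℝ) : ℝ := ∫ x in Ωᶜ, eta x * gs s x

lemma dq_nonneg (u : EE N → ℝ) (s : ℝ) : 0 ≤ dq u s :=
  integral_nonneg fun x => mul_nonneg (sq_nonneg _) (gs_pos _ _).le

lemma Th_nonneg (Ω : Set (EE N)) (s : ℝ) : 0 ≤ Th Ω s :=
  integral_nonneg fun x => mul_nonneg (eta_nonneg _) (gs_pos _ _).le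

lemma integrable_mul_eta_mul_gs {p : EE N → ℝ} (hp : Continuous p) (s : ℝ) :
    Integrable fun x => p x * eta x * gs s x := by
  have := continuous_eta (N := N)
  have := continuous_gs (N := N) s
  exact Continuous.integrable_of_hasCompactSupport (by fun_prop)
    (hasCompactSupport_eta.mono fun x hx h => hx (by simp [h]))

lemma integrable_eta_mul_gs (s : ℝ) : Integrable fun x : EE N => eta x * gs s x := by
  simpa using integrable_mul_eta_mul_gs (N := N) (p := fun _ => 1) continuous_const s

lemma sq_integral_Zf_mul_le {u : EE N → ℝ} (hu : ContDiff ℝ 1 u) {q : EE N → ℝ} (hq : Continuous q)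
    (h0 : ∀ x, 1 / 2 < ‖x‖ → q x = 0) {s : ℝ} :
    (∫ x, Zf u x * q x * gs s x) ^ 2 ≤ dq u s * ∫ x, q x ^ 2 * gs s x := by
  have hZ := continuous_Zf hu
  have hg := continuous_gs (N := N) s
  have hout : ∀ x : EE N, x ∉ closedBall (0 : EE N) (1 / 2) → q x = 0 := fun x hx =>
    h0 x (by rw [mem_closedBall_zero_iff] at hx; linarith)
  rw [← setIntegral_eq_integral_of_forall_compl_eq_zero (s := closedBall (0 : EE N) (1 / 2))
      (f := fun x => Zf u x * q x * gs s x) (fun x hx => by rw [hout x hx]; ring),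
    ← setIntegral_eq_integral_of_forall_compl_eq_zero (s := closedBall (0 : EE N) (1 / 2))
      (f := fun x => q x ^ 2 * gs s x) (fun x hx => by rw [hout x hx]; ring)]
  have hi : ∀ F : EE N → ℝ, Continuous F → IntegrableOn F (closedBall (0 : EE N) (1 / 2)) := fun F hF =>
    hF.continuousOn.integrableOn_compact (isCompact_closedBall _ _)
  have h := sq_integral_mul_le (μ := volume.restrict (closedBall (0 : EE N) (1 / 2)))
    (f := fun x => Zf u x * √(gs s x)) (g := fun x => q x * √(gs s x))
    (hi _ (by fun_prop)) (hi _ (by fun_prop)) (hi _ (by fun_prop))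
  have e1 : ∀ x : EE N, Zf u x * √(gs s x) * (q x * √(gs s x)) = Zf u x * q x * gs s x := fun x => by
    have := Real.mul_self_sqrt (gs_pos s x).le
    linear_combination Zf u x * q x * this
  have e2 : ∀ x : EE N, (Zf u x * √(gs s x)) ^ 2 = Zf u x ^ 2 * gs s x := fun x => by
    rw [mul_pow, Real.sq_sqrt (gs_pos s x).le]
  have e3 : ∀ x : EE N, (q x * √(gs s x)) ^ 2 = q x ^ 2 * gs s x := fun x => by
    rw [mul_pow, Real.sq_sqrt (gs_pos s x).le]
  simp only [e1, e2, e3] at h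
  exact h

lemma differentiableAt_inner_right (f x : EE N) : DifferentiableAt ℝ (fun y : EE N => ⟪y, f⟫) x :=
  differentiableAt_id.inner ℝ (differentiableAt_const f)

lemma gradient_inner_right (f x : EE N) : gradient (fun y : EE N => ⟪y, f⟫) x = f := by
  have : HasFDerivAt (fun y : EE N => ⟪y, f⟫) (innerSL ℝ f) x := by
    have h := (innerSL ℝ f).hasFDerivAt (x := x)
    refine h.congr_of_eventuallyEq (Eventually.of_forall fun y => ?_)
    simp [real_inner_comm]
  refine ext_inner_right ℝ fun y => ?_
  rw [← fderiv_apply_eq_inner, this.fderiv, innerSL_apply_apply]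

/-- The quadratic polynomial used to test the zero set. -/
def slabPoly (s : ℝ) (f x : EE N) : ℝ := s - ⟪x, f⟫ * ⟪x, f⟫

lemma contDiff_slabPoly (s : ℝ) (f : EE N) : ContDiff ℝ (⊤ : ℕ∞) (slabPoly s f) :=
  contDiff_const.sub ((contDiff_id.inner ℝ contDiff_const).mul (contDiff_id.inner ℝ contDiff_const))

lemma gradient_slabPoly (s : ℝ) (f x : EE N) : gradient (slabPoly s f) x = (-2 * ⟪x, f⟫) • f := by
  have h1 := differentiableAt_inner_right f x
  have h := gradient_sub' (f := fun _ : EE N => s) (g := fun y => ⟪y, f⟫ * ⟪y, f⟫) (x := x)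
    (by fun_prop) (h1.mul h1)
  refine h.trans ?_
  rw [gradient_mul' h1 h1, gradient_inner_right, show gradient (fun _ : EE N => s) x = 0 by simp [gradient]]
  module

lemma lap_slabPoly (s : ℝ) {f : EE N} (hf : ‖f‖ = 1) (x : EE N) : lap N (slabPoly s f) x = -2 := by
  rw [← dv_gradient (contDiff_two_of_infty (contDiff_slabPoly s f)),
    show gradient (slabPoly s f) = fun x => (⟪x, f⟫) • ((-2 : ℝ) • f) from
      funext fun x => by rw [gradient_slabPoly]; module,
    dv_smul (differentiableAt_inner_right f x) (by fun_prop), dv_const, fderiv_apply_eq_inner, gradient_inner_right,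
    real_inner_smul_right, real_inner_self_eq_norm_sq, hf]
  norm_num

lemma exists_integral_slabPoly : ∃ C : ℝ, 0 < C ∧ ∀ s : ℝ, 0 < s → ∀ f : EE N, ‖f‖ = 1 →
    |∫ x, slabPoly s f x * eta x * gs s x| ≤ s * (C * s ^ 6) := by
  obtain ⟨C, hC, hT⟩ := exists_tail_bound (N := N)
  obtain ⟨K, hK0, hK⟩ := exists_eta_bound (N := N)
  refine ⟨(K + 1) * C, by positivity, fun s hs f hf => ?_⟩
  have hX : ContDiff ℝ 1 fun x : EE N => (⟪x, f⟫ * eta x) • f :=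
    contDiff_one_of_infty ((contDiff_id.inner ℝ contDiff_const).mul contDiff_eta) |>.smul contDiff_const
  have h := integral_dv_mul_gs s hX (hasCompactSupport_eta.mono fun x hx h => hx (by simp [h]))
  have hde : ∀ x : EE N, DifferentiableAt ℝ (eta : EE N → ℝ) x := fun x => contDiff_eta.differentiable (by simp) x
  have e1 : ∀ x, dv (fun x : EE N => (⟪x, f⟫ * eta x) • f) x = ⟪x, f⟫ * ⟪gradient eta x, f⟫ + eta x := by
    intro x
    rw [dv_smul (f := fun x => ⟪x, f⟫ * eta x) (X := fun _ => f) ((differentiableAt_inner_right f x).mul (hde x))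
      (by fun_prop), dv_const, fderiv_apply_eq_inner,
      gradient_mul' (differentiableAt_inner_right f x) (hde x), gradient_inner_right, inner_add_left, real_inner_smul_left,
      real_inner_smul_left, real_inner_self_eq_norm_sq, hf]
    ring
  have e2 : ∀ x : EE N, ⟪(⟪x, f⟫ * eta x) • f, x⟫ * gs s x = ⟪x, f⟫ * ⟪x, f⟫ * eta x * gs s x := by
    intro x
    rw [real_inner_smul_left, real_inner_comm x f]; ring
  simp only [e1, e2] at h
  have i1 : Integrable fun x => (⟪x, f⟫ * ⟪gradient eta x, f⟫) * gs s x := by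
    have c1 := continuous_gs (N := N) s
    have c2 := continuous_gradient (contDiff_one_of_infty (contDiff_eta (N := N)))
    refine Continuous.integrable_of_hasCompactSupport (by fun_prop)
      ((hasCompactSupport_eta (N := N)).gradient.mono fun x hx h => hx (by simp only [h]; simp))
  have i2 := integrable_eta_mul_gs (N := N) s
  have i3 : Integrable fun x : EE N => ⟪x, f⟫ * ⟪x, f⟫ * eta x * gs s x :=
    integrable_mul_eta_mul_gs (by fun_prop) s
  have e3 : ∀ x : EE N, slabPoly s f x * eta x * gs s x =
      s * (eta x * gs s x) - ⟪x, f⟫ * ⟪x, f⟫ * eta x * gs s x := fun x => by unfold slabPoly; ring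
  simp only [e3]
  rw [integral_sub (i2.const_mul s) i3, integral_const_mul]
  simp only [add_mul] at h
  rw [integral_add i1 i2] at h
  have hb := hT s hs (fun x => ⟪x, f⟫ * ⟪gradient eta x, f⟫) K (fun x hx => by
    rw [gradient_eq_zero_of_eventuallyEq (eta_eventuallyEq_one hx)]; simp) (fun x => ?_)
  · generalize (∫ x, ⟪x, f⟫ * ⟪gradient eta x, f⟫ * gs s x) = I1 at *
    generalize (∫ x : EE N, eta x * gs s x) = I2 at *
    generalize (∫ x : EE N, ⟪x, f⟫ * ⟪x, f⟫ * eta x * gs s x) = I3 at *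
    have : s * I2 - I3 = -(s * I1) := by field_simp at h; linarith
    rw [this, abs_neg, abs_mul, abs_of_pos hs]
    gcongr
    refine hb.trans ?_
    have : 0 ≤ C * s ^ 6 := by positivity
    nlinarith
  · rcases le_or_gt ‖x‖ (1 / 2) with hx | hx
    · have h1 := abs_real_inner_le_norm x f
      have h2 := abs_real_inner_le_norm (gradient eta x) f
      rw [hf, mul_one] at h1 h2
      rw [abs_mul]
      calc _ ≤ 1 * K := mul_le_mul (h1.trans (by linarith)) (h2.trans (hK x).1) (abs_nonneg _) zero_le_one
        _ = K := one_mul _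
    · rw [gradient_eq_zero_of_eventuallyEq (eta_eventuallyEq_zero hx)]; simpa using hK0

lemma MemP.exists_integral_compl_le {M : ℝ} {Ω : Set (EE N)} {u : EE N → ℝ} (hu : MemP N 1 0 M Ω u) :
    ∃ C : ℝ, 0 < C ∧ ∀ s : ℝ, 0 < s → s ≤ 1 → ∀ f : EE N, ‖f‖ = 1 →
      ∫ x in Ωᶜ, (1 - ⟪x, f⟫ ^ 2 / s) * eta x * gs s x ≤ C * (√(dq u s) / s + s) := by
  obtain ⟨C1, hC1, h1⟩ := hu.exists_integral_Zf_eta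
  obtain ⟨C2, hC2, h2⟩ := exists_integral_slabPoly (N := N)
  obtain ⟨C3, hC3, h3⟩ := exists_poly_gs_le (N := N) 2
  refine ⟨√C3 + C1 + C2, by positivity, fun s hs hs1 f hf => ?_⟩
  have hp := contDiff_slabPoly s f
  have hin : ∀ x : EE N, |⟪x, f⟫| ≤ ‖x‖ := fun x => by
    have := abs_real_inner_le_norm x f
    rwa [hf, mul_one] at this
  have habs : ∀ x : EE N, |slabPoly s f x| ≤ s + ‖x‖ ^ 2 := fun x => by
    have : ⟪x, f⟫ * ⟪x, f⟫ ≤ ‖x‖ ^ 2 := by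
      rw [← sq, ← sq_abs]; exact pow_le_pow_left₀ (abs_nonneg _) (hin x) 2
    unfold slabPoly
    rw [abs_le]
    constructor <;> nlinarith [mul_self_nonneg ⟪x, f⟫]
  have a1 := h1 s hs hs1 _ hp fun x hx => ⟨(habs x).trans (by nlinarith [norm_nonneg x]), by
    rw [gradient_slabPoly, norm_smul, hf, mul_one, Real.norm_eq_abs, abs_mul]
    have := hin x
    norm_num
    linarith⟩
  have e0 : ∀ x, s * lap N (slabPoly s f) x - ⟪x, gradient (slabPoly s f) x⟫ + 2 * slabPoly s f x = 0 := by
    intro x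
    rw [lap_slabPoly s hf, gradient_slabPoly, real_inner_smul_right]
    unfold slabPoly
    ring
  simp only [e0, mul_zero, zero_mul, integral_zero, sub_zero] at a1
  have a2 := h2 s hs f hf
  have ip := integrable_mul_eta_mul_gs hp.continuous s
  have hadd := integral_add_compl hu.isOpen.measurableSet ip
  have a3 := sq_integral_Zf_mul_le (s := s) hu.contDiff (q := fun x => slabPoly s f x * eta x)
    (hp.continuous.mul continuous_eta) (fun x hx => by
      rw [eta_eq_zero hx.le, mul_zero])
  have a4 : ∫ x, (slabPoly s f x * eta x) ^ 2 * gs s x ≤ C3 * s ^ 2 := by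
    have h4 := integral_gs (N := N) (show 0 < 4 * s by positivity)
    calc _ ≤ ∫ x, C3 * s ^ 2 * gs (4 * s) x := by
          refine integral_mono_of_nonneg (Eventually.of_forall fun x =>
            mul_nonneg (sq_nonneg _) (gs_pos _ _).le) ((integrable_gs (by positivity)).const_mul _)
            (Eventually.of_forall fun x => ?_)
          refine le_trans ?_ (h3 s hs x)
          refine mul_le_mul_of_nonneg_right ?_ (gs_pos _ _).le
          rw [← sq_abs, abs_mul, abs_of_nonneg (eta_nonneg x)]
          refine pow_le_pow_left₀ (mul_nonneg (abs_nonneg _) (eta_nonneg _)) ?_ 2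
          exact (mul_le_of_le_one_right (abs_nonneg _) (eta_le_one x)).trans (habs x)
      _ = _ := by rw [integral_const_mul, h4, mul_one]
  have a5 : |∫ x, Zf u x * (slabPoly s f x * eta x) * gs s x| ≤ √(dq u s) * (√C3 * s) := by
    refine Real.abs_le_sqrt (a3.trans (mul_le_mul_of_nonneg_left a4 (dq_nonneg _ _))) |>.trans_eq ?_
    rw [Real.sqrt_mul (dq_nonneg _ _), Real.sqrt_mul hC3.le, Real.sqrt_sq hs.le]
  have e1 : ∀ x, (1 - ⟪x, f⟫ ^ 2 / s) * eta x * gs s x = s⁻¹ * (slabPoly s f x * eta x * gs s x) := by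
    intro x; unfold slabPoly; field_simp
  simp only [e1]
  rw [integral_const_mul]
  generalize (∫ x, Zf u x * (slabPoly s f x * eta x) * gs s x) = A at *
  generalize (∫ x in Ω, slabPoly s f x * eta x * gs s x) = B at *
  generalize (∫ x in Ωᶜ, slabPoly s f x * eta x * gs s x) = B' at *
  rw [← hadd] at a2
  have hs6 : s ^ 6 ≤ s ^ 3 := pow_le_pow_of_le_one hs.le hs1 (by norm_num)
  have hs7 : s ^ 7 ≤ s ^ 2 := pow_le_pow_of_le_one hs.le hs1 (by norm_num)
  have a6 : s * B' ≤ √(dq u s) * (√C3 * s) + C1 * s ^ 3 + C2 * s ^ 3 := by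
    have b1 := (abs_le.1 a1).1
    have b1' := (abs_le.1 a1).2
    have b2 := (abs_le.1 a2).2
    have b3 := (abs_le.1 a5).1
    have b4 : s * (B + B') ≤ C2 * s ^ 3 := by
      calc s * (B + B') ≤ s * (s * (C2 * s ^ 6)) := mul_le_mul_of_nonneg_left b2 hs.le
        _ = C2 * s * s ^ 7 := by ring
        _ ≤ C2 * s * s ^ 2 := mul_le_mul_of_nonneg_left hs7 (by positivity)
        _ = _ := by ring
    have b5 : C1 * s ^ 6 ≤ C1 * s ^ 3 := by gcongr
    linarith
  rw [inv_mul_eq_div, div_le_iff₀ hs]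
  have e2 : (√C3 + C1 + C2) * (√(dq u s) / s + s) * s = (√C3 + C1 + C2) * (√(dq u s) + s ^ 2) := by
    field_simp
  rw [e2]
  have a7 : B' ≤ √(dq u s) * √C3 + (C1 + C2) * s ^ 2 := by
    refine le_of_mul_le_mul_left ?_ hs
    calc _ ≤ _ := a6
      _ = _ := by ring
  have : 0 ≤ √(dq u s) * (C1 + C2) + √C3 * s ^ 2 := by positivity
  linarith

end

section

variable {N : ℕ}

lemma exists_gs_slab_radius : ∃ R : ℝ, 0 < R ∧ ∀ s : ℝ, 0 < s → ∀ x : EE N, R * √s ≤ ‖x‖ →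
    (‖x‖ ^ 2 / s - 1 / 2) * gs s x ≤ 1 / 8 * gs (4 * s) x := by
  obtain ⟨C, hC, h⟩ := exists_exp_bound 2 (show (0 : ℝ) < 3 / 8 by norm_num)
  refine ⟨√(8 * 2 ^ N * C), by positivity, fun s hs x hx => ?_⟩
  set y := ‖x‖ ^ 2 / s with hy
  have hy0 : 0 ≤ y := by positivity
  have hyR : 8 * 2 ^ N * C ≤ y := by
    rw [hy, le_div_iff₀ hs]
    have := pow_le_pow_left₀ (by positivity) hx 2
    rwa [mul_pow, Real.sq_sqrt (by positivity), Real.sq_sqrt hs.le] at this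
  have h1 := h y hy0
  have he : Real.exp (-(3 * ‖x‖ ^ 2 / (8 * s))) = Real.exp (-(3 / 8 * y)) := by
    congr 1; rw [hy]; field_simp
  rw [gs_eq_four hs, he, ← mul_assoc]
  refine mul_le_mul_of_nonneg_right ?_ (gs_pos _ _).le
  set E := Real.exp (-(3 / 8 * y))
  have hE : 0 < E := Real.exp_pos _
  have h2 : (1 + y) * E ≤ 1 / (8 * 2 ^ N) := by
    rw [le_div_iff₀ (by positivity)]
    refine le_of_mul_le_mul_left ?_ hC
    calc C * ((1 + y) * E * (8 * 2 ^ N)) = (8 * 2 ^ N * C) * ((1 + y) * E) := by ring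
      _ ≤ (1 + y) * ((1 + y) * E) := mul_le_mul_of_nonneg_right (by linarith) (by positivity)
      _ = (1 + y) ^ 2 * E := by ring
      _ ≤ C := h1
      _ = C * 1 := (mul_one _).symm
  calc (y - 1 / 2) * (2 ^ N * E) ≤ (1 + y) * (2 ^ N * E) :=
        mul_le_mul_of_nonneg_right (by linarith) (by positivity)
    _ = 2 ^ N * ((1 + y) * E) := by ring
    _ ≤ 2 ^ N * (1 / (8 * 2 ^ N)) := by gcongr
    _ = 1 / 8 := by field_simp

lemma MemP.exists_Th_le {M : ℝ} {Ω : Set (EE N)} {u : EE N → ℝ} (hu : MemP N 1 0 M Ω u)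
    (hN : ∃ e : EE N, ‖e‖ = 1)
    (hδ : limsup (fun r => deltaFn N u r) (nhdsWithin 0 (Ioi 0)) = 0) :
    ∃ C : ℝ, 0 < C ∧ ∃ s₀ : ℝ, 0 < s₀ ∧ s₀ ≤ 1 ∧ ∀ s, 0 < s → s < s₀ →
      Th Ω s ≤ 1 / 4 * Th Ω (4 * s) + C * (√(dq u s) / s + s) := by
  obtain ⟨C, hC, h⟩ := hu.exists_integral_compl_le
  obtain ⟨R, hR, hR'⟩ := exists_gs_slab_radius (N := N)
  obtain ⟨r₀, hr0, hr1, hsl⟩ := exists_slab hu hN hδ (show 0 < 1 / (2 * R) by positivity)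
  refine ⟨2 * C, by positivity, min 1 ((r₀ / R) ^ 2), by positivity, min_le_left _ _, fun s hs hss => ?_⟩
  have hs1 : s ≤ 1 := (hss.trans_le (min_le_left _ _)).le
  have hRs : R * √s < r₀ := by
    have : √s < r₀ / R := (Real.sqrt_lt' (by positivity)).2 (hss.trans_le (min_le_right _ _))
    rwa [lt_div_iff₀ hR, mul_comm] at this
  obtain ⟨f, hf, hfs⟩ := hsl (R * √s) (by positivity) hRs
  have h1 := h s hs hs1 f hf
  have i1 := integrable_eta_mul_gs (N := N) s
  have i2 := integrable_eta_mul_gs (N := N) (4 * s)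
  have i3 : Integrable fun x => (1 - ⟪x, f⟫ ^ 2 / s) * eta x * gs s x :=
    integrable_mul_eta_mul_gs (by fun_prop) s
  have h2 : 1 / 2 * Th Ω s - 1 / 8 * Th Ω (4 * s) ≤ ∫ x in Ωᶜ, (1 - ⟪x, f⟫ ^ 2 / s) * eta x * gs s x := by
    unfold Th
    rw [← integral_const_mul, ← integral_const_mul, ← integral_sub (i1.integrableOn.const_mul _)
      (i2.integrableOn.const_mul _)]
    refine setIntegral_mono_on ((i1.integrableOn.const_mul _).sub (i2.integrableOn.const_mul _))
      i3.integrableOn hu.isOpen.measurableSet.compl fun x hx => ?_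
    suffices hk : 1 / 2 * gs s x - 1 / 8 * gs (4 * s) x ≤ (1 - ⟪x, f⟫ ^ 2 / s) * gs s x by
      calc _ = eta x * (1 / 2 * gs s x - 1 / 8 * gs (4 * s) x) := by ring
        _ ≤ eta x * ((1 - ⟪x, f⟫ ^ 2 / s) * gs s x) := mul_le_mul_of_nonneg_left hk (eta_nonneg x)
        _ = _ := by ring
    have g1 := gs_pos s x
    have g2 := gs_pos (4 * s) x
    rcases lt_or_ge ‖x‖ (R * √s) with hx1 | hx1
    · have h3 := hfs x hx1 hx
      have h4 : 1 / (2 * R) * (R * √s) = √s / 2 := by field_simp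
      rw [h4] at h3
      have h5 : ⟪x, f⟫ ^ 2 ≤ s / 4 := by
        rw [← sq_abs]
        refine (pow_le_pow_left₀ (abs_nonneg _) h3 2).trans_eq ?_
        rw [div_pow, Real.sq_sqrt hs.le]; norm_num
      have h6 : ⟪x, f⟫ ^ 2 / s ≤ 1 / 4 := by rw [div_le_iff₀ hs]; linarith
      nlinarith
    · have h3 := hR' s hs x hx1
      have h4 : ⟪x, f⟫ ^ 2 / s ≤ ‖x‖ ^ 2 / s := by
        have := abs_real_inner_le_norm x f
        rw [hf, mul_one] at this
        have h5 : ⟪x, f⟫ ^ 2 ≤ ‖x‖ ^ 2 := by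
          rw [← sq_abs]; exact pow_le_pow_left₀ (abs_nonneg _) this 2
        exact div_le_div_of_nonneg_right h5 hs.le
      nlinarith
  linarith

lemma MemP.summable_dq {M : ℝ} {Ω : Set (EE N)} {u : EE N → ℝ} (hu : MemP N 1 0 M Ω u)
    (hq : QuadGrowth u) : Summable fun k : ℕ => (((1 / 4 : ℝ) ^ k) ^ 2)⁻¹ * dq u ((1 / 4) ^ k) :=
  summable_gs_of_summable_balls (H := fun x => Zf u x ^ 2) ((continuous_Zf hu.contDiff).pow 2)
    (fun x => sq_nonneg _) (hu.summable_Zf hq)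

lemma sqrt_dq_div_sq (u : EE N → ℝ) (s : ℝ) : (√(dq u s) / s) ^ 2 = (s ^ 2)⁻¹ * dq u s := by
  rw [div_pow, Real.sq_sqrt (dq_nonneg _ _)]; ring

lemma MemP.summable_Th {M : ℝ} {Ω : Set (EE N)} {u : EE N → ℝ} (hu : MemP N 1 0 M Ω u)
    (hq : QuadGrowth u) (hN : ∃ e : EE N, ‖e‖ = 1)
    (hδ : limsup (fun r => deltaFn N u r) (nhdsWithin 0 (Ioi 0)) = 0) :
    Summable fun k : ℕ => Th Ω ((1 / 4) ^ k) ^ 2 := by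
  obtain ⟨C, hC, s₀, hs0, hs1, h⟩ := hu.exists_Th_le hN hδ
  have hD := hu.summable_dq hq
  obtain ⟨k₀, hk⟩ := exists_pow_lt_of_lt_one hs0 (show (1 / 4 : ℝ) < 1 by norm_num)
  have hG : Summable fun k : ℕ => ((1 / 4 : ℝ) ^ k) ^ 2 := by
    have : Summable fun k : ℕ => ((1 / 16 : ℝ)) ^ k := summable_geometric_of_lt_one (by norm_num) (by norm_num)
    refine this.congr fun k => ?_
    rw [← pow_mul, mul_comm, pow_mul]; norm_num
  have hb := ((hD.add hG).mul_left (4 * C ^ 2))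
  have hb' := (summable_nat_add_iff 1).2 hb
  refine summable_of_le_mul_add (θ := 1 / 8) (k₀ := k₀) (fun k => sq_nonneg _) (by norm_num) hb'
    (fun k => mul_nonneg (by positivity) (add_nonneg (mul_nonneg (by positivity) (dq_nonneg _ _)) (by positivity)))
    fun k hk' => ?_
  have hs : (0 : ℝ) < (1 / 4) ^ (k + 1) := by positivity
  have hss : (1 / 4 : ℝ) ^ (k + 1) < s₀ :=
    (pow_le_pow_of_le_one (by norm_num) (by norm_num) (by omega)).trans_lt hk
  have h1 := h _ hs hss
  have e4 : 4 * (1 / 4 : ℝ) ^ (k + 1) = (1 / 4) ^ k := by rw [pow_succ]; ring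
  rw [e4] at h1
  rw [← sqrt_dq_div_sq]
  generalize √(dq u ((1 / 4) ^ (k + 1))) / (1 / 4) ^ (k + 1) = X at *
  generalize (1 / 4 : ℝ) ^ (k + 1) = Y at *
  have h2 := pow_le_pow_left₀ (Th_nonneg Ω Y) h1 2
  generalize Th Ω ((1 / 4) ^ k) = A at *
  refine h2.trans ?_
  nlinarith [sq_nonneg (1 / 4 * A - C * (X + Y)), mul_nonneg (sq_nonneg C) (sq_nonneg (X - Y))]

/-- The Gaussian average of the derivative of `u` in direction `e`. -/
def bb (u : EE N → ℝ) (e : EE N) (s : ℝ) : ℝ := ∫ x, fderiv ℝ u x e * eta x * gs s x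

lemma integral_odd_eq_zero {f : EE N → ℝ} (h : ∀ x, f (-x) = -f x) : ∫ x, f x = 0 := by
  have := integral_neg_eq_self f (volume : Measure (EE N))
  simp only [h] at this
  rw [integral_neg] at this
  linarith

lemma exists_norm_mul_gs_le : ∃ C : ℝ, 0 < C ∧ ∀ s : ℝ, 0 < s → ∀ x : EE N,
    ‖x‖ * gs s x ≤ C * √s * gs (4 * s) x := by
  obtain ⟨C, hC, h⟩ := exists_poly_gs_le (N := N) 1
  refine ⟨C, hC, fun s hs x => ?_⟩
  have h1 := h s hs x
  simp only [pow_one] at h1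
  have hq := Real.sq_sqrt hs.le
  have hq0 : 0 < √s := Real.sqrt_pos.2 hs
  have h2 : √s * ‖x‖ ≤ s + ‖x‖ ^ 2 := by nlinarith [sq_nonneg (√s - ‖x‖), norm_nonneg x]
  refine le_of_mul_le_mul_left ?_ hq0
  calc √s * (‖x‖ * gs s x) = √s * ‖x‖ * gs s x := by ring
    _ ≤ (s + ‖x‖ ^ 2) * gs s x := mul_le_mul_of_nonneg_right h2 (gs_pos _ _).le
    _ ≤ _ := h1
    _ = √s ^ 2 * C * gs (4 * s) x := by rw [hq]; ring
    _ = _ := by ring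

lemma MemP.exists_bb_le {M : ℝ} {Ω : Set (EE N)} {u : EE N → ℝ} (hu : MemP N 1 0 M Ω u)
    {e : EE N} (he : ‖e‖ = 1) :
    ∃ C : ℝ, 0 < C ∧ ∀ s : ℝ, 0 < s → s ≤ 1 →
      |bb u e s| ≤ C * √s * (Th Ω (4 * s) + √(dq u s) / s) + C * s := by
  obtain ⟨C1, hC1, h1⟩ := hu.exists_integral_Zf_eta
  obtain ⟨C2, hC2, h2⟩ := exists_norm_mul_gs_le (N := N)
  obtain ⟨C3, hC3, h3⟩ := exists_poly_gs_le (N := N) 1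
  obtain ⟨C4, hC4, hT⟩ := exists_tail_bound (N := N)
  obtain ⟨K, hK0, hK⟩ := exists_eta_bound (N := N)
  have hM0 : 0 ≤ M := (abs_nonneg _).trans (hu.2.2.2.2.1 0 (by simp))
  refine ⟨√C3 + C2 + C1 + M * K * C4, by positivity, fun s hs hs1 => ?_⟩
  have hin : ∀ x : EE N, |⟪x, e⟫| ≤ ‖x‖ := fun x => by
    have := abs_real_inner_le_norm x e
    rwa [he, mul_one] at this
  have hp : ContDiff ℝ (⊤ : ℕ∞) fun x : EE N => ⟪x, e⟫ := contDiff_id.inner ℝ contDiff_const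
  have a1 := h1 s hs hs1 _ hp fun x hx => ⟨(hin x).trans (by linarith), by
    rw [gradient_inner_right, he]; norm_num⟩
  have hlap : ∀ x, lap N (fun x => ⟪x, e⟫) x = 0 := fun x => by
    rw [← dv_gradient (contDiff_two_of_infty hp),
      show gradient (fun x : EE N => ⟪x, e⟫) = fun _ => e from funext (gradient_inner_right e), dv_const]
  have e0 : ∀ x, s * lap N (fun x => ⟪x, e⟫) x - ⟪x, gradient (fun x => ⟪x, e⟫) x⟫ + 2 * ⟪x, e⟫ = ⟪x, e⟫ := by
    intro x; rw [hlap, gradient_inner_right]; ring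
  simp only [e0] at a1
  have ip := integrable_mul_eta_mul_gs hp.continuous s
  have hadd := integral_add_compl hu.isOpen.measurableSet ip
  have hodd : ∫ x, ⟪x, e⟫ * eta x * gs s x = 0 := integral_odd_eq_zero fun x => by
    rw [eta_neg, gs_neg, inner_neg_left]; ring
  rw [hodd] at hadd
  have a3 := sq_integral_Zf_mul_le (s := s) hu.contDiff (q := fun x => ⟪x, e⟫ * eta x)
    (hp.continuous.mul continuous_eta) (fun x hx => by
      rw [eta_eq_zero hx.le, mul_zero])
  have a4 : ∫ x, (⟪x, e⟫ * eta x) ^ 2 * gs s x ≤ C3 * s := by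
    have h4 := integral_gs (N := N) (show 0 < 4 * s by positivity)
    calc _ ≤ ∫ x, C3 * s * gs (4 * s) x := by
          refine integral_mono_of_nonneg (Eventually.of_forall fun x =>
            mul_nonneg (sq_nonneg _) (gs_pos _ _).le) ((integrable_gs (by positivity)).const_mul _)
            (Eventually.of_forall fun x => ?_)
          have h5 := h3 s hs x
          simp only [pow_one] at h5
          refine le_trans ?_ h5
          refine mul_le_mul_of_nonneg_right ?_ (gs_pos _ _).le
          rw [← sq_abs, abs_mul, abs_of_nonneg (eta_nonneg x)]
          have : (|⟪x, e⟫| * eta x) ^ 2 ≤ ‖x‖ ^ 2 :=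
            pow_le_pow_left₀ (mul_nonneg (abs_nonneg _) (eta_nonneg _))
              ((mul_le_of_le_one_right (abs_nonneg _) (eta_le_one x)).trans (hin x)) 2
          linarith
      _ = _ := by rw [integral_const_mul, h4, mul_one]
  have a5 : |∫ x, Zf u x * (⟪x, e⟫ * eta x) * gs s x| ≤ √(dq u s) * (√C3 * √s) := by
    refine Real.abs_le_sqrt (a3.trans (mul_le_mul_of_nonneg_left a4 (dq_nonneg _ _))) |>.trans_eq ?_
    rw [Real.sqrt_mul (dq_nonneg _ _), Real.sqrt_mul hC3.le]
  have i4 := integrable_eta_mul_gs (N := N) (4 * s)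
  have a6 : |∫ x in Ωᶜ, ⟪x, e⟫ * eta x * gs s x| ≤ C2 * √s * Th Ω (4 * s) := by
    unfold Th
    rw [← integral_const_mul, ← Real.norm_eq_abs]
    refine norm_integral_le_of_norm_le (i4.integrableOn.const_mul _)
      (Eventually.of_forall fun x => ?_)
    rw [Real.norm_eq_abs, abs_mul, abs_mul, abs_of_nonneg (eta_nonneg x), abs_of_pos (gs_pos s x)]
    calc |⟪x, e⟫| * eta x * gs s x ≤ ‖x‖ * eta x * gs s x :=
          mul_le_mul_of_nonneg_right (mul_le_mul_of_nonneg_right (hin x) (eta_nonneg x)) (gs_pos _ _).le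
      _ = eta x * (‖x‖ * gs s x) := by ring
      _ ≤ eta x * (C2 * √s * gs (4 * s) x) := mul_le_mul_of_nonneg_left (h2 s hs x) (eta_nonneg x)
      _ = _ := by ring
  have hE1 : ContDiff ℝ 1 (eta : EE N → ℝ) := contDiff_one_of_infty contDiff_eta
  have hX : ContDiff ℝ 1 fun x : EE N => (u x * eta x) • e :=
    (hu.contDiff.mul hE1).smul contDiff_const
  have h := integral_dv_mul_gs s hX (hasCompactSupport_eta.mono fun x hx h => hx (by simp [h]))
  have hde : ∀ x : EE N, DifferentiableAt ℝ (eta : EE N → ℝ) x := hE1.differentiable (by norm_num)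
  have hdu : ∀ x : EE N, DifferentiableAt ℝ u x := hu.contDiff.differentiable (by norm_num)
  have e1 : ∀ x, dv (fun x : EE N => (u x * eta x) • e) x * gs s x =
      u x * ⟪gradient eta x, e⟫ * gs s x + fderiv ℝ u x e * eta x * gs s x := by
    intro x
    rw [dv_smul (f := fun x => u x * eta x) (X := fun _ => e) ((hdu x).mul (hde x))
      (by fun_prop), dv_const, fderiv_apply_eq_inner,
      gradient_mul' (hdu x) (hde x), inner_add_left, real_inner_smul_left,
      real_inner_smul_left, fderiv_apply_eq_inner u]
    ring
  have e2 : ∀ x : EE N, ⟪(u x * eta x) • e, x⟫ * gs s x = u x * (eta x * ⟪x, e⟫) * gs s x := by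
    intro x
    rw [real_inner_smul_left, real_inner_comm x e]; ring
  simp only [e1, e2] at h
  have i1 : Integrable fun x => u x * ⟪gradient eta x, e⟫ * gs s x := by
    have c1 := continuous_gs (N := N) s
    have c2 := continuous_gradient (contDiff_one_of_infty (contDiff_eta (N := N)))
    have c3 := hu.contDiff.continuous
    refine Continuous.integrable_of_hasCompactSupport (by fun_prop)
      ((hasCompactSupport_eta (N := N)).gradient.mono fun x hx h => hx (by simp only [h]; simp))
  have i2 := integrable_mul_eta_mul_gs (hu.continuous_fderiv_apply e) s
  rw [integral_add i1 i2] at h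
  have hb := hT s hs (fun x => u x * ⟪gradient eta x, e⟫) (M * K) (fun x hx => by
    rw [gradient_eq_zero_of_eventuallyEq (eta_eventuallyEq_one hx)]; simp) (fun x => by
    rcases le_or_gt ‖x‖ (1 / 2) with hx | hx
    · have h2 := abs_real_inner_le_norm (gradient eta x) e
      rw [he, mul_one] at h2
      rw [abs_mul]
      exact mul_le_mul (hu.2.2.2.2.1 x (by rw [mem_ball_zero_iff]; linarith)) (h2.trans (hK x).1)
        (abs_nonneg _) hM0
    · rw [gradient_eq_zero_of_eventuallyEq (eta_eventuallyEq_zero hx)]; simp; positivity)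
  change _ + bb u e s = _ at h
  generalize (∫ x, Zf u x * (⟪x, e⟫ * eta x) * gs s x) = A at *
  generalize (∫ x in Ω, ⟪x, e⟫ * eta x * gs s x) = B at *
  generalize (∫ x in Ωᶜ, ⟪x, e⟫ * eta x * gs s x) = B' at *
  generalize (∫ x, u x * ⟪gradient eta x, e⟫ * gs s x) = E at *
  generalize (∫ x, u x * (eta x * ⟪x, e⟫) * gs s x) = U at *
  obtain rfl : B = -B' := by linarith
  have hU : U = s * (E + bb u e s) := by rw [h]; field_simp
  have hs6 : s ^ 6 ≤ s ^ 2 := pow_le_pow_of_le_one hs.le hs1 (by norm_num)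
  have hs5 : s ^ 6 ≤ s ^ 1 := pow_le_pow_of_le_one hs.le hs1 (by norm_num)
  have key : s * |bb u e s| ≤ √(dq u s) * (√C3 * √s) + s * (C2 * √s * Th Ω (4 * s)) + C1 * s ^ 2 +
      s * (M * K * C4 * s) := by
    have e5 : s * bb u e s = (A - (s * -B' - U)) - A - s * B' - s * E := by rw [hU]; ring
    have e6 : s * |bb u e s| = |s * bb u e s| := by rw [abs_mul, abs_of_pos hs]
    have c1 : |s * B'| ≤ s * (C2 * √s * Th Ω (4 * s)) := by
      rw [abs_mul, abs_of_pos hs]; exact mul_le_mul_of_nonneg_left a6 hs.le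
    have c2 : |s * E| ≤ s * (M * K * (C4 * s ^ 6)) := by
      rw [abs_mul, abs_of_pos hs]; exact mul_le_mul_of_nonneg_left hb hs.le
    have b5 : C1 * s ^ 6 ≤ C1 * s ^ 2 := by gcongr
    have b6 : s * (M * K * (C4 * s ^ 6)) ≤ s * (M * K * (C4 * s ^ 1)) := by gcongr
    rw [e6, e5]
    have d1 := abs_sub (A - (s * -B' - U)) A
    have d2 := abs_sub (A - (s * -B' - U) - A) (s * B')
    have d3 := abs_sub (A - (s * -B' - U) - A - s * B') (s * E)
    linarith
  refine le_of_mul_le_mul_left (key.trans ?_) hs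
  have e7 : s * ((√C3 + C2 + C1 + M * K * C4) * √s * (Th Ω (4 * s) + √(dq u s) / s) +
      (√C3 + C2 + C1 + M * K * C4) * s) =
      (√C3 + C2 + C1 + M * K * C4) * √s * (s * Th Ω (4 * s) + √(dq u s)) +
      (√C3 + C2 + C1 + M * K * C4) * s ^ 2 := by field_simp
  rw [e7]
  have t1 : 0 ≤ (C2 + C1 + M * K * C4) * √s * √(dq u s) := by positivity
  have t2 : 0 ≤ (√C3 + C1 + M * K * C4) * √s * (s * Th Ω (4 * s)) :=
    mul_nonneg (by positivity) (mul_nonneg hs.le (Th_nonneg _ _))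
  have t3 : 0 ≤ (√C3 + C2) * s ^ 2 := by positivity
  linarith

lemma Th_le_of_le (Ω : Set (EE N)) {s t : ℝ} (hs : 0 < s) (hst : s ≤ t) (ht : t ≤ 4 * s) :
    Th Ω s ≤ 2 ^ N * Th Ω t := by
  unfold Th
  rw [← integral_const_mul]
  refine integral_mono (integrable_eta_mul_gs s).integrableOn
    ((integrable_eta_mul_gs t).integrableOn.const_mul _) fun x => ?_
  calc eta x * gs s x ≤ eta x * (2 ^ N * gs t x) :=
        mul_le_mul_of_nonneg_left (gs_le_of_le hs hst ht x) (eta_nonneg x)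
    _ = _ := by ring

lemma dq_le_of_le {u : EE N → ℝ} (hu : ContDiff ℝ 1 u) {s t : ℝ} (hs : 0 < s) (hst : s ≤ t)
    (ht : t ≤ 4 * s) : dq u s ≤ 2 ^ N * dq u t := by
  unfold dq
  have hZ := continuous_Zf hu
  have hi : ∀ F : EE N → ℝ, Continuous F → IntegrableOn F (closedBall (0 : EE N) (1 / 2)) := fun F hF =>
    hF.continuousOn.integrableOn_compact (isCompact_closedBall _ _)
  have c1 := continuous_gs (N := N) s
  have c2 := continuous_gs (N := N) t
  rw [← integral_const_mul]
  refine integral_mono (hi _ (by fun_prop)) (hi _ (by fun_prop)) fun x => ?_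
  calc Zf u x ^ 2 * gs s x ≤ Zf u x ^ 2 * (2 ^ N * gs t x) :=
        mul_le_mul_of_nonneg_left (gs_le_of_le hs hst ht x) (sq_nonneg _)
    _ = _ := by ring

lemma MemP.exists_summable_bb {M : ℝ} {Ω : Set (EE N)} {u : EE N → ℝ} (hu : MemP N 1 0 M Ω u)
    (hq : QuadGrowth u) {e : EE N} (he : ‖e‖ = 1)
    (hδ : limsup (fun r => deltaFn N u r) (nhdsWithin 0 (Ioi 0)) = 0) :
    ∃ β : ℕ → ℝ, Summable β ∧ (∀ k, 0 ≤ β k) ∧ ∀ k, ∀ s ∈ Icc ((1 / 4 : ℝ) ^ (k + 2)) ((1 / 4) ^ (k + 1)),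
      bb u e s ^ 2 ≤ s * β k := by
  obtain ⟨C, hC, h⟩ := hu.exists_bb_le he
  have hT := hu.summable_Th hq ⟨e, he⟩ hδ
  have hD := (summable_nat_add_iff 1).2 (hu.summable_dq hq)
  have hG : Summable fun k : ℕ => (1 / 4 : ℝ) ^ k := summable_geometric_of_lt_one (by norm_num) (by norm_num)
  refine ⟨fun k => 3 * C ^ 2 * (4 ^ N * Th Ω ((1 / 4) ^ k) ^ 2 +
    16 * 2 ^ N * ((((1 / 4 : ℝ) ^ (k + 1)) ^ 2)⁻¹ * dq u ((1 / 4) ^ (k + 1))) + (1 / 4) ^ k),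
    (((hT.mul_left _).add (hD.mul_left _)).add hG).mul_left _, fun k => ?_, fun k s hs => ?_⟩
  · have := dq_nonneg u ((1 / 4) ^ (k + 1))
    positivity
  · have h2 : (0 : ℝ) < (1 / 4) ^ (k + 2) := by positivity
    have hs0 : 0 < s := h2.trans_le hs.1
    have e1 : (1 / 4 : ℝ) ^ k = 4 * (1 / 4) ^ (k + 1) := by rw [pow_succ]; ring
    have e2 : (1 / 4 : ℝ) ^ (k + 1) = 4 * (1 / 4) ^ (k + 2) := by rw [pow_succ _ (k + 1)]; ring
    have h1 : (1 / 4 : ℝ) ^ (k + 1) ≤ 1 := pow_le_one₀ (by norm_num) (by norm_num)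
    have hs1 : s ≤ 1 := hs.2.trans h1
    have a1 := h s hs0 hs1
    have a2 := Th_le_of_le Ω (s := 4 * s) (t := (1 / 4) ^ k) (by positivity) (by linarith [hs.2])
      (by linarith [hs.1])
    have a3 := dq_le_of_le hu.contDiff hs0 hs.2 (by linarith [hs.1])
    have a4 : (√(dq u s) / s) ^ 2 ≤
        16 * 2 ^ N * ((((1 / 4 : ℝ) ^ (k + 1)) ^ 2)⁻¹ * dq u ((1 / 4) ^ (k + 1))) := by
      rw [sqrt_dq_div_sq]
      have : (s ^ 2)⁻¹ ≤ 16 * (((1 / 4 : ℝ) ^ (k + 1)) ^ 2)⁻¹ := by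
        have h3 : ((1 / 4 : ℝ) ^ (k + 1)) ^ 2 ≤ 16 * s ^ 2 := by nlinarith [hs.1, hs.2]
        rw [inv_eq_one_div, ← div_eq_mul_inv, div_le_div_iff₀ (by positivity) (by positivity)]
        linarith
      calc _ ≤ 16 * (((1 / 4 : ℝ) ^ (k + 1)) ^ 2)⁻¹ * (2 ^ N * dq u ((1 / 4) ^ (k + 1))) :=
            mul_le_mul this a3 (dq_nonneg _ _) (by positivity)
        _ = _ := by ring
    have a5 : Th Ω (4 * s) ^ 2 ≤ 4 ^ N * Th Ω ((1 / 4) ^ k) ^ 2 := by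
      refine (pow_le_pow_left₀ (Th_nonneg _ _) a2 2).trans_eq ?_
      rw [mul_pow, ← pow_mul, mul_comm N 2, pow_mul]; norm_num
    have a6 : s ≤ (1 / 4) ^ k := by linarith [hs.2]
    have hq := Real.sq_sqrt hs0.le
    have a7 := pow_le_pow_left₀ (abs_nonneg _) a1 2
    rw [sq_abs] at a7
    have hX := Th_nonneg Ω (4 * s)
    generalize √(dq u s) / s = Y at *
    generalize Th Ω (4 * s) = X at *
    calc bb u e s ^ 2 ≤ _ := a7
      _ ≤ 3 * ((C * √s * X) ^ 2 + (C * √s * Y) ^ 2 + (C * s) ^ 2) := by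
        nlinarith [sq_nonneg (C * √s * X - C * √s * Y), sq_nonneg (C * √s * X - C * s),
          sq_nonneg (C * √s * Y - C * s)]
      _ = s * (3 * C ^ 2 * (X ^ 2 + Y ^ 2 + s)) := by
        rw [mul_pow, mul_pow, mul_pow, mul_pow, mul_pow, hq]; ring
      _ ≤ _ := mul_le_mul_of_nonneg_left (mul_le_mul_of_nonneg_left (by linarith) (by positivity)) hs0.le

end

section

variable {N : ℕ}

lemma lap_sub {f g : EE N → ℝ} (hf : ContDiff ℝ 2 f) (hg : ContDiff ℝ 2 g) (x : EE N) :
    lap N (fun y => f y - g y) x = lap N f x - lap N g x := by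
  have hgf : Differentiable ℝ (gradient f) :=
    (contDiff_gradient (m := 1) hf (by norm_num)).differentiable (by norm_num)
  have hgg : Differentiable ℝ (gradient g) :=
    (contDiff_gradient (m := 1) hg (by norm_num)).differentiable (by norm_num)
  rw [← dv_gradient (hf.sub hg), ← dv_gradient hf, ← dv_gradient hg,
    show gradient (fun y => f y - g y) = fun y => gradient f y - gradient g y from
      funext fun y => gradient_sub' (hf.differentiable (by norm_num) y) (hg.differentiable (by norm_num) y)]
  unfold dv
  rw [← Finset.sum_sub_distrib]
  refine Finset.sum_congr rfl fun i _ => ?_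
  rw [fderiv_fun_sub (hgf x) (hgg x)]
  rfl

lemma MemP.exists_signed_trunc {M : ℝ} {Ω : Set (EE N)} {u : EE N → ℝ} (hu : MemP N 1 0 M Ω u)
    (e : EE N) {ε : ℝ} (hε : 0 < ε) :
    ∃ w : EE N → ℝ, ContDiff ℝ (⊤ : ℕ∞) w ∧ ∀ x ∈ ball (0 : EE N) (3 / 4),
      |w x - fderiv ℝ u x e| ≤ 2 * ε ∧ |w x| ≤ |fderiv ℝ u x e| ∧ 0 ≤ w x * lap N w x := by
  obtain ⟨w1, h1, h1n, h1e, h1l⟩ := hu.exists_trunc e (show (3 / 4 : ℝ) < 1 by norm_num) hε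
  obtain ⟨w2, h2, h2n, h2e, h2l⟩ := hu.exists_trunc (-e) (show (3 / 4 : ℝ) < 1 by norm_num) hε
  have hv := hu.continuous_fderiv_apply e
  refine ⟨fun x => w1 x - w2 x, h1.sub h2, fun x hx => ?_⟩
  have hlap := lap_sub (contDiff_two_of_infty h1) (contDiff_two_of_infty h2) x
  have hb : ∀ᶠ y in nhds x, y ∈ ball (0 : EE N) (3 / 4) := isOpen_ball.mem_nhds hx
  have e1 := h1e x hx
  have e2 := h2e x hx
  rw [map_neg] at e2
  rcases le_total (fderiv ℝ u x e) 0 with h | h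
  · have z1 : w1 x = 0 := by rw [e1]; exact Tr_eq_zero hε (h.trans hε.le)
    have l1 : lap N w1 x = 0 := by
      refine lap_eq_zero_of_eventuallyEq (c := 0) ?_
      filter_upwards [hb, hv.continuousAt.eventually (gt_mem_nhds (h.trans_lt hε))] with y hy hy'
      rw [h1e y hy]; exact Tr_eq_zero hε hy'.le
    have a1 := Tr_le hε (-fderiv ℝ u x e)
    have a2 := le_Tr hε (-fderiv ℝ u x e)
    have a3 := h2n x
    rw [max_eq_left (by linarith)] at a1 a2
    simp only [z1, l1, hlap, zero_sub]
    rw [abs_neg, abs_of_nonneg a3, abs_of_nonpos h, e2]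
    refine ⟨by rw [abs_le]; constructor <;> linarith, by linarith, ?_⟩
    rw [← e2]
    have := mul_nonneg a3 (h2l x hx)
    linarith
  · have z1 : w2 x = 0 := by rw [e2]; exact Tr_eq_zero hε (by linarith)
    have l1 : lap N w2 x = 0 := by
      refine lap_eq_zero_of_eventuallyEq (c := 0) ?_
      filter_upwards [hb, hv.continuousAt.eventually (lt_mem_nhds (show -ε < fderiv ℝ u x e by linarith))] with y hy hy'
      rw [h2e y hy, map_neg]; exact Tr_eq_zero hε (by linarith)
    have a1 := Tr_le hε (fderiv ℝ u x e)
    have a2 := le_Tr hε (fderiv ℝ u x e)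
    have a3 := h1n x
    rw [max_eq_left h] at a1 a2
    simp only [z1, l1, hlap, sub_zero]
    rw [abs_of_nonneg a3, abs_of_nonneg h, e1]
    refine ⟨by rw [abs_le]; constructor <;> linarith, by linarith, ?_⟩
    rw [← e1]
    exact mul_nonneg a3 (h1l x hx)

lemma exists_cutoff_energy : ∃ C : ℝ, 0 < C ∧ ∀ s : ℝ, 0 < s → s ≤ 1 → ∀ (w : EE N → ℝ) (V : ℝ),
    ContDiff ℝ (⊤ : ℕ∞) w → (∀ x ∈ ball (0 : EE N) (3 / 4), |w x| ≤ V) →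
    |∫ x, (2 * (w x * eta x) * ⟪gradient w x, gradient eta x⟫ + w x ^ 2 * eta x * lap N eta x) * gs s x| ≤
      C * V ^ 2 * s := by
  obtain ⟨C, hC, hT⟩ := exists_tail_bound (N := N)
  obtain ⟨K, hK0, hK⟩ := exists_eta_bound (N := N)
  refine ⟨(K + K ^ 2 + 1) * C, by positivity, fun s hs hs1 w V hw hV => ?_⟩
  have hw1 : ContDiff ℝ 1 w := contDiff_one_of_infty hw
  have he1 : ContDiff ℝ 1 (eta : EE N → ℝ) := contDiff_one_of_infty contDiff_eta
  have hge : ContDiff ℝ 1 (gradient (eta : EE N → ℝ)) :=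
    contDiff_gradient (m := 1) (contDiff_two_of_infty contDiff_eta) (by norm_num)
  have hdw : ∀ x, DifferentiableAt ℝ w x := hw1.differentiable (by norm_num)
  have hde : ∀ x : EE N, DifferentiableAt ℝ (eta : EE N → ℝ) x := he1.differentiable (by norm_num)
  have hX : ContDiff ℝ 1 fun x : EE N => (w x * w x * eta x) • gradient eta x :=
    ((hw1.mul hw1).mul he1).smul hge
  have h := integral_dv_mul_gs s hX (hasCompactSupport_eta.mono fun x hx h => hx (by simp [h]))
  have e1 : ∀ x, dv (fun x : EE N => (w x * w x * eta x) • gradient eta x) x * gs s x =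
      (2 * (w x * eta x) * ⟪gradient w x, gradient eta x⟫ + w x ^ 2 * eta x * lap N eta x) * gs s x +
      w x ^ 2 * ‖gradient eta x‖ ^ 2 * gs s x := by
    intro x
    rw [dv_smul (f := fun x => w x * w x * eta x) (((hdw x).mul (hdw x)).mul (hde x))
      (hge.differentiable (by norm_num) x), dv_gradient (contDiff_two_of_infty contDiff_eta),
      fderiv_apply_eq_inner, gradient_mul' (f := fun x => w x * w x) ((hdw x).mul (hdw x)) (hde x),
      gradient_mul' (hdw x) (hdw x), inner_add_left, real_inner_smul_left,
      real_inner_smul_left, inner_add_left, real_inner_smul_left, real_inner_self_eq_norm_sq]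
    ring
  have e2 : ∀ x : EE N, ⟪(w x * w x * eta x) • gradient eta x, x⟫ * gs s x =
      w x ^ 2 * eta x * ⟪gradient eta x, x⟫ * gs s x := by
    intro x
    rw [real_inner_smul_left]; ring
  simp only [e1, e2] at h
  have c1 := continuous_gs (N := N) s
  have c2 := hge.continuous
  have c3 := hw.continuous
  have c4 := continuous_gradient hw1
  have c5 := continuous_eta (N := N)
  have c6 := continuous_lap (contDiff_eta (N := N))
  have i1 : Integrable fun x => (2 * (w x * eta x) * ⟪gradient w x, gradient eta x⟫ +
      w x ^ 2 * eta x * lap N eta x) * gs s x :=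
    Continuous.integrable_of_hasCompactSupport (by fun_prop)
      (hasCompactSupport_eta.mono fun x hx h => hx (by simp only [h]; ring))
  have i2 : Integrable fun x => w x ^ 2 * ‖gradient eta x‖ ^ 2 * gs s x :=
    Continuous.integrable_of_hasCompactSupport (by fun_prop)
      ((hasCompactSupport_eta (N := N)).gradient.mono fun x hx h => hx (by simp only [h]; simp))
  rw [integral_add i1 i2] at h
  have hV0 : 0 ≤ V := (abs_nonneg _).trans (hV 0 (by simp))
  have hw2 : ∀ x : EE N, ‖x‖ ≤ 1 / 2 → w x ^ 2 ≤ V ^ 2 := fun x hx => by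
    rw [← sq_abs]
    exact pow_le_pow_left₀ (abs_nonneg _) (hV x (by rw [mem_ball_zero_iff]; linarith)) 2
  have t1 := hT s hs (fun x => w x ^ 2 * eta x * ⟪gradient eta x, x⟫) (V ^ 2 * K) (fun x hx => by
    rw [gradient_eq_zero_of_eventuallyEq (eta_eventuallyEq_one hx)]; simp) (fun x => by
    rcases le_or_gt ‖x‖ (1 / 2) with hx | hx
    · have h2 := abs_real_inner_le_norm (gradient eta x) x
      have h3 : ‖gradient eta x‖ * ‖x‖ ≤ K * 1 :=
        mul_le_mul (hK x).1 (by linarith) (norm_nonneg _) hK0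
      rw [abs_mul, abs_mul, abs_of_nonneg (sq_nonneg (w x)), abs_of_nonneg (eta_nonneg x)]
      calc _ ≤ V ^ 2 * 1 * (K * 1) := mul_le_mul (mul_le_mul (hw2 x hx) (eta_le_one x) (eta_nonneg x)
              (sq_nonneg _)) (h2.trans h3) (abs_nonneg _) (by positivity)
        _ = _ := by ring
    · rw [gradient_eq_zero_of_eventuallyEq (eta_eventuallyEq_zero hx)]; simp; positivity)
  have t2 := hT s hs (fun x => w x ^ 2 * ‖gradient eta x‖ ^ 2) (V ^ 2 * K ^ 2) (fun x hx => by
    rw [gradient_eq_zero_of_eventuallyEq (eta_eventuallyEq_one hx)]; simp) (fun x => by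
    rcases le_or_gt ‖x‖ (1 / 2) with hx | hx
    · rw [abs_of_nonneg (by positivity)]
      exact mul_le_mul (hw2 x hx) (pow_le_pow_left₀ (norm_nonneg _) (hK x).1 2) (by positivity)
        (by positivity)
    · rw [gradient_eq_zero_of_eventuallyEq (eta_eventuallyEq_zero hx)]; simp; positivity)
  generalize (∫ x, (2 * (w x * eta x) * ⟪gradient w x, gradient eta x⟫ +
      w x ^ 2 * eta x * lap N eta x) * gs s x) = I1 at *
  generalize (∫ x, w x ^ 2 * ‖gradient eta x‖ ^ 2 * gs s x) = I2 at *
  generalize (∫ x, w x ^ 2 * eta x * ⟪gradient eta x, x⟫ * gs s x) = I3 at *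
  have hI : I1 = s⁻¹ * I3 - I2 := by linarith
  rw [hI]
  have u1 : |s⁻¹ * I3| ≤ V ^ 2 * K * (C * s) := by
    rw [abs_mul, abs_of_pos (inv_pos.2 hs), inv_mul_le_iff₀ hs]
    refine t1.trans ?_
    have : s ^ 6 ≤ s ^ 2 := pow_le_pow_of_le_one hs.le hs1 (by norm_num)
    calc V ^ 2 * K * (C * s ^ 6) ≤ V ^ 2 * K * (C * s ^ 2) := by gcongr
      _ = _ := by ring
  have u2 : |I2| ≤ V ^ 2 * K ^ 2 * (C * s) := by
    refine t2.trans ?_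
    have : s ^ 6 ≤ s ^ 1 := pow_le_pow_of_le_one hs.le hs1 (by norm_num)
    calc V ^ 2 * K ^ 2 * (C * s ^ 6) ≤ V ^ 2 * K ^ 2 * (C * s ^ 1) := by gcongr
      _ = _ := by ring
  have : 0 ≤ C * V ^ 2 * s := by positivity
  have := abs_sub (s⁻¹ * I3) I2
  linarith

lemma exists_heat_ineq : ∃ C : ℝ, 0 < C ∧ ∀ s : ℝ, 0 < s → s ≤ 1 → ∀ (w : EE N → ℝ) (V : ℝ),
    ContDiff ℝ (⊤ : ℕ∞) w → (∀ x ∈ ball (0 : EE N) (3 / 4), |w x| ≤ V ∧ 0 ≤ w x * lap N w x) →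
    ∃ F' : ℝ, HasDerivAt (fun s => ∫ x, (w x * eta x) ^ 2 * gs s x) F' s ∧
      (∫ x, (w x * eta x) ^ 2 * gs s x) - (∫ x, w x * eta x * gs s x) ^ 2 - C * V ^ 2 * s ^ 2 ≤ s * F' := by
  obtain ⟨C, hC, h⟩ := exists_cutoff_energy (N := N)
  refine ⟨C, hC, fun s hs hs1 w V hw hV => ?_⟩
  have h1 := h s hs hs1 w V hw fun x hx => (hV x hx).1
  have he := contDiff_eta (N := N)
  have hW : ContDiff ℝ (⊤ : ℕ∞) fun x => w x * eta x := hw.mul he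
  have hW1 := contDiff_one_of_infty hW
  have hWc : HasCompactSupport fun x => w x * eta x := hasCompactSupport_eta.mul_left
  have hd := hasDerivAt_integral_gs_lap (h := fun x => (w x * eta x) * (w x * eta x))
    (contDiff_two_of_infty (hW.mul hW)) (hWc.mul_left) hs
  have hp := gaussian_poincare hW1 hWc hs
  simp only [← sq] at hd
  refine ⟨_, hd, ?_⟩
  have c1 := continuous_gs (N := N) s
  have c2 := (contDiff_gradient_infty he).continuous
  have c3 := hw.continuous
  have c4 := (contDiff_gradient_infty hw).continuous
  have c5 := continuous_eta (N := N)
  have c6 := continuous_lap he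
  have c7 := continuous_gradient hW1
  have c8 := continuous_lap (hW.mul hW)
  have i1 : Integrable fun x => ‖gradient (fun x => w x * eta x) x‖ ^ 2 * gs s x :=
    Continuous.integrable_of_hasCompactSupport (by fun_prop)
      (hWc.gradient.mono fun x hx h => hx (by simp only [h]; simp))
  have i2 : Integrable fun x => (2 * (w x * eta x) * ⟪gradient w x, gradient eta x⟫ +
      w x ^ 2 * eta x * lap N eta x) * gs s x :=
    Continuous.integrable_of_hasCompactSupport (by fun_prop)
      (hasCompactSupport_eta.mono fun x hx h => hx (by simp only [h]; ring))
  have elap : ∀ x, lap N (fun x => (w x * eta x) ^ 2) x = 2 * ‖gradient (fun x => w x * eta x) x‖ ^ 2 +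
      2 * (2 * (w x * eta x) * ⟪gradient w x, gradient eta x⟫ + w x ^ 2 * eta x * lap N eta x) +
      2 * eta x ^ 2 * (w x * lap N w x) := by
    intro x
    simp only [sq (w _ * eta _)]
    rw [lap_mul (contDiff_two_of_infty hW) (contDiff_two_of_infty hW),
      lap_mul (contDiff_two_of_infty hw) (contDiff_two_of_infty he), real_inner_self_eq_norm_sq]
    ring
  have i3 : Integrable fun x => lap N (fun x => (w x * eta x) ^ 2) x * gs s x := by
    have hWW : ContDiff ℝ (⊤ : ℕ∞) fun x => (w x * eta x) ^ 2 := hW.pow 2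
    have c9 := continuous_lap hWW
    refine Continuous.integrable_of_hasCompactSupport (by fun_prop)
      (HasCompactSupport.intro (isCompact_closedBall 0 (1 / 2)) fun x hx => ?_)
    rw [lap_eq_zero_of_eventuallyEq (c := 0), zero_mul]
    filter_upwards [eta_eventuallyEq_zero (x := x) (by simpa using hx)] with y hy
    simp [hy]
  have key : 2 * (∫ x, ‖gradient (fun x => w x * eta x) x‖ ^ 2 * gs s x) +
      2 * (∫ x, (2 * (w x * eta x) * ⟪gradient w x, gradient eta x⟫ +
      w x ^ 2 * eta x * lap N eta x) * gs s x) ≤ ∫ x, lap N (fun x => (w x * eta x) ^ 2) x * gs s x := by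
    rw [← integral_const_mul, ← integral_const_mul, ← integral_add (i1.const_mul 2) (i2.const_mul 2)]
    refine integral_mono ((i1.const_mul 2).add (i2.const_mul 2)) i3 fun x => ?_
    have hx : 0 ≤ eta x ^ 2 * (w x * lap N w x) := by
      rcases lt_or_ge ‖x‖ (3 / 4) with hx | hx
      · exact mul_nonneg (sq_nonneg _) (hV x (by rwa [mem_ball_zero_iff])).2
      · rw [eta_eq_zero (by linarith)]; simp
    have := mul_nonneg hx (gs_pos s x).le
    simp only [elap]
    linarith
  have b1 := (abs_le.1 h1).1
  generalize (∫ x, ‖gradient (fun x => w x * eta x) x‖ ^ 2 * gs s x) = I1 at *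
  generalize (∫ x, (2 * (w x * eta x) * ⟪gradient w x, gradient eta x⟫ +
      w x ^ 2 * eta x * lap N eta x) * gs s x) = I2 at *
  generalize (∫ x, lap N (fun x => (w x * eta x) ^ 2) x * gs s x) = I3 at *
  have b2 : I1 - C * V ^ 2 * s ≤ 2⁻¹ * I3 := by linarith
  have b3 := mul_le_mul_of_nonneg_left b2 hs.le
  nlinarith

end

section

variable {N : ℕ}

lemma abs_integral_mul_eta_mul_gs_le {p : EE N → ℝ} {c : ℝ}
    (hc : ∀ x ∈ ball (0 : EE N) (3 / 4), |p x| ≤ c) {s : ℝ} (hs : 0 < s) :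
    |∫ x, p x * eta x * gs s x| ≤ c := by
  have h0 : 0 ≤ c := (abs_nonneg _).trans (hc 0 (by simp))
  have hi : ∫ x : EE N, c * gs s x = c := by
    rw [integral_const_mul (c), integral_gs hs, mul_one]
  rw [← hi, ← Real.norm_eq_abs]
  refine norm_integral_le_of_norm_le ((integrable_gs hs).const_mul c) (Eventually.of_forall fun x => ?_)
  rw [norm_mul, norm_mul, Real.norm_of_nonneg (gs_pos s x).le, Real.norm_of_nonneg (eta_nonneg x)]
  refine mul_le_mul_of_nonneg_right ?_ (gs_pos s x).le
  by_cases hx : ‖x‖ < 3 / 4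
  · exact (mul_le_of_le_one_right (norm_nonneg _) (eta_le_one x)).trans
      (hc x (by simpa using hx))
  · rw [eta_eq_zero (by linarith), mul_zero]; exact h0

/-- The Gaussian mean square of the cut-off directional derivative of `u`. -/
def FF (u : EE N → ℝ) (e : EE N) (s : ℝ) : ℝ := ∫ x, (fderiv ℝ u x e * eta x) ^ 2 * gs s x

lemma sq_mul_eta (f : EE N → ℝ) (s : ℝ) (x : EE N) :
    (f x * eta x) ^ 2 * gs s x = (f x ^ 2 * eta x) * eta x * gs s x := by ring

lemma MemP.exists_abs_fderiv_le {M : ℝ} {Ω : Set (EE N)} {u : EE N → ℝ} (hu : MemP N 1 0 M Ω u)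
    (e : EE N) : ∃ V : ℝ, 0 ≤ V ∧ ∀ x ∈ ball (0 : EE N) (3 / 4), |fderiv ℝ u x e| ≤ V := by
  obtain ⟨V, hV⟩ := (isCompact_closedBall (0 : EE N) (3 / 4)).exists_bound_of_continuousOn
    (hu.continuous_fderiv_apply e).continuousOn
  exact ⟨V, (norm_nonneg _).trans (hV 0 (mem_closedBall_self (by norm_num))), fun x hx => hV x (ball_subset_closedBall hx)⟩

lemma MemP.exists_almost_monotone {M : ℝ} {Ω : Set (EE N)} {u : EE N → ℝ} (hu : MemP N 1 0 M Ω u)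
    (e : EE N) : ∃ C : ℝ, 0 < C ∧ ∀ s' s'' β : ℝ, 0 < s' → s' ≤ s'' → s'' ≤ 4 * s' → s'' ≤ 1 →
      (∀ s ∈ Icc s' s'', bb u e s ^ 2 ≤ s * β) →
      FF u e s' / s' - 3 * β - C * s'' ≤ FF u e s'' / s'' := by
  obtain ⟨C, hC, hheat⟩ := exists_heat_ineq (N := N)
  obtain ⟨V, hV0, hV⟩ := hu.exists_abs_fderiv_le e
  have hvc := hu.continuous_fderiv_apply e
  refine ⟨C * V ^ 2 + 1, by positivity, fun s' s'' β hs' hs hs4 hs1 hb => ?_⟩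
  have hs'' : 0 < s'' := hs'.trans_le hs
  have hβ : 0 ≤ β := by
    have := hb s' ⟨le_rfl, hs⟩
    have h2 := sq_nonneg (bb u e s')
    exact nonneg_of_mul_nonneg_right (h2.trans this) hs'
  have key : ∀ ε : ℝ, 0 < ε → FF u e s' / s' - 3 * β - C * V ^ 2 * s'' - 16 * V / s' * ε
      ≤ FF u e s'' / s'' := by
    intro ε hε
    obtain ⟨w, hw, hwp⟩ := hu.exists_signed_trunc e hε
    have hwc := hw.continuous
    have hwV : ∀ x ∈ ball (0 : EE N) (3 / 4), |w x| ≤ V := fun x hx => (hwp x hx).2.1.trans (hV x hx)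
    have hF : ∀ s, 0 < s → FF u e s - 4 * ε * V ≤ (∫ x, (w x * eta x) ^ 2 * gs s x) ∧
        (∫ x, (w x * eta x) ^ 2 * gs s x) ≤ FF u e s := by
      intro s hs
      have h1 := continuous_eta (N := N)
      have i1 : Integrable fun x => (w x * eta x) ^ 2 * gs s x := by
        simp_rw [sq_mul_eta]; exact integrable_mul_eta_mul_gs (by fun_prop) s
      have i2 : Integrable fun x => (fderiv ℝ u x e * eta x) ^ 2 * gs s x := by
        simp_rw [sq_mul_eta (fun x => fderiv ℝ u x e)]; exact integrable_mul_eta_mul_gs (by fun_prop) s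
      constructor
      · have h2 := abs_integral_mul_eta_mul_gs_le (c := 4 * ε * V) (s := s)
          (p := fun x => (fderiv ℝ u x e ^ 2 - w x ^ 2) * eta x) (fun x hx => ?_) hs
        · have h3 : ∫ x, (fderiv ℝ u x e ^ 2 - w x ^ 2) * eta x * eta x * gs s x =
              FF u e s - ∫ x, (w x * eta x) ^ 2 * gs s x := by
            rw [FF, ← integral_sub i2 i1]; congr 1; ext x; ring
          rw [h3] at h2
          linarith [(abs_le.1 h2).2]
        · rw [abs_mul, abs_of_nonneg (eta_nonneg x)]
          refine (mul_le_of_le_one_right (abs_nonneg _) (eta_le_one x)).trans ?_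
          rw [show fderiv ℝ u x e ^ 2 - w x ^ 2 = (fderiv ℝ u x e - w x) * (fderiv ℝ u x e + w x) by ring,
            abs_mul, abs_sub_comm]
          calc _ ≤ (2 * ε) * (V + V) := mul_le_mul (hwp x hx).1
                ((abs_add_le _ _).trans (add_le_add (hV x hx) (hwV x hx))) (abs_nonneg _) (by positivity)
            _ = _ := by ring
      · refine integral_mono_of_nonneg (Eventually.of_forall fun x => ?_) i2 (Eventually.of_forall fun x => ?_)
        · have := (gs_pos s x).le
          dsimp only [Pi.zero_apply]; positivity
        · refine mul_le_mul_of_nonneg_right ?_ (gs_pos s x).le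
          by_cases hx : ‖x‖ < 3 / 4
          · rw [mul_pow, mul_pow]
            exact mul_le_mul_of_nonneg_right (sq_le_sq.2 (hwp x (by simpa using hx)).2.1) (sq_nonneg _)
          · rw [eta_eq_zero (by linarith), mul_zero, mul_zero]
    have hbε : ∀ s ∈ Icc s' s'', (∫ x, w x * eta x * gs s x) ^ 2 ≤ s * β + 4 * ε * V := by
      intro s hsm
      have hs0 : 0 < s := hs'.trans_le hsm.1
      have i1 := integrable_mul_eta_mul_gs hwc s
      have i2 := integrable_mul_eta_mul_gs hvc s
      have h2 := abs_integral_mul_eta_mul_gs_le (c := 2 * ε) (s := s)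
          (p := fun x => w x - fderiv ℝ u x e) (fun x hx => (hwp x hx).1) hs0
      have h3 : ∫ x, (w x - fderiv ℝ u x e) * eta x * gs s x =
              (∫ x, w x * eta x * gs s x) - bb u e s := by
            rw [bb, ← integral_sub i1 i2]; congr 1; ext x; ring
      rw [h3] at h2
      have h4 := abs_integral_mul_eta_mul_gs_le (c := V) hwV hs0
      have h5 : |bb u e s| ≤ V := abs_integral_mul_eta_mul_gs_le (c := V) hV hs0
      have h6 := hb s hsm
      generalize (∫ x, w x * eta x * gs s x) = B at *
      have : (B - bb u e s) * (B + bb u e s) ≤ 2 * ε * (V + V) := by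
        refine (le_abs_self _).trans ?_
        rw [abs_mul]
        exact mul_le_mul h2 ((abs_add_le _ _).trans (add_le_add h4 h5)) (abs_nonneg _) (by positivity)
      nlinarith
    set G : ℝ → ℝ := fun s => (∫ x, (w x * eta x) ^ 2 * gs s x) / s with hG
    set m : ℝ := -((β + 4 * ε * V / s') / s' + C * V ^ 2) with hm
    have hder : ∀ s ∈ Icc s' s'', ∃ g, HasDerivAt G g s ∧ m ≤ g := by
      intro s hsm
      have hs0 : 0 < s := hs'.trans_le hsm.1
      obtain ⟨F', hd, hle⟩ := hheat s hs0 (hsm.2.trans hs1) w V hw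
        (fun x hx => ⟨hwV x hx, (hwp x hx).2.2⟩)
      refine ⟨_, hd.div (hasDerivAt_id s) hs0.ne', ?_⟩
      have h1 := hbε s hsm
      simp only [mul_one]
      rw [le_div_iff₀ (by positivity)]
      have h2 : (s * β + 4 * ε * V) ≤ (β + 4 * ε * V / s') / s' * s ^ 2 := by
        have h3 : 1 ≤ s / s' := (one_le_div hs').2 hsm.1
        have h4 : (β + 4 * ε * V / s') / s' * s ^ 2 = s * β * (s / s') + 4 * ε * V * (s / s') ^ 2 := by
          field_simp
        rw [h4]
        have h5 : 0 ≤ s * β := by positivity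
        have h6 : 0 ≤ 4 * ε * V := by positivity
        have h7 : 1 ≤ (s / s') ^ 2 := one_le_pow₀ h3
        nlinarith
      rw [hm]
      linarith
    have hmv := Convex.mul_sub_le_image_sub_of_le_deriv (convex_Icc s' s'') (f := G)
      (fun s hsm => by obtain ⟨g, hg, _⟩ := hder s hsm; exact hg.continuousAt.continuousWithinAt)
      (fun s hsm => by
        obtain ⟨g, hg, _⟩ := hder s (interior_subset hsm); exact hg.differentiableAt.differentiableWithinAt)
      (C := m) (fun s hsm => by obtain ⟨g, hg, h⟩ := hder s (interior_subset hsm); rwa [hg.deriv])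
      s' ⟨le_rfl, hs⟩ s'' ⟨hs, le_rfl⟩ hs
    have hG' : FF u e s' / s' - 4 * ε * V / s' ≤ G s' := by
      rw [← sub_div]; exact div_le_div_of_nonneg_right (hF s' hs').1 hs'.le
    have hG'' : G s'' ≤ FF u e s'' / s'' := div_le_div_of_nonneg_right (hF s'' hs'').2 hs''.le
    have h1 : -m * (s'' - s') ≤ 3 * (β + 4 * ε * V / s') + C * V ^ 2 * s'' := by
      rw [hm, neg_neg, add_mul]
      refine add_le_add ?_ (mul_le_mul_of_nonneg_left (by linarith) (by positivity))
      have h2 : (s'' - s') / s' ≤ 3 := by rw [div_le_iff₀ hs']; linarith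
      have h3 : 0 ≤ β + 4 * ε * V / s' := by positivity
      calc _ = (s'' - s') / s' * (β + 4 * ε * V / s') := by ring
        _ ≤ _ := mul_le_mul_of_nonneg_right h2 h3
    have h4 : 16 * V / s' * ε = 4 * (4 * ε * V / s') := by ring
    rw [h4]
    nlinarith
  have hlim : Tendsto (fun ε : ℝ => FF u e s' / s' - 3 * β - C * V ^ 2 * s'' - 16 * V / s' * ε)
      (nhdsWithin 0 (Ioi 0)) (nhds (FF u e s' / s' - 3 * β - C * V ^ 2 * s'' - 16 * V / s' * 0)) :=
    (Continuous.tendsto (by fun_prop) 0).mono_left nhdsWithin_le_nhds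
  have := le_of_tendsto hlim (eventually_nhdsWithin_of_forall fun ε hε => key ε hε)
  nlinarith

end

section

variable {N : ℕ}

lemma gs_sq_eq {r : ℝ} (hr : 0 < r) (x : EE N) :
    gs (r ^ 2) x = Real.exp (-‖x‖ ^ 2 / (2 * r ^ 2)) *
      (Real.exp (-(N / 2 * Real.log (2 * Real.pi))) * (r ^ N)⁻¹) := by
  rw [gs, Real.log_mul (by positivity) (by positivity), Real.log_pow,
    show (r ^ N)⁻¹ = Real.exp (-(N * Real.log r)) by
      rw [Real.exp_neg, Real.exp_nat_mul, Real.exp_log hr], ← Real.exp_add, ← Real.exp_add]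
  congr 1
  push_cast
  ring

lemma exists_le_gs_sq (R : ℝ) : ∃ c : ℝ, 0 < c ∧ ∀ r : ℝ, 0 < r → ∀ x : EE N, ‖x‖ ≤ R * r →
    c * (r ^ N)⁻¹ ≤ gs (r ^ 2) x := by
  refine ⟨Real.exp (-(R ^ 2 / 2)) * Real.exp (-(N / 2 * Real.log (2 * Real.pi))), by positivity,
    fun r hr x hx => ?_⟩
  rw [gs_sq_eq hr, mul_assoc]
  refine mul_le_mul_of_nonneg_right (Real.exp_le_exp.2 ?_) (by positivity)
  rw [neg_div, neg_le_neg_iff, div_le_div_iff₀ (by positivity) (by positivity)]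
  have : ‖x‖ ^ 2 ≤ (R * r) ^ 2 := pow_le_pow_left₀ (norm_nonneg _) hx 2
  nlinarith

lemma exists_gs_sq_le : ∃ C : ℝ, 0 < C ∧ ∀ r : ℝ, 0 < r → ∀ x : EE N, gs (r ^ 2) x ≤ C * (r ^ N)⁻¹ := by
  refine ⟨Real.exp (-(N / 2 * Real.log (2 * Real.pi))), by positivity, fun r hr x => ?_⟩
  rw [gs_sq_eq hr]
  refine mul_le_of_le_one_left (by positivity) (Real.exp_le_one_iff.2 ?_)
  rw [neg_div, neg_nonpos]; positivity

lemma gradient_rescale {u : EE N → ℝ} (hu : ContDiff ℝ 1 u) {r : ℝ} (hr : 0 < r) (x e : EE N) :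
    ⟪gradient (fun y => u (r • y) / r ^ 2) x, e⟫ = fderiv ℝ u (r • x) e / r := by
  have h1 : HasFDerivAt (fun y : EE N => r • y) (r • ContinuousLinearMap.id ℝ (EE N)) x :=
    (hasFDerivAt_id x).const_smul r
  have h2 := (hu.differentiable (by norm_num) (r • x)).hasFDerivAt
  have h3 : HasFDerivAt (fun y => u (r • y) * (r ^ 2)⁻¹) _ x := (h2.comp x h1).mul_const (r ^ 2)⁻¹
  simp_rw [div_eq_mul_inv]
  rw [← fderiv_apply_eq_inner, h3.fderiv]
  simp
  field_simp

lemma quadGrowth_of_tendsto {u u₀ : EE N → ℝ} (hu₀ : Continuous u₀) {r : ℕ → ℝ} (hr : ∀ j, 0 < r j)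
    (hlim : Tendsto r atTop (nhds 0))
    (hconv : TendstoUniformlyOn (fun j x => u (r j • x) / r j ^ 2) u₀ atTop (closedBall 0 1)) :
    QuadGrowth u := by
  obtain ⟨A, hA⟩ := (isCompact_closedBall (0 : EE N) 1).exists_bound_of_continuousOn hu₀.continuousOn
  refine ⟨A + 1, fun τ hτ => ?_⟩
  obtain ⟨j, hj, hj'⟩ := ((Metric.tendstoUniformlyOn_iff.1 hconv 1 one_pos).and
    (hlim.eventually (eventually_lt_nhds hτ))).exists
  refine ⟨r j, hr j, hj'.le, fun x hx => ?_⟩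
  have hrj := hr j
  have hy : (r j)⁻¹ • x ∈ closedBall (0 : EE N) 1 := by
    rw [mem_closedBall_zero_iff, norm_smul, norm_inv, Real.norm_of_nonneg hrj.le,
      inv_mul_le_iff₀ hrj, mul_one]
    exact hx
  have h1 := hj _ hy
  have h2 := hA _ hy
  rw [smul_inv_smul₀ hrj.ne', Real.dist_eq] at h1
  rw [Real.norm_eq_abs] at h2
  have h3 : |u x / r j ^ 2| ≤ A + 1 := by
    have := abs_sub_abs_le_abs_sub (u x / r j ^ 2) (u₀ ((r j)⁻¹ • x))
    rw [abs_sub_comm] at this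
    linarith
  rwa [abs_div, abs_of_pos (by positivity : 0 < r j ^ 2), div_le_iff₀ (by positivity)] at h3

lemma integrable_FF {u : EE N → ℝ} (hu : ContDiff ℝ 1 u) (e : EE N) (s : ℝ) :
    Integrable fun x => (fderiv ℝ u x e * eta x) ^ 2 * gs s x := by
  have h1 := continuous_eta (N := N)
  have h2 : Continuous fun x => fderiv ℝ u x e :=
    (hu.continuous_fderiv (by norm_num)).clm_apply continuous_const
  simp_rw [sq_mul_eta (fun x => fderiv ℝ u x e)]
  exact integrable_mul_eta_mul_gs (by fun_prop) s

lemma exists_blowup_le_FF {u u₀ : EE N → ℝ} (hu : ContDiff ℝ 1 u) (hu₀ : ContDiff ℝ 1 u₀) {r : ℕ → ℝ}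
    (hr : ∀ j, 0 < r j) (hlim : Tendsto r atTop (nhds 0)) {e : EE N} (he : ‖e‖ = 1)
    (hgconv : ∀ K : Set (EE N), IsCompact K →
      TendstoUniformlyOn (fun j x => gradient (fun y => u (r j • y) / r j ^ 2) x)
        (gradient u₀) atTop K)
    (hne : ∃ x, fderiv ℝ u₀ x e ≠ 0) :
    ∃ c : ℝ, 0 < c ∧ ∀ᶠ j in atTop, c ≤ FF u e (r j ^ 2) / r j ^ 2 := by
  obtain ⟨x₀, hx₀⟩ := hne
  have hc0 : Continuous fun x => |fderiv ℝ u₀ x e| :=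
    ((hu₀.continuous_fderiv (by norm_num)).clm_apply continuous_const).abs
  set a := |fderiv ℝ u₀ x₀ e| / 3 with ha
  have ha0 : 0 < a := by positivity
  obtain ⟨δ, hδ, hball⟩ := Metric.nhds_basis_closedBall.mem_iff.1
    (hc0.continuousAt.eventually (lt_mem_nhds (show 2 * a < |fderiv ℝ u₀ x₀ e| by linarith)))
  obtain ⟨c, hc, hgs⟩ := exists_le_gs_sq (N := N) (‖x₀‖ + δ)
  set ω := (volume (closedBall (0 : EE N) 1)).toReal with hω
  have hω0 : 0 < ω := ENNReal.toReal_pos (measure_closedBall_pos volume _ one_pos).ne'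
    measure_closedBall_lt_top.ne
  refine ⟨a ^ 2 * c * (δ ^ N * ω), by positivity, ?_⟩
  have hsmall : ∀ᶠ j in atTop, r j * (‖x₀‖ + δ) < 1 / 4 := by
    have : Tendsto (fun j => r j * (‖x₀‖ + δ)) atTop (nhds (0 * (‖x₀‖ + δ))) := hlim.mul_const _
    rw [zero_mul] at this
    exact this.eventually (eventually_lt_nhds (by norm_num))
  filter_upwards [hsmall, Metric.tendstoUniformlyOn_iff.1 (hgconv _ (isCompact_closedBall x₀ δ)) a ha0]
    with j hj1 hj2
  have hrj := hr j
  rw [le_div_iff₀ (by positivity)]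
  set B := closedBall (r j • x₀) (r j * δ) with hB
  have hpt : ∀ y ∈ B, (a * r j) ^ 2 * (c * (r j ^ N)⁻¹) ≤
      (fderiv ℝ u y e * eta y) ^ 2 * gs (r j ^ 2) y := by
    intro y hy
    set x := (r j)⁻¹ • y with hxdef
    have hyx : y = r j • x := (smul_inv_smul₀ hrj.ne' y).symm
    have hx : x ∈ closedBall x₀ δ := by
      rw [hB, hyx, mem_closedBall, dist_eq_norm, ← smul_sub, norm_smul, Real.norm_of_nonneg hrj.le] at hy
      rw [mem_closedBall, dist_eq_norm]
      exact le_of_mul_le_mul_left hy hrj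
    have hxn : ‖x‖ ≤ ‖x₀‖ + δ := by
      rw [mem_closedBall, dist_eq_norm] at hx
      linarith [norm_le_norm_add_norm_sub' x x₀]
    have hyn : ‖y‖ ≤ (‖x₀‖ + δ) * r j := by
      rw [hyx, norm_smul, Real.norm_of_nonneg hrj.le, mul_comm]
      exact mul_le_mul_of_nonneg_right hxn hrj.le
    rw [eta_eq_one (by linarith), mul_one]
    refine mul_le_mul ?_ (hgs _ hrj y hyn) (by positivity) (sq_nonneg _)
    rw [sq_le_sq, abs_of_pos (by positivity)]
    have h1 := hj2 x hx
    rw [dist_eq_norm] at h1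
    have h2 := abs_real_inner_le_norm (gradient u₀ x - gradient (fun y => u (r j • y) / r j ^ 2) x) e
    rw [inner_sub_left, he, mul_one, gradient_rescale hu hrj, ← fderiv_apply_eq_inner, ← hyx] at h2
    have h3 : 2 * a < |fderiv ℝ u₀ x e| := hball hx
    have h4 := abs_sub_abs_le_abs_sub (fderiv ℝ u₀ x e) (fderiv ℝ u y e / r j)
    have h5 : a ≤ |fderiv ℝ u y e / r j| := by linarith
    rwa [abs_div, abs_of_pos hrj, le_div_iff₀ hrj] at h5
  have hvol : (volume B).toReal = r j ^ N * (δ ^ N * ω) := by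
    rw [hB, Measure.addHaar_closedBall_center, volume_real_ball (by positivity), mul_pow, mul_assoc]
  have hi := integrable_FF hu e (r j ^ 2)
  calc a ^ 2 * c * (δ ^ N * ω) * r j ^ 2 = (volume B).toReal * ((a * r j) ^ 2 * (c * (r j ^ N)⁻¹)) := by
        rw [hvol]; field_simp
    _ = ∫ y in B, (a * r j) ^ 2 * (c * (r j ^ N)⁻¹) := by
        rw [setIntegral_const, smul_eq_mul, Measure.real]
    _ ≤ ∫ y in B, (fderiv ℝ u y e * eta y) ^ 2 * gs (r j ^ 2) y :=
        setIntegral_mono_on (integrableOn_const measure_closedBall_lt_top.ne) hi.integrableOn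
          measurableSet_closedBall hpt
    _ ≤ FF u e (r j ^ 2) := setIntegral_le_integral hi (Eventually.of_forall fun y => by
        have := (gs_pos (r j ^ 2) y).le
        dsimp only [Pi.zero_apply]; positivity)

/-- Two-sided bounds for the Gaussian mean square along the dyadic scales `4⁻ᵏ`. -/
lemma MemP.exists_FF_bounds {M : ℝ} {Ω : Set (EE N)} {u : EE N → ℝ} (hu : MemP N 1 0 M Ω u)
    {e : EE N} {β : ℕ → ℝ} (hβ : Summable β) (hβ0 : ∀ k, 0 ≤ β k)
    (hb : ∀ k, ∀ s ∈ Icc ((1 / 4 : ℝ) ^ (k + 2)) ((1 / 4) ^ (k + 1)), bb u e s ^ 2 ≤ s * β k)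
    {r : ℕ → ℝ} (hr : ∀ j, 0 < r j) (hlim : Tendsto r atTop (nhds 0)) {c : ℝ} (hc : 0 < c)
    (hlow : ∀ᶠ j in atTop, c ≤ FF u e (r j ^ 2) / r j ^ 2) :
    ∃ C : ℝ, 0 < C ∧ ∀ᶠ k : ℕ in atTop, c / 2 * (1 / 4 : ℝ) ^ k ≤ FF u e ((1 / 4) ^ k) ∧
      FF u e ((1 / 4) ^ k) ≤ C * (1 / 4) ^ k := by
  obtain ⟨D, hD, hmono⟩ := hu.exists_almost_monotone e
  set err : ℕ → ℝ := fun k => 3 * β k + D * (1 / 4) ^ (k + 1) with herr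
  have herr0 : ∀ k, 0 ≤ err k := fun k => by have := hβ0 k; rw [herr]; positivity
  have herrs : Summable err := (hβ.mul_left 3).add
    (((summable_nat_add_iff 1).2 (summable_geometric_of_lt_one (by norm_num) (by norm_num : (1 / 4 : ℝ) < 1))).mul_left D)
  have hstep : ∀ k, ∀ s ∈ Icc ((1 / 4 : ℝ) ^ (k + 2)) ((1 / 4) ^ (k + 1)),
      FF u e s / s - err k ≤ FF u e ((1 / 4) ^ (k + 1)) / (1 / 4) ^ (k + 1) := by
    intro k s hs
    have h0 : (0 : ℝ) < (1 / 4) ^ (k + 2) := by positivity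
    have h1 := hmono s ((1 / 4) ^ (k + 1)) (β k) (h0.trans_le hs.1) hs.2
      (by have := hs.1; rw [pow_succ] at this; linarith) (pow_le_one₀ (by norm_num) (by norm_num))
      (fun t ht => hb k t ⟨hs.1.trans ht.1, ht.2⟩)
    rw [herr]; linarith
  have hchain : ∀ k m, k ≤ m → FF u e ((1 / 4) ^ (m + 1)) / (1 / 4) ^ (m + 1) - ∑ i ∈ Finset.Ico k m, err i ≤
      FF u e ((1 / 4) ^ (k + 1)) / (1 / 4) ^ (k + 1) := by
    intro k m hkm
    induction m, hkm using Nat.le_induction with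
    | base => simp
    | succ m hkm ih =>
      rw [Finset.sum_Ico_succ_top hkm]
      have := hstep m ((1 / 4) ^ (m + 2)) ⟨le_rfl, pow_le_pow_of_le_one (by norm_num) (by norm_num) (by omega)⟩
      rw [show m + 1 + 1 = m + 2 from rfl]
      linarith
  have htail : ∃ K, ∀ k m, K ≤ k → ∑ i ∈ Finset.Ico k m, err i ≤ c / 2 := by
    have h1 := tendsto_sum_nat_add err
    obtain ⟨K, hK⟩ := eventually_atTop.1 (h1.eventually (eventually_lt_nhds (half_pos hc)))
    refine ⟨K, fun k m hk => ?_⟩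
    refine le_trans ?_ (hK k hk).le
    rw [Finset.sum_Ico_eq_sum_range]
    simp_rw [add_comm k]
    exact ((summable_nat_add_iff k).2 herrs).sum_le_tsum _ (fun i _ => herr0 _)
  obtain ⟨K, hK⟩ := htail
  refine ⟨|FF u e ((1 / 4) ^ (0 + 1)) / (1 / 4) ^ (0 + 1)| + ∑' i, err i + 1, ?_, ?_⟩
  · have : 0 ≤ ∑' i, err i := tsum_nonneg herr0
    positivity
  filter_upwards [eventually_ge_atTop (K + 1)] with k hk
  obtain ⟨k, rfl⟩ : ∃ l, k = l + 1 := ⟨k - 1, by omega⟩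
  have hpos : (0 : ℝ) < (1 / 4) ^ (k + 1) := by positivity
  rw [← le_div_iff₀ hpos, ← div_le_iff₀ hpos]
  constructor
  · obtain ⟨j, hj, hj'⟩ := (hlow.and (hlim.eventually (eventually_lt_nhds
      (show (0 : ℝ) < (1 / 4) ^ (k + 2) by positivity)))).exists
    have hrj := hr j
    have hle : r j ^ 2 ≤ (1 / 4) ^ (k + 2) := by
      have : (1 / 4 : ℝ) ^ (k + 2) ≤ 1 := pow_le_one₀ (by norm_num) (by norm_num)
      nlinarith
    obtain ⟨n, hn1, hn2⟩ := exists_nat_pow_near_of_lt_one (x := r j ^ 2) (y := (1 / 4 : ℝ)) (by positivity)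
      (hle.trans (pow_le_one₀ (by norm_num) (by norm_num))) (by norm_num) (by norm_num)
    have hnk : k + 2 < n + 1 :=
      (pow_lt_pow_iff_right_of_lt_one₀ (by norm_num : (0 : ℝ) < 1 / 4) (by norm_num)).1 (hn1.trans_le hle)
    obtain ⟨m, rfl⟩ : ∃ m, n = m + 1 := ⟨n - 1, by omega⟩
    have h1 := hstep m (r j ^ 2) ⟨hn1.le, hn2⟩
    have h2 := hchain k m (by omega)
    have h3 := hK k (m + 1) (by omega)
    rw [Finset.sum_Ico_succ_top (by omega)] at h3
    linarith
  · have h1 := hchain 0 k (Nat.zero_le _)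
    have h2 : ∑ i ∈ Finset.Ico 0 k, err i ≤ ∑' i, err i := herrs.sum_le_tsum _ (fun i _ => herr0 _)
    have h3 := le_abs_self (FF u e ((1 / 4) ^ (0 + 1)) / (1 / 4) ^ (0 + 1))
    linarith

end

section

variable {N : ℕ}

/-- Caccioppoli's inequality for nonnegative subharmonic functions. -/
lemma caccioppoli {w : EE N → ℝ} (hw : ContDiff ℝ (⊤ : ℕ∞) w) (h0 : ∀ x, 0 ≤ w x) {R : ℝ}
    (hlap : ∀ x ∈ ball (0 : EE N) R, 0 ≤ lap N w x) {ζ : EE N → ℝ} (hζ : ContDiff ℝ 1 ζ)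
    (hs : tsupport ζ ⊆ ball 0 R) :
    ∫ x, ζ x ^ 2 * ‖gradient w x‖ ^ 2 ≤ 4 * ∫ x, w x ^ 2 * ‖gradient ζ x‖ ^ 2 := by
  have hc := hasCompactSupport_of_tsupport_subset_ball hs
  have hw1 : ContDiff ℝ 1 w := contDiff_one_of_infty hw
  have hgw := continuous_gradient hw1
  have hgζ := continuous_gradient hζ
  have hcw := hw.continuous
  have hcζ := hζ.continuous
  have hcf : HasCompactSupport fun x => w x * (ζ x * ζ x) :=
    hc.mono fun x hx h => hx (by simp [h])
  have h1 := integral_inner_gradient (f := fun x => w x * (ζ x * ζ x)) (h := w)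
    (hw1.mul (hζ.mul hζ)) (contDiff_two_of_infty hw) hcf
  have h2 : 0 ≤ ∫ x, w x * (ζ x * ζ x) * lap N w x := by
    refine integral_nonneg fun x => ?_
    by_cases hx : x ∈ ball (0 : EE N) R
    · exact mul_nonneg (mul_nonneg (h0 x) (mul_self_nonneg _)) (hlap x hx)
    · have : ζ x = 0 := image_eq_zero_of_notMem_tsupport fun h => hx (hs h)
      simp [this]
  have hg : ∀ x, gradient (fun x => w x * (ζ x * ζ x)) x =
      w x • (ζ x • gradient ζ x + ζ x • gradient ζ x) + (ζ x * ζ x) • gradient w x := fun x => by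
    have d1 := hw1.differentiable (by norm_num) x
    have d2 := hζ.differentiable (by norm_num) x
    rw [gradient_mul' (g := fun x => ζ x * ζ x) d1 (d2.mul d2), gradient_mul' d2 d2]
  have i1 : Integrable fun x => ζ x ^ 2 * ‖gradient w x‖ ^ 2 :=
    Continuous.integrable_of_hasCompactSupport (by fun_prop) (hc.mono fun x hx h => hx (by simp [h]))
  have i2 : Integrable fun x => w x ^ 2 * ‖gradient ζ x‖ ^ 2 :=
    Continuous.integrable_of_hasCompactSupport (by fun_prop)
      (hc.gradient.mono fun x hx h => hx (by simp [h]))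
  have i3 : Integrable fun x => ⟪gradient (fun x => w x * (ζ x * ζ x)) x, gradient w x⟫ := by
    simp_rw [hg]
    exact Continuous.integrable_of_hasCompactSupport (by fun_prop)
      (hc.mono fun x hx h => hx (by simp [h]))
  have h3 : ∫ x, ((1 / 2 : ℝ) * (ζ x ^ 2 * ‖gradient w x‖ ^ 2) - 2 * (w x ^ 2 * ‖gradient ζ x‖ ^ 2)) ≤
      ∫ x, ⟪gradient (fun x => w x * (ζ x * ζ x)) x, gradient w x⟫ := by
    refine integral_mono ((i1.const_mul _).sub (i2.const_mul _)) i3 fun x => ?_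
    dsimp only
    rw [hg, inner_add_left, real_inner_smul_left, real_inner_smul_left, inner_add_left,
      real_inner_smul_left, real_inner_self_eq_norm_sq]
    have h4 := abs_le.1 (abs_real_inner_le_norm (gradient ζ x) (gradient w x))
    have h5 := abs_le.1 (show |w x * ζ x * ⟪gradient ζ x, gradient w x⟫| ≤
        |w x| * |ζ x| * (‖gradient ζ x‖ * ‖gradient w x‖) by
      rw [abs_mul, abs_mul]
      exact mul_le_mul_of_nonneg_left (abs_real_inner_le_norm _ _) (by positivity))
    have h6 := sq_nonneg (|ζ x| * ‖gradient w x‖ - 2 * (|w x| * ‖gradient ζ x‖))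
    have h7 := sq_abs (ζ x)
    have h8 := sq_abs (w x)
    have h9 : (|ζ x| * ‖gradient w x‖ - 2 * (|w x| * ‖gradient ζ x‖)) ^ 2 =
      ζ x ^ 2 * ‖gradient w x‖ ^ 2 - 4 * (|w x| * |ζ x| * (‖gradient ζ x‖ * ‖gradient w x‖)) +
        4 * (w x ^ 2 * ‖gradient ζ x‖ ^ 2) := by rw [← h7, ← h8]; ring
    nlinarith [h5.1]
  rw [integral_sub (i1.const_mul _) (i2.const_mul _), integral_const_mul, integral_const_mul] at h3
  linarith

lemma integrable_of_tendsto_of_integral_le {f : ℕ → EE N → ℝ} {g : EE N → ℝ}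
    (hf : ∀ n, Integrable (f n)) (h0 : ∀ n x, 0 ≤ f n x) (hg : AEStronglyMeasurable g volume)
    (hlim : ∀ x, Tendsto (fun n => f n x) atTop (nhds (g x))) {A : ℝ} (hA : ∀ n, ∫ x, f n x ≤ A) :
    Integrable g ∧ ∫ x, g x ≤ A := by
  have hA0 : 0 ≤ A := (integral_nonneg (h0 0)).trans (hA 0)
  have hg0 : ∀ x, 0 ≤ g x := fun x => ge_of_tendsto' (hlim x) fun n => h0 n x
  have h1 : ∫⁻ x, ENNReal.ofReal (g x) ≤ ENNReal.ofReal A := by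
    have h2 : ∀ x, ENNReal.ofReal (g x) = liminf (fun n => ENNReal.ofReal (f n x)) atTop := fun x =>
      ((ENNReal.tendsto_ofReal (hlim x)).liminf_eq).symm
    simp_rw [h2]
    refine (lintegral_liminf_le' fun n => (hf n).aemeasurable.ennreal_ofReal).trans ?_
    refine liminf_le_of_frequently_le' (Frequently.of_forall fun n => ?_)
    rw [← ofReal_integral_eq_lintegral_ofReal (hf n) (Eventually.of_forall (h0 n))]
    exact ENNReal.ofReal_le_ofReal (hA n)
  constructor
  · refine ⟨hg, ?_⟩
    rw [hasFiniteIntegral_iff_ofReal (Eventually.of_forall hg0)]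
    exact h1.trans_lt ENNReal.ofReal_lt_top
  · rw [integral_eq_lintegral_of_nonneg_ae (Eventually.of_forall hg0) hg]
    exact ENNReal.toReal_le_of_le_ofReal hA0 h1

/-- The gradient of the positive part of the derivative of `u` in the direction `e`. -/
def posGrad (u : EE N → ℝ) (e x : EE N) : EE N := gradient (fun y => max (fderiv ℝ u y e) 0) x

lemma measurable_posGrad (u : EE N → ℝ) (e : EE N) : Measurable (posGrad u e) := measurable_gradient _

lemma posGrad_eq_zero {u : EE N → ℝ} {e x : EE N} (h : fderiv ℝ u x e ≤ 0) : posGrad u e x = 0 :=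
  gradient_max_eq_zero (v := fun y => fderiv ℝ u y e) h

lemma Tr_le_abs {ε : ℝ} (hε : 0 < ε) (s : ℝ) : Tr ε s ≤ |s| :=
  (Tr_le hε s).trans (max_le (le_abs_self s) (abs_nonneg s))

lemma MemP.norm_gradient_trunc_le {M : ℝ} {Ω : Set (EE N)} {u : EE N → ℝ} (hu : MemP N 1 0 M Ω u)
    (e : EE N) {R ε : ℝ} (hR : R < 1) (hε : 0 < ε) {w : EE N → ℝ}
    (hw : ∀ x ∈ ball (0 : EE N) R, w x = Tr ε (fderiv ℝ u x e)) {x : EE N} (hx : x ∈ ball (0 : EE N) R) :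
    ‖gradient w x‖ ≤ ‖posGrad u e x‖ := by
  rw [hu.gradient_trunc e hR hε hw hx, norm_smul, Real.norm_of_nonneg (Real.smoothTransition.nonneg _)]
  exact mul_le_of_le_one_left (norm_nonneg _) (Real.smoothTransition.le_one _)

lemma MemP.caccioppoli_posGrad {M : ℝ} {Ω : Set (EE N)} {u : EE N → ℝ} (hu : MemP N 1 0 M Ω u)
    (e : EE N) {R : ℝ} (hR : R < 1) {ζ : EE N → ℝ} (hζ : ContDiff ℝ 1 ζ) (hs : tsupport ζ ⊆ ball 0 R) :
    Integrable (fun x => ζ x ^ 2 * ‖posGrad u e x‖ ^ 2) ∧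
      ∫ x, ζ x ^ 2 * ‖posGrad u e x‖ ^ 2 ≤ 4 * ∫ x, fderiv ℝ u x e ^ 2 * ‖gradient ζ x‖ ^ 2 := by
  have hε : ∀ n : ℕ, (0 : ℝ) < 1 / ((n : ℝ) + 1) := fun n => Nat.one_div_pos_of_nat
  choose w hw h0 hwT hlap using fun n : ℕ => hu.exists_trunc e hR (hε n)
  have hc := hasCompactSupport_of_tsupport_subset_ball hs
  have hcζ := hζ.continuous
  have hgζ := continuous_gradient hζ
  have hcv := hu.continuous_fderiv_apply e
  refine integrable_of_tendsto_of_integral_le (f := fun n x => ζ x ^ 2 * ‖gradient (w n) x‖ ^ 2)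
    (fun n => ?_) (fun n x => by positivity) ?_ (fun x => ?_) (fun n => ?_)
  · have := continuous_gradient (contDiff_one_of_infty (hw n))
    exact Continuous.integrable_of_hasCompactSupport (by fun_prop)
      (hc.mono fun x hx h => hx (by simp [h]))
  · exact ((hcζ.pow 2).measurable.mul ((measurable_posGrad u e).norm.pow_const 2)).aestronglyMeasurable
  · by_cases hx : x ∈ ball (0 : EE N) R
    · refine tendsto_const_nhds.congr' ?_
      rcases le_or_gt (fderiv ℝ u x e) 0 with hv | hv
      · refine Eventually.of_forall fun n => ?_
        dsimp only
        rw [hu.gradient_trunc e hR (hε n) (hwT n) hx, posGrad_eq_zero hv, ← posGrad, posGrad_eq_zero hv, smul_zero]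
      · obtain ⟨m, hm⟩ := exists_nat_ge (2 / fderiv ℝ u x e)
        filter_upwards [eventually_ge_atTop m] with n hn
        rw [hu.gradient_trunc e hR (hε n) (hwT n) hx, Real.smoothTransition.one_of_one_le, one_smul, posGrad]
        have h1 : (m : ℝ) ≤ n := by exact_mod_cast hn
        rw [div_le_iff₀ hv] at hm
        rw [div_div_eq_mul_div, div_one]
        nlinarith
    · have : ζ x = 0 := image_eq_zero_of_notMem_tsupport fun h => hx (hs h)
      simp [this]
  · refine (caccioppoli (hw n) (h0 n) (hlap n) hζ hs).trans ?_
    refine mul_le_mul_of_nonneg_left ?_ (by norm_num)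
    refine integral_mono_of_nonneg (Eventually.of_forall fun x => by positivity)
      (Continuous.integrable_of_hasCompactSupport (by fun_prop)
        (hc.gradient.mono fun x hx h => hx (by simp [h]))) (Eventually.of_forall fun x => ?_)
    by_cases hx : x ∈ ball (0 : EE N) R
    · refine mul_le_mul_of_nonneg_right ?_ (by positivity)
      rw [hwT n x hx, sq_le_sq, abs_of_nonneg (Tr_nonneg (hε n) _)]
      exact Tr_le_abs (hε n) _
    · have h1 : gradient ζ x = 0 := gradient_eq_zero_of_eventuallyEq (c := 0)
        (notMem_tsupport_iff_eventuallyEq.1 fun h => hx (hs h))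
      simp [h1]

end

section

variable {N : ℕ}

/-- The Gaussian energy of the positive part of a directional derivative. -/
def En (u : EE N → ℝ) (e : EE N) (s : ℝ) : ℝ := ∫ x, eta x ^ 2 * ‖posGrad u e x‖ ^ 2 * gs s x

lemma exists_gs_eq_mul_sq {s : ℝ} (hs : 0 < s) :
    ∃ κ : ℝ, 0 < κ ∧ ∀ x : EE N, gs s x = κ * gs (2 * s) x ^ 2 := by
  refine ⟨Real.exp (N * Real.log (2 * Real.pi * (2 * s)) - N / 2 * Real.log (2 * Real.pi * s)),
    Real.exp_pos _, fun x => ?_⟩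
  rw [gs, gs, ← Real.exp_nat_mul, ← Real.exp_add]
  congr 1
  push_cast
  field_simp
  ring

lemma MemP.exists_En_le {M : ℝ} {Ω : Set (EE N)} {u : EE N → ℝ} (hu : MemP N 1 0 M Ω u) (e : EE N) :
    ∃ C : ℝ, 0 < C ∧ ∀ s : ℝ, 0 < s → s ≤ 1 →
      Integrable (fun x => eta x ^ 2 * ‖posGrad u e x‖ ^ 2 * gs s x) ∧
      En u e s ≤ C * (FF u e (4 * s) / s + s) := by
  obtain ⟨Ct, hCt, htail⟩ := exists_tail_bound (N := N)
  obtain ⟨C1, hC1, hpoly⟩ := exists_poly_gs_le (N := N) 1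
  obtain ⟨K, hK0, hK⟩ := exists_eta_bound (N := N)
  obtain ⟨V, hV0, hV⟩ := hu.exists_abs_fderiv_le e
  have hcη := continuous_eta (N := N)
  have hη1 : ContDiff ℝ 1 (eta : EE N → ℝ) := contDiff_one_of_infty contDiff_eta
  have hgη := continuous_gradient hη1
  have hcv := hu.continuous_fderiv_apply e
  refine ⟨8 * V ^ 2 * K ^ 2 * Ct + 2 * C1 + 1, by positivity, fun s hs hs1 => ?_⟩
  obtain ⟨κ, hκ, hκs⟩ := exists_gs_eq_mul_sq (N := N) hs
  have hcg := continuous_gs (N := N) s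
  have hg1 : ContDiff ℝ 1 (gs (2 * s) : EE N → ℝ) := (contDiff_gs (2 * s)).of_le (by exact_mod_cast le_top)
  have hsub : tsupport (fun x : EE N => eta x * gs (2 * s) x) ⊆ ball 0 (3 / 4) :=
    (tsupport_mul_subset_left).trans (by
      rw [tsupport_eta]; exact closedBall_subset_ball (by norm_num))
  obtain ⟨h1, h2⟩ := hu.caccioppoli_posGrad e (R := 3 / 4) (by norm_num)
    (ζ := fun x => eta x * gs (2 * s) x) (hη1.mul hg1) hsub
  have heq : (fun x => eta x ^ 2 * ‖posGrad u e x‖ ^ 2 * gs s x) =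
      fun x => κ * ((eta x * gs (2 * s) x) ^ 2 * ‖posGrad u e x‖ ^ 2) := by
    ext x; rw [hκs]; ring
  refine ⟨by rw [heq]; exact h1.const_mul κ, ?_⟩
  have hEn : En u e s = κ * ∫ x, (eta x * gs (2 * s) x) ^ 2 * ‖posGrad u e x‖ ^ 2 := by
    rw [En, heq, integral_const_mul]
  have hb : Integrable fun x => fderiv ℝ u x e ^ 2 * ‖gradient (eta : EE N → ℝ) x‖ ^ 2 * gs s x :=
    Continuous.integrable_of_hasCompactSupport (by fun_prop)
      (hasCompactSupport_eta.gradient.mono fun x hx h => hx (by simp [h]))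
  have hb2 := integrable_FF hu.contDiff e (4 * s)
  have hpt : ∀ x, κ * (fderiv ℝ u x e ^ 2 * ‖gradient (fun x => eta x * gs (2 * s) x) x‖ ^ 2) ≤
      2 * (fderiv ℝ u x e ^ 2 * ‖gradient (eta : EE N → ℝ) x‖ ^ 2 * gs s x) +
        C1 / (2 * s) * ((fderiv ℝ u x e * eta x) ^ 2 * gs (4 * s) x) := by
    intro x
    have hp := hpoly s hs x
    rw [pow_one, pow_one] at hp
    have hp' : ‖x‖ ^ 2 * gs s x ≤ C1 * s * gs (4 * s) x := by
      have := mul_pos hs (gs_pos s x)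
      rw [add_mul] at hp; linarith
    have hg : gradient (fun x : EE N => eta x * gs (2 * s) x) x =
        gs (2 * s) x • (gradient eta x - (eta x / (2 * s)) • x) := by
      rw [gradient_mul' (hη1.differentiable (by norm_num) x) (hg1.differentiable (by norm_num) x),
        gradient_gs, smul_smul, smul_sub, smul_smul, add_comm, sub_eq_add_neg, ← neg_smul]
      congr 2; ring
    rw [hg, norm_smul, mul_pow, Real.norm_eq_abs, sq_abs]
    have h3 : ‖gradient eta x - (eta x / (2 * s)) • x‖ ^ 2 ≤
        2 * ‖gradient (eta : EE N → ℝ) x‖ ^ 2 + 2 * ((eta x / (2 * s)) ^ 2 * ‖x‖ ^ 2) := by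
      have h4 := norm_sub_le (gradient (eta : EE N → ℝ) x) ((eta x / (2 * s)) • x)
      have h5 : ‖(eta x / (2 * s)) • x‖ ^ 2 = (eta x / (2 * s)) ^ 2 * ‖x‖ ^ 2 := by
        rw [norm_smul, mul_pow, Real.norm_eq_abs, sq_abs]
      rw [← h5]
      have h6 := norm_nonneg (gradient eta x - (eta x / (2 * s)) • x)
      have h7 := pow_le_pow_left₀ h6 h4 2
      nlinarith [sq_nonneg (‖gradient (eta : EE N → ℝ) x‖ - ‖(eta x / (2 * s)) • x‖)]
    have hv2 := sq_nonneg (fderiv ℝ u x e)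
    calc _ = fderiv ℝ u x e ^ 2 * gs s x * ‖gradient eta x - (eta x / (2 * s)) • x‖ ^ 2 := by
          rw [hκs]; ring
      _ ≤ fderiv ℝ u x e ^ 2 * gs s x *
          (2 * ‖gradient (eta : EE N → ℝ) x‖ ^ 2 + 2 * ((eta x / (2 * s)) ^ 2 * ‖x‖ ^ 2)) :=
          mul_le_mul_of_nonneg_left h3 (mul_nonneg hv2 (gs_pos _ _).le)
      _ = 2 * (fderiv ℝ u x e ^ 2 * ‖gradient (eta : EE N → ℝ) x‖ ^ 2 * gs s x) +
          2 * (fderiv ℝ u x e ^ 2 * (eta x / (2 * s)) ^ 2) * (‖x‖ ^ 2 * gs s x) := by ring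
      _ ≤ 2 * (fderiv ℝ u x e ^ 2 * ‖gradient (eta : EE N → ℝ) x‖ ^ 2 * gs s x) +
          2 * (fderiv ℝ u x e ^ 2 * (eta x / (2 * s)) ^ 2) * (C1 * s * gs (4 * s) x) := by
          have := mul_le_mul_of_nonneg_left hp'
            (by positivity : 0 ≤ 2 * (fderiv ℝ u x e ^ 2 * (eta x / (2 * s)) ^ 2))
          linarith
      _ = _ := by field_simp
  have h3 : κ * ∫ x, fderiv ℝ u x e ^ 2 * ‖gradient (fun x => eta x * gs (2 * s) x) x‖ ^ 2 ≤
      2 * (∫ x, fderiv ℝ u x e ^ 2 * ‖gradient (eta : EE N → ℝ) x‖ ^ 2 * gs s x) +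
        C1 / (2 * s) * FF u e (4 * s) := by
    rw [FF, ← integral_const_mul, ← integral_const_mul, ← integral_const_mul,
      ← integral_add (hb.const_mul _) (hb2.const_mul _)]
    exact integral_mono_of_nonneg (Eventually.of_forall fun x => by positivity)
      ((hb.const_mul _).add (hb2.const_mul _)) (Eventually.of_forall hpt)
  have h4 := htail s hs (fun x => fderiv ℝ u x e ^ 2 * ‖gradient (eta : EE N → ℝ) x‖ ^ 2) (V ^ 2 * K ^ 2)
    (fun x hx => by rw [gradient_eq_zero_of_eventuallyEq (eta_eventuallyEq_one hx)]; simp)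
    (fun x => by
      by_cases hx : ‖x‖ < 3 / 4
      · rw [abs_of_nonneg (by positivity)]
        refine mul_le_mul ?_ (pow_le_pow_left₀ (norm_nonneg _) (hK x).1 2) (by positivity) (by positivity)
        rw [sq_le_sq, abs_of_nonneg hV0]
        exact hV x (by simpa using hx)
      · rw [gradient_eq_zero_of_eventuallyEq (eta_eventuallyEq_zero (by linarith))]
        simp; positivity)
  have h5 := (abs_le.1 h4).2
  have h6 : s ^ 6 ≤ s := by simpa using pow_le_pow_of_le_one hs.le hs1 (by norm_num : 1 ≤ 6)
  have h7 : V ^ 2 * K ^ 2 * (Ct * s ^ 6) ≤ V ^ 2 * K ^ 2 * Ct * s := by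
    rw [mul_assoc (V ^ 2 * K ^ 2)]
    exact mul_le_mul_of_nonneg_left (mul_le_mul_of_nonneg_left h6 hCt.le) (by positivity)
  have h8 : 0 ≤ FF u e (4 * s) / s := div_nonneg (integral_nonneg fun x => by
    have := (gs_pos (4 * s) x).le
    dsimp only [Pi.zero_apply]; positivity) hs.le
  have h9 : C1 / (2 * s) * FF u e (4 * s) = C1 / 2 * (FF u e (4 * s) / s) := by field_simp
  have h10 := mul_le_mul_of_nonneg_left h2 hκ.le
  rw [hEn]
  have h11 : 0 ≤ V ^ 2 * K ^ 2 * Ct := by positivity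
  have h12 : 0 ≤ V ^ 2 * K ^ 2 * Ct * (FF u e (4 * s) / s) := by positivity
  have h13 : 0 ≤ C1 * s := by positivity
  nlinarith

end

section

variable {N : ℕ}

/-- The Gaussian mean of the absolute value of the cut-off directional derivative. -/
def BA (u : EE N → ℝ) (e : EE N) (s : ℝ) : ℝ := ∫ x, |fderiv ℝ u x e| * eta x * gs s x

lemma BA_nonneg (u : EE N → ℝ) (e : EE N) (s : ℝ) : 0 ≤ BA u e s :=
  integral_nonneg fun x => mul_nonneg (mul_nonneg (abs_nonneg _) (eta_nonneg x)) (gs_pos s x).le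

lemma exists_fderiv_le_BA (L : ℝ) : ∃ C : ℝ, 0 < C ∧ ∀ s : ℝ, 0 < s → (L + 1) * √s ≤ 1 / 4 →
    ∀ {M : ℝ} {Ω : Set (EE N)} {u : EE N → ℝ}, MemP N 1 0 M Ω u → ∀ e x : EE N, ‖x‖ ≤ L * √s →
      fderiv ℝ u x e ≤ C * BA u e s := by
  obtain ⟨κ, hκ0, hκ⟩ := exists_bound_of_hasCompactSupport (contDiff_kap (N := N)).continuous
    hasCompactSupport_kap
  obtain ⟨c, hc, hgs⟩ := exists_le_gs_sq (N := N) (L + 1)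
  refine ⟨κ / c + 1, by positivity, fun s hs hsL M Ω u hu e x hx => ?_⟩
  set δ := √s with hδ
  have hδ0 : 0 < δ := Real.sqrt_pos.2 hs
  have hδs : δ ^ 2 = s := Real.sq_sqrt hs.le
  have hball : ∀ ε ≤ δ, closedBall x ε ⊆ ball (0 : EE N) (3 / 4) := by
    intro ε hε y hy
    rw [mem_closedBall, dist_eq_norm] at hy
    rw [mem_ball_zero_iff]
    have := norm_le_norm_add_norm_sub' y x
    nlinarith
  have hcv := hu.continuous_fderiv_apply e
  have hi : Integrable fun y => |fderiv ℝ u y e| * eta y * gs s y := integrable_mul_eta_mul_gs hcv.abs s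
  have key : ∀ ε : ℝ, 0 < ε → fderiv ℝ u x e ≤ κ / c * BA u e s + 2 * ε := by
    intro ε hε
    obtain ⟨w, hw, h0, hwT, hlap⟩ := hu.exists_trunc e (R := 3 / 4) (by norm_num) hε
    have h1 : w x ≤ moll δ w x := by
      refine le_moll_of_subharmonic (contDiff_one_of_infty hw) hδ0 fun t ht => ?_
      have hsup := tsupport_psiAt ht.1 x
      have h2 := integral_inner_gradient (f := psiAt t x) (h := w)
        (contDiff_one_of_infty (contDiff_psiAt t x)) (contDiff_two_of_infty hw)
        (HasCompactSupport.intro' (isCompact_closedBall x t) isClosed_closedBall fun y hy =>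
          image_eq_zero_of_notMem_tsupport fun h => hy (hsup h))
      have h3 : ∫ y, psiAt t x y * lap N w y ≤ 0 := integral_nonpos fun y => by
        by_cases hy : y ∈ closedBall x t
        · exact mul_nonpos_of_nonpos_of_nonneg (psiAt_nonpos t x y) (hlap y (hball t ht.2.le hy))
        · have : psiAt t x y = 0 := image_eq_zero_of_notMem_tsupport fun h => hy (hsup h)
          simp [this]
      have h4 : ∫ y, ⟪gradient w y, gradient (psiAt t x) y⟫ = ∫ y, ⟪gradient (psiAt t x) y, gradient w y⟫ :=
        integral_congr_ae (Eventually.of_forall fun y => real_inner_comm _ _)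
      rw [h4, h2]
      linarith
    have h2 : moll δ w x ≤ κ / c * BA u e s := by
      rw [moll_eq_integral hδ0, BA, ← integral_const_mul]
      refine integral_mono_of_nonneg (Eventually.of_forall fun y => ?_) (hi.const_mul _)
        (Eventually.of_forall fun y => ?_)
      · have := kap_nonneg (δ⁻¹ • (y - x))
        have := h0 y
        dsimp only [Pi.zero_apply]; positivity
      · dsimp only
        by_cases hy : ‖y - x‖ < δ
        · have hyn : ‖y‖ ≤ (L + 1) * δ := by
            have := norm_le_norm_add_norm_sub' y x
            nlinarith
          have hyb : y ∈ ball (0 : EE N) (3 / 4) := by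
            rw [mem_ball_zero_iff]; linarith
          rw [eta_eq_one (by linarith), mul_one, hwT y hyb]
          have h3 := hgs δ hδ0 y hyn
          rw [hδs] at h3
          have h4 : (δ ^ N)⁻¹ * kap (δ⁻¹ • (y - x)) ≤ κ / c * gs s y := by
            have h5 := (le_abs_self _).trans (hκ (δ⁻¹ • (y - x)))
            calc _ ≤ (δ ^ N)⁻¹ * κ := mul_le_mul_of_nonneg_left h5 (by positivity)
              _ = κ / c * (c * (δ ^ N)⁻¹) := by field_simp
              _ ≤ _ := mul_le_mul_of_nonneg_left h3 (by positivity)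
          calc _ ≤ κ / c * gs s y * |fderiv ℝ u y e| :=
                mul_le_mul h4 (Tr_le_abs hε _) (Tr_nonneg hε _) (mul_nonneg (by positivity) (gs_pos _ _).le)
            _ = _ := by ring
        · rw [kap_eq_zero]
          · have := gs_pos s y
            have := eta_nonneg y
            rw [mul_zero, zero_mul]; positivity
          · rw [norm_smul, norm_inv, Real.norm_of_nonneg hδ0.le, ← div_eq_inv_mul, one_le_div hδ0]
            exact not_lt.1 hy
    have h3 := le_Tr hε (fderiv ℝ u x e)
    rw [← hwT x (hball 0 hδ0.le (by simp))] at h3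
    linarith [le_max_left (fderiv ℝ u x e) 0]
  have h4 : fderiv ℝ u x e ≤ κ / c * BA u e s :=
    le_of_forall_pos_le_add fun ε hε => by linarith [key (ε / 2) (half_pos hε)]
  have := BA_nonneg u e s
  linarith

lemma exists_mul_exp_le (A : ℝ) {ε : ℝ} (hε : 0 < ε) :
    ∃ L : ℝ, 0 < L ∧ A * Real.exp (-(3 * L ^ 2 / 8)) ≤ ε := by
  refine ⟨1 + 8 * |A| / (3 * ε), by positivity, ?_⟩
  set L := 1 + 8 * |A| / (3 * ε) with hL
  have h1 : 1 ≤ L := by rw [hL]; linarith [show 0 ≤ 8 * |A| / (3 * ε) by positivity]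
  rw [Real.exp_neg, ← div_eq_mul_inv, div_le_iff₀ (Real.exp_pos _)]
  have h2 := Real.add_one_le_exp (3 * L ^ 2 / 8)
  have h3 : ε * (3 * L / 8) = 3 * ε / 8 + |A| := by rw [hL]; field_simp
  have h4 : A ≤ |A| := le_abs_self A
  calc A ≤ ε * (3 * L / 8) := by rw [h3]; linarith
    _ ≤ ε * Real.exp (3 * L ^ 2 / 8) := mul_le_mul_of_nonneg_left (by nlinarith) hε.le

lemma gs_le_of_le_norm {s L : ℝ} (hs : 0 < s) (hL : 0 ≤ L) {x : EE N} (hx : L * √s ≤ ‖x‖) :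
    gs s x ≤ 2 ^ N * Real.exp (-(3 * L ^ 2 / 8)) * gs (4 * s) x := by
  rw [gs_eq_four hs]
  refine mul_le_mul_of_nonneg_right (mul_le_mul_of_nonneg_left (Real.exp_le_exp.2 ?_) (by positivity))
    (gs_pos _ _).le
  have h1 := pow_le_pow_left₀ (by positivity) hx 2
  rw [mul_pow, Real.sq_sqrt hs.le] at h1
  rw [neg_le_neg_iff, div_le_div_iff₀ (by norm_num) (by positivity)]
  nlinarith

lemma BA_neg (u : EE N → ℝ) (e : EE N) (s : ℝ) : BA u (-e) s = BA u e s := by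
  simp [BA]

lemma FF_neg (u : EE N → ℝ) (e : EE N) (s : ℝ) : FF u (-e) s = FF u e s := by
  simp [FF]

lemma bb_neg (u : EE N → ℝ) (e : EE N) (s : ℝ) : bb u (-e) s = -bb u e s := by
  simp [bb, integral_neg]

lemma MemP.FF_le {M : ℝ} {Ω : Set (EE N)} {u : EE N → ℝ} (hu : MemP N 1 0 M Ω u) (e : EE N)
    {L : ℝ} (hL : 0 ≤ L) : ∃ C : ℝ, 0 < C ∧ ∀ s : ℝ, 0 < s → (L + 1) * √s ≤ 1 / 4 →
      FF u e s ≤ C * BA u e s ^ 2 + 2 ^ N * Real.exp (-(3 * L ^ 2 / 8)) * FF u e (4 * s) := by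
  obtain ⟨C, hC, h⟩ := exists_fderiv_le_BA (N := N) L
  refine ⟨C, hC, fun s hs hsL => ?_⟩
  have hv : ∀ x : EE N, ‖x‖ ≤ L * √s → |fderiv ℝ u x e| ≤ C * BA u e s := fun x hx => by
    have h1 := h s hs hsL hu e x hx
    have h2 := h s hs hsL hu (-e) x hx
    rw [BA_neg, map_neg] at h2
    exact abs_le.2 ⟨by linarith, h1⟩
  have hcv := hu.continuous_fderiv_apply e
  have hi : Integrable fun y => |fderiv ℝ u y e| * eta y * gs s y := integrable_mul_eta_mul_gs hcv.abs s
  have hi2 := integrable_FF hu.contDiff e (4 * s)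
  have hB := BA_nonneg u e s
  have h3 : C * BA u e s ^ 2 + 2 ^ N * Real.exp (-(3 * L ^ 2 / 8)) * FF u e (4 * s) =
      ∫ x, (C * BA u e s * (|fderiv ℝ u x e| * eta x * gs s x) +
        2 ^ N * Real.exp (-(3 * L ^ 2 / 8)) * ((fderiv ℝ u x e * eta x) ^ 2 * gs (4 * s) x)) := by
    rw [integral_add (hi.const_mul _) (hi2.const_mul _), integral_const_mul, integral_const_mul, FF,
      ← BA]
    ring
  rw [h3, FF]
  refine integral_mono (integrable_FF hu.contDiff e s) ((hi.const_mul _).add (hi2.const_mul _)) fun x => ?_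
  dsimp only
  have hg := gs_pos s x
  have hg4 := gs_pos (4 * s) x
  have hη := eta_nonneg x
  have hη1 := eta_le_one x
  rcases le_total ‖x‖ (L * √s) with hx | hx
  · have h4 : (fderiv ℝ u x e * eta x) ^ 2 ≤ C * BA u e s * (|fderiv ℝ u x e| * eta x) := by
      calc (fderiv ℝ u x e * eta x) ^ 2 = (|fderiv ℝ u x e| * eta x) * (|fderiv ℝ u x e| * eta x) := by
            rw [← sq, mul_pow, mul_pow, sq_abs]
        _ ≤ C * BA u e s * (|fderiv ℝ u x e| * eta x) :=
            mul_le_mul_of_nonneg_right ((mul_le_of_le_one_right (abs_nonneg _) hη1).trans (hv x hx))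
              (by positivity)
    have h5 := mul_le_mul_of_nonneg_right h4 hg.le
    have h6 : 0 ≤ 2 ^ N * Real.exp (-(3 * L ^ 2 / 8)) * ((fderiv ℝ u x e * eta x) ^ 2 * gs (4 * s) x) := by
      positivity
    linarith
  · have h5 := mul_le_mul_of_nonneg_left (gs_le_of_le_norm hs hL hx) (sq_nonneg (fderiv ℝ u x e * eta x))
    have h6 : 0 ≤ C * BA u e s * (|fderiv ℝ u x e| * eta x * gs s x) := by positivity
    linarith

lemma MemP.exists_le_BA_sq {M : ℝ} {Ω : Set (EE N)} {u : EE N → ℝ} (hu : MemP N 1 0 M Ω u) (e : EE N)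
    {c C : ℝ} (hc : 0 < c) (h : ∀ᶠ k : ℕ in atTop, c * (1 / 4 : ℝ) ^ k ≤ FF u e ((1 / 4) ^ k) ∧
      FF u e ((1 / 4) ^ k) ≤ C * (1 / 4) ^ k) :
    ∃ c₁ : ℝ, 0 < c₁ ∧ ∀ᶠ k : ℕ in atTop, c₁ * (1 / 4 : ℝ) ^ k ≤ BA u e ((1 / 4) ^ k) ^ 2 := by
  obtain ⟨L, hL, hLε⟩ := exists_mul_exp_le (2 ^ N * (4 * C)) (half_pos hc)
  obtain ⟨D, hD, hFF⟩ := hu.FF_le e hL.le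
  refine ⟨c / 2 / D, by positivity, ?_⟩
  have hlim : Tendsto (fun k : ℕ => (L + 1) * √((1 / 4 : ℝ) ^ k)) atTop (nhds ((L + 1) * √0)) :=
    ((Real.continuous_sqrt.tendsto 0).comp
      (tendsto_pow_atTop_nhds_zero_of_lt_one (by norm_num) (by norm_num))).const_mul _
  rw [Real.sqrt_zero, mul_zero] at hlim
  obtain ⟨K, hK⟩ := eventually_atTop.1 h
  filter_upwards [hlim.eventually (eventually_le_nhds (by norm_num : (0 : ℝ) < 1 / 4)),
    eventually_ge_atTop (K + 1)] with k hk1 hk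
  obtain ⟨k, rfl⟩ : ∃ l, k = l + 1 := ⟨k - 1, by omega⟩
  have h1 := hFF _ (by positivity) hk1
  have h2 := (hK _ (by omega : K ≤ k + 1)).1
  have h3 := (hK k (by omega)).2
  have h4 : 4 * (1 / 4 : ℝ) ^ (k + 1) = (1 / 4) ^ k := by rw [pow_succ]; ring
  rw [h4] at h1
  have h5 : 2 ^ N * Real.exp (-(3 * L ^ 2 / 8)) * FF u e ((1 / 4) ^ k) ≤ c / 2 * (1 / 4) ^ (k + 1) := by
    refine (mul_le_mul_of_nonneg_left h3 (by positivity)).trans ?_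
    rw [← h4]
    have := mul_le_mul_of_nonneg_right hLε (by positivity : (0 : ℝ) ≤ (1 / 4) ^ (k + 1))
    linarith
  rw [div_mul_eq_mul_div, div_le_iff₀ hD]
  linarith

end

section

variable {N : ℕ}

lemma integrable_mul_gs {f : EE N → ℝ} (hf : Continuous f) (hc : HasCompactSupport f) (s : ℝ) :
    Integrable fun x => f x * gs s x :=
  (hf.mul (continuous_gs s)).integrable_of_hasCompactSupport hc.mul_right

/-- Disjointly supported functions are negatively correlated, so the Poincaré inequality bounds the
product of their means. -/
lemma sq_integral_mul_integral_le {f h : EE N → ℝ} (hf : ContDiff ℝ 1 f) (hh : ContDiff ℝ 1 h)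
    (hcf : HasCompactSupport f) (hch : HasCompactSupport h) (hfh : ∀ x, f x * h x = 0) {s : ℝ}
    (hs : 0 < s) :
    ((∫ x, f x * gs s x) * ∫ x, h x * gs s x) ^ 2 ≤
      (s * ∫ x, ‖gradient f x‖ ^ 2 * gs s x) * (s * ∫ x, ‖gradient h x‖ ^ 2 * gs s x) := by
  have hpf := gaussian_poincare hf hcf hs
  have hph := gaussian_poincare hh hch hs
  set a := ∫ x, f x * gs s x with ha
  set b := ∫ x, h x * gs s x with hb
  have hg := integrable_gs (N := N) hs
  have hsq : ∀ x : EE N, √(gs s x) * √(gs s x) = gs s x := fun x => Real.mul_self_sqrt (gs_pos s x).le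
  have hvar : ∀ p : EE N → ℝ, Continuous p → HasCompactSupport p →
      Integrable (fun x => ((p x - ∫ x, p x * gs s x) * √(gs s x)) ^ 2) ∧
      ∫ x, ((p x - ∫ x, p x * gs s x) * √(gs s x)) ^ 2 =
        (∫ x, p x ^ 2 * gs s x) - (∫ x, p x * gs s x) ^ 2 := by
    intro p hp hc
    have i1 := integrable_mul_gs hp hc s
    have i2 : Integrable fun x => p x ^ 2 * gs s x :=
      integrable_mul_gs (hp.pow 2) (hc.mono fun x hx h => hx (by simp [h])) s
    set m := ∫ x, p x * gs s x with hm
    have heq : (fun x => ((p x - m) * √(gs s x)) ^ 2) =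
        fun x => (p x ^ 2 * gs s x - 2 * m * (p x * gs s x)) + m ^ 2 * gs s x := by
      ext x; rw [mul_pow, sq (√(gs s x)), hsq]; ring
    have i3 : Integrable fun x => p x ^ 2 * gs s x - 2 * m * (p x * gs s x) := i2.sub (i1.const_mul _)
    rw [heq]
    refine ⟨i3.add (hg.const_mul _), ?_⟩
    rw [integral_add i3 (hg.const_mul _), integral_sub i2 (i1.const_mul _), integral_const_mul,
      integral_const_mul, integral_gs hs, ← hm]
    ring
  have i1 := integrable_mul_gs hf.continuous hcf s
  have i2 := integrable_mul_gs hh.continuous hch s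
  have heq : (fun x => (f x - a) * √(gs s x) * ((h x - b) * √(gs s x))) =
      fun x => (-(b * (f x * gs s x)) - a * (h x * gs s x)) + a * b * gs s x := by
    ext x
    rw [show (f x - a) * √(gs s x) * ((h x - b) * √(gs s x)) =
      (f x * h x - b * f x - a * h x + a * b) * (√(gs s x) * √(gs s x)) by ring, hfh, hsq]
    ring
  have i3 : Integrable fun x => -(b * (f x * gs s x)) - a * (h x * gs s x) :=
    (i1.const_mul b).neg.sub (i2.const_mul a)
  have i4 : Integrable fun x => -(b * (f x * gs s x)) := (i1.const_mul b).neg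
  have hF := hvar f hf.continuous hcf
  have hH := hvar h hh.continuous hch
  have hCS := sq_integral_mul_le hF.1 hH.1 (by rw [← ha, ← hb, heq]; exact i3.add (hg.const_mul _))
  rw [← ha, ← hb, heq, integral_add i3 (hg.const_mul _), integral_sub i4 (i2.const_mul a),
    integral_neg, integral_const_mul, integral_const_mul, integral_const_mul, integral_gs hs, ← ha, ← hb] at hCS
  have h1 : 0 ≤ ∫ x, ((f x - a) * √(gs s x)) ^ 2 := integral_nonneg fun x => sq_nonneg _
  have h2 : 0 ≤ ∫ x, ((h x - b) * √(gs s x)) ^ 2 := integral_nonneg fun x => sq_nonneg _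
  rw [← ha] at hF
  rw [← hb] at hH
  calc (a * b) ^ 2 = (-(b * a) - a * b + a * b * 1) ^ 2 := by ring
    _ ≤ _ := hCS
    _ ≤ _ := mul_le_mul (by rw [hF.2]; linarith) (by rw [hH.2]; linarith) h2
      (h1.trans (by rw [hF.2]; linarith))

lemma MemP.exists_product_le {M : ℝ} {Ω : Set (EE N)} {u : EE N → ℝ} (hu : MemP N 1 0 M Ω u)
    (e : EE N) : ∃ C : ℝ, 0 < C ∧ ∀ s : ℝ, 0 < s → s ≤ 1 →
      ((BA u e s ^ 2 - bb u e s ^ 2) / 4) ^ 2 ≤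
        s ^ 2 * ((2 * En u e s + C * s) * (2 * En u (-e) s + C * s)) := by
  obtain ⟨Ct, hCt, htail⟩ := exists_tail_bound (N := N)
  obtain ⟨K, hK0, hK⟩ := exists_eta_bound (N := N)
  obtain ⟨V, hV0, hV⟩ := hu.exists_abs_fderiv_le e
  have hcη := continuous_eta (N := N)
  have hη1 : ContDiff ℝ 1 (eta : EE N → ℝ) := contDiff_one_of_infty contDiff_eta
  have hgη := continuous_gradient hη1
  refine ⟨2 * (V ^ 2 * K ^ 2 * Ct) + 1, by positivity, fun s hs hs1 => ?_⟩
  -- the energy of a truncation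
  have hgrad : ∀ e' : EE N, (∀ x, |fderiv ℝ u x e'| = |fderiv ℝ u x e|) → ∀ (ε : ℝ) (w : EE N → ℝ),
      0 < ε → ContDiff ℝ (⊤ : ℕ∞) w → (∀ x ∈ ball (0 : EE N) (3 / 4), w x = Tr ε (fderiv ℝ u x e')) →
      ∫ x, ‖gradient (fun x => w x * eta x) x‖ ^ 2 * gs s x ≤
        2 * En u e' s + (2 * (V ^ 2 * K ^ 2 * Ct) + 1) * s := by
    intro e' he' ε w hε hw hwT
    have hw1 := contDiff_one_of_infty hw
    have hcw := hw.continuous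
    have hcg := continuous_gs (N := N) s
    obtain ⟨C0, _, hEn⟩ := hu.exists_En_le e'
    have i1 := (hEn s hs hs1).1
    have i2 : Integrable fun x => w x ^ 2 * ‖gradient (eta : EE N → ℝ) x‖ ^ 2 * gs s x :=
      Continuous.integrable_of_hasCompactSupport (by fun_prop)
        (hasCompactSupport_eta.gradient.mono fun x hx h => hx (by simp [h]))
    have hpt : ∀ x, ‖gradient (fun x => w x * eta x) x‖ ^ 2 * gs s x ≤
        2 * (eta x ^ 2 * ‖posGrad u e' x‖ ^ 2 * gs s x) +
          2 * (w x ^ 2 * ‖gradient (eta : EE N → ℝ) x‖ ^ 2 * gs s x) := by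
      intro x
      rw [gradient_mul' (hw1.differentiable (by norm_num) x) (hη1.differentiable (by norm_num) x)]
      have hηP : eta x * ‖gradient w x‖ ≤ eta x * ‖posGrad u e' x‖ := by
        by_cases hx : x ∈ ball (0 : EE N) (3 / 4)
        · exact mul_le_mul_of_nonneg_left
            (hu.norm_gradient_trunc_le e' (by norm_num) hε hwT hx) (eta_nonneg x)
        · rw [eta_eq_zero (by simp at hx; linarith)]; simp
      have h1 : ‖w x • gradient eta x + eta x • gradient w x‖ ≤
          |w x| * ‖gradient (eta : EE N → ℝ) x‖ + eta x * ‖posGrad u e' x‖ := by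
        refine (norm_add_le _ _).trans ?_
        rw [norm_smul, norm_smul, Real.norm_eq_abs, Real.norm_of_nonneg (eta_nonneg x)]
        linarith
      have h2 := pow_le_pow_left₀ (norm_nonneg _) h1 2
      have h3 : ‖w x • gradient eta x + eta x • gradient w x‖ ^ 2 ≤
          2 * (eta x ^ 2 * ‖posGrad u e' x‖ ^ 2) + 2 * (w x ^ 2 * ‖gradient (eta : EE N → ℝ) x‖ ^ 2) := by
        rw [← sq_abs (w x)]
        nlinarith [sq_nonneg (|w x| * ‖gradient (eta : EE N → ℝ) x‖ - eta x * ‖posGrad u e' x‖)]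
      have := mul_le_mul_of_nonneg_right h3 (gs_pos s x).le
      linarith
    have h3 : ∫ x, ‖gradient (fun x => w x * eta x) x‖ ^ 2 * gs s x ≤
        2 * En u e' s + 2 * ∫ x, w x ^ 2 * ‖gradient (eta : EE N → ℝ) x‖ ^ 2 * gs s x := by
      rw [En, ← integral_const_mul, ← integral_const_mul, ← integral_add (i1.const_mul _) (i2.const_mul _)]
      refine integral_mono_of_nonneg (Eventually.of_forall fun x => ?_)
        ((i1.const_mul _).add (i2.const_mul _)) (Eventually.of_forall hpt)
      have := gs_pos s x
      dsimp only [Pi.zero_apply]; positivity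
    have h4 := htail s hs (fun x => w x ^ 2 * ‖gradient (eta : EE N → ℝ) x‖ ^ 2) (V ^ 2 * K ^ 2)
      (fun x hx => by rw [gradient_eq_zero_of_eventuallyEq (eta_eventuallyEq_one hx)]; simp)
      (fun x => by
        by_cases hx : ‖x‖ < 3 / 4
        · rw [abs_of_nonneg (by positivity)]
          refine mul_le_mul ?_ (pow_le_pow_left₀ (norm_nonneg _) (hK x).1 2) (by positivity) (by positivity)
          have hxb : x ∈ ball (0 : EE N) (3 / 4) := by simpa using hx
          rw [sq_le_sq, abs_of_nonneg hV0, hwT x hxb, abs_of_nonneg (Tr_nonneg hε _)]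
          exact (Tr_le_abs hε _).trans ((he' x).le.trans (hV x hxb))
        · rw [gradient_eq_zero_of_eventuallyEq (eta_eventuallyEq_zero (by linarith))]
          simp; positivity)
    have h5 := (abs_le.1 h4).2
    have h6 : s ^ 6 ≤ s := by simpa using pow_le_pow_of_le_one hs.le hs1 (by norm_num : 1 ≤ 6)
    have h7 : V ^ 2 * K ^ 2 * (Ct * s ^ 6) ≤ V ^ 2 * K ^ 2 * Ct * s := by
      rw [mul_assoc (V ^ 2 * K ^ 2)]
      exact mul_le_mul_of_nonneg_left (mul_le_mul_of_nonneg_left h6 hCt.le) (by positivity)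
    nlinarith
  have hmean : ∀ e' : EE N, (∀ x, |fderiv ℝ u x e'| = |fderiv ℝ u x e|) → ∀ (ε : ℝ) (w : EE N → ℝ),
      0 < ε → Continuous w → (∀ x ∈ ball (0 : EE N) (3 / 4), w x = Tr ε (fderiv ℝ u x e')) →
      |(∫ x, w x * eta x * gs s x) - (BA u e s + bb u e' s) / 2| ≤ 2 * ε := by
    intro e' he' ε w hε hcw hwT
    have hcv := hu.continuous_fderiv_apply e
    have hcv' := hu.continuous_fderiv_apply e'
    have i1 := integrable_mul_eta_mul_gs hcw s
    have i2 := integrable_mul_eta_mul_gs hcv.abs s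
    have i3 := integrable_mul_eta_mul_gs hcv' s
    have h1 := abs_integral_mul_eta_mul_gs_le (c := 2 * ε) (s := s)
      (p := fun x => w x - (|fderiv ℝ u x e| + fderiv ℝ u x e') / 2) (fun x hx => ?_) hs
    · have i4 : Integrable fun x => 2⁻¹ * (|fderiv ℝ u x e| * eta x * gs s x) +
          2⁻¹ * (fderiv ℝ u x e' * eta x * gs s x) := (i2.const_mul _).add (i3.const_mul _)
      have h2 : ∫ x, (w x - (|fderiv ℝ u x e| + fderiv ℝ u x e') / 2) * eta x * gs s x =
          (∫ x, w x * eta x * gs s x) - (BA u e s + bb u e' s) / 2 := by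
        have h3 : (BA u e s + bb u e' s) / 2 = ∫ x, (2⁻¹ * (|fderiv ℝ u x e| * eta x * gs s x) +
            2⁻¹ * (fderiv ℝ u x e' * eta x * gs s x)) := by
          rw [integral_add (i2.const_mul _) (i3.const_mul _), integral_const_mul, integral_const_mul,
            BA, bb]
          ring
        rw [h3, ← integral_sub i1 i4]
        congr 1; ext x; ring
      rwa [h2] at h1
    · rw [← he' x, hwT x hx]
      have h2 := le_Tr hε (fderiv ℝ u x e')
      have h3 := Tr_le hε (fderiv ℝ u x e')
      have h4 : (|fderiv ℝ u x e'| + fderiv ℝ u x e') / 2 = max (fderiv ℝ u x e') 0 := by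
        rcases le_total 0 (fderiv ℝ u x e') with h | h
        · rw [abs_of_nonneg h, max_eq_left h]; ring
        · rw [abs_of_nonpos h, max_eq_right h]; ring
      rw [h4, abs_le]
      constructor <;> linarith
  have hneg : ∀ x, |fderiv ℝ u x (-e)| = |fderiv ℝ u x e| := fun x => by rw [map_neg, abs_neg]
  have hε : ∀ n : ℕ, (0 : ℝ) < 1 / ((n : ℝ) + 1) := fun n => Nat.one_div_pos_of_nat
  choose w hw h0 hwT hlap using fun n : ℕ => hu.exists_trunc e (R := 3 / 4) (by norm_num) (hε n)
  choose w' hw' h0' hwT' hlap' using fun n : ℕ => hu.exists_trunc (-e) (R := 3 / 4) (by norm_num) (hε n)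
  have hε0 : Tendsto (fun n : ℕ => 2 * (1 / ((n : ℝ) + 1))) atTop (nhds 0) := by
    simpa using (tendsto_one_div_add_atTop_nhds_zero_nat (𝕜 := ℝ)).const_mul 2
  have hlimit : ∀ (A : ℕ → ℝ) (B : ℝ), (∀ n : ℕ, |A n - B| ≤ 2 * (1 / ((n : ℝ) + 1))) →
      Tendsto A atTop (nhds B) := fun A B h =>
    tendsto_iff_norm_sub_tendsto_zero.2 (squeeze_zero (fun _ => norm_nonneg _) h hε0)
  have l1 := hlimit _ _ fun n => hmean e (fun _ => rfl) _ (w n) (hε n) (hw n).continuous (hwT n)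
  have l2 := hlimit _ _ fun n => hmean (-e) hneg _ (w' n) (hε n) (hw' n).continuous (hwT' n)
  have h1 := le_of_tendsto' ((l1.mul l2).pow 2) (b := s ^ 2 * ((2 * En u e s + (2 * (V ^ 2 * K ^ 2 * Ct) + 1) * s) *
    (2 * En u (-e) s + (2 * (V ^ 2 * K ^ 2 * Ct) + 1) * s))) fun n => by
    have hc : ∀ p : EE N → ℝ, HasCompactSupport fun x => p x * eta x := fun p =>
      hasCompactSupport_eta.mul_left
    have h2 := sq_integral_mul_integral_le ((contDiff_one_of_infty (hw n)).mul hη1)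
      ((contDiff_one_of_infty (hw' n)).mul hη1) (hc _) (hc _) (fun x => by
        by_cases hx : x ∈ ball (0 : EE N) (3 / 4)
        · rw [hwT n x hx, hwT' n x hx, map_neg]
          rcases le_total (fderiv ℝ u x e) 0 with h | h
          · rw [Tr_eq_zero (hε n) (h.trans (hε n).le)]; ring
          · rw [Tr_eq_zero (hε n) ((neg_nonpos.2 h).trans (hε n).le)]; ring
        · rw [eta_eq_zero (by simp at hx; linarith)]; ring) hs
    refine h2.trans ?_
    rw [show ∀ a b : ℝ, s ^ 2 * (a * b) = (s * a) * (s * b) by intros; ring]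
    have hpos : ∀ f : EE N → ℝ, 0 ≤ ∫ x, ‖gradient f x‖ ^ 2 * gs s x := fun f =>
      integral_nonneg fun x => mul_nonneg (sq_nonneg _) (gs_pos s x).le
    have h3 := hgrad e (fun _ => rfl) _ (w n) (hε n) (hw n) (hwT n)
    have h4 := hgrad (-e) hneg _ (w' n) (hε n) (hw' n) (hwT' n)
    exact mul_le_mul (mul_le_mul_of_nonneg_left h3 hs.le) (mul_le_mul_of_nonneg_left h4 hs.le)
      (mul_nonneg hs.le (hpos _)) (mul_nonneg hs.le ((hpos _).trans h3))
  rw [bb_neg] at h1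
  calc _ = ((BA u e s + bb u e s) / 2 * ((BA u e s + -bb u e s) / 2)) ^ 2 := by ring
    _ ≤ _ := h1

end

section

variable {N : ℕ}

lemma tendsto_quarter_pow : Tendsto (fun k : ℕ => (1 / 4 : ℝ) ^ k) atTop (nhds 0) :=
  tendsto_pow_atTop_nhds_zero_of_lt_one (by norm_num) (by norm_num)

lemma En_nonneg (u : EE N → ℝ) (e : EE N) (s : ℝ) : 0 ≤ En u e s :=
  integral_nonneg fun x => mul_nonneg (mul_nonneg (sq_nonneg _) (sq_nonneg _)) (gs_pos s x).le

lemma MemP.exists_En_le_const {M : ℝ} {Ω : Set (EE N)} {u : EE N → ℝ} (hu : MemP N 1 0 M Ω u)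
    (e : EE N) {C : ℝ} (hC : 0 < C)
    (h : ∀ᶠ k : ℕ in atTop, FF u e ((1 / 4) ^ k) ≤ C * (1 / 4 : ℝ) ^ k) :
    ∃ D : ℝ, 0 < D ∧ ∀ᶠ k : ℕ in atTop, En u e ((1 / 4) ^ k) ≤ D := by
  obtain ⟨B, hB, hE⟩ := hu.exists_En_le e
  obtain ⟨K, hK⟩ := eventually_atTop.1 h
  refine ⟨B * (4 * C + 1), by positivity, eventually_atTop.2 ⟨K + 1, fun k hk => ?_⟩⟩
  obtain ⟨m, rfl⟩ : ∃ m, k = m + 1 := ⟨k - 1, by omega⟩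
  have h1 := hK m (by omega)
  have hm : (0 : ℝ) < (1 / 4) ^ m := by positivity
  have hs1 : (1 / 4 : ℝ) ^ (m + 1) ≤ 1 := pow_le_one₀ (by norm_num) (by norm_num)
  refine (hE _ (by positivity) hs1).2.trans (mul_le_mul_of_nonneg_left (add_le_add ?_ hs1) hB.le)
  have h4 : 4 * (1 / 4 : ℝ) ^ (m + 1) = (1 / 4) ^ m := by rw [pow_succ]; ring
  rw [h4, div_le_iff₀ (by positivity), pow_succ]
  linarith

/-- Along a geometric sequence of scales the Gaussian energies of both phases stay bounded away
from zero. -/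
lemma MemP.exists_le_En {M : ℝ} {Ω : Set (EE N)} {u : EE N → ℝ} (hu : MemP N 1 0 M Ω u)
    (e : EE N) {β : ℕ → ℝ} (hβ : Summable β)
    (hb : ∀ k, ∀ s ∈ Icc ((1 / 4 : ℝ) ^ (k + 2)) ((1 / 4) ^ (k + 1)), bb u e s ^ 2 ≤ s * β k)
    {c C : ℝ} (hc : 0 < c) (hC : 0 < C)
    (h : ∀ᶠ k : ℕ in atTop, c * (1 / 4 : ℝ) ^ k ≤ FF u e ((1 / 4) ^ k) ∧
      FF u e ((1 / 4) ^ k) ≤ C * (1 / 4) ^ k) :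
    ∃ d : ℝ, 0 < d ∧ ∀ᶠ k : ℕ in atTop, d ≤ En u e ((1 / 4) ^ k) := by
  obtain ⟨D, hD, hED⟩ := hu.exists_En_le_const (-e) hC (h.mono fun k hk => by rw [FF_neg]; exact hk.2)
  obtain ⟨c₁, hc₁, hBA⟩ := hu.exists_le_BA_sq e hc h
  obtain ⟨B, hB, hprod⟩ := hu.exists_product_le e
  set d := (c₁ / 8) ^ 2 / (2 * D + B) with hd
  have hd0 : 0 < d := by positivity
  refine ⟨d / 4, by positivity, ?_⟩
  have hβ' : ∀ᶠ k : ℕ in atTop, β (k - 1) ≤ c₁ / 2 :=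
    (hβ.tendsto_atTop_zero.comp (tendsto_sub_atTop_nat 1)).eventually
      (eventually_le_nhds (half_pos hc₁))
  have hs' := tendsto_quarter_pow.const_mul B
  rw [mul_zero] at hs'
  filter_upwards [hED, hBA, hβ', hs'.eventually (eventually_le_nhds (half_pos hd0)),
    eventually_ge_atTop 1] with k hk1 hk2 hk3 hk4 hk5
  have hb' := hb (k - 1) ((1 / 4) ^ k)
    ⟨pow_le_pow_of_le_one (by norm_num) (by norm_num) (by omega), by rw [Nat.sub_add_cancel hk5]⟩
  have hs : (0 : ℝ) < (1 / 4) ^ k := by positivity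
  have hs1 : (1 / 4 : ℝ) ^ k ≤ 1 := pow_le_one₀ (by norm_num) (by norm_num)
  have hp := hprod _ hs hs1
  set s : ℝ := (1 / 4) ^ k
  set E := En u e s
  have hE0 : 0 ≤ E := En_nonneg u e s
  have hE0' : 0 ≤ En u (-e) s := En_nonneg u (-e) s
  have h1 : c₁ / 8 * s ≤ (BA u e s ^ 2 - bb u e s ^ 2) / 4 := by
    have := mul_le_mul_of_nonneg_left hk3 hs.le
    linarith
  have h2 := pow_le_pow_left₀ (by positivity) h1 2
  have h3 : s ^ 2 * (c₁ / 8) ^ 2 ≤ s ^ 2 * ((2 * E + B * s) * (2 * En u (-e) s + B * s)) := by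
    rw [mul_pow] at h2; linarith
  have h4 := le_of_mul_le_mul_left h3 (by positivity)
  have h5 : (c₁ / 8) ^ 2 ≤ (2 * E + B * s) * (2 * D + B) := by
    refine h4.trans (mul_le_mul_of_nonneg_left ?_ (by positivity))
    have := mul_le_mul_of_nonneg_left hs1 hB.le
    linarith
  have h6 : d ≤ 2 * E + B * s := by rwa [hd, div_le_iff₀ (by positivity)]
  linarith

end

section

variable {N : ℕ}

/-- One factor of the ACF functional of the directional derivative in direction `e`. -/
def phaseEnergy (u : EE N → ℝ) (e : EE N) (ρ : ℝ) : ℝ :=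
  ∫ x in ball (0 : EE N) ρ, ‖posGrad u e x‖ ^ 2 * ‖x‖ ^ ((2 : ℤ) - (N : ℤ))

lemma zpow_two_sub_eq (hN : 2 ≤ N) {t : ℝ} (ht : 0 < t) :
    t ^ ((2 : ℤ) - (N : ℤ)) = (t ^ (N - 2))⁻¹ := by
  rw [← zpow_natCast, ← zpow_neg]
  congr 1
  omega

lemma sq_mul_inv_pow_eq (hN : 2 ≤ N) {t : ℝ} (ht : 0 < t) : t ^ 2 * (t ^ N)⁻¹ = (t ^ (N - 2))⁻¹ := by
  obtain ⟨m, rfl⟩ := Nat.exists_eq_add_of_le hN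
  rw [Nat.add_sub_cancel_left, pow_add]
  field_simp

lemma zpow_two_sub_le (hN : 2 ≤ N) {a t : ℝ} (ha : 0 < a) (h : a ≤ t) :
    t ^ ((2 : ℤ) - (N : ℤ)) ≤ a ^ 2 * (a ^ N)⁻¹ := by
  rw [zpow_two_sub_eq hN (ha.trans_le h), sq_mul_inv_pow_eq hN ha]
  exact inv_anti₀ (by positivity) (pow_le_pow_left₀ ha.le h _)

lemma le_zpow_two_sub (hN : 2 ≤ N) {a t : ℝ} (ht : 0 < t) (h : t ≤ a) :
    a ^ 2 * (a ^ N)⁻¹ ≤ t ^ ((2 : ℤ) - (N : ℤ)) := by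
  rw [zpow_two_sub_eq hN ht, sq_mul_inv_pow_eq hN (ht.trans_le h)]
  exact inv_anti₀ (by positivity) (pow_le_pow_left₀ ht.le h _)

lemma aestronglyMeasurable_phase (u : EE N → ℝ) (e : EE N) (μ : Measure (EE N)) :
    AEStronglyMeasurable (fun x => ‖posGrad u e x‖ ^ 2 * ‖x‖ ^ ((2 : ℤ) - (N : ℤ))) μ :=
  (((measurable_posGrad u e).norm.pow_const 2).mul (measurable_norm.pow_const _)).aestronglyMeasurable

lemma phase_nonneg (u : EE N → ℝ) (e x : EE N) :
    0 ≤ ‖posGrad u e x‖ ^ 2 * ‖x‖ ^ ((2 : ℤ) - (N : ℤ)) :=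
  mul_nonneg (sq_nonneg _) (zpow_nonneg (norm_nonneg _) _)

lemma MemP.integrableOn_phase_diff (hN : 2 ≤ N) {M : ℝ} {Ω : Set (EE N)} {u : EE N → ℝ}
    (hu : MemP N 1 0 M Ω u) (e : EE N) {a ρ : ℝ} (ha : 0 < a) (hρ0 : 0 < ρ) (hρ : ρ < 1) :
    IntegrableOn (fun x => ‖posGrad u e x‖ ^ 2 * ‖x‖ ^ ((2 : ℤ) - (N : ℤ)))
      (ball (0 : EE N) ρ \ ball 0 a) := by
  let b : ContDiffBump (0 : EE N) := ⟨ρ, (1 + ρ) / 2, hρ0, by linarith⟩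
  have hb : ContDiff ℝ 1 b := b.contDiff
  have hs : tsupport b ⊆ ball (0 : EE N) ((3 + ρ) / 4) := by
    rw [b.tsupport_eq]
    exact closedBall_subset_ball (show (1 + ρ) / 2 < (3 + ρ) / 4 by linarith)
  have hi := (hu.caccioppoli_posGrad e (by linarith : (3 + ρ) / 4 < 1) hb hs).1
  refine Integrable.mono' (g := fun x => (b x ^ 2 * ‖posGrad u e x‖ ^ 2) * (a ^ 2 * (a ^ N)⁻¹))
    (hi.mul_const _).integrableOn (aestronglyMeasurable_phase u e _) ?_
  refine (ae_restrict_mem (measurableSet_ball.diff measurableSet_ball)).mono fun x hx => ?_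
  rw [Real.norm_of_nonneg (phase_nonneg u e x), b.one_of_mem_closedBall (ball_subset_closedBall hx.1),
    one_pow, one_mul]
  refine mul_le_mul_of_nonneg_left (zpow_two_sub_le hN ha ?_) (sq_nonneg _)
  simpa using hx.2

lemma MemP.integrableOn_phase_small (hN : 2 ≤ N) {M : ℝ} {Ω : Set (EE N)} {u : EE N → ℝ}
    (hu : MemP N 1 0 M Ω u) (e : EE N) {D : ℝ}
    (hD : ∀ᶠ k : ℕ in atTop, En u e ((1 / 4) ^ k) ≤ D) :
    ∃ a : ℝ, 0 < a ∧ IntegrableOn (fun x => ‖posGrad u e x‖ ^ 2 * ‖x‖ ^ ((2 : ℤ) - (N : ℤ)))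
      (ball (0 : EE N) a) := by
  obtain ⟨K, hK⟩ := eventually_atTop.1 hD
  obtain ⟨c, hc, hg⟩ := exists_le_gs_sq (N := N) 2
  obtain ⟨B, hB, hE⟩ := hu.exists_En_le e
  have h_int : ∀ k : ℕ, Integrable (fun x => eta x ^ 2 * ‖posGrad u e x‖ ^ 2 * gs ((1 / 4 : ℝ) ^ k) x) :=
    fun k => (hE _ (by positivity) (pow_le_one₀ (by norm_num) (by norm_num))).1
  set f : EE N → ℝ := fun x => ‖posGrad u e x‖ ^ 2 * ‖x‖ ^ ((2 : ℤ) - (N : ℤ)) with hf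
  let A : ℕ → Set (EE N) := fun k =>
    closedBall 0 ((1 / 2 : ℝ) ^ (k + K + 2)) \ closedBall 0 ((1 / 2) ^ (k + K + 3))
  have hA : ∀ k, MeasurableSet (A k) := fun k => measurableSet_closedBall.diff measurableSet_closedBall
  have hpt : ∀ k, ∀ x ∈ A k, f x ≤ ((1 / 4 : ℝ) ^ (k + K + 3) / c) *
      (eta x ^ 2 * ‖posGrad u e x‖ ^ 2 * gs ((1 / 4 : ℝ) ^ (k + K + 3)) x) := by
    intro k x hx
    have h1 : ‖x‖ ≤ (1 / 2) ^ (k + K + 2) := mem_closedBall_zero_iff.1 hx.1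
    have h2 : (1 / 2) ^ (k + K + 3) ≤ ‖x‖ := (not_le.1 fun h => hx.2 (mem_closedBall_zero_iff.2 h)).le
    have hη : eta x = 1 := by
      refine eta_eq_one (h1.trans ?_)
      rw [pow_add]
      have : (1 / 2 : ℝ) ^ (k + K) ≤ 1 := pow_le_one₀ (by norm_num) (by norm_num)
      norm_num; linarith
    have hr : ((1 / 2 : ℝ) ^ (k + K + 3)) ^ 2 = (1 / 4) ^ (k + K + 3) := by
      rw [← pow_mul, mul_comm, pow_mul]; norm_num
    have h3 := hg ((1 / 2) ^ (k + K + 3)) (by positivity) x (by rw [pow_succ]; linarith)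
    have h4 := zpow_two_sub_le hN (by positivity) h2
    rw [hr] at h3 h4
    set R := ((1 / 2 : ℝ) ^ (k + K + 3)) ^ N
    rw [hη, one_pow, one_mul, hf]
    have h5 : ‖x‖ ^ ((2 : ℤ) - (N : ℤ)) ≤ (1 / 4 : ℝ) ^ (k + K + 3) / c * gs ((1 / 4) ^ (k + K + 3)) x := by
      refine h4.trans ?_
      rw [div_mul_eq_mul_div, le_div_iff₀ hc, mul_assoc]
      refine mul_le_mul_of_nonneg_left ?_ (by positivity)
      rwa [mul_comm]
    calc ‖posGrad u e x‖ ^ 2 * ‖x‖ ^ ((2 : ℤ) - (N : ℤ))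
        ≤ ‖posGrad u e x‖ ^ 2 * ((1 / 4 : ℝ) ^ (k + K + 3) / c * gs ((1 / 4) ^ (k + K + 3)) x) :=
          mul_le_mul_of_nonneg_left h5 (sq_nonneg _)
      _ = _ := by ring
  have hAi : ∀ k, IntegrableOn f (A k) := fun k =>
    Integrable.mono' ((h_int (k + K + 3)).const_mul ((1 / 4 : ℝ) ^ (k + K + 3) / c)).integrableOn
      (aestronglyMeasurable_phase u e _) <| (ae_restrict_mem (hA k)).mono fun x hx => by
        rw [Real.norm_of_nonneg (phase_nonneg u e x)]; exact hpt k x hx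
  have hsum : Summable fun k => ∫ x in A k, ‖f x‖ := by
    have hgeo : Summable fun k : ℕ => (1 / 4 : ℝ) ^ k * ((1 / 4) ^ (K + 3) / c * D) :=
      (summable_geometric_of_lt_one (by norm_num) (by norm_num)).mul_right _
    refine Summable.of_nonneg_of_le (fun k => integral_nonneg fun x => norm_nonneg _) (fun k => ?_) hgeo
    have hi := (h_int (k + K + 3)).const_mul ((1 / 4 : ℝ) ^ (k + K + 3) / c)
    have e1 : ∫ x in A k, ‖f x‖ ≤ ∫ x in A k, ((1 / 4 : ℝ) ^ (k + K + 3) / c) *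
        (eta x ^ 2 * ‖posGrad u e x‖ ^ 2 * gs ((1 / 4 : ℝ) ^ (k + K + 3)) x) :=
      setIntegral_mono_on (hAi k).norm hi.integrableOn (hA k) fun x hx => by
        rw [Real.norm_of_nonneg (phase_nonneg u e x)]; exact hpt k x hx
    have e2 := setIntegral_le_integral (s := A k) hi (ae_of_all _ fun x =>
      mul_nonneg (by positivity) (mul_nonneg (mul_nonneg (sq_nonneg _) (sq_nonneg _)) (gs_pos _ x).le))
    rw [integral_const_mul] at e1
    rw [integral_const_mul, integral_const_mul] at e2
    have e3 := mul_le_mul_of_nonneg_left (hK (k + K + 3) (by omega))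
      (by positivity : (0 : ℝ) ≤ (1 / 4) ^ (k + K + 3) / c)
    rw [En] at e3
    refine (e1.trans (e2.trans e3)).trans_eq ?_
    rw [show k + K + 3 = k + (K + 3) by ring, pow_add]; ring
  refine ⟨(1 / 2) ^ (K + 2), by positivity, ?_⟩
  have hU := integrableOn_iUnion_of_summable_integral_norm hAi hsum
  have h0 : IntegrableOn f {(0 : EE N)} :=
    integrableOn_singleton enorm_ne_top isCompact_singleton.measure_lt_top
  refine (hU.union h0).mono_set fun x hx => ?_
  rcases eq_or_ne x 0 with rfl | hx0
  · exact Or.inr rfl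
  have hx' : ‖x‖ < (1 / 2) ^ (K + 2) := by simpa using hx
  have hpos : (0 : ℝ) < (1 / 2) ^ (K + 2) := by positivity
  obtain ⟨n, hn1, hn2⟩ := exists_nat_pow_near_of_lt_one (div_pos (norm_pos_iff.2 hx0) hpos)
    ((div_le_one hpos).2 hx'.le) (by norm_num : (0 : ℝ) < 1 / 2) (by norm_num)
  rw [lt_div_iff₀ hpos, ← pow_add] at hn1
  rw [div_le_iff₀ hpos, ← pow_add] at hn2
  refine Or.inl (mem_iUnion.2 ⟨n, mem_closedBall_zero_iff.2 ?_, fun h => ?_⟩)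
  · rwa [add_assoc]
  · refine (mem_closedBall_zero_iff.1 h).not_gt ?_
    rwa [show n + K + 3 = n + 1 + (K + 2) by ring]

lemma MemP.integrableOn_phase (hN : 2 ≤ N) {M : ℝ} {Ω : Set (EE N)} {u : EE N → ℝ}
    (hu : MemP N 1 0 M Ω u) (e : EE N) {D : ℝ}
    (hD : ∀ᶠ k : ℕ in atTop, En u e ((1 / 4) ^ k) ≤ D) {ρ : ℝ} (hρ0 : 0 < ρ) (hρ : ρ < 1) :
    IntegrableOn (fun x => ‖posGrad u e x‖ ^ 2 * ‖x‖ ^ ((2 : ℤ) - (N : ℤ))) (ball (0 : EE N) ρ) := by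
  obtain ⟨a, ha, h⟩ := hu.integrableOn_phase_small hN e hD
  refine (h.union (hu.integrableOn_phase_diff hN e ha hρ0 hρ)).mono_set fun x hx => ?_
  by_cases hxa : x ∈ ball (0 : EE N) a
  · exact Or.inl hxa
  · exact Or.inr ⟨hx, hxa⟩

end

section

variable {N : ℕ}

lemma MemP.exists_le_phaseEnergy (hN : 2 ≤ N) {M : ℝ} {Ω : Set (EE N)} {u : EE N → ℝ}
    (hu : MemP N 1 0 M Ω u) (e : EE N) {d D : ℝ} (hd : 0 < d)
    (h : ∀ᶠ k : ℕ in atTop, d ≤ En u e ((1 / 4) ^ k) ∧ En u e ((1 / 4) ^ k) ≤ D) :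
    ∃ c : ℝ, 0 < c ∧ ∀ ρ : ℝ, 0 < ρ → ρ < 1 → c * ρ ^ 2 ≤ phaseEnergy u e ρ := by
  obtain ⟨L, hL, hLε⟩ := exists_mul_exp_le (2 ^ N * D) (half_pos hd)
  obtain ⟨C, hC, hg⟩ := exists_gs_sq_le (N := N)
  obtain ⟨B, hB, hE⟩ := hu.exists_En_le e
  obtain ⟨K, hK⟩ := eventually_atTop.1 h
  obtain ⟨K', hK'⟩ : ∃ K' : ℕ, L * (1 / 2) ^ K' < 1 := by
    obtain ⟨n, hn⟩ := exists_pow_lt_of_lt_one (inv_pos.2 hL) (by norm_num : (1 / 2 : ℝ) < 1)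
    refine ⟨n, ?_⟩
    exact (mul_lt_mul_of_pos_left hn hL).trans_eq (mul_inv_cancel₀ hL.ne')
  have hi : ∀ ρ : ℝ, 0 < ρ → ρ < 1 →
      IntegrableOn (fun x => ‖posGrad u e x‖ ^ 2 * ‖x‖ ^ ((2 : ℤ) - (N : ℤ))) (ball (0 : EE N) ρ) :=
    fun ρ hρ0 hρ => hu.integrableOn_phase hN e (h.mono fun k hk => hk.2) hρ0 hρ
  have hmono : ∀ ρ₁ ρ₂ : ℝ, 0 < ρ₁ → ρ₁ ≤ ρ₂ → ρ₂ < 1 → phaseEnergy u e ρ₁ ≤ phaseEnergy u e ρ₂ :=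
    fun ρ₁ ρ₂ h0 h12 h2 => setIntegral_mono_set (hi ρ₂ (h0.trans_le h12) h2)
      (ae_of_all _ fun x => phase_nonneg u e x) (ball_subset_ball h12).eventuallyLE
  set Q := C * L ^ N / L ^ 2 with hQ
  have hQ0 : 0 < Q := by positivity
  -- the bound along the scales `L / 2 ^ k`
  have hdisc : ∀ k : ℕ, K + K' + 1 ≤ k → d / 2 / Q * ((1 / 2 : ℝ) ^ k) ^ 2 ≤ phaseEnergy u e (L * (1 / 2) ^ k) := by
    intro k hk
    obtain ⟨m, rfl⟩ : ∃ m, k = m + 1 := ⟨k - 1, by omega⟩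
    set r : ℝ := (1 / 2) ^ (m + 1) with hr
    have hr0 : 0 < r := by positivity
    have hr2 : r ^ 2 = (1 / 4) ^ (m + 1) := by rw [hr, ← pow_mul, mul_comm, pow_mul]; norm_num
    have hr4 : 4 * r ^ 2 = (1 / 4) ^ m := by rw [hr2, pow_succ]; ring
    have hLr : L * r < 1 := (mul_le_mul_of_nonneg_left
      (pow_le_pow_of_le_one (by norm_num) (by norm_num) (by omega)) hL.le).trans_lt hK'
    have hρ : 0 < L * r := by positivity
    have i1 := (hE (r ^ 2) (by positivity) (by rw [hr2]; exact pow_le_one₀ (by norm_num) (by norm_num))).1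
    have i2 := (hE (4 * r ^ 2) (by positivity)
      (by rw [hr4]; exact pow_le_one₀ (by norm_num) (by norm_num))).1
    have i3 := (integrable_indicator_iff measurableSet_ball).2 (hi _ hρ hLr)
    set f : EE N → ℝ := fun x => ‖posGrad u e x‖ ^ 2 * ‖x‖ ^ ((2 : ℤ) - (N : ℤ)) with hf
    set ε := 2 ^ N * Real.exp (-(3 * L ^ 2 / 8)) with hε
    have hpt : ∀ x : EE N, x ≠ 0 → eta x ^ 2 * ‖posGrad u e x‖ ^ 2 * gs (r ^ 2) x ≤
        Q / r ^ 2 * (ball (0 : EE N) (L * r)).indicator f x +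
          ε * (eta x ^ 2 * ‖posGrad u e x‖ ^ 2 * gs (4 * r ^ 2) x) := by
      intro x hx
      have hp : 0 ≤ eta x ^ 2 * ‖posGrad u e x‖ ^ 2 := mul_nonneg (sq_nonneg _) (sq_nonneg _)
      have hp4 : 0 ≤ ε * (eta x ^ 2 * ‖posGrad u e x‖ ^ 2 * gs (4 * r ^ 2) x) :=
        mul_nonneg (by positivity) (mul_nonneg hp (gs_pos _ x).le)
      by_cases hxb : x ∈ ball (0 : EE N) (L * r)
      · rw [indicator_of_mem hxb]
        have h1 := le_zpow_two_sub hN (norm_pos_iff.2 hx) (mem_ball_zero_iff.1 hxb).le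
        have h2 := hg r hr0 x
        have h3 : C * (r ^ N)⁻¹ = Q / r ^ 2 * ((L * r) ^ 2 * ((L * r) ^ N)⁻¹) := by
          rw [hQ, mul_pow, mul_pow]; field_simp
        have h4 : gs (r ^ 2) x ≤ Q / r ^ 2 * ‖x‖ ^ ((2 : ℤ) - (N : ℤ)) :=
          (h2.trans_eq h3).trans (mul_le_mul_of_nonneg_left h1 (by positivity))
        have h5 : eta x ^ 2 * ‖posGrad u e x‖ ^ 2 ≤ ‖posGrad u e x‖ ^ 2 :=
          mul_le_of_le_one_left (sq_nonneg _) (pow_le_one₀ (eta_nonneg x) (eta_le_one x))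
        have h6 := mul_le_mul h5 h4 (gs_pos _ x).le (sq_nonneg _)
        have h7 : ‖posGrad u e x‖ ^ 2 * (Q / r ^ 2 * ‖x‖ ^ ((2 : ℤ) - (N : ℤ))) = Q / r ^ 2 * f x := by
          rw [hf]; ring
        linarith
      · rw [indicator_of_notMem hxb, mul_zero, zero_add]
        have hx' : L * √(r ^ 2) ≤ ‖x‖ := by
          rw [Real.sqrt_sq hr0.le]; simpa using hxb
        have h1 := mul_le_mul_of_nonneg_left (gs_le_of_le_norm (by positivity) hL.le hx') hp
        rw [← hε] at h1
        linarith
    have j1 : Integrable fun x => Q / r ^ 2 * (ball (0 : EE N) (L * r)).indicator f x := i3.const_mul _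
    have j2 : Integrable fun x => ε * (eta x ^ 2 * ‖posGrad u e x‖ ^ 2 * gs (4 * r ^ 2) x) :=
      i2.const_mul _
    have : Nonempty (Fin N) := ⟨⟨0, by omega⟩⟩
    have hae : ∀ᵐ x : EE N, x ≠ 0 := by
      rw [ae_iff]; simp
    have h1 := integral_mono_ae i1 (j1.add j2) (hae.mono hpt)
    have h2 : ∫ x, (Q / r ^ 2 * (ball (0 : EE N) (L * r)).indicator f x +
        ε * (eta x ^ 2 * ‖posGrad u e x‖ ^ 2 * gs (4 * r ^ 2) x)) =
        Q / r ^ 2 * phaseEnergy u e (L * r) + ε * En u e (4 * r ^ 2) := by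
      rw [integral_add j1 j2, integral_const_mul, integral_const_mul, integral_indicator measurableSet_ball]
      rfl
    have h3 : En u e (r ^ 2) ≤ Q / r ^ 2 * phaseEnergy u e (L * r) + ε * En u e (4 * r ^ 2) :=
      h1.trans_eq h2
    have h4 := mul_le_mul_of_nonneg_left (hK m (by omega)).2 (by positivity : 0 ≤ ε)
    have h5 := (hK (m + 1) (by omega)).1
    rw [hr4] at h3
    rw [← hr2] at h5
    have h6 : ε * D = 2 ^ N * D * Real.exp (-(3 * L ^ 2 / 8)) := by rw [hε]; ring
    have h7 : d / 2 ≤ Q / r ^ 2 * phaseEnergy u e (L * r) := by linarith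
    rw [div_mul_eq_mul_div, le_div_iff₀ (by positivity)] at h7
    rw [div_mul_eq_mul_div, div_le_iff₀ hQ0]
    linarith
  -- all radii
  set κ := K + K' + 1
  set t : ℝ := min 1 (L * (1 / 2) ^ κ) with ht
  have ht0 : 0 < t := lt_min one_pos (by positivity)
  refine ⟨d / 2 / Q * (t / (2 * L)) ^ 2, by positivity, fun ρ hρ0 hρ1 => ?_⟩
  have hy : 0 < ρ * t / (L * (1 / 2) ^ κ) := by positivity
  have hρt : ρ * t ≤ L * (1 / 2) ^ κ :=
    (mul_le_of_le_one_left ht0.le hρ1.le).trans (min_le_right _ _)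
  obtain ⟨n, hn1, hn2⟩ := exists_nat_pow_near_of_lt_one hy
    ((div_le_one (by positivity)).2 hρt) (by norm_num : (0 : ℝ) < 1 / 2) (by norm_num)
  rw [lt_div_iff₀ (by positivity)] at hn1
  rw [div_le_iff₀ (by positivity)] at hn2
  have e1 : (1 / 2 : ℝ) ^ (n + 1) * (L * (1 / 2) ^ κ) = L * (1 / 2) ^ (κ + (n + 1)) := by
    rw [pow_add (1 / 2 : ℝ) κ]; ring
  have e2 : (1 / 2 : ℝ) ^ n * (L * (1 / 2) ^ κ) = 2 * L * (1 / 2) ^ (κ + (n + 1)) := by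
    rw [pow_add (1 / 2 : ℝ) κ, pow_succ]; ring
  rw [e1] at hn1
  rw [e2] at hn2
  have h1 := hdisc (κ + (n + 1)) (by omega)
  have h2 := hmono _ ρ (by positivity) (hn1.le.trans (mul_le_of_le_one_right hρ0.le (min_le_left _ _))) hρ1
  refine le_trans ?_ (h1.trans h2)
  rw [mul_assoc, ← mul_pow]
  refine mul_le_mul_of_nonneg_left (pow_le_pow_left₀ (by positivity) ?_ 2) (by positivity)
  rw [div_mul_eq_mul_div, div_le_iff₀ (by positivity)]
  linarith

lemma acf_eq_phaseEnergy (u : EE N → ℝ) (e : EE N) (ρ : ℝ) :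
    acf N (fun x => fderiv ℝ u x e) ρ =
      ρ ^ (-4 : ℤ) * phaseEnergy u e ρ * phaseEnergy u (-e) ρ := by
  simp only [acf, phaseEnergy, posGrad, map_neg]

end

/-- if the zero set is thin and some blow-up has a nontrivial directional
derivative, the ACF functional is bounded below. -/
theorem acf_lower_bound (N : ℕ) (hN : 2 ≤ N) (M : ℝ) (hM : 0 < M)
    (Ω : Set (EuclideanSpace ℝ (Fin N))) (u : EuclideanSpace ℝ (Fin N) → ℝ)
    (hu : MemP N 1 0 M Ω u)
    (hδ : Filter.limsup (fun r => deltaFn N u r) (nhdsWithin 0 (Set.Ioi 0)) = 0)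
    (e : EuclideanSpace ℝ (Fin N)) (he : ‖e‖ = 1)
    (r : ℕ → ℝ) (hrpos : ∀ j, 0 < r j)
    (hrlim : Filter.Tendsto r Filter.atTop (nhds 0))
    (u₀ : EuclideanSpace ℝ (Fin N) → ℝ) (hu₀ : ContDiff ℝ 1 u₀)
    (hconv : ∀ K : Set (EuclideanSpace ℝ (Fin N)), IsCompact K →
      TendstoUniformlyOn (fun j x => u (r j • x) / r j ^ 2) u₀ Filter.atTop K)
    (hgconv : ∀ K : Set (EuclideanSpace ℝ (Fin N)), IsCompact K →
      TendstoUniformlyOn (fun j x => gradient (fun y => u (r j • y) / r j ^ 2) x)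
        (gradient u₀) Filter.atTop K)
    (hne : ∃ x, fderiv ℝ u₀ x e ≠ 0) :
    ∃ Ce : ℝ, 0 < Ce ∧
      ∀ ρ : ℝ, 0 < ρ → ρ < 1 → Ce ≤ acf N (fun x => fderiv ℝ u x e) ρ := by
  have hq : QuadGrowth u := quadGrowth_of_tendsto hu₀.continuous hrpos hrlim
    (hconv _ (isCompact_closedBall 0 1))
  obtain ⟨β, hβ, hβ0, hb⟩ := hu.exists_summable_bb hq he hδ
  obtain ⟨c, hc, hlow⟩ := exists_blowup_le_FF hu.contDiff hu₀ hrpos hrlim he hgconv hne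
  obtain ⟨C, hC, hFF⟩ := hu.exists_FF_bounds hβ hβ0 hb hrpos hrlim hc hlow
  have key : ∀ e' : EE N, (∀ s, FF u e' s = FF u e s) → (∀ s, bb u e' s ^ 2 = bb u e s ^ 2) →
      ∃ c : ℝ, 0 < c ∧ ∀ ρ : ℝ, 0 < ρ → ρ < 1 → c * ρ ^ 2 ≤ phaseEnergy u e' ρ := by
    intro e' hF' hb'
    simp only [← hF'] at hFF
    simp only [← hb'] at hb
    obtain ⟨D, -, hD⟩ := hu.exists_En_le_const e' hC (hFF.mono fun k hk => hk.2)
    obtain ⟨d, hd, hd'⟩ := hu.exists_le_En e' hβ hb (half_pos hc) hC hFF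
    exact hu.exists_le_phaseEnergy hN e' hd (hd'.and hD)
  obtain ⟨c₁, hc₁, h₁⟩ := key e (fun _ => rfl) fun _ => rfl
  obtain ⟨c₂, hc₂, h₂⟩ := key (-e) (FF_neg u e) fun s => by rw [bb_neg, neg_sq]
  refine ⟨c₁ * c₂, by positivity, fun ρ hρ0 hρ1 => ?_⟩
  rw [acf_eq_phaseEnergy, mul_assoc]
  have h := mul_le_mul (h₁ ρ hρ0 hρ1) (h₂ ρ hρ0 hρ1) (by positivity)
    ((by positivity : 0 ≤ c₁ * ρ ^ 2).trans (h₁ ρ hρ0 hρ1))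
  calc c₁ * c₂ = ρ ^ (-4 : ℤ) * (c₁ * ρ ^ 2 * (c₂ * ρ ^ 2)) := by
        rw [zpow_neg]; field_simp
    _ ≤ _ := mul_le_mul_of_nonneg_left h (by positivity)
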